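/- Under the stated hypotheses, the equation (φ_p(x'))' + a·φ_p(x⁺) − b·φ_p(x⁻) = G_x(x,t) + f(t) possesses Lagrange stability: every solution x(t) exists for all t ∈ ℝ and satisfies sup_{t∈ℝ}(|x(t)| + |x'(t)|) < ∞. -/

import Mathlib

/-- The one-dimensional `p`-Laplacian nonlinearity `φ_p(s) = |s|^{p-2} s`. -/
noncomputable def phi (p s : ℝ) : ℝ := |s| ^ (p - 2) * s

/-- The `p`-analogue of `π`: `π_p = 2π (p-1)^{1/p} / (p sin(π/p))`. -/
noncomputable def pip (p : ℝ) : ℝ :=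
  2 * Real.pi * (p - 1) ^ (1 / p) / (p * Real.sin (Real.pi / p))

/-- Mixed partial derivative `D_x^i D_t^j F(x,t)` of a function of two real variables. -/
noncomputable def iterD (F : ℝ → ℝ → ℝ) (i j : ℕ) (x t : ℝ) : ℝ :=
  iteratedDeriv i (fun y => iteratedDeriv j (F y) t) x

namespace JumpingKAM

open Complex MeasureTheory Set Filter Topology

/-- The open horizontal strip of half-width `σ` around the real axis. -/
def strip (σ : ℝ) : Set ℂ := {s | |s.im| < σ}

lemma mem_strip {σ : ℝ} {s : ℂ} : s ∈ strip σ ↔ |s.im| < σ := Iff.rfl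

lemma isOpen_strip (σ : ℝ) : IsOpen (strip σ) :=
  isOpen_lt (continuous_abs.comp continuous_im) continuous_const

lemma strip_mono {σ τ : ℝ} (h : τ ≤ σ) : strip τ ⊆ strip σ := fun _ hs => lt_of_lt_of_le hs h

lemma ofReal_mem_strip {σ : ℝ} (hσ : 0 < σ) (x : ℝ) : (x : ℂ) ∈ strip σ := by
  simpa [strip] using hσ

lemma add_real_mem_strip {σ : ℝ} {s : ℂ} (hs : s ∈ strip σ) (x : ℝ) : s + x ∈ strip σ := by
  simpa [strip] using hs

lemma closedBall_subset_strip {σ δ : ℝ} {s : ℂ} (hs : s ∈ strip (σ - δ)) :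
    Metric.closedBall s δ ⊆ strip σ := by
  intro z hz
  have h1 : |(z - s).im| ≤ δ := (abs_im_le_norm _).trans (by simpa [dist_eq] using hz)
  have h2 : |s.im| < σ - δ := hs
  rw [sub_im] at h1
  rw [mem_strip]
  have : |z.im| ≤ |z.im - s.im| + |s.im| := by simpa using abs_add_le (z.im - s.im) s.im
  linarith

/-- Derivatives of a jointly continuous family of holomorphic functions are jointly continuous. -/
lemma continuousOn_deriv_of_family {X : Type*} [TopologicalSpace X] {f : X → ℂ → ℂ}
    {W : Set (X × ℂ)} (hW : IsOpen W) (hf : ContinuousOn (fun q : X × ℂ => f q.1 q.2) W)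
    (hd : ∀ q ∈ W, DifferentiableAt ℂ (f q.1) q.2) :
    ContinuousOn (fun q : X × ℂ => deriv (f q.1) q.2) W := by
  rintro ⟨x0, z0⟩ h0
  obtain ⟨A, hA, B, hB, hAB⟩ := mem_nhds_prod_iff.1 (hW.mem_nhds h0)
  obtain ⟨r, hr, hrB⟩ := Metric.mem_nhds_iff.1 hB
  have hdiff : ∀ x ∈ A, DifferentiableOn ℂ (f x) (Metric.ball z0 r) := fun x hx z hz =>
    (hd (x, z) (hAB ⟨hx, hrB hz⟩)).differentiableWithinAt
  have hlu : TendstoLocallyUniformlyOn f (f x0) (𝓝 x0) (Metric.ball z0 r) := by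
    rw [Metric.tendstoLocallyUniformlyOn_iff]
    intro ε hε z hz
    have hc : ContinuousAt (fun q : X × ℂ => f q.1 q.2) (x0, z) :=
      hf.continuousAt (hW.mem_nhds (hAB ⟨mem_of_mem_nhds hA, hrB hz⟩))
    have hev := Metric.continuousAt_iff'.1 hc (ε / 2) (half_pos hε)
    rw [nhds_prod_eq] at hev
    obtain ⟨p, hp, q, hq, hpq⟩ := eventually_prod_iff.1 hev
    refine ⟨{w | q w}, mem_nhdsWithin_of_mem_nhds hq, hp.mono fun x hx w hw => ?_⟩
    have h1 := hpq hx hw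
    have h2 := hpq hp.self_of_nhds hw
    calc dist (f x0 w) (f x w) ≤ dist (f x0 w) (f x0 z) + dist (f x w) (f x0 z) :=
          dist_triangle_right _ _ _
      _ < ε := by linarith
  have hder := hlu.deriv (eventually_of_mem hA hdiff) Metric.isOpen_ball
  have hc0 : ContinuousAt (deriv (f x0)) z0 :=
    ((hdiff x0 (mem_of_mem_nhds hA)).deriv Metric.isOpen_ball).continuousOn.continuousAt
      (Metric.isOpen_ball.mem_nhds (Metric.mem_ball_self hr))
  refine ContinuousAt.continuousWithinAt ?_
  rw [Metric.continuousAt_iff']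
  intro ε hε
  rw [Metric.tendstoLocallyUniformlyOn_iff] at hder
  obtain ⟨t, ht, hev⟩ := hder (ε / 2) (half_pos hε) z0 (Metric.mem_ball_self hr)
  rw [IsOpen.nhdsWithin_eq Metric.isOpen_ball (Metric.mem_ball_self hr)] at ht
  have h3 := Metric.continuousAt_iff'.1 hc0 (ε / 2) (half_pos hε)
  rw [nhds_prod_eq]
  filter_upwards [hev.prod_mk (h3.and ht)] with q hq
  have h4 := hq.1 q.2 hq.2.2
  rw [dist_comm, Function.comp_apply] at h4
  calc dist (deriv (f q.1) q.2) (deriv (f x0) z0) ≤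
        dist (deriv (f q.1) q.2) (deriv (f x0) q.2) + dist (deriv (f x0) q.2) (deriv (f x0) z0) :=
        dist_triangle _ _ _
    _ < ε := by linarith [hq.2.1]

/-- Primitives of a continuous family depend continuously on all variables. -/
lemma continuousOn_primitive {X : Type*} [TopologicalSpace X] {f : X → ℝ → ℂ} {W : Set X}
    (hf : ContinuousOn (fun q : X × ℝ => f q.1 q.2) (W ×ˢ univ)) (a : ℝ) :
    ContinuousOn (fun q : X × ℝ => ∫ t in a..q.2, f q.1 t) (W ×ˢ univ) := by
  have h1 : Continuous (Function.uncurry fun (x : W) (t : ℝ) => f x t) := by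
    have : Continuous fun q : W × ℝ => (((q.1 : X), q.2) : X × ℝ) := by fun_prop
    exact hf.comp_continuous this (fun q => ⟨q.1.2, mem_univ _⟩)
  have h2 := intervalIntegral.continuous_parametric_primitive_of_continuous (μ := volume)
    (a₀ := a) h1
  rw [continuousOn_iff_continuous_domRestrict]
  have h3 : Continuous fun q : (W ×ˢ (univ : Set ℝ) : Set (X × ℝ)) =>
      ((⟨q.1.1, q.2.1⟩ : W), q.1.2) := by fun_prop
  exact h2.comp h3

/-- Differentiation under the integral sign for a continuous family of holomorphic functions. -/
lemma hasDerivAt_integral_family {f : ℝ → ℂ → ℂ} {D : Set ℂ} (hD : IsOpen D)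
    (hf : ContinuousOn (fun q : ℝ × ℂ => f q.1 q.2) (univ ×ˢ D))
    (hd : ∀ t, DifferentiableOn ℂ (f t) D) (a b : ℝ) {s : ℂ} (hs : s ∈ D) :
    HasDerivAt (fun z => ∫ t in a..b, f t z) (∫ t in a..b, deriv (f t) s) s := by
  have hda : ∀ q ∈ (univ : Set ℝ) ×ˢ D, DifferentiableAt ℂ (f q.1) q.2 := fun q hq =>
    (hd q.1).differentiableAt (hD.mem_nhds hq.2)
  have hf' := continuousOn_deriv_of_family (isOpen_univ.prod hD) hf hda
  obtain ⟨r, hr, hrD⟩ := Metric.nhds_basis_closedBall.mem_iff.1 (hD.mem_nhds hs)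
  have hK : IsCompact (uIcc a b ×ˢ Metric.closedBall s r) :=
    isCompact_uIcc.prod (isCompact_closedBall s r)
  obtain ⟨M, hM⟩ := hK.exists_bound_of_continuousOn
    (hf'.mono (prod_mono (subset_univ _) hrD))
  have hcont : ∀ z ∈ D, Continuous fun t => f t z := fun z hz =>
    hf.comp_continuous (f := fun t => (t, z)) (by fun_prop) (fun t => ⟨mem_univ _, hz⟩)
  have hcont' : Continuous fun t => deriv (f t) s :=
    hf'.comp_continuous (f := fun t => (t, s)) (by fun_prop) (fun t => ⟨mem_univ _, hs⟩)
  refine (intervalIntegral.hasDerivAt_integral_of_dominated_loc_of_deriv_le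
    (F := fun z t => f t z) (F' := fun z t => deriv (f t) z) (bound := fun _ => M)
    (Metric.closedBall_mem_nhds s hr) ?_ ((hcont s hs).intervalIntegrable _ _)
    hcont'.aestronglyMeasurable ?_ intervalIntegrable_const ?_).2
  · filter_upwards [hD.mem_nhds hs] with z hz using (hcont z hz).aestronglyMeasurable
  · exact ae_of_all _ fun t ht z hz => hM (t, z) ⟨uIoc_subset_uIcc ht, hz⟩
  · exact ae_of_all _ fun t _ z hz => (hda (t, z) ⟨mem_univ _, hrD hz⟩).hasDerivAt

/-- The character `z ↦ exp (2πi z)`. -/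
noncomputable def ee (z : ℂ) : ℂ := exp (2 * Real.pi * I * z)

lemma ee_add (z w : ℂ) : ee (z + w) = ee z * ee w := by
  simp only [ee, mul_add, exp_add]

lemma ee_int (n : ℤ) : ee n = 1 := by
  rw [ee, mul_comm, exp_int_mul_two_pi_mul_I]

lemma ee_zero : ee 0 = 1 := by simp [ee]

lemma norm_ee (z : ℂ) : ‖ee z‖ = Real.exp (-(2 * Real.pi * z.im)) := by
  rw [ee, norm_exp]; congr 1; simp

lemma norm_ee_int_mul_le (m : ℤ) (z : ℂ) :
    ‖ee (m * z)‖ ≤ Real.exp (2 * Real.pi * |(m : ℝ)| * |z.im|) := by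
  rw [norm_ee]
  apply Real.exp_le_exp.2
  have : -((m : ℂ) * z).im ≤ |(m : ℝ)| * |z.im| := by
    rw [← abs_mul]; simpa using neg_le_abs ((m : ℝ) * z.im)
  nlinarith [Real.pi_pos]

lemma differentiable_ee : Differentiable ℂ ee := by
  unfold ee; fun_prop

lemma continuous_ee : Continuous ee := differentiable_ee.continuous

lemma ee_int_mul_add_one (m : ℤ) (z : ℂ) : ee (m * (z + 1)) = ee (m * z) := by
  rw [mul_add, ee_add, mul_one, ee_int, mul_one]

/-- Pointwise Fourier inversion for a continuous `1`-periodic function. -/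
lemma hasSum_fourier {g : ℝ → ℂ} (hg : Continuous g) (hper : ∀ x, g (x + 1) = g x)
    (hs : Summable fun m : ℤ => ∫ x in (0 : ℝ)..1, g x * ee (-(m * (x : ℂ)))) (x : ℝ) :
    HasSum (fun m : ℤ => (∫ x in (0 : ℝ)..1, g x * ee (-(m * (x : ℂ)))) * ee (m * (x : ℂ))) (g x) := by
  have hp : Function.Periodic g 1 := hper
  have : Fact ((0 : ℝ) < 1) := ⟨one_pos⟩
  let F : C(AddCircle (1 : ℝ), ℂ) := ⟨hp.lift, by
    exact continuous_coinduced_dom.2 hg⟩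
  have hF : ∀ x : ℝ, F (x : AddCircle (1 : ℝ)) = g x := fun x => hp.lift_coe x
  have hcoef : ∀ m : ℤ, fourierCoeff F m = ∫ x in (0 : ℝ)..1, g x * ee (-(m * (x : ℂ))) := by
    intro m
    rw [fourierCoeff_eq_intervalIntegral _ m 0]
    simp only [div_one, one_smul, zero_add, smul_eq_mul]
    refine intervalIntegral.integral_congr fun x _ => ?_
    simp only [hF, fourier_coe_apply, ee]
    rw [mul_comm]
    congr 2
    push_cast
    ring
  have hs' : Summable (fourierCoeff F) := by
    simpa only [← hcoef] using hs
  have := has_pointwise_sum_fourier_series_of_summable hs' (x : AddCircle (1 : ℝ))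
  rw [hF] at this
  convert this using 2 with m
  rw [hcoef, fourier_coe_apply, smul_eq_mul, ee]
  congr 2
  push_cast
  ring

/-- Contour shift for periodic holomorphic functions. -/
lemma integral_shift {σ : ℝ} {g : ℂ → ℂ} (hg : DifferentiableOn ℂ g (strip σ))
    (hper : ∀ s ∈ strip σ, g (s + 1) = g s) {η : ℝ} (hη : |η| < σ) :
    ∫ x in (0 : ℝ)..1, g (x + η * I) = ∫ x in (0 : ℝ)..1, g x := by
  have hsub : (uIcc (0 : ℂ).re (1 + η * I : ℂ).re ×ℂ uIcc (0 : ℂ).im (1 + η * I : ℂ).im) ⊆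
      strip σ := by
    rintro z ⟨-, hz⟩
    simp only [zero_im, add_im, one_im, mul_im, ofReal_re, I_im, mul_one, ofReal_im, I_re,
      mul_zero, add_zero, zero_add, mem_preimage] at hz
    have := abs_sub_left_of_mem_uIcc hz
    simp only [sub_zero] at this
    exact lt_of_le_of_lt this hη
  have h := integral_boundary_rect_eq_zero_of_differentiableOn g 0 (1 + η * I) (hg.mono hsub)
  simp only [zero_im, zero_re, add_im, add_re, one_im, one_re, mul_im, mul_re, ofReal_re, I_im,
    mul_one, ofReal_im, I_re, mul_zero, add_zero, zero_add, sub_zero, ofReal_zero, zero_mul,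
    ofReal_one] at h
  have h2 : ∫ y in (0 : ℝ)..η, g (1 + y * I) = ∫ y in (0 : ℝ)..η, g (y * I) := by
    refine intervalIntegral.integral_congr fun y hy => ?_
    have hy' := abs_sub_left_of_mem_uIcc hy
    simp only [sub_zero] at hy'
    show g (1 + y * I) = g (y * I)
    rw [add_comm]
    exact hper _ (by simpa [strip] using lt_of_le_of_lt hy' hη)
  rw [h2] at h
  linear_combination -h

lemma norm_ee_real_sub_one_ge {x d : ℝ} (h : ∀ n : ℤ, d ≤ |x + n|) : d ≤ ‖ee x - 1‖ := by
  set y : ℝ := x + (-(round x) : ℤ) with hy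
  have hyl : |y| ≤ 1 / 2 := by
    have := abs_sub_round x
    simpa [hy, sub_eq_add_neg] using this
  have he : ee x = ee y := by
    rw [hy, ofReal_add, ofReal_intCast, ee_add, ee_int, mul_one]
  have hd : d ≤ |y| := h _
  have hn : ‖ee x - 1‖ = 2 * |Real.sin (Real.pi * y)| := by
    have h1 : ee x = exp (I * ((2 * (Real.pi * y) : ℝ) : ℂ)) := by
      rw [he, ee]; congr 1; push_cast; ring
    rw [h1, norm_exp_I_mul_ofReal_sub_one, norm_mul, Real.norm_eq_abs, Real.norm_eq_abs]
    simp
  rw [hn]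
  have h2 : |Real.pi * y| ≤ Real.pi / 2 := by
    rw [abs_mul, abs_of_pos Real.pi_pos]; nlinarith [Real.pi_pos]
  have h3 := Real.mul_abs_le_abs_sin h2
  rw [abs_mul, abs_of_pos Real.pi_pos] at h3
  have h4 : 2 / Real.pi * (Real.pi * |y|) = 2 * |y| := by field_simp
  rw [h4] at h3
  linarith [abs_nonneg y]

/-- The Diophantine weight sum. -/
lemma summable_cube_exp {δ : ℝ} (hδ : 0 < δ) (hδ1 : δ ≤ 1 / 2) :
    Summable (fun m : ℤ => |(m : ℝ)| ^ 3 * Real.exp (-(2 * Real.pi * |(m : ℝ)| * δ))) ∧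
    ∑' m : ℤ, |(m : ℝ)| ^ 3 * Real.exp (-(2 * Real.pi * |(m : ℝ)| * δ)) ≤ 12 / δ ^ 4 := by
  set r := Real.exp (-(2 * Real.pi * δ)) with hr
  have hr0 : 0 < r := Real.exp_pos _
  have hx : δ ≤ 1 - r := by
    have h1 : 1 + 2 * Real.pi * δ ≤ Real.exp (2 * Real.pi * δ) := by
      have := Real.add_one_le_exp (2 * Real.pi * δ); linarith
    have h2 : r ≤ (1 + 2 * Real.pi * δ)⁻¹ := by
      rw [hr, Real.exp_neg]
      exact inv_anti₀ (by positivity) h1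
    have h3 : (1 + 2 * Real.pi * δ)⁻¹ ≤ 1 - δ := by
      rw [inv_le_comm₀ (by positivity) (by linarith), inv_le_iff_one_le_mul₀ (by linarith)]
      nlinarith [Real.pi_gt_three, mul_pos hδ hδ, mul_nonneg hδ.le (by linarith : 0 ≤ 1 / 2 - δ),
        mul_pos hδ Real.pi_pos, mul_nonneg (mul_pos hδ Real.pi_pos).le (by linarith : 0 ≤ 1 / 2 - δ)]
    linarith
  have hr1 : r < 1 := by linarith
  have hS := (hasSum_choose_mul_geometric_of_norm_lt_one 3 (r := r)
    (by rw [Real.norm_eq_abs, abs_of_pos hr0]; exact hr1)).mul_left 6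
  have hle : ∀ n : ℕ, (n : ℝ) ^ 3 * r ^ n ≤ 6 * (((n + 3).choose 3 : ℕ) * r ^ n) := by
    intro n
    rw [← mul_assoc]
    refine mul_le_mul_of_nonneg_right ?_ (by positivity)
    have : n ^ 3 ≤ 6 * (n + 3).choose 3 := by
      have h6 : (n + 3).descFactorial 3 = 6 * (n + 3).choose 3 :=
        Nat.descFactorial_eq_factorial_mul_choose _ _
      rw [← h6]
      simp [Nat.descFactorial]
      nlinarith [sq_nonneg n, Nat.zero_le n]
    exact_mod_cast this
  have hs1 : Summable fun n : ℕ => (n : ℝ) ^ 3 * r ^ n :=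
    Summable.of_nonneg_of_le (fun n => by positivity) hle hS.summable
  have hsum : ∑' n : ℕ, (n : ℝ) ^ 3 * r ^ n ≤ 6 / δ ^ 4 := by
    refine (hs1.tsum_le_tsum hle hS.summable).trans ?_
    rw [hS.tsum_eq, div_eq_mul_one_div 6 (δ ^ 4)]
    gcongr
  have key : ∀ n : ℕ, Real.exp (-(2 * Real.pi * (n : ℝ) * δ)) = r ^ n := by
    intro n
    rw [hr, ← Real.exp_nat_mul]; congr 1; ring
  have hZ := HasSum.of_nat_of_neg (f := fun m : ℤ => |(m : ℝ)| ^ 3 *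
      Real.exp (-(2 * Real.pi * |(m : ℝ)| * δ)))
    (hf₁ := by simpa [key] using hs1.hasSum) (hf₂ := by simpa [key] using hs1.hasSum)
  refine ⟨hZ.summable, ?_⟩
  rw [hZ.tsum_eq]
  simp
  have : (12 : ℝ) / δ ^ 4 = 6 / δ ^ 4 + 6 / δ ^ 4 := by ring
  linarith

/-- Diophantine condition with exponent `3`. -/
def Dioph (γ β : ℝ) : Prop :=
  ∀ m n : ℤ, m ≠ 0 → γ / |(m : ℝ)| ^ 3 ≤ |(m : ℝ) * β + n|

variable {Φ : ℝ → ℂ → ℂ} {σ δ M γ β : ℝ}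

lemma cont_slice (hc : ContinuousOn (fun q : ℝ × ℂ => Φ q.1 q.2) (univ ×ˢ strip σ))
    (y : ℝ) : ContinuousOn (Φ y) (strip σ) :=
  hc.comp (f := fun s : ℂ => (y, s)) (by fun_prop) (fun _ hs => ⟨mem_univ _, hs⟩)

/-- Fourier coefficient of a function on the strip. -/
noncomputable def fcoef (Φ : ℝ → ℂ → ℂ) (m : ℤ) (y : ℝ) : ℂ :=
  ∫ x in (0 : ℝ)..1, Φ y x * ee (-(m * (x : ℂ)))

lemma fcoef_shift (hd : DifferentiableOn ℂ (Φ y) (strip σ))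
    (hp : ∀ s ∈ strip σ, Φ y (s + 1) = Φ y s) (m : ℤ) {η : ℝ} (hη : |η| < σ) :
    ∫ x in (0 : ℝ)..1, Φ y (x + η * I) * ee (-(m * (x : ℂ))) = fcoef Φ m y * ee (m * (η * I)) := by
  have h := integral_shift (g := fun s => Φ y s * ee (-(m * s)))
    (hd.mul ((differentiable_ee.comp (by fun_prop)).differentiableOn))
    (fun s hs => by
      show Φ y (s + 1) * ee (-(m * (s + 1))) = Φ y s * ee (-(m * s))
      rw [hp s hs, show -((m : ℂ) * (s + 1)) = ((-m : ℤ) : ℂ) * (s + 1) by push_cast; ring,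
        ee_int_mul_add_one]
      push_cast; rw [neg_mul]) hη
  rw [fcoef, ← h, ← intervalIntegral.integral_mul_const]
  refine intervalIntegral.integral_congr fun x _ => ?_
  show _ = Φ y (x + η * I) * ee (-(m * (x + η * I))) * ee (m * (η * I))
  rw [mul_assoc, ← ee_add]
  congr 2
  ring

lemma norm_fcoef_le (hd : DifferentiableOn ℂ (Φ y) (strip σ)) (hσ : 0 < σ)
    (hp : ∀ s ∈ strip σ, Φ y (s + 1) = Φ y s) (hM : ∀ s ∈ strip σ, ‖Φ y s‖ ≤ M) (m : ℤ) :
    ‖fcoef Φ m y‖ ≤ M * Real.exp (-(2 * Real.pi * |(m : ℝ)| * σ)) := by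
  have h1 : ∀ τ ∈ Ioo 0 σ, ‖fcoef Φ m y‖ ≤ M * Real.exp (-(2 * Real.pi * |(m : ℝ)| * τ)) := by
    intro τ hτ
    obtain ⟨η, hη, hmη⟩ : ∃ η : ℝ, |η| = τ ∧ (m : ℝ) * η = -(|(m : ℝ)| * τ) := by
      rcases le_total 0 (m : ℝ) with h | h
      · exact ⟨-τ, by rw [abs_neg, abs_of_pos hτ.1], by rw [abs_of_nonneg h]; ring⟩
      · exact ⟨τ, abs_of_pos hτ.1, by rw [abs_of_nonpos h]; ring⟩
    have h2 := fcoef_shift hd hp m (η := η) (by rw [hη]; exact hτ.2)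
    have h3 : ‖∫ x in (0 : ℝ)..1, Φ y (x + η * I) * ee (-(m * (x : ℂ)))‖ ≤ M * |1 - 0| := by
      refine intervalIntegral.norm_integral_le_of_norm_le_const fun x _ => ?_
      rw [norm_mul, norm_ee]
      simp only [neg_im, mul_im, intCast_re, ofReal_im, mul_zero, intCast_im, zero_mul, add_zero,
        neg_zero, Real.exp_zero, mul_one]
      exact hM _ (by simpa [strip, hη] using hτ.2)
    rw [h2, norm_mul, norm_ee] at h3
    have h4 : ((m : ℂ) * (η * I)).im = -(|(m : ℝ)| * τ) := by simpa using hmη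
    rw [h4] at h3
    rw [Real.exp_neg, ← div_eq_mul_inv, le_div_iff₀ (Real.exp_pos _)]
    have h5 : -(2 * Real.pi * -(|(m : ℝ)| * τ)) = 2 * Real.pi * |(m : ℝ)| * τ := by ring
    rw [h5] at h3
    simpa using h3
  have h2 : Tendsto (fun τ : ℝ => M * Real.exp (-(2 * Real.pi * |(m : ℝ)| * τ))) (𝓝[<] σ)
      (𝓝 (M * Real.exp (-(2 * Real.pi * |(m : ℝ)| * σ)))) := by
    have : Continuous (fun τ : ℝ => M * Real.exp (-(2 * Real.pi * |(m : ℝ)| * τ))) := by fun_prop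
    exact this.continuousWithinAt
  refine ge_of_tendsto h2 ?_
  filter_upwards [Ioo_mem_nhdsLT hσ] with τ hτ using h1 τ hτ

/-- The small-divisor equation on a strip. -/
lemma exists_cohomological (hγ : 0 < γ) (hβ : Dioph γ β) (hδ : 0 < δ) (hδ1 : δ ≤ 1 / 2)
    (hδσ : δ < σ)
    (hc : ContinuousOn (fun q : ℝ × ℂ => Φ q.1 q.2) (univ ×ˢ strip σ))
    (hd : ∀ y, DifferentiableOn ℂ (Φ y) (strip σ))
    (hp : ∀ y, ∀ s ∈ strip σ, Φ y (s + 1) = Φ y s) (hM : ∀ y, ∀ s ∈ strip σ, ‖Φ y s‖ ≤ M)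
    (h0 : ∀ y, ∫ x in (0 : ℝ)..1, Φ y x = 0) (hr : ∀ y (x : ℝ), (Φ y x).im = 0) :
    ∃ c : ℝ → ℂ → ℂ, ContinuousOn (fun q : ℝ × ℂ => c q.1 q.2) (univ ×ˢ strip (σ - δ)) ∧
      (∀ y, DifferentiableOn ℂ (c y) (strip (σ - δ))) ∧
      (∀ y s, c y (s + 1) = c y s) ∧
      (∀ y, ∀ s ∈ strip (σ - δ), c y (s + β) - c y s = Φ y s) ∧
      (∀ y, ∀ s ∈ strip (σ - δ), ‖c y s‖ ≤ 12 / γ / δ ^ 4 * M) ∧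
      (∀ y (x : ℝ), (c y x).im = 0) := by
  have hσ : 0 < σ := hδ.trans hδσ
  have hM0 : 0 ≤ M := (norm_nonneg _).trans (hM 0 0 (by simpa using ofReal_mem_strip hσ 0))
  set d : ℤ → ℂ := fun m => ee (m * β) - 1 with hd_def
  have hdge : ∀ m : ℤ, m ≠ 0 → γ / |(m : ℝ)| ^ 3 ≤ ‖d m‖ := by
    intro m hm
    have := norm_ee_real_sub_one_ge (x := m * β) (hβ m · hm)
    simpa [hd_def] using this
  set T : ℤ → ℝ → ℂ → ℂ := fun m y s => fcoef Φ m y / d m * ee (m * s) with hT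
  set u : ℤ → ℝ := fun m => M / γ * (|(m : ℝ)| ^ 3 * Real.exp (-(2 * Real.pi * |(m : ℝ)| * δ)))
    with hu
  have hpre : ∀ (m : ℤ) y, ∀ s ∈ strip (σ - δ), ‖fcoef Φ m y‖ * ‖ee (m * s)‖ ≤
      M * Real.exp (-(2 * Real.pi * |(m : ℝ)| * δ)) := by
    intro m y s hs
    have h1 := norm_fcoef_le (hd y) hσ (hp y) (hM y) m
    have h2 := norm_ee_int_mul_le m s
    have hs' : |s.im| < σ - δ := hs
    calc ‖fcoef Φ m y‖ * ‖ee (m * s)‖ ≤ (M * Real.exp (-(2 * Real.pi * |(m : ℝ)| * σ))) *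
          Real.exp (2 * Real.pi * |(m : ℝ)| * |s.im|) := by gcongr
      _ = M * Real.exp (-(2 * Real.pi * |(m : ℝ)| * (σ - |s.im|))) := by
          rw [mul_assoc, ← Real.exp_add]; congr 2; ring
      _ ≤ M * Real.exp (-(2 * Real.pi * |(m : ℝ)| * δ)) := by
          gcongr
          linarith
  have hTu : ∀ m y, ∀ s ∈ strip (σ - δ), ‖T m y s‖ ≤ u m := by
    intro m y s hs
    rcases eq_or_ne m 0 with rfl | hm
    · simp [hT, hu, hd_def, ee_zero]
    · have hm' : 0 < |(m : ℝ)| := abs_pos.2 (by exact_mod_cast hm)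
      have hdm := hdge m hm
      have hdp : 0 < γ / |(m : ℝ)| ^ 3 := by positivity
      rw [hT, norm_mul, norm_div, div_mul_eq_mul_div]
      calc ‖fcoef Φ m y‖ * ‖ee (m * s)‖ / ‖d m‖ ≤
            (M * Real.exp (-(2 * Real.pi * |(m : ℝ)| * δ))) / (γ / |(m : ℝ)| ^ 3) :=
            div_le_div₀ (by positivity) (hpre m y s hs) hdp hdm
        _ = u m := by rw [hu]; field_simp
  obtain ⟨hsum, hle⟩ := summable_cube_exp hδ hδ1
  have husum : Summable u := hsum.mul_left _
  have hacont : ∀ m, Continuous (fcoef Φ m) := by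
    intro m
    refine intervalIntegral.continuous_parametric_intervalIntegral_of_continuous' (μ := volume)
      (f := fun y (x : ℝ) => Φ y x * ee (-(m * (x : ℂ)))) ?_ 0 1
    refine Continuous.mul ?_ (continuous_ee.comp (by fun_prop))
    exact hc.comp_continuous (f := fun q : ℝ × ℝ => (q.1, (q.2 : ℂ))) (by fun_prop)
      (fun q => ⟨mem_univ _, ofReal_mem_strip hσ _⟩)
  refine ⟨fun y s => ∑' m, T m y s, ?_, ?_, ?_, ?_, ?_, ?_⟩
  · refine continuousOn_tsum (u := u) (fun m => Continuous.continuousOn ?_) husum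
      (fun m q hq => hTu m q.1 q.2 hq.2)
    exact (((hacont m).comp continuous_fst).div_const _).mul (continuous_ee.comp (by fun_prop))
  · intro y
    exact differentiableOn_tsum_of_summable_norm husum
      (fun m => ((differentiable_ee.comp (by fun_prop)).const_mul _).differentiableOn)
      (isOpen_strip _) (fun m s hs => hTu m y s hs)
  · intro y s
    refine tsum_congr fun m => ?_
    simp only [hT, ee_int_mul_add_one]
  · intro y s hs
    have hsβ : s + β ∈ strip (σ - δ) := add_real_mem_strip hs β
    have hs1 := Summable.of_norm_bounded husum (fun m => hTu m y _ hsβ)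
    have hs2 := Summable.of_norm_bounded husum (fun m => hTu m y _ hs)
    show (∑' m, T m y (s + β)) - ∑' m, T m y s = Φ y s
    rw [← hs1.tsum_sub hs2]
    have hterm : ∀ m, T m y (s + β) - T m y s = fcoef Φ m y * ee (m * s) := by
      intro m
      rcases eq_or_ne m 0 with rfl | hm
      · have : fcoef Φ 0 y = 0 := by simpa [fcoef, ee_zero] using h0 y
        simp [hT, this]
      · have hdm : d m ≠ 0 := norm_pos_iff.1 (lt_of_lt_of_le
          (by have : 0 < |(m : ℝ)| := abs_pos.2 (by exact_mod_cast hm)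
              positivity) (hdge m hm))
        simp only [hT, mul_add, ee_add]
        rw [div_mul_eq_mul_div, div_mul_eq_mul_div, ← sub_div, div_eq_iff hdm, hd_def]
        ring
    simp_rw [hterm]
    have hs' : |s.im| < σ := strip_mono (by linarith) hs
    have hsx : s = s.re + s.im * I := (re_add_im s).symm
    have hF := hasSum_fourier (g := fun x : ℝ => Φ y (x + s.im * I)) ?_ ?_ ?_ s.re
    · rw [hsx]
      rw [← hF.tsum_eq]
      refine tsum_congr fun m => ?_
      rw [fcoef_shift (hd y) (hp y) m hs', mul_add, ee_add]
      ring
    · exact (cont_slice hc y).comp_continuous (by fun_prop) (fun x => by simpa [strip] using hs')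
    · intro x
      show Φ y ((x + 1 : ℝ) + s.im * I) = _
      rw [← hp y (x + s.im * I) (by simpa [strip] using hs')]
      congr 1; push_cast; ring
    · simp_rw [fcoef_shift (hd y) (hp y) _ hs']
      have hb : ∀ m : ℤ, ‖fcoef Φ m y * ee (m * (s.im * I))‖ ≤
          ‖fcoef Φ 0 y * ee ((0 : ℤ) * (s.im * I))‖ * (if m = 0 then 1 else 0) + γ * u m := by
        intro m
        have hs3 : ((s.im : ℂ) * I) ∈ strip (σ - δ) := by
          simpa [strip] using hs
        rcases eq_or_ne m 0 with rfl | hm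
        · simp [hu]
        · rw [norm_mul, if_neg hm, mul_zero, zero_add]
          refine (hpre m y _ hs3).trans ?_
          have hm' : (1 : ℝ) ≤ |(m : ℝ)| := by exact_mod_cast Int.one_le_abs hm
          rw [hu]
          simp only
          rw [← mul_assoc, mul_div_cancel₀ _ hγ.ne']
          refine mul_le_mul_of_nonneg_left ?_ hM0
          exact le_mul_of_one_le_left (Real.exp_pos _).le (one_le_pow₀ hm')
      refine Summable.of_norm_bounded (Summable.add ?_ (husum.mul_left γ)) hb
      exact ((hasSum_ite_eq 0 (1 : ℝ)).summable).mul_left _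
  · intro y s hs
    refine (tsum_of_norm_bounded husum.hasSum (fun m => hTu m y s hs)).trans ?_
    rw [hu, tsum_mul_left]
    calc M / γ * _ ≤ M / γ * (12 / δ ^ 4) := by gcongr
      _ = _ := by ring
  · intro y x
    rw [← conj_eq_iff_im]
    have hee : ∀ z : ℂ, (starRingEnd ℂ) (ee z) = ee (-(starRingEnd ℂ) z) := by
      intro z
      rw [ee, ee, ← exp_conj]
      congr 1
      simp [map_ofNat]
    have hcf : ∀ m, (starRingEnd ℂ) (fcoef Φ m y) = fcoef Φ (-m) y := by
      intro m
      simp only [fcoef, intervalIntegral.integral_of_le zero_le_one]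
      rw [← integral_conj]
      simp only [← intervalIntegral.integral_of_le zero_le_one]
      refine intervalIntegral.integral_congr fun z _ => ?_
      simp only [map_mul, hee]
      rw [conj_eq_iff_im.2 (hr y z)]
      simp
    rw [conj_tsum, ← (Equiv.neg ℤ).tsum_eq]
    refine tsum_congr fun m => ?_
    simp only [Equiv.neg_apply, hT, map_mul, map_div₀, hcf, hee, hd_def, map_sub]
    simp
/-- Functions of a parameter `y`, an angle `θ` and a complex angle `s` on a strip, periodic in `s`
and twisted-periodic in `θ`. -/
structure PF (β σ : ℝ) (F : ℝ → ℝ → ℂ → ℂ) : Prop where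
  cont : ContinuousOn (fun q : (ℝ × ℝ) × ℂ => F q.1.1 q.1.2 q.2) (univ ×ˢ strip σ)
  diff : ∀ y θ, DifferentiableOn ℂ (F y θ) (strip σ)
  per : ∀ y θ, ∀ s ∈ strip σ, F y θ (s + 1) = F y θ s
  tw : ∀ y θ, ∀ s ∈ strip σ, F y (θ + 1) s = F y θ (s + β)
  real : ∀ y θ (x : ℝ), (F y θ x).im = 0

/-- Uniform bound on a strip. -/
def Bd (σ M : ℝ) (F : ℝ → ℝ → ℂ → ℂ) : Prop := ∀ y θ, ∀ s ∈ strip σ, ‖F y θ s‖ ≤ M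

/-- `F` is the `θ`-derivative of `G`. -/
def DT (σ : ℝ) (G F : ℝ → ℝ → ℂ → ℂ) : Prop :=
  ∀ y θ, ∀ s ∈ strip σ, HasDerivAt (fun t => G y t s) (F y θ s) θ

/-- The derivative in the complex angle. -/
noncomputable def ds (F : ℝ → ℝ → ℂ → ℂ) : ℝ → ℝ → ℂ → ℂ := fun y θ s => deriv (F y θ) s

/-- The average over the torus. -/
noncomputable def mean (F : ℝ → ℝ → ℂ → ℂ) (y : ℝ) : ℂ :=
  ∫ x in (0 : ℝ)..1, ∫ θ in (0 : ℝ)..1, F y θ x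

variable {β σ τ δ M N γ : ℝ} {F G : ℝ → ℝ → ℂ → ℂ}

lemma Bd.mono (h : Bd σ M F) (hτ : τ ≤ σ) (hM : M ≤ N) : Bd τ N F :=
  fun y θ s hs => (h y θ s (strip_mono hτ hs)).trans hM

lemma Bd.nonneg (h : Bd σ M F) (hσ : 0 < σ) : 0 ≤ M :=
  (norm_nonneg _).trans (h 0 0 0 (by simpa using ofReal_mem_strip hσ 0))

lemma Bd.add (hF : Bd σ M F) (hG : Bd σ N G) : Bd σ (M + N) (fun y θ s => F y θ s + G y θ s) :=
  fun y θ s hs => norm_add_le_of_le (hF y θ s hs) (hG y θ s hs)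

lemma Bd.sub (hF : Bd σ M F) (hG : Bd σ N G) : Bd σ (M + N) (fun y θ s => F y θ s - G y θ s) :=
  fun y θ s hs => norm_sub_le_of_le (hF y θ s hs) (hG y θ s hs)

lemma Bd.mul (hF : Bd σ M F) (hG : Bd σ N G) : Bd σ (M * N) (fun y θ s => F y θ s * G y θ s) :=
  fun y θ s hs => norm_mul_le_of_le (hF y θ s hs) (hG y θ s hs)

lemma DT.mul {G' F' : ℝ → ℝ → ℂ → ℂ} (h : DT σ G F) (h' : DT σ G' F') :
    DT σ (fun y θ s => G y θ s * G' y θ s)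
      (fun y θ s => F y θ s * G' y θ s + G y θ s * F' y θ s) :=
  fun y θ s hs => (h y θ s hs).mul (h' y θ s hs)

namespace PF

lemma mono (h : PF β σ F) (hτ : τ ≤ σ) : PF β τ F :=
  ⟨h.cont.mono (prod_mono_right (strip_mono hτ)), fun y θ => (h.diff y θ).mono (strip_mono hτ),
    fun y θ s hs => h.per y θ s (strip_mono hτ hs), fun y θ s hs => h.tw y θ s (strip_mono hτ hs),
    h.real⟩

lemma param {g : ℝ → ℝ} (hg : Continuous g) : PF β σ (fun y _ _ => (g y : ℂ)) :=
  ⟨by fun_prop, fun y θ => differentiableOn_const _, fun _ _ _ _ => rfl, fun _ _ _ _ => rfl,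
    fun y _ _ => ofReal_im _⟩

lemma add (hF : PF β σ F) (hG : PF β σ G) : PF β σ (fun y θ s => F y θ s + G y θ s) :=
  ⟨hF.cont.add hG.cont, fun y θ => (hF.diff y θ).add (hG.diff y θ),
    fun y θ s hs => by rw [hF.per y θ s hs, hG.per y θ s hs],
    fun y θ s hs => by rw [hF.tw y θ s hs, hG.tw y θ s hs],
    fun y θ x => by rw [add_im, hF.real, hG.real, add_zero]⟩

lemma sub (hF : PF β σ F) (hG : PF β σ G) : PF β σ (fun y θ s => F y θ s - G y θ s) :=
  ⟨hF.cont.sub hG.cont, fun y θ => (hF.diff y θ).sub (hG.diff y θ),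
    fun y θ s hs => by rw [hF.per y θ s hs, hG.per y θ s hs],
    fun y θ s hs => by rw [hF.tw y θ s hs, hG.tw y θ s hs],
    fun y θ x => by rw [sub_im, hF.real, hG.real, sub_zero]⟩

lemma neg (hF : PF β σ F) : PF β σ (fun y θ s => -F y θ s) :=
  ⟨hF.cont.neg, fun y θ => (hF.diff y θ).neg,
    fun y θ s hs => by rw [hF.per y θ s hs], fun y θ s hs => by rw [hF.tw y θ s hs],
    fun y θ x => by rw [neg_im, hF.real, neg_zero]⟩

lemma mul (hF : PF β σ F) (hG : PF β σ G) : PF β σ (fun y θ s => F y θ s * G y θ s) :=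
  ⟨hF.cont.mul hG.cont, fun y θ => (hF.diff y θ).mul (hG.diff y θ),
    fun y θ s hs => by rw [hF.per y θ s hs, hG.per y θ s hs],
    fun y θ s hs => by rw [hF.tw y θ s hs, hG.tw y θ s hs],
    fun y θ x => by rw [mul_im, hF.real, hG.real, mul_zero, zero_mul, add_zero]⟩

lemma inv (hF : PF β σ F) (h0 : ∀ y θ, ∀ s ∈ strip σ, F y θ s ≠ 0) :
    PF β σ (fun y θ s => (F y θ s)⁻¹) :=
  ⟨hF.cont.inv₀ (fun q hq => h0 _ _ _ hq.2), fun y θ => (hF.diff y θ).inv (h0 y θ),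
    fun y θ s hs => by rw [hF.per y θ s hs], fun y θ s hs => by rw [hF.tw y θ s hs],
    fun y θ x => by rw [inv_im, hF.real, neg_zero, zero_div]⟩

lemma differentiableAt (hF : PF β σ F) {y θ : ℝ} {s : ℂ} (hs : s ∈ strip σ) :
    DifferentiableAt ℂ (F y θ) s := (hF.diff y θ).differentiableAt ((isOpen_strip σ).mem_nhds hs)

lemma hasDerivAt (hF : PF β σ F) {y θ : ℝ} {s : ℂ} (hs : s ∈ strip σ) :
    HasDerivAt (F y θ) (JumpingKAM.ds F y θ s) s := (hF.differentiableAt hs).hasDerivAt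

lemma ofReal_re (hF : PF β σ F) (y θ x : ℝ) : ((F y θ x).re : ℂ) = F y θ x :=
  Complex.ext (by simp) (by simp [hF.real])

lemma ds (hσ : 0 < σ) (hF : PF β σ F) : PF β σ (ds F) := by
  refine ⟨?_, fun y θ => (hF.diff y θ).deriv (isOpen_strip σ), ?_, ?_, ?_⟩
  · exact continuousOn_deriv_of_family (f := fun (p : ℝ × ℝ) => F p.1 p.2)
      (isOpen_univ.prod (isOpen_strip σ)) hF.cont (fun q hq => hF.differentiableAt hq.2)
  · intro y θ s hs
    have h1 : (fun z => F y θ (z + 1)) =ᶠ[𝓝 s] F y θ := by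
      filter_upwards [(isOpen_strip σ).mem_nhds hs] with z hz using hF.per y θ z hz
    rw [JumpingKAM.ds, ← deriv_comp_add_const, h1.deriv_eq]
    rfl
  · intro y θ s hs
    have h1 : F y (θ + 1) =ᶠ[𝓝 s] (fun z => F y θ (z + β)) := by
      filter_upwards [(isOpen_strip σ).mem_nhds hs] with z hz using hF.tw y θ z hz
    rw [JumpingKAM.ds, h1.deriv_eq, deriv_comp_add_const]
    rfl
  · intro y θ x
    have h := (hF.hasDerivAt (y := y) (θ := θ) (ofReal_mem_strip hσ x)).comp_ofReal
    have him : HasDerivAt (fun t : ℝ => (F y θ t).im) (JumpingKAM.ds F y θ x).im x :=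
      imCLM.hasFDerivAt.comp_hasDerivAt x h
    have h0 : (fun t : ℝ => (F y θ t).im) = fun _ => 0 := by
      funext t; exact hF.real y θ t
    rw [h0] at him
    exact (him.unique (hasDerivAt_const _ _))

lemma bd_ds (hF : PF β σ F) (hM : Bd σ M F) (hδ : 0 < δ) :
    Bd (σ - δ) (M / δ) (JumpingKAM.ds F) := by
  intro y θ s hs
  have hb := closedBall_subset_strip hs
  refine norm_deriv_le_of_forall_mem_sphere_norm_le hδ ?_ ?_
  · refine DifferentiableOn.diffContOnCl ?_
    rw [closure_ball _ hδ.ne']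
    exact (hF.diff y θ).mono hb
  · exact fun z hz => hM y θ z (hb (Metric.sphere_subset_closedBall hz))

lemma cont_theta (hF : PF β σ F) (y : ℝ) {s : ℂ} (hs : s ∈ strip σ) :
    Continuous fun θ => F y θ s :=
  hF.cont.comp_continuous (f := fun θ : ℝ => ((y, θ), s)) (by fun_prop)
    (fun _ => ⟨mem_univ _, hs⟩)

lemma cont_real (hF : PF β σ F) (hσ : 0 < σ) (y θ : ℝ) : Continuous fun x : ℝ => F y θ x :=
  hF.cont.comp_continuous (f := fun x : ℝ => ((y, θ), (x : ℂ))) (by fun_prop)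
    (fun _ => ⟨mem_univ _, ofReal_mem_strip hσ _⟩)

lemma add_int (hF : PF β σ F) (y θ : ℝ) {s : ℂ} (hs : s ∈ strip σ) (n : ℤ) :
    F y (θ + n) s = F y θ (s + (n * β : ℝ)) := by
  induction n using Int.induction_on generalizing s with
  | zero => simp
  | succ n ih =>
    rw [show θ + (((n : ℤ) + 1 : ℤ) : ℝ) = θ + (n : ℤ) + 1 by push_cast; ring, hF.tw y _ s hs,
      ih (add_real_mem_strip hs β)]
    congr 1
    push_cast
    ring
  | pred n ih =>
    have hs' : s + ((-β : ℝ) : ℂ) ∈ strip σ := add_real_mem_strip hs _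
    have h := hF.tw y (θ + ((-(n : ℤ) - 1 : ℤ) : ℝ)) _ hs'
    rw [show θ + ((-(n : ℤ) - 1 : ℤ) : ℝ) + 1 = θ + ((-(n : ℤ) : ℤ) : ℝ) by push_cast; ring,
      ih hs'] at h
    rw [show s = s + ((-β : ℝ) : ℂ) + β by push_cast; ring, ← h]
    congr 1
    push_cast
    ring

lemma bd_of_unit (hF : PF β σ F) (hb : ∀ y, ∀ θ ∈ Icc (0 : ℝ) 1, ∀ s ∈ strip σ, ‖F y θ s‖ ≤ M) :
    Bd σ M F := by
  intro y θ s hs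
  have h := hF.add_int y (Int.fract θ) hs ⌊θ⌋
  rw [Int.fract_add_floor] at h
  rw [h]
  exact hb y _ ⟨Int.fract_nonneg θ, (Int.fract_lt_one θ).le⟩ _ (add_real_mem_strip hs _)

lemma cont_prim (hF : PF β σ F) :
    ContinuousOn (fun q : (ℝ × ℂ) × ℝ => ∫ θ in (0 : ℝ)..q.2, F q.1.1 θ q.1.2)
      ((univ ×ˢ strip σ) ×ˢ univ) := by
  refine continuousOn_primitive (f := fun (p : ℝ × ℂ) θ => F p.1 θ p.2) ?_ 0
  exact hF.cont.comp (f := fun q : (ℝ × ℂ) × ℝ => ((q.1.1, q.2), q.1.2)) (by fun_prop)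
    (fun q hq => ⟨mem_univ _, hq.1.2⟩)

lemma hasDerivAt_prim (hF : PF β σ F) (y a b : ℝ) {s : ℂ} (hs : s ∈ strip σ) :
    HasDerivAt (fun z => ∫ θ in a..b, F y θ z) (∫ θ in a..b, JumpingKAM.ds F y θ s) s := by
  refine hasDerivAt_integral_family (isOpen_strip σ) ?_ (hF.diff y) a b hs
  exact hF.cont.comp (f := fun q : ℝ × ℂ => ((y, q.1), q.2)) (by fun_prop)
    (fun q hq => ⟨mem_univ _, hq.2⟩)

lemma integral_real (hF : PF β σ F) (y a b x : ℝ) : (∫ θ in a..b, F y θ x).im = 0 := by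
  have : ∫ θ in a..b, F y θ x = ((∫ θ in a..b, (F y θ x).re : ℝ) : ℂ) := by
    rw [← intervalIntegral.integral_ofReal]
    simp only [hF.ofReal_re]
  rw [this, ofReal_im]

lemma cont_int_real (hF : PF β σ F) (hσ : 0 < σ) :
    Continuous fun q : ℝ × ℝ => ∫ θ in (0 : ℝ)..1, F q.1 θ q.2 :=
  hF.cont_prim.comp_continuous (f := fun q : ℝ × ℝ => ((q.1, (q.2 : ℂ)), (1 : ℝ)))
    (by fun_prop) (fun q => ⟨⟨mem_univ _, ofReal_mem_strip hσ _⟩, mem_univ _⟩)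

lemma cont_mean (hF : PF β σ F) (hσ : 0 < σ) : Continuous (mean F) :=
  intervalIntegral.continuous_parametric_intervalIntegral_of_continuous' (μ := volume)
    (f := fun y (x : ℝ) => ∫ θ in (0 : ℝ)..1, F y θ x) (hF.cont_int_real hσ) 0 1

lemma mean_real (hF : PF β σ F) (y : ℝ) : (mean F y).im = 0 := by
  have : mean F y = ((∫ x in (0 : ℝ)..1, (∫ θ in (0 : ℝ)..1, F y θ x).re : ℝ) : ℂ) := by
    rw [← intervalIntegral.integral_ofReal, mean]
    refine intervalIntegral.integral_congr fun x _ => ?_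
    exact (conj_eq_iff_re.1 (conj_eq_iff_im.2 (hF.integral_real y 0 1 x))).symm
  rw [this, ofReal_im]

lemma norm_mean_le (hσ : 0 < σ) (hM : Bd σ M F) (y : ℝ) : ‖mean F y‖ ≤ M := by
  have h := intervalIntegral.norm_integral_le_of_norm_le_const (a := 0) (b := 1) (C := M)
    (f := fun x : ℝ => ∫ θ in (0 : ℝ)..1, F y θ x) fun x _ => by
      have h := intervalIntegral.norm_integral_le_of_norm_le_const (a := 0) (b := 1) (C := M)
        (f := fun θ : ℝ => F y θ x) fun θ _ => hM y θ x (ofReal_mem_strip hσ x)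
      simpa using h
  simpa [mean] using h

lemma mean_add (hF : PF β σ F) (hG : PF β σ G) (hσ : 0 < σ) (y : ℝ) :
    mean (fun y θ s => F y θ s + G y θ s) y = mean F y + mean G y := by
  have h1 : ∀ x : ℝ, ∫ θ in (0 : ℝ)..1, (F y θ x + G y θ x) =
      (∫ θ in (0 : ℝ)..1, F y θ x) + ∫ θ in (0 : ℝ)..1, G y θ x := fun x =>
    intervalIntegral.integral_add ((hF.cont_theta y (ofReal_mem_strip hσ x)).intervalIntegrable _ _)
      ((hG.cont_theta y (ofReal_mem_strip hσ x)).intervalIntegrable _ _)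
  simp only [mean, h1]
  exact intervalIntegral.integral_add
    (((hF.cont_int_real hσ).comp (Continuous.prodMk_right y)).intervalIntegrable _ _)
    (((hG.cont_int_real hσ).comp (Continuous.prodMk_right y)).intervalIntegrable _ _)

lemma mean_const_mul (c : ℝ → ℂ) (y : ℝ) :
    mean (fun y θ s => c y * F y θ s) y = c y * mean F y := by
  simp only [mean, intervalIntegral.integral_const_mul]

lemma mean_ds (hF : PF β σ F) (hσ : 0 < σ) (y : ℝ) : mean (JumpingKAM.ds F) y = 0 := by
  have h1 : ∀ x : ℝ, HasDerivAt (fun x : ℝ => ∫ θ in (0 : ℝ)..1, F y θ x)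
      (∫ θ in (0 : ℝ)..1, JumpingKAM.ds F y θ x) x := fun x =>
    (hF.hasDerivAt_prim y 0 1 (ofReal_mem_strip hσ x)).comp_ofReal
  rw [mean, intervalIntegral.integral_eq_sub_of_hasDerivAt (fun x _ => h1 x)
    ((((hF.ds hσ).cont_int_real hσ).comp (Continuous.prodMk_right y)).intervalIntegrable _ _)]
  rw [sub_eq_zero]
  refine intervalIntegral.integral_congr fun θ _ => ?_
  have := hF.per y θ 0 (by simpa using ofReal_mem_strip hσ 0)
  simpa using this

lemma mean_dt (hG : PF β σ G) (hF : PF β σ F) (h : DT σ G F) (hσ : 0 < σ) (y : ℝ) :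
    mean F y = 0 := by
  have h1 : ∀ x : ℝ, ∫ θ in (0 : ℝ)..1, F y θ x = G y 0 (x + β : ℝ) - G y 0 x := by
    intro x
    have hx := ofReal_mem_strip hσ x
    rw [intervalIntegral.integral_eq_sub_of_hasDerivAt (fun θ _ => h y θ x hx)
      ((hF.cont_theta y hx).intervalIntegrable _ _)]
    have := hG.tw y 0 x hx
    rw [zero_add] at this
    rw [this]; push_cast; rfl
  simp only [mean, h1]
  have hc := hG.cont_real hσ y 0
  have hper : Function.Periodic (fun x : ℝ => G y 0 x) 1 := fun x => by
    have := hG.per y 0 x (ofReal_mem_strip hσ x)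
    simpa using this
  have hcβ : Continuous fun x : ℝ => G y 0 (x + β : ℝ) := hc.comp (continuous_add_const β)
  rw [intervalIntegral.integral_sub (hcβ.intervalIntegrable _ _) (hc.intervalIntegrable _ _),
    intervalIntegral.integral_comp_add_right (fun x : ℝ => G y 0 x) β, sub_eq_zero]
  have := hper.intervalIntegral_add_eq (0 + β) 0
  rw [show (1 : ℝ) + β = 0 + β + 1 by ring, this, zero_add]

end PF

lemma DT.dsl (hG : PF β σ G) (hF : PF β σ F) (hσ : 0 < σ) (h : DT σ G F) :
    DT σ (ds G) (ds F) := by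
  intro y θ s hs
  have h1 : ∀ t, ds G y t s = ds G y θ s + ∫ u in θ..t, ds F y u s := by
    intro t
    have h2 : ∀ z ∈ strip σ, G y t z = G y θ z + ∫ u in θ..t, F y u z := by
      intro z hz
      rw [intervalIntegral.integral_eq_sub_of_hasDerivAt (fun u _ => h y u z hz)
        ((hF.cont_theta y hz).intervalIntegrable _ _)]
      ring
    have h3 : G y t =ᶠ[𝓝 s] fun z => G y θ z + ∫ u in θ..t, F y u z := by
      filter_upwards [(isOpen_strip σ).mem_nhds hs] with z hz using h2 z hz
    have h4 := (hG.hasDerivAt (y := y) (θ := θ) hs).add (hF.hasDerivAt_prim y θ t hs)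
    exact (h4.congr_of_eventuallyEq h3).deriv
  have hc : Continuous fun u => ds F y u s := (hF.ds hσ).cont_theta y hs
  have h5 : HasDerivAt (fun t => ds G y θ s + ∫ u in θ..t, ds F y u s) (ds F y θ s) θ :=
    (hc.integral_hasStrictDerivAt θ θ).hasDerivAt.const_add _
  exact h5.congr_of_eventuallyEq (Eventually.of_forall h1)

/-- Solution of `∂_θ G = F` on the twisted torus for functions of mean zero. -/
lemma exists_solve (hγ : 0 < γ) (hβ : Dioph γ β) (hδ : 0 < δ) (hδ1 : δ ≤ 1 / 2) (hδσ : δ < σ)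
    (hF : PF β σ F) (hM : Bd σ M F) (h0 : ∀ y, mean F y = 0) :
    ∃ G, PF β (σ - δ) G ∧ Bd (σ - δ) ((12 / γ + 1) / δ ^ 4 * M) G ∧ DT (σ - δ) G F := by
  have hσ : 0 < σ := hδ.trans hδσ
  have hM0 := hM.nonneg hσ
  set Φ : ℝ → ℂ → ℂ := fun y s => ∫ θ in (0 : ℝ)..1, F y θ s with hΦ
  obtain ⟨c, hc1, hc2, hc3, hc4, hc5, hc6⟩ := exists_cohomological (Φ := Φ) (M := M) hγ hβ hδ hδ1 hδσ
    (hF.cont_prim.comp (f := fun q : ℝ × ℂ => ((q.1, q.2), (1 : ℝ))) (by fun_prop)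
      (fun q hq => ⟨hq, mem_univ _⟩))
    (fun y s hs => (hF.hasDerivAt_prim y 0 1 hs).differentiableAt.differentiableWithinAt)
    (fun y s hs => intervalIntegral.integral_congr fun θ _ => hF.per y θ s hs)
    (fun y s hs => by
      simpa using intervalIntegral.norm_integral_le_of_norm_le_const (a := 0) (b := 1) (C := M)
        (f := fun θ : ℝ => F y θ s) fun θ _ => hM y θ s hs)
    h0 (fun y x => hF.integral_real y 0 1 x)
  have hle : σ - δ ≤ σ := by linarith
  have hG : PF β (σ - δ) (fun y θ s => c y s + ∫ t in (0 : ℝ)..θ, F y t s) := by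
    refine ⟨?_, ?_, ?_, ?_, ?_⟩
    · refine ContinuousOn.add ?_ ?_
      · exact hc1.comp (f := fun q : (ℝ × ℝ) × ℂ => (q.1.1, q.2)) (by fun_prop)
          (fun q hq => ⟨mem_univ _, hq.2⟩)
      · exact hF.cont_prim.comp (f := fun q : (ℝ × ℝ) × ℂ => ((q.1.1, q.2), q.1.2)) (by fun_prop)
          (fun q hq => ⟨⟨mem_univ _, strip_mono hle hq.2⟩, mem_univ _⟩)
    · exact fun y θ => (hc2 y).add fun s hs =>
        (hF.hasDerivAt_prim y 0 θ (strip_mono hle hs)).differentiableAt.differentiableWithinAt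
    · intro y θ s hs
      show c y (s + 1) + _ = _
      rw [hc3]
      congr 1
      exact intervalIntegral.integral_congr fun t _ => hF.per y t s (strip_mono hle hs)
    · intro y θ s hs
      have hs' := strip_mono hle hs
      have hint : ∀ a b : ℝ, IntervalIntegrable (fun t => F y t s) volume a b := fun a b =>
        (hF.cont_theta y hs').intervalIntegrable _ _
      show c y s + ∫ t in (0 : ℝ)..(θ + 1), F y t s = c y (s + β) + ∫ t in (0 : ℝ)..θ, F y t (s + β)
      rw [← intervalIntegral.integral_add_adjacent_intervals (hint 0 1) (hint 1 (θ + 1))]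
      have h1 : ∫ t in (1 : ℝ)..(θ + 1), F y t s = ∫ t in (0 : ℝ)..θ, F y t (s + β) := by
        have := intervalIntegral.integral_comp_add_right (a := 0) (b := θ) (fun t => F y t s) 1
        rw [zero_add] at this
        rw [← this]
        exact intervalIntegral.integral_congr fun t _ => hF.tw y t s hs'
      rw [h1, ← add_assoc]
      congr 1
      have := hc4 y s hs
      rw [hΦ] at this
      linear_combination -this
    · intro y θ x
      rw [add_im, hc6, hF.integral_real, add_zero]
  refine ⟨_, hG, hG.bd_of_unit ?_, ?_⟩
  · intro y θ hθ s hs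
    have h1 := intervalIntegral.norm_integral_le_of_norm_le_const (a := 0) (b := θ) (C := M)
        (f := fun θ : ℝ => F y θ s) fun t _ => hM y t s (strip_mono hle hs)
    rw [sub_zero, abs_of_nonneg hθ.1] at h1
    have h2 : M * θ ≤ 1 / δ ^ 4 * M := by
      have : 1 ≤ 1 / δ ^ 4 := by
        rw [le_div_iff₀ (by positivity), one_mul]
        exact pow_le_one₀ hδ.le (by linarith)
      nlinarith [hθ.1, hθ.2]
    refine (norm_add_le_of_le (hc5 y s hs) (h1.trans h2)).trans (le_of_eq ?_)
    field_simp
  · intro y θ s hs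
    exact ((hF.cont_theta y (strip_mono hle hs)).integral_hasStrictDerivAt 0 θ).hasDerivAt.const_add _

/-- Complex neighbourhood of `{(t, h) : t ∈ ℝ, |h| < r}`. -/
def dom (ρ r : ℝ) : Set (ℂ × ℂ) := {z | |z.1.im| < ρ ∧ |z.2.im| < ρ ∧ |z.2.re| < r}

lemma isOpen_dom (ρ r : ℝ) : IsOpen (dom ρ r) := by
  refine IsOpen.inter ?_ (IsOpen.inter ?_ ?_)
  · exact isOpen_lt (continuous_abs.comp (continuous_im.comp continuous_fst)) continuous_const
  · exact isOpen_lt (continuous_abs.comp (continuous_im.comp continuous_snd)) continuous_const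
  · exact isOpen_lt (continuous_abs.comp (continuous_re.comp continuous_snd)) continuous_const

lemma dom_mono {ρ ρ' r r' : ℝ} (h : ρ ≤ ρ') (h' : r ≤ r') : dom ρ r ⊆ dom ρ' r' :=
  fun _ hz => ⟨hz.1.trans_le h, hz.2.1.trans_le h, hz.2.2.trans_le h'⟩

/-- If `z` lies in the smaller domain and `w` is `δ`-close then `w` lies in the larger one. -/
lemma mem_dom_of_close {ρ r δ : ℝ} {z w : ℂ × ℂ} (hz : z ∈ dom (ρ - δ) (r - δ))
    (h1 : ‖w.1 - z.1‖ ≤ δ) (h2 : ‖w.2 - z.2‖ ≤ δ) : w ∈ dom ρ r := by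
  obtain ⟨a1, a2, a3⟩ := hz
  have b1 := (abs_im_le_norm _).trans h1
  have b2 := (abs_im_le_norm _).trans h2
  have b3 := (abs_re_le_norm _).trans h2
  simp only [sub_im, sub_re] at b1 b2 b3
  have c : ∀ x y : ℝ, |x| ≤ |x - y| + |y| := fun x y => by simpa using abs_add_le (x - y) y
  exact ⟨by linarith [c w.1.im z.1.im], by linarith [c w.2.im z.2.im],
    by linarith [c w.2.re z.2.re]⟩

/-- A family of real-analytic Hamiltonians, depending continuously on parameters,
`1`-periodic in time `θ` and in the angle. -/
structure Ham (ρ r : ℝ) (K : ℝ → ℝ → ℂ × ℂ → ℂ) : Prop where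
  cont : ContinuousOn (fun q : (ℝ × ℝ) × (ℂ × ℂ) => K q.1.1 q.1.2 q.2) (univ ×ˢ dom ρ r)
  ana : ∀ y θ, AnalyticOnNhd ℂ (K y θ) (dom ρ r)
  per : ∀ y θ, ∀ z ∈ dom ρ r, K y θ (z.1 + 1, z.2) = K y θ z
  pert : ∀ y θ, ∀ z ∈ dom ρ r, K y (θ + 1) z = K y θ z
  real : ∀ y θ, ∀ t h : ℝ, |h| < r → (K y θ (t, h)).im = 0

/-- Partial derivative in the angle. -/
noncomputable def pt (K : ℝ → ℝ → ℂ × ℂ → ℂ) : ℝ → ℝ → ℂ × ℂ → ℂ :=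
  fun y θ z => deriv (fun t => K y θ (t, z.2)) z.1

/-- Partial derivative in the action. -/
noncomputable def ph (K : ℝ → ℝ → ℂ × ℂ → ℂ) : ℝ → ℝ → ℂ × ℂ → ℂ :=
  fun y θ z => deriv (fun h => K y θ (z.1, h)) z.2

variable {ρ r ρ' r' δ M β σ : ℝ} {K K' : ℝ → ℝ → ℂ × ℂ → ℂ}

namespace Ham

lemma mono (h : Ham ρ r K) (h1 : ρ' ≤ ρ) (h2 : r' ≤ r) : Ham ρ' r' K :=
  ⟨h.cont.mono (prod_mono_right (dom_mono h1 h2)), fun y θ => (h.ana y θ).mono (dom_mono h1 h2),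
    fun y θ z hz => h.per y θ z (dom_mono h1 h2 hz),
    fun y θ z hz => h.pert y θ z (dom_mono h1 h2 hz),
    fun y θ t x hx => h.real y θ t x (hx.trans_le h2)⟩

lemma sub (h : Ham ρ r K) (h' : Ham ρ r K') : Ham ρ r (fun y θ z => K y θ z - K' y θ z) :=
  ⟨h.cont.sub h'.cont, fun y θ => (h.ana y θ).sub (h'.ana y θ),
    fun y θ z hz => by rw [h.per y θ z hz, h'.per y θ z hz],
    fun y θ z hz => by rw [h.pert y θ z hz, h'.pert y θ z hz],
    fun y θ t x hx => by rw [sub_im, h.real y θ t x hx, h'.real y θ t x hx, sub_zero]⟩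

variable (hK : Ham ρ r K)
include hK

lemma differentiableAt {y θ : ℝ} {z : ℂ × ℂ} (hz : z ∈ dom ρ r) : DifferentiableAt ℂ (K y θ) z :=
  ((hK.ana y θ) z hz).differentiableAt

lemma hasDerivAt_t {y θ : ℝ} {z : ℂ × ℂ} (hz : z ∈ dom ρ r) :
    HasDerivAt (fun t => K y θ (t, z.2)) (fderiv ℂ (K y θ) z (1, 0)) z.1 :=
  HasFDerivAt.comp_hasDerivAt (f := fun t : ℂ => (t, z.2)) z.1
    (hK.differentiableAt hz).hasFDerivAt ((hasDerivAt_id _).prodMk (hasDerivAt_const _ _))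

lemma hasDerivAt_h {y θ : ℝ} {z : ℂ × ℂ} (hz : z ∈ dom ρ r) :
    HasDerivAt (fun h => K y θ (z.1, h)) (fderiv ℂ (K y θ) z (0, 1)) z.2 :=
  HasFDerivAt.comp_hasDerivAt (f := fun h : ℂ => (z.1, h)) z.2
    (hK.differentiableAt hz).hasFDerivAt ((hasDerivAt_const _ _).prodMk (hasDerivAt_id _))

lemma pt_eq {y θ : ℝ} {z : ℂ × ℂ} (hz : z ∈ dom ρ r) :
    pt K y θ z = fderiv ℂ (K y θ) z (1, 0) := (hK.hasDerivAt_t hz).deriv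

lemma ph_eq {y θ : ℝ} {z : ℂ × ℂ} (hz : z ∈ dom ρ r) :
    ph K y θ z = fderiv ℂ (K y θ) z (0, 1) := (hK.hasDerivAt_h hz).deriv

/-- Chain rule along a holomorphic curve. -/
lemma hasDerivAt_comp {y θ : ℝ} {f g : ℂ → ℂ} {f' g' s : ℂ} (hz : (f s, g s) ∈ dom ρ r)
    (hf : HasDerivAt f f' s) (hg : HasDerivAt g g' s) :
    HasDerivAt (fun s => K y θ (f s, g s))
      (pt K y θ (f s, g s) * f' + ph K y θ (f s, g s) * g') s := by
  have h := HasFDerivAt.comp_hasDerivAt (f := fun s => (f s, g s)) s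
    (hK.differentiableAt (y := y) (θ := θ) hz).hasFDerivAt (hf.prodMk hg)
  refine h.congr_deriv ?_
  rw [hK.pt_eq hz, hK.ph_eq hz]
  have : ((f', g') : ℂ × ℂ) = f' • (1, 0) + g' • (0, 1) := by simp
  rw [this, map_add, map_smul, map_smul, smul_eq_mul, smul_eq_mul]
  ring

omit hK in
private lemma real_deriv {f : ℂ → ℂ} {f' : ℂ} {x : ℝ} (h : HasDerivAt f f' x)
    (hr : ∀ᶠ t : ℝ in 𝓝 x, (f t).im = 0) : f'.im = 0 := by
  have him : HasDerivAt (fun t : ℝ => (f t).im) f'.im x :=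
    imCLM.hasFDerivAt.comp_hasDerivAt x h.comp_ofReal
  have h0 : (fun t : ℝ => (f t).im) =ᶠ[𝓝 x] fun _ => 0 := hr
  exact (him.congr_of_eventuallyEq h0.symm).unique (hasDerivAt_const _ _)

lemma pt (hρ : 0 < ρ) : Ham ρ r (pt K) := by
  refine ⟨?_, fun y θ => ?_, ?_, ?_, ?_⟩
  · have hp : Continuous fun q : ((ℝ × ℝ) × ℂ) × ℂ => (q.1.1, (q.2, q.1.2)) := by fun_prop
    have h1 := continuousOn_deriv_of_family
      (f := fun (p : (ℝ × ℝ) × ℂ) t => K p.1.1 p.1.2 (t, p.2))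
      (W := (fun q : ((ℝ × ℝ) × ℂ) × ℂ => (q.1.1, (q.2, q.1.2))) ⁻¹' (univ ×ˢ dom ρ r))
      ((isOpen_univ.prod (isOpen_dom ρ r)).preimage hp)
      (hK.cont.comp hp.continuousOn (mapsTo_preimage _ _))
      (fun q hq => (hK.hasDerivAt_t (z := (q.2, q.1.2)) hq.2).differentiableAt)
    exact h1.comp (f := fun q : (ℝ × ℝ) × (ℂ × ℂ) => ((q.1, q.2.2), q.2.1)) (by fun_prop)
      (fun q hq => ⟨mem_univ _, hq.2⟩)
  · have h1 : AnalyticOnNhd ℂ (fun z => fderiv ℂ (K y θ) z (1, 0)) (dom ρ r) := fun z hz =>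
      (ContinuousLinearMap.apply ℂ ℂ ((1, 0) : ℂ × ℂ)).analyticAt _ |>.comp
        ((hK.ana y θ).fderiv z hz)
    exact h1.congr (isOpen_dom ρ r) fun z hz => (hK.pt_eq hz).symm
  · intro y θ z hz
    have h1 : (fun t => K y θ (t + 1, z.2)) =ᶠ[𝓝 z.1] fun t => K y θ (t, z.2) := by
      have : Continuous fun t : ℂ => (t, z.2) := by fun_prop
      filter_upwards [this.continuousAt.preimage_mem_nhds ((isOpen_dom ρ r).mem_nhds hz)] with t ht
        using hK.per y θ (t, z.2) ht
    show deriv (fun t => K y θ (t, z.2)) (z.1 + 1) = _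
    rw [← deriv_comp_add_const, h1.deriv_eq]
    rfl
  · intro y θ z hz
    have h1 : (fun t => K y (θ + 1) (t, z.2)) =ᶠ[𝓝 z.1] fun t => K y θ (t, z.2) := by
      have : Continuous fun t : ℂ => (t, z.2) := by fun_prop
      filter_upwards [this.continuousAt.preimage_mem_nhds ((isOpen_dom ρ r).mem_nhds hz)] with t ht
        using hK.pert y θ (t, z.2) ht
    exact h1.deriv_eq
  · intro y θ t h hh
    have hz : ((t : ℂ), (h : ℂ)) ∈ dom ρ r := ⟨by simpa using hρ, by simpa using hρ, by simpa using hh⟩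
    rw [hK.pt_eq hz]
    exact real_deriv (hK.hasDerivAt_t hz) (Eventually.of_forall fun x => hK.real y θ x h hh)

lemma ph (hρ : 0 < ρ) : Ham ρ r (ph K) := by
  refine ⟨?_, fun y θ => ?_, ?_, ?_, ?_⟩
  · have hp : Continuous fun q : ((ℝ × ℝ) × ℂ) × ℂ => (q.1.1, (q.1.2, q.2)) := by fun_prop
    have h1 := continuousOn_deriv_of_family
      (f := fun (p : (ℝ × ℝ) × ℂ) h => K p.1.1 p.1.2 (p.2, h))
      (W := (fun q : ((ℝ × ℝ) × ℂ) × ℂ => (q.1.1, (q.1.2, q.2))) ⁻¹' (univ ×ˢ dom ρ r))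
      ((isOpen_univ.prod (isOpen_dom ρ r)).preimage hp)
      (hK.cont.comp hp.continuousOn (mapsTo_preimage _ _))
      (fun q hq => (hK.hasDerivAt_h (z := (q.1.2, q.2)) hq.2).differentiableAt)
    exact h1.comp (f := fun q : (ℝ × ℝ) × (ℂ × ℂ) => ((q.1, q.2.1), q.2.2)) (by fun_prop)
      (fun q hq => ⟨mem_univ _, hq.2⟩)
  · have h1 : AnalyticOnNhd ℂ (fun z => fderiv ℂ (K y θ) z (0, 1)) (dom ρ r) := fun z hz =>
      (ContinuousLinearMap.apply ℂ ℂ ((0, 1) : ℂ × ℂ)).analyticAt _ |>.comp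
        ((hK.ana y θ).fderiv z hz)
    exact h1.congr (isOpen_dom ρ r) fun z hz => (hK.ph_eq hz).symm
  · intro y θ z hz
    have h1 : (fun h => K y θ (z.1 + 1, h)) =ᶠ[𝓝 z.2] fun h => K y θ (z.1, h) := by
      have : Continuous fun h : ℂ => (z.1, h) := by fun_prop
      filter_upwards [this.continuousAt.preimage_mem_nhds ((isOpen_dom ρ r).mem_nhds hz)] with h hh
        using hK.per y θ (z.1, h) hh
    exact h1.deriv_eq
  · intro y θ z hz
    have h1 : (fun h => K y (θ + 1) (z.1, h)) =ᶠ[𝓝 z.2] fun h => K y θ (z.1, h) := by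
      have : Continuous fun h : ℂ => (z.1, h) := by fun_prop
      filter_upwards [this.continuousAt.preimage_mem_nhds ((isOpen_dom ρ r).mem_nhds hz)] with h hh
        using hK.pert y θ (z.1, h) hh
    exact h1.deriv_eq
  · intro y θ t h hh
    have hz : ((t : ℂ), (h : ℂ)) ∈ dom ρ r := ⟨by simpa using hρ, by simpa using hρ, by simpa using hh⟩
    rw [hK.ph_eq hz]
    refine real_deriv (hK.hasDerivAt_h hz) ?_
    filter_upwards [(isOpen_lt continuous_abs continuous_const).mem_nhds hh] with x hx
      using hK.real y θ t x hx

/-- Equality of mixed partial derivatives. -/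
lemma pt_ph_comm (hρ : 0 < ρ) {y θ : ℝ} {z : ℂ × ℂ} (hz : z ∈ dom ρ r) :
    JumpingKAM.pt (JumpingKAM.ph K) y θ z = JumpingKAM.ph (JumpingKAM.pt K) y θ z := by
  have hs : IsSymmSndFDerivAt ℂ (K y θ) z :=
    ((hK.ana y θ) z hz).contDiffAt.isSymmSndFDerivAt (n := ⊤) (by simp)
  have hd : DifferentiableAt ℂ (fderiv ℂ (K y θ)) z := ((hK.ana y θ).fderiv z hz).differentiableAt
  have key : ∀ v w : ℂ × ℂ, fderiv ℂ (fun x => fderiv ℂ (K y θ) x v) z w =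
      fderiv ℂ (fderiv ℂ (K y θ)) z w v := by
    intro v w
    rw [fderiv_clm_apply hd (differentiableAt_const _)]
    simp
  rw [(hK.ph hρ).pt_eq hz, (hK.pt hρ).ph_eq hz]
  have e1 : JumpingKAM.ph K y θ =ᶠ[𝓝 z] fun x => fderiv ℂ (K y θ) x (0, 1) := by
    filter_upwards [(isOpen_dom ρ r).mem_nhds hz] with x hx using hK.ph_eq hx
  have e2 : JumpingKAM.pt K y θ =ᶠ[𝓝 z] fun x => fderiv ℂ (K y θ) x (1, 0) := by
    filter_upwards [(isOpen_dom ρ r).mem_nhds hz] with x hx using hK.pt_eq hx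
  rw [e1.fderiv_eq, e2.fderiv_eq, key, key]
  exact hs.eq _ _

lemma norm_pt_le (hM : ∀ y θ, ∀ z ∈ dom ρ r, ‖K y θ z‖ ≤ M) (hδ : 0 < δ) (y θ : ℝ)
    {z : ℂ × ℂ} (hz : z ∈ dom (ρ - δ) (r - δ)) : ‖JumpingKAM.pt K y θ z‖ ≤ M / δ := by
  have hb : ∀ t ∈ Metric.closedBall z.1 δ, (t, z.2) ∈ dom ρ r := fun t ht =>
    mem_dom_of_close hz (by simpa [dist_eq] using ht) (by simpa using hδ.le)
  refine norm_deriv_le_of_forall_mem_sphere_norm_le hδ ?_ ?_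
  · refine DifferentiableOn.diffContOnCl ?_
    rw [closure_ball _ hδ.ne']
    exact fun t ht => (hK.hasDerivAt_t (z := (t, z.2)) (hb t ht)).differentiableAt.differentiableWithinAt
  · exact fun t ht => hM y θ _ (hb t (Metric.sphere_subset_closedBall ht))

lemma norm_ph_le (hM : ∀ y θ, ∀ z ∈ dom ρ r, ‖K y θ z‖ ≤ M) (hδ : 0 < δ) (y θ : ℝ)
    {z : ℂ × ℂ} (hz : z ∈ dom (ρ - δ) (r - δ)) : ‖JumpingKAM.ph K y θ z‖ ≤ M / δ := by
  have hb : ∀ h ∈ Metric.closedBall z.2 δ, (z.1, h) ∈ dom ρ r := fun t ht =>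
    mem_dom_of_close hz (by simpa using hδ.le) (by simpa [dist_eq] using ht)
  refine norm_deriv_le_of_forall_mem_sphere_norm_le hδ ?_ ?_
  · refine DifferentiableOn.diffContOnCl ?_
    rw [closure_ball _ hδ.ne']
    exact fun t ht => (hK.hasDerivAt_h (z := (z.1, t)) (hb t ht)).differentiableAt.differentiableWithinAt
  · exact fun t ht => hM y θ _ (hb t (Metric.sphere_subset_closedBall ht))

end Ham

/-- Composition of a Hamiltonian with a torus `(s + βθ + u, v)`. -/
def comp (β : ℝ) (K : ℝ → ℝ → ℂ × ℂ → ℂ) (u v : ℝ → ℝ → ℂ → ℂ) : ℝ → ℝ → ℂ → ℂ :=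
  fun y θ s => K y θ (s + (β * θ : ℝ) + u y θ s, v y θ s)

variable {u v : ℝ → ℝ → ℂ → ℂ}

/-- The torus lies in the domain. -/
def InDom (β σ ρ r : ℝ) (u v : ℝ → ℝ → ℂ → ℂ) : Prop :=
  ∀ y θ, ∀ s ∈ strip σ, (s + (β * θ : ℝ) + u y θ s, v y θ s) ∈ dom ρ r

lemma PF.comp (hK : Ham ρ r K) (hu : PF β σ u) (hv : PF β σ v)
    (hd : InDom β σ ρ r u v) (hσ : 0 < σ) : PF β σ (comp β K u v) := by
  refine ⟨?_, ?_, ?_, ?_, ?_⟩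
  · refine hK.cont.comp (f := fun q : (ℝ × ℝ) × ℂ =>
      (q.1, (q.2 + (β * q.1.2 : ℝ) + u q.1.1 q.1.2 q.2, v q.1.1 q.1.2 q.2))) ?_
      (fun q hq => ⟨mem_univ _, hd _ _ _ hq.2⟩)
    exact continuousOn_fst.prodMk ((ContinuousOn.add (by fun_prop) hu.cont).prodMk hv.cont)
  · intro y θ s hs
    exact (hK.hasDerivAt_comp (hd y θ s hs) (((hasDerivAt_id s).add_const _).add
      (hu.hasDerivAt hs)) (hv.hasDerivAt hs)).differentiableAt.differentiableWithinAt
  · intro y θ s hs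
    have := hK.per y θ _ (hd y θ s hs)
    rw [JumpingKAM.comp, hu.per y θ s hs, hv.per y θ s hs, JumpingKAM.comp, ← this]
    congr 2
    ring
  · intro y θ s hs
    have := hK.pert y θ _ (hd y θ (s + β) (add_real_mem_strip hs β))
    rw [JumpingKAM.comp, hu.tw y θ s hs, hv.tw y θ s hs, JumpingKAM.comp, ← this]
    congr 2
    push_cast
    ring
  · intro y θ x
    have hx := ofReal_mem_strip hσ x
    have h := (hd y θ x hx).2.2
    rw [JumpingKAM.comp, ← hu.ofReal_re, ← hv.ofReal_re]
    rw [← ofReal_add, ← ofReal_add]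
    exact hK.real y θ _ _ h

lemma ds_comp (hK : Ham ρ r K) (hu : PF β σ u) (hv : PF β σ v)
    (hd : InDom β σ ρ r u v) {y θ : ℝ} {s : ℂ} (hs : s ∈ strip σ) :
    ds (comp β K u v) y θ s = comp β (pt K) u v y θ s * (1 + ds u y θ s) +
      comp β (ph K) u v y θ s * ds v y θ s :=
  (hK.hasDerivAt_comp (hd y θ s hs) (((hasDerivAt_id s).add_const _).add
      (hu.hasDerivAt hs)) (hv.hasDerivAt hs)).deriv

variable {ρ r δ M β σ γ : ℝ} {K : ℝ → ℝ → ℂ × ℂ → ℂ} {F G u v Q E₁ E₂ : ℝ → ℝ → ℂ → ℂ} {l : ℝ → ℝ}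

lemma norm_dslope_le {g : ℂ → ℂ} {Z M : ℝ} (hM : 0 < M) (hg : DifferentiableOn ℂ g (Metric.ball 0 Z))
    (hb : ∀ z ∈ Metric.ball (0 : ℂ) Z, ‖g z‖ ≤ M) {z : ℂ} (hz : z ∈ Metric.ball (0 : ℂ) Z) :
    ‖dslope g 0 z‖ ≤ 3 * M / Z := by
  have hZ : 0 < Z := Metric.pos_of_mem_ball hz
  refine Complex.norm_dslope_le_div_of_mapsTo_ball hg (fun w hw => ?_) hz
  rw [Metric.mem_closedBall, dist_eq_norm]
  have h0 := hb 0 (by simpa using hZ)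
  linarith [norm_sub_le (g w) (g 0), hb w hw]

/-- Cauchy estimate for the quadratic Taylor remainder. -/
lemma norm_taylor_two_le {g : ℂ → ℂ} {Z M : ℝ} {g' : ℂ} (hM : 0 < M) (hZ : 1 < Z)
    (hg : DifferentiableOn ℂ g (Metric.ball 0 Z))
    (hb : ∀ z ∈ Metric.ball (0 : ℂ) Z, ‖g z‖ ≤ M) (hg' : HasDerivAt g g' 0) :
    ‖g 1 - g 0 - g'‖ ≤ 9 * M / Z ^ 2 := by
  have h0 : Metric.ball (0 : ℂ) Z ∈ 𝓝 (0 : ℂ) := Metric.ball_mem_nhds _ (by linarith)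
  have h1 : (1 : ℂ) ∈ Metric.ball (0 : ℂ) Z := by simpa using hZ
  have hd : DifferentiableOn ℂ (dslope g 0) (Metric.ball 0 Z) :=
    (differentiableOn_dslope h0).2 hg
  have h := norm_dslope_le (M := 3 * M / Z) (by positivity) hd
    (fun z hz => norm_dslope_le hM hg hb hz) h1
  rw [dslope_of_ne _ one_ne_zero, slope_def_field, dslope_same, dslope_of_ne _ one_ne_zero,
    slope_def_field, hg'.deriv] at h
  calc _ ≤ _ := by simpa using h
    _ = _ := by field_simp; ring

lemma PF.abs_im_le (hF : PF β σ F) (hb : Bd σ 1 (JumpingKAM.ds F)) {y θ : ℝ} {s : ℂ} (hs : s ∈ strip σ) :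
    |(F y θ s).im| ≤ |s.im| := by
  have hc : Convex ℝ (strip σ) := by
    have : strip σ = Complex.imCLM ⁻¹' (Metric.ball 0 σ) := by
      ext z; simp [strip]
    rw [this]
    exact (convex_ball (0 : ℝ) σ).linear_preimage imCLM.toLinearMap
  have hσ : 0 < σ := (abs_nonneg _).trans_lt hs
  have h := hc.norm_image_sub_le_of_norm_deriv_le (f := F y θ) (C := 1)
    (fun x hx => hF.differentiableAt hx) (fun x hx => hb y θ x hx)
    (ofReal_mem_strip hσ s.re) hs
  have e : s - (s.re : ℂ) = s.im * I := by
    apply Complex.ext <;> simp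
  rw [e, norm_mul, norm_I, mul_one, one_mul, norm_real, Real.norm_eq_abs] at h
  refine le_trans ?_ ((abs_im_le_norm _).trans h)
  rw [sub_im, hF.real, sub_zero]

/-- A perturbation of size `≤ σ` of a torus with small derivatives stays in the domain. -/
lemma mem_dom_of_bd (hσ : σ ≤ 1 / 4) (hu : PF β σ u) (hv : PF β σ v) (hu' : Bd σ 1 (ds u))
    (hv' : Bd σ 1 (ds v)) (hv0 : Bd σ (1 / 2) v) {y θ : ℝ} {s a b : ℂ} (hs : s ∈ strip σ)
    (ha : ‖a‖ ≤ σ) (hb : ‖b‖ ≤ σ) :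
    (s + (β * θ : ℝ) + u y θ s + a, v y θ s + b) ∈ dom (4 * σ) 1 := by
  have hs' : |s.im| < σ := hs
  have h1 := (hu.abs_im_le hu' (y := y) (θ := θ) hs)
  have h2 := (hv.abs_im_le hv' (y := y) (θ := θ) hs)
  have h3 := (abs_re_le_norm _).trans (hv0 y θ s hs)
  have a1 := (abs_im_le_norm _).trans ha
  have b1 := (abs_im_le_norm _).trans hb
  have b2 := (abs_re_le_norm _).trans hb
  have tri : ∀ x y : ℝ, |x + y| ≤ |x| + |y| := abs_add_le
  have h0 := abs_nonneg s.im
  refine ⟨?_, ?_, ?_⟩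
  · simp only [add_im, ofReal_im, add_zero]
    linarith [tri (s.im + (u y θ s).im) a.im, tri s.im (u y θ s).im]
  · simp only [add_im]
    linarith [tri (v y θ s).im b.im]
  · simp only [add_re]
    linarith [tri (v y θ s).re b.re]

lemma inDom_of_bd (hσ : σ ≤ 1 / 4) (hu : PF β σ u) (hv : PF β σ v) (hu' : Bd σ 1 (ds u))
    (hv' : Bd σ 1 (ds v)) (hv0 : Bd σ (1 / 2) v) : InDom β σ (4 * σ) 1 u v := by
  intro y θ s hs
  have h0 : 0 ≤ σ := (abs_nonneg _).trans (le_of_lt hs)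
  simpa using mem_dom_of_bd hσ hu hv hu' hv' hv0 (y := y) (θ := θ) hs (a := 0) (b := 0)
    (by simpa using h0) (by simpa using h0)

/-- An approximately invariant torus `U = s + βθ + u`, `V = v` with counterterm `l`. -/
structure Approx (β σ : ℝ) (K : ℝ → ℝ → ℂ × ℂ → ℂ) (l : ℝ → ℝ)
    (u v Q E₁ E₂ : ℝ → ℝ → ℂ → ℂ) : Prop where
  pfl : Continuous l
  pfu : PF β σ u
  pfv : PF β σ v
  pfQ : PF β σ Q
  pfE₁ : PF β σ E₁
  pfE₂ : PF β σ E₂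
  dtu : DT σ u (fun y θ s => comp β (ph K) u v y θ s + (l y - β : ℝ) + E₁ y θ s)
  dtv : DT σ v (fun y θ s => -comp β (pt K) u v y θ s + E₂ y θ s)
  dtQ : DT σ Q (ds v)

lemma mean_congr (hσ : 0 < σ) (h : ∀ y θ, ∀ s ∈ strip σ, F y θ s = G y θ s) (y : ℝ) :
    mean F y = mean G y := by
  simp only [mean, fun θ x : ℝ => h y θ x (ofReal_mem_strip hσ x)]

lemma ds_add (hF : PF β σ F) (hG : PF β σ G) {y θ : ℝ} {s : ℂ} (hs : s ∈ strip σ) :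
    ds (fun y θ s => F y θ s + G y θ s) y θ s = ds F y θ s + ds G y θ s :=
  ((hF.hasDerivAt hs).add (hG.hasDerivAt hs)).deriv

namespace Approx

variable (h : Approx β σ K l u v Q E₁ E₂) (hK : Ham (4 * σ) 1 K) (hσ : 0 < σ)
  (hd : InDom β σ (4 * σ) 1 u v)

include h hK hσ hd

lemma pf_rhs_u : PF β σ (fun y θ s => comp β (ph K) u v y θ s + (l y - β : ℝ) + E₁ y θ s) :=
  ((PF.comp (hK.ph (by linarith)) h.pfu h.pfv hd hσ).add
    (PF.param (h.pfl.sub continuous_const))).add h.pfE₁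

lemma pf_rhs_v : PF β σ (fun y θ s => -comp β (pt K) u v y θ s + E₂ y θ s) :=
  ((PF.comp (hK.pt (by linarith)) h.pfu h.pfv hd hσ).neg).add h.pfE₂

lemma mean_cross (y : ℝ) :
    mean (fun y θ s => E₂ y θ s * (1 + ds u y θ s) - E₁ y θ s * ds v y θ s) y = 0 := by
  have pu := h.pf_rhs_u hK hσ hd
  have pv := h.pf_rhs_v hK hσ hd
  have pK := PF.comp hK h.pfu h.pfv hd hσ
  have dus := h.dtu.dsl h.pfu pu hσ
  have m1 := PF.mean_dt h.pfv pv h.dtv hσ y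
  have m2 := PF.mean_dt (h.pfv.mul (h.pfu.ds hσ)) ((pv.mul (h.pfu.ds hσ)).add (h.pfv.mul (pu.ds hσ)))
    (h.dtv.mul dus) hσ y
  have m3 := (h.pfv.mul pu).neg.mean_ds hσ y
  have m4 := pK.mean_ds hσ y
  have m5 : mean (fun y θ s => ((l y - β : ℝ) : ℂ) * ds v y θ s) y = 0 := by
    rw [PF.mean_const_mul (fun y => ((l y - β : ℝ) : ℂ)), h.pfv.mean_ds hσ, mul_zero]
  have p5 : PF β σ (fun y θ s => ((l y - β : ℝ) : ℂ) * ds v y θ s) :=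
    (PF.param (h.pfl.sub continuous_const)).mul (h.pfv.ds hσ)
  have p2 := (pv.mul (h.pfu.ds hσ)).add (h.pfv.mul (pu.ds hσ))
  have p3 := (h.pfv.mul pu).neg.ds hσ
  rw [mean_congr hσ (G := fun y θ s => _) ?_ y,
    PF.mean_add (((pv.add p2).add p3).add (pK.ds hσ)) p5 hσ,
    PF.mean_add ((pv.add p2).add p3) (pK.ds hσ) hσ, PF.mean_add (pv.add p2) p3 hσ,
    PF.mean_add pv p2 hσ, m1, m2, m3, m4, m5]
  · simp
  · intro y θ s hs
    have e3 : ds (fun y θ s => -(v y θ s * (comp β (ph K) u v y θ s + (l y - β : ℝ) + E₁ y θ s)))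
        y θ s = -(ds v y θ s * (comp β (ph K) u v y θ s + (l y - β : ℝ) + E₁ y θ s) + v y θ s *
        ds (fun y θ s => comp β (ph K) u v y θ s + (l y - β : ℝ) + E₁ y θ s) y θ s) :=
      (((h.pfv.hasDerivAt hs).mul (pu.hasDerivAt hs)).neg).deriv
    rw [e3, ds_comp hK h.pfu h.pfv hd hs]
    ring

/-- The `θ`-derivative of `ds u`. -/
lemma dt_ds_u : DT σ (ds u) (fun y θ s => comp β (pt (ph K)) u v y θ s * (1 + ds u y θ s) +
    comp β (ph (ph K)) u v y θ s * ds v y θ s + ds E₁ y θ s) := by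
  have hp := PF.comp (hK.ph (by linarith)) h.pfu h.pfv hd hσ
  intro y θ s hs
  refine (h.dtu.dsl h.pfu (h.pf_rhs_u hK hσ hd) hσ y θ s hs).congr_deriv ?_
  beta_reduce
  rw [← ds_comp (hK.ph (by linarith)) h.pfu h.pfv hd hs]
  exact (((hp.hasDerivAt hs).add_const _).add (h.pfE₁.hasDerivAt hs)).deriv

/-- The `θ`-derivative of `ds v`. -/
lemma dt_ds_v : DT σ (ds v) (fun y θ s => -(comp β (pt (pt K)) u v y θ s * (1 + ds u y θ s) +
    comp β (pt (ph K)) u v y θ s * ds v y θ s) + ds E₂ y θ s) := by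
  have hp := PF.comp (hK.pt (by linarith)) h.pfu h.pfv hd hσ
  intro y θ s hs
  refine (h.dtv.dsl h.pfv (h.pf_rhs_v hK hσ hd) hσ y θ s hs).congr_deriv ?_
  have e := ds_comp (hK.pt (by linarith)) h.pfu h.pfv hd (y := y) (θ := θ) hs
  have e2 : comp β (ph (pt K)) u v y θ s = comp β (pt (ph K)) u v y θ s :=
    (hK.pt_ph_comm (by linarith) (hd y θ s hs)).symm
  rw [e2] at e
  beta_reduce
  rw [← e]
  exact ((hp.hasDerivAt hs).neg.add (h.pfE₂.hasDerivAt hs)).deriv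

end Approx

lemma PF.one : PF β σ (fun _ _ _ => 1) := by
  simpa using PF.param (β := β) (σ := σ) (g := fun _ => 1) continuous_const

lemma PF.one_add_ds (hu : PF β σ u) (hσ : 0 < σ) : PF β σ (fun y θ s => 1 + JumpingKAM.ds u y θ s) :=
  PF.one.add (hu.ds hσ)

lemma one_add_ds_ne (hu : Bd σ (1 / 4) (ds u)) (y θ : ℝ) {s : ℂ} (hs : s ∈ strip σ) :
    3 / 4 ≤ ‖1 + ds u y θ s‖ := by
  have h1 := hu y θ s hs
  have h2 := norm_sub_le (1 + ds u y θ s) (ds u y θ s)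
  rw [add_sub_cancel_right, norm_one] at h2
  linarith

lemma PF.inv_one_add_ds (hu : PF β σ u) (hσ : 0 < σ) (hb : Bd σ (1 / 4) (JumpingKAM.ds u)) :
    PF β σ (fun y θ s => (1 + JumpingKAM.ds u y θ s)⁻¹) :=
  (hu.one_add_ds hσ).inv fun y θ s hs h => by
    have := one_add_ds_ne hb y θ hs
    rw [h, norm_zero] at this
    norm_num at this

lemma bd_inv_one_add_ds (hb : Bd σ (1 / 4) (ds u)) :
    Bd σ (4 / 3) (fun y θ s => (1 + ds u y θ s)⁻¹) := fun y θ s hs => by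
  rw [norm_inv, inv_le_comm₀ (by linarith [one_add_ds_ne hb y θ hs]) (by norm_num)]
  linarith [one_add_ds_ne hb y θ hs]

/-- The twist coefficient of the linearised problem. -/
noncomputable def twist (β : ℝ) (K : ℝ → ℝ → ℂ × ℂ → ℂ) (u v : ℝ → ℝ → ℂ → ℂ) :
    ℝ → ℝ → ℂ → ℂ :=
  fun y θ s => comp β (ph (ph K)) u v y θ s * ((1 + ds u y θ s)⁻¹ * (1 + ds u y θ s)⁻¹)

/-- Solution of the linearised equations in the adapted frame. -/
lemma newton_solve {L e : ℝ} (h : Approx β σ K l u v Q E₁ E₂) (hγ : 0 < γ) (hβ : Dioph γ β)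
    (hδ : 0 < δ) (hδ1 : δ ≤ 1 / 2) (hδσ : 2 * δ < σ) (hL : (12 / γ + 1) / δ ^ 4 ≤ L) (hL1 : 1 ≤ L)
    (hK : Ham (4 * σ) 1 K) (hd : InDom β σ (4 * σ) 1 u v)
    (hK2 : ∀ y θ, ∀ z ∈ dom (4 * σ) 1, ‖ph (ph K) y θ z‖ ≤ 1 / 16)
    (bu : Bd σ (1 / 4) (ds u)) (bv : Bd σ (1 / 2) (ds v)) (bQ : Bd σ 1 Q)
    (b1 : Bd σ e E₁) (b2 : Bd σ e E₂) :
    ∃ (ξ η : ℝ → ℝ → ℂ → ℂ) (m : ℝ → ℝ), PF β (σ - 2 * δ) ξ ∧ PF β (σ - 2 * δ) η ∧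
      Continuous m ∧ Bd (σ - 2 * δ) (21 * L ^ 2 * e) ξ ∧ Bd (σ - 2 * δ) (10 * L * e) η ∧
      (∀ y, |m y| ≤ 8 * L * e) ∧
      DT (σ - 2 * δ) η (fun y θ s => -(E₂ y θ s * (1 + ds u y θ s) - E₁ y θ s * ds v y θ s) -
        m y * ds v y θ s) ∧
      DT (σ - 2 * δ) ξ (fun y θ s => -(E₁ y θ s * (1 + ds u y θ s)⁻¹) +
        η y θ s * twist β K u v y θ s + m y * (1 + ds u y θ s)⁻¹) := by
  have hσ : 0 < σ := by linarith
  have he : 0 ≤ e := b1.nonneg hσ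
  have hσ' : 0 < σ - δ := by linarith
  have le1 : σ - δ ≤ σ := by linarith
  have hLe : e ≤ L * e := by nlinarith
  have pa := h.pfu.one_add_ds hσ
  have pA := h.pfu.inv_one_add_ds hσ bu
  have bA := bd_inv_one_add_ds bu
  have pB : PF β σ (twist β K u v) := (PF.comp ((hK.ph (by linarith)).ph (by linarith)) h.pfu h.pfv hd hσ).mul
    (pA.mul pA)
  have bB : Bd σ (1 / 9) (twist β K u v) := by
    refine Bd.mono (Bd.mul (fun y θ s hs => hK2 y θ _ (hd y θ s hs)) (bA.mul bA)) le_rfl ?_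
    norm_num
  have pv := h.pfv.ds hσ
  have ba : Bd σ (5 / 4) (fun y θ s => 1 + ds u y θ s) := fun y θ s hs => by
    have := norm_add_le (1 : ℂ) (ds u y θ s)
    rw [norm_one] at this
    linarith [bu y θ s hs]
  have pF := ((h.pfE₂.mul pa).sub (h.pfE₁.mul pv)).neg
  have bF : Bd σ (e * (5 / 4) + e * (1 / 2))
      (fun y θ s => -(E₂ y θ s * (1 + ds u y θ s) - E₁ y θ s * ds v y θ s)) := fun y θ s hs => by
    rw [norm_neg]
    exact (b2.mul ba).sub (b1.mul bv) y θ s hs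
  have mF : ∀ y, mean (fun y θ s => -(E₂ y θ s * (1 + ds u y θ s) - E₁ y θ s * ds v y θ s)) y = 0 := by
    intro y
    have := PF.mean_const_mul (F := fun y θ s => E₂ y θ s * (1 + ds u y θ s) - E₁ y θ s * ds v y θ s)
      (fun _ => -1) y
    rw [h.mean_cross hK hσ hd, mul_zero] at this
    rw [← this]
    exact mean_congr hσ (fun y θ s _ => by ring) y
  obtain ⟨ηa, pηa, bηa, dηa⟩ := exists_solve hγ hβ hδ hδ1 (by linarith) pF bF mF
  have bηa : Bd (σ - δ) (2 * L * e) ηa := by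
    refine bηa.mono le_rfl ?_
    have : (12 / γ + 1) / δ ^ 4 * (e * (5 / 4) + e * (1 / 2)) ≤ L * (e * (5 / 4) + e * (1 / 2)) :=
      mul_le_mul_of_nonneg_right hL (by positivity)
    nlinarith
  have pA' := pA.mono le1
  have pB' := pB.mono le1
  have pQ' := h.pfQ.mono le1
  have pE' := h.pfE₁.mono le1
  have pD := pA'.sub (pQ'.mul pB')
  have pN := (pE'.mul pA').sub (pηa.mul pB')
  have bN := ((b1.mono le1 le_rfl).mul (bA.mono le1 le_rfl)).sub (bηa.mul (bB.mono le1 le_rfl))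
  set N := mean (fun y θ s => E₁ y θ s * (1 + ds u y θ s)⁻¹ - ηa y θ s * twist β K u v y θ s) with hN
  set D := mean (fun y θ s => (1 + ds u y θ s)⁻¹ - Q y θ s * twist β K u v y θ s) with hD
  have hD2 : ∀ y, 1 / 2 ≤ (D y).re := by
    intro y
    have pR := (((h.pfu.ds hσ).mul pA).neg.sub (h.pfQ.mul pB)).mono le1
    have bR := (((bu.mul bA).mono le1 le_rfl).add ((bQ.mul bB).mono le1 le_rfl))
    have e1 : D y = 1 + mean (fun y θ s => -(ds u y θ s * (1 + ds u y θ s)⁻¹) -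
        Q y θ s * twist β K u v y θ s) y := by
      have := PF.mean_add PF.one pR hσ' y
      rw [show mean (fun _ _ _ => (1 : ℂ)) y = 1 by simp [mean]] at this
      rw [← this]
      refine mean_congr hσ' (fun y θ s hs => ?_) y
      have hne : 1 + ds u y θ s ≠ 0 := fun h0 => by
        have := one_add_ds_ne bu y θ (strip_mono le1 hs)
        rw [h0, norm_zero] at this
        norm_num at this
      field_simp
      ring
    have e2 := PF.norm_mean_le hσ' (M := 4 / 9) (F := fun y θ s =>
      -(ds u y θ s * (1 + ds u y θ s)⁻¹) - Q y θ s * twist β K u v y θ s) (fun y θ s hs => by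
        refine (norm_sub_le _ _).trans ?_
        rw [norm_neg]
        have h1 := bu.mul bA y θ s (strip_mono le1 hs)
        have h2 := bQ.mul bB y θ s (strip_mono le1 hs)
        linarith) y
    have e3 := (abs_re_le_norm _).trans e2
    rw [e1, add_re, one_re]
    linarith [(abs_le.1 e3).1]
  have cN : Continuous N := pN.cont_mean hσ'
  have cD : Continuous D := pD.cont_mean hσ'
  set m : ℝ → ℝ := fun y => (N y).re / (D y).re with hm
  have cm : Continuous m := (continuous_re.comp cN).div (continuous_re.comp cD)
    fun y => by have := hD2 y; show (D y).re ≠ 0; linarith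
  have bm : ∀ y, |m y| ≤ 8 * L * e := by
    intro y
    rw [hm]
    dsimp only
    rw [abs_div, abs_of_pos (a := (D y).re) (by linarith [hD2 y]), div_le_iff₀ (by linarith [hD2 y])]
    have h1 := (abs_re_le_norm _).trans (PF.norm_mean_le hσ' bN y)
    have h2 : 8 * L * e * (1 / 2) ≤ 8 * L * e * (D y).re :=
      mul_le_mul_of_nonneg_left (hD2 y) (by positivity)
    refine h1.trans (le_trans ?_ h2)
    nlinarith
  have mD : ∀ y, (m y : ℂ) * D y = N y := by
    intro y
    have h1 : ((D y).re : ℂ) = D y := Complex.ext (by simp) (by simp [hD, pD.mean_real])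
    have h2 : ((N y).re : ℂ) = N y := Complex.ext (by simp) (by simp [hN, pN.mean_real])
    rw [← h1, ← h2, hm]
    push_cast
    rw [div_mul_cancel₀]
    exact_mod_cast (by linarith [hD2 y] : (D y).re ≠ 0)
  have pη := pηa.sub ((PF.param cm).mul pQ')
  have bη : Bd (σ - δ) (10 * L * e) (fun y θ s => ηa y θ s - m y * Q y θ s) := by
    refine Bd.mono (bηa.sub (Bd.mul (M := 8 * L * e) (fun y θ s _ => ?_) (bQ.mono le1 le_rfl)))
      le_rfl (by linarith)
    rw [norm_real]
    exact bm y
  have pξ := ((pE'.mul pA').neg.add (pη.mul pB')).add ((PF.param cm).mul pA')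
  have mξ : ∀ y, mean (fun y θ s => -(E₁ y θ s * (1 + ds u y θ s)⁻¹) +
      (ηa y θ s - m y * Q y θ s) * twist β K u v y θ s + m y * (1 + ds u y θ s)⁻¹) y = 0 := by
    intro y
    have e1 := PF.mean_const_mul (F := fun y θ s =>
      E₁ y θ s * (1 + ds u y θ s)⁻¹ - ηa y θ s * twist β K u v y θ s) (fun _ => -1) y
    have e2 := PF.mean_const_mul (F := fun y θ s =>
      (1 + ds u y θ s)⁻¹ - Q y θ s * twist β K u v y θ s) (fun y => m y) y
    have p1 : PF β (σ - δ) (fun y θ s => -1 * (E₁ y θ s * (1 + ds u y θ s)⁻¹ -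
        ηa y θ s * twist β K u v y θ s)) := by simpa using pN.neg
    have e3 := PF.mean_add p1 ((PF.param cm).mul pD) hσ' y
    rw [e1, e2, ← hN, ← hD, mD] at e3
    rw [← (by ring : -1 * N y + N y = 0), ← e3]
    exact mean_congr hσ' (fun y θ s _ => by ring) y
  have bξ : Bd (σ - δ) (21 * L * e) (fun y θ s => -(E₁ y θ s * (1 + ds u y θ s)⁻¹) +
      (ηa y θ s - m y * Q y θ s) * twist β K u v y θ s + m y * (1 + ds u y θ s)⁻¹) := by
    intro y θ s hs
    have h1 := (b1.mul bA) y θ s (strip_mono le1 hs)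
    have h2 := (bη.mul (bB.mono le1 le_rfl)) y θ s hs
    have h3 := bA y θ s (strip_mono le1 hs)
    have h4 : ‖(m y : ℂ) * (1 + ds u y θ s)⁻¹‖ ≤ 8 * L * e * (4 / 3) := by
      refine norm_mul_le_of_le ?_ h3
      rw [norm_real]
      exact bm y
    refine (norm_add_le _ _).trans ?_
    refine (add_le_add (norm_add_le _ _) le_rfl).trans ?_
    rw [norm_neg]
    nlinarith
  obtain ⟨ξ, pξ', bξ', dξ⟩ := exists_solve hγ hβ hδ hδ1 (by linarith) pξ bξ mξ
  have e2 : σ - δ - δ = σ - 2 * δ := by ring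
  rw [e2] at pξ' bξ' dξ
  have le2 : σ - 2 * δ ≤ σ - δ := by linarith
  refine ⟨ξ, fun y θ s => ηa y θ s - m y * Q y θ s, m, pξ', pη.mono le2, cm, bξ'.mono le_rfl ?_,
    bη.mono le2 le_rfl, bm, ?_, dξ⟩
  · calc _ ≤ L * (21 * L * e) := mul_le_mul_of_nonneg_right hL (by positivity)
      _ = _ := by ring
  · intro y θ s hs
    exact (dηa y θ s (strip_mono le2 hs)).sub
      ((h.dtQ y θ s (strip_mono (le2.trans le1) hs)).const_mul _)

variable {β σ γ : ℝ} {K : ℝ → ℝ → ℂ × ℂ → ℂ} {u v Q E₁ E₂ ΔU ΔV : ℝ → ℝ → ℂ → ℂ} {l : ℝ → ℝ}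

lemma Ham.norm_taylor_le {ρ r Z : ℝ} {c : ℂ} {y θ : ℝ} {w d : ℂ × ℂ} (hK : Ham ρ r K)
    (hb : ∀ z ∈ dom ρ r, ‖K y θ z - c‖ ≤ 1) (hZ : 1 < Z)
    (hd : ∀ z ∈ Metric.ball (0 : ℂ) Z, (w.1 + z * d.1, w.2 + z * d.2) ∈ dom ρ r) :
    ‖K y θ (w.1 + d.1, w.2 + d.2) - K y θ w -
      (JumpingKAM.pt K y θ w * d.1 + JumpingKAM.ph K y θ w * d.2)‖ ≤ 9 / Z ^ 2 := by
  have hg : ∀ z ∈ Metric.ball (0 : ℂ) Z, HasDerivAt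
      (fun z : ℂ => K y θ (w.1 + z * d.1, w.2 + z * d.2) - c)
      (JumpingKAM.pt K y θ (w.1 + z * d.1, w.2 + z * d.2) * d.1 +
        JumpingKAM.ph K y θ (w.1 + z * d.1, w.2 + z * d.2) * d.2) z := by
    intro z hz
    refine (hK.hasDerivAt_comp (f := fun z => w.1 + z * d.1) (g := fun z => w.2 + z * d.2)
      (hd z hz) ?_ ?_).sub_const c
    · simpa using ((hasDerivAt_id z).mul_const d.1).const_add w.1
    · simpa using ((hasDerivAt_id z).mul_const d.2).const_add w.2
  have h0 := hg 0 (by simpa using by linarith)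
  have := norm_taylor_two_le (M := 1) one_pos hZ
    (fun z hz => (hg z hz).differentiableAt.differentiableWithinAt)
    (fun z hz => hb _ (hd z hz)) h0
  simpa using this

lemma Ham.bd_taylor {σ' D : ℝ} {c : ℂ} (hK : Ham (4 * σ) 1 K) (hσ : σ ≤ 1 / 4) (hσ' : σ' ≤ σ)
    (hσ0 : 0 < σ') (hb : ∀ y θ, ∀ z ∈ dom (4 * σ) 1, ‖K y θ z - c‖ ≤ 1)
    (hu : PF β σ u) (hv : PF β σ v) (hu' : Bd σ 1 (ds u))
    (hv' : Bd σ 1 (ds v)) (hv0 : Bd σ (1 / 2) v) (hU : Bd σ' D ΔU) (hV : Bd σ' D ΔV) (hD : 0 < D)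
    (hD' : D < σ) :
    Bd σ' (9 * D ^ 2 / σ ^ 2) (fun y θ s =>
      comp β K (fun y θ s => u y θ s + ΔU y θ s) (fun y θ s => v y θ s + ΔV y θ s) y θ s -
      comp β K u v y θ s - (comp β (JumpingKAM.pt K) u v y θ s * ΔU y θ s +
      comp β (JumpingKAM.ph K) u v y θ s * ΔV y θ s)) := by
  intro y θ s hs
  have h := hK.norm_taylor_le (y := y) (θ := θ) (Z := σ / D) (hb y θ)
    (w := (s + (β * θ : ℝ) + u y θ s, v y θ s)) (d := (ΔU y θ s, ΔV y θ s))
    (by rwa [one_lt_div hD]) (fun z hz => by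
      have hz' : ‖z‖ < σ / D := by simpa using hz
      have key : ∀ x : ℂ, ‖x‖ ≤ D → ‖z * x‖ ≤ σ := fun x hx => by
        refine (norm_mul_le_of_le hz'.le hx).trans_eq ?_
        field_simp
      exact mem_dom_of_bd hσ hu hv hu' hv' hv0 (strip_mono hσ' hs)
        (key _ (hU y θ s hs)) (key _ (hV y θ s hs)))
  have e : s + ((β * θ : ℝ) : ℂ) + (u y θ s + ΔU y θ s) = s + (β * θ : ℝ) + u y θ s + ΔU y θ s := by
    ring
  simp only [comp, e]
  refine h.trans_eq ?_
  field_simp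

/-- One step of the quasi-Newton iteration. -/
theorem newton_step {L e : ℝ} {c : ℂ} (h : Approx β σ K l u v Q E₁ E₂) (hγ : 0 < γ)
    (hβ : Dioph γ β) (hσ : 0 < σ) (hσ4 : σ ≤ 1 / 4) (he : 0 < e) (hL1 : 1 ≤ L)
    (hL : (12 / γ + 1) / (σ / 10) ^ 4 ≤ L) (hsmall : 96 * L ^ 2 * e ≤ σ)
    (hK : Ham (4 * σ) 1 K)
    (hKh : ∀ y θ, ∀ z ∈ dom (4 * σ) 1, ‖ph K y θ z - c‖ ≤ 1)
    (hKt : ∀ y θ, ∀ z ∈ dom (4 * σ) 1, ‖pt K y θ z‖ ≤ 1)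
    (hK2 : ∀ y θ, ∀ z ∈ dom (4 * σ) 1, ‖ph (ph K) y θ z‖ ≤ 1 / 16)
    (bu : Bd σ (1 / 4) (ds u)) (bv : Bd σ (1 / 2) (ds v)) (bv0 : Bd σ (1 / 2) v) (bQ : Bd σ 1 Q)
    (b1 : Bd σ e E₁) (b2 : Bd σ e E₂) :
    ∃ (l' : ℝ → ℝ) (u' v' Q' E₁' E₂' : ℝ → ℝ → ℂ → ℂ),
      Approx β (σ / 2) K l' u' v' Q' E₁' E₂' ∧
      Bd (σ / 2) (10 ^ 4 * L ^ 4 * e ^ 2 / σ ^ 2) E₁' ∧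
      Bd (σ / 2) (10 ^ 4 * L ^ 4 * e ^ 2 / σ ^ 2) E₂' ∧
      (∀ y, |l' y - l y| ≤ 320 * L ^ 3 * e / σ) ∧
      Bd (σ / 2) (320 * L ^ 3 * e / σ) (fun y θ s => u' y θ s - u y θ s) ∧
      Bd (σ / 2) (320 * L ^ 3 * e / σ) (fun y θ s => ds u' y θ s - ds u y θ s) ∧
      Bd (σ / 2) (320 * L ^ 3 * e / σ) (fun y θ s => v' y θ s - v y θ s) ∧
      Bd (σ / 2) (320 * L ^ 3 * e / σ) (fun y θ s => ds v' y θ s - ds v y θ s) ∧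
      Bd (σ / 2) (320 * L ^ 3 * e / σ) (fun y θ s => Q' y θ s - Q y θ s) := by
  have bu1 : Bd σ 1 (ds u) := bu.mono le_rfl (by norm_num)
  have bv1 : Bd σ 1 (ds v) := bv.mono le_rfl (by norm_num)
  have hd := inDom_of_bd hσ4 h.pfu h.pfv bu1 bv1 bv0
  have hρ : 0 < 4 * σ := by linarith
  obtain ⟨ξ, η, m, pξ, pη, cm, bξ, bη, bm, dη, dξ⟩ := newton_solve (δ := σ / 10) h hγ hβ
    (by linarith) (by linarith) (by linarith) hL hL1 hK hd hK2 bu bv bQ b1 b2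
  set σ₁ := σ - 2 * (σ / 10) with hσ₁
  have hσ₁0 : 0 < σ₁ := by linarith
  have le1 : σ₁ ≤ σ := by linarith
  have pa := h.pfu.one_add_ds hσ
  have pA := h.pfu.inv_one_add_ds hσ bu
  have bA := bd_inv_one_add_ds bu
  have pv := h.pfv.ds hσ
  have ba : Bd σ (5 / 4) (fun y θ s => 1 + ds u y θ s) := fun y θ s hs => by
    have := norm_add_le (1 : ℂ) (ds u y θ s)
    rw [norm_one] at this
    linarith [bu y θ s hs]
  have hL2 : L ≤ L ^ 2 := by nlinarith
  have hL3 : L ^ 2 ≤ L ^ 3 := pow_le_pow_right₀ hL1 (by norm_num)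
  have hL4 : L ^ 3 ≤ L ^ 4 := pow_le_pow_right₀ hL1 (by norm_num)
  have hLe : L * e ≤ L ^ 2 * e := mul_le_mul_of_nonneg_right hL2 he.le
  set D := 32 * L ^ 2 * e with hD
  have hD0 : 0 < D := by positivity
  have hDσ : D < σ := by linarith
  set ΔU : ℝ → ℝ → ℂ → ℂ := fun y θ s => ξ y θ s * (1 + ds u y θ s) with hΔU
  set ΔV : ℝ → ℝ → ℂ → ℂ := fun y θ s => ξ y θ s * ds v y θ s + η y θ s * (1 + ds u y θ s)⁻¹ with hΔV
  have pU : PF β σ₁ ΔU := pξ.mul (pa.mono le1)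
  have pV : PF β σ₁ ΔV := (pξ.mul (pv.mono le1)).add (pη.mul (pA.mono le1))
  have bU : Bd σ₁ D ΔU := (bξ.mul (ba.mono le1 le_rfl)).mono le_rfl (by linarith)
  have bV : Bd σ₁ D ΔV := ((bξ.mul (bv.mono le1 le_rfl)).add (bη.mul (bA.mono le1 le_rfl))).mono
    le_rfl (by linarith)
  set u' : ℝ → ℝ → ℂ → ℂ := fun y θ s => u y θ s + ΔU y θ s with hu'
  set v' : ℝ → ℝ → ℂ → ℂ := fun y θ s => v y θ s + ΔV y θ s with hv'
  have pu' : PF β σ₁ u' := (h.pfu.mono le1).add pU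
  have pv' : PF β σ₁ v' := (h.pfv.mono le1).add pV
  have hd1 : InDom β σ₁ (4 * σ) 1 u v := fun y θ s hs => hd y θ s (strip_mono le1 hs)
  have hd' : InDom β σ₁ (4 * σ) 1 u' v' := fun y θ s hs => by
    have := mem_dom_of_bd hσ4 h.pfu h.pfv bu1 bv1 bv0 (y := y) (θ := θ) (strip_mono le1 hs)
      ((bU y θ s hs).trans hDσ.le) ((bV y θ s hs).trans hDσ.le)
    rwa [add_assoc] at this
  have pcomp : ∀ {F : ℝ → ℝ → ℂ × ℂ → ℂ}, Ham (4 * σ) 1 F → PF β σ₁ (comp β F u v) := fun hF =>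
    PF.comp hF (h.pfu.mono le1) (h.pfv.mono le1) hd1 hσ₁0
  have pR : ∀ {F : ℝ → ℝ → ℂ × ℂ → ℂ}, Ham (4 * σ) 1 F → PF β σ₁ (fun y θ s =>
      comp β F u' v' y θ s - comp β F u v y θ s - (comp β (pt F) u v y θ s * ΔU y θ s +
      comp β (ph F) u v y θ s * ΔV y θ s)) := fun hF =>
    ((PF.comp hF pu' pv' hd' hσ₁0).sub (pcomp hF)).sub
      (((pcomp (hF.pt hρ)).mul pU).add ((pcomp (hF.ph hρ)).mul pV))
  have bR₁ := (hK.ph hρ).bd_taylor hσ4 le1 hσ₁0 hKh h.pfu h.pfv bu1 bv1 bv0 bU bV hD0 hDσ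
  have bR₂ := (hK.pt hρ).bd_taylor (c := 0) hσ4 le1 hσ₁0 (by simpa using hKt) h.pfu h.pfv bu1 bv1
    bv0 bU bV hD0 hDσ
  have pR₁ := pR (hK.ph hρ)
  have pR₂ := pR (hK.pt hρ)
  have pdE₁ := (h.pfE₁.ds hσ).mono le1
  have pdE₂ := (h.pfE₂.ds hσ).mono le1
  have bdE₁ := (h.pfE₁.bd_ds b1 (δ := σ / 10) (by linarith)).mono (τ := σ₁) (by linarith) le_rfl
  have bdE₂ := (h.pfE₂.bd_ds b2 (δ := σ / 10) (by linarith)).mono (τ := σ₁) (by linarith) le_rfl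
  have pA1 := pA.mono le1
  have bA1 := bA.mono le1 le_rfl
  have pE₁' := (pξ.mul pdE₁).sub pR₁
  have bE₁' := (bξ.mul bdE₁).sub bR₁
  have pE₂' := ((pξ.mul pdE₂).sub ((pη.mul pdE₁).mul (pA1.mul pA1))).add pR₂
  have bE₂' := ((bξ.mul bdE₂).sub ((bη.mul bdE₁).mul (bA1.mul bA1))).add bR₂
  have pdV := (pV.ds hσ₁0)
  have bdV := pV.bd_ds bV (δ := σ / 10) (by linarith)
  obtain ⟨q, pq, bq, dq⟩ := exists_solve (δ := σ / 10) hγ hβ (by linarith) (by linarith)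
    (by linarith) (pdV.mono (τ := σ₁ - σ / 10) (by linarith)) bdV
    (fun y => pV.mean_ds hσ₁0 y)
  have le2 : σ / 2 ≤ σ₁ - σ / 10 - σ / 10 := by linarith
  have le3 : σ / 2 ≤ σ₁ := by linarith
  have le4 : σ / 2 ≤ σ := by linarith
  have le5 : σ / 2 ≤ σ₁ - σ / 10 := by linarith
  have hne : ∀ y θ, ∀ s ∈ strip σ₁, 1 + ds u y θ s ≠ 0 := fun y θ s hs h0 => by
    have := one_add_ds_ne bu y θ (strip_mono le1 hs)
    rw [h0, norm_zero] at this
    norm_num at this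
  have hσ1 : (1 : ℝ) ≤ 1 / σ := by
    rw [le_div_iff₀ hσ]
    linarith
  have hσ2 : 1 / σ ≤ 1 / σ ^ 2 := by
    rw [div_le_div_iff₀ hσ (by positivity)]
    nlinarith
  have hbig : D / (σ / 10) ≤ 320 * L ^ 3 * e / σ := by
    rw [hD, show 32 * L ^ 2 * e / (σ / 10) = 320 * L ^ 2 * e / σ by field_simp; ring]
    gcongr
  have hD' : D ≤ 320 * L ^ 3 * e / σ := by
    refine le_trans ?_ hbig
    rw [le_div_iff₀ (by linarith)]
    nlinarith
  have htail : 9 * D ^ 2 / σ ^ 2 = 9216 * (L ^ 4 * e ^ 2 / σ ^ 2) := by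
    rw [hD]; ring
  have hq1 : L ^ 2 * e ^ 2 / σ ≤ L ^ 4 * e ^ 2 / σ ^ 2 := by
    have h1 : L ^ 2 * e ^ 2 ≤ L ^ 4 * e ^ 2 := mul_le_mul_of_nonneg_right (hL3.trans hL4) (by positivity)
    calc L ^ 2 * e ^ 2 / σ = L ^ 2 * e ^ 2 * (1 / σ) := by ring
      _ ≤ L ^ 4 * e ^ 2 * (1 / σ ^ 2) := mul_le_mul h1 hσ2 (by positivity) (by positivity)
      _ = _ := by ring
  have hq2 : L * e ^ 2 / σ ≤ L ^ 4 * e ^ 2 / σ ^ 2 := by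
    refine le_trans ?_ hq1
    gcongr
  have dsU : ∀ y θ, ∀ s ∈ strip σ₁, ds u' y θ s - ds u y θ s = ds ΔU y θ s := fun y θ s hs => by
    rw [hu', ds_add (h.pfu.mono le1) pU hs, add_sub_cancel_left]
  have dsV : ∀ y θ, ∀ s ∈ strip σ₁, ds v' y θ s = ds v y θ s + ds ΔV y θ s := fun y θ s hs =>
    ds_add (h.pfv.mono le1) pV hs
  refine ⟨fun y => l y + m y, u', v', fun y θ s => Q y θ s + q y θ s, _, _,
    ⟨h.pfl.add cm, pu'.mono le3, pv'.mono le3, (h.pfQ.mono le4).add (pq.mono le2), pE₁'.mono le3,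
      pE₂'.mono le3, ?_, ?_, ?_⟩, bE₁'.mono le3 ?_, bE₂'.mono le3 ?_, ?_, ?_, ?_, ?_, ?_, ?_⟩
  · intro y θ s hs
    have hs1 := strip_mono le3 hs
    have hs0 := strip_mono le4 hs
    refine ((h.dtu y θ s hs0).add ((dξ y θ s hs1).mul
      ((h.dt_ds_u hK hσ hd y θ s hs0).const_add 1))).congr_deriv ?_
    have hA := mul_inv_cancel₀ (hne y θ s hs1)
    simp only [hΔU, hΔV, twist]
    push_cast
    linear_combination (-E₁ y θ s + η y θ s * comp β (ph (ph K)) u v y θ s * (1 + ds u y θ s)⁻¹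
      + m y) * hA
  · intro y θ s hs
    have hs1 := strip_mono le3 hs
    have hs0 := strip_mono le4 hs
    have e2 : comp β (ph (pt K)) u v y θ s = comp β (pt (ph K)) u v y θ s :=
      (hK.pt_ph_comm hρ (hd y θ s hs0)).symm
    have dinv := (hasDerivAt_inv (hne y θ s hs1)).comp θ
      ((h.dt_ds_u hK hσ hd y θ s hs0).const_add 1)
    refine ((h.dtv y θ s hs0).add (((dξ y θ s hs1).mul (h.dt_ds_v hK hσ hd y θ s hs0)).add
      ((dη y θ s hs1).mul dinv))).congr_deriv ?_
    have hA := mul_inv_cancel₀ (hne y θ s hs1)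
    have hA2 : ((1 + ds u y θ s) ^ 2)⁻¹ = (1 + ds u y θ s)⁻¹ * (1 + ds u y θ s)⁻¹ := by
      rw [sq, mul_inv]
    simp only [hΔU, hΔV, twist, Function.comp, hA2, e2]
    linear_combination (-(E₂ y θ s) - η y θ s * comp β (pt (ph K)) u v y θ s *
      (1 + ds u y θ s)⁻¹) * hA
  · intro y θ s hs
    rw [dsV y θ s (strip_mono le3 hs)]
    exact (h.dtQ y θ s (strip_mono le4 hs)).add (dq y θ s (strip_mono le2 hs))
  · rw [htail, show 21 * L ^ 2 * e * (e / (σ / 10)) = 210 * (L ^ 2 * e ^ 2 / σ) by field_simp; ring,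
      show 10 ^ 4 * L ^ 4 * e ^ 2 / σ ^ 2 = 10 ^ 4 * (L ^ 4 * e ^ 2 / σ ^ 2) by ring]
    have : 0 ≤ L ^ 4 * e ^ 2 / σ ^ 2 := by positivity
    linarith
  · rw [htail, show 21 * L ^ 2 * e * (e / (σ / 10)) = 210 * (L ^ 2 * e ^ 2 / σ) by field_simp; ring,
      show 10 * L * e * (e / (σ / 10)) * (4 / 3 * (4 / 3)) = 1600 / 9 * (L * e ^ 2 / σ) by
        field_simp; ring,
      show 10 ^ 4 * L ^ 4 * e ^ 2 / σ ^ 2 = 10 ^ 4 * (L ^ 4 * e ^ 2 / σ ^ 2) by ring]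
    have : 0 ≤ L ^ 4 * e ^ 2 / σ ^ 2 := by positivity
    linarith
  · intro y
    rw [add_sub_cancel_left]
    exact (bm y).trans (le_trans (by linarith) hD')
  · intro y θ s hs
    simp only [hu', add_sub_cancel_left]
    exact (bU y θ s (strip_mono le3 hs)).trans hD'
  · intro y θ s hs
    beta_reduce
    rw [dsU y θ s (strip_mono le3 hs)]
    exact (pU.bd_ds bU (δ := σ / 10) (by linarith) y θ s (strip_mono le5 hs)).trans hbig
  · intro y θ s hs
    simp only [hv', add_sub_cancel_left]
    exact (bV y θ s (strip_mono le3 hs)).trans hD'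
  · intro y θ s hs
    beta_reduce
    rw [dsV y θ s (strip_mono le3 hs), add_sub_cancel_left]
    exact (bdV y θ s (strip_mono le5 hs)).trans hbig
  · intro y θ s hs
    beta_reduce
    rw [add_sub_cancel_left]
    refine (bq y θ s (strip_mono le2 hs)).trans ?_
    calc _ ≤ L * (D / (σ / 10)) := mul_le_mul_of_nonneg_right hL (by positivity)
      _ = _ := by rw [hD]; field_simp; ring

variable {ρ r δ M ε ω : ℝ} {K K' : ℝ → ℝ → ℂ × ℂ → ℂ} {D : ℕ → ℝ → ℝ → ℂ × ℂ → ℂ}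

namespace Ham

lemma lin (ω : ℝ) : Ham ρ r (fun _ _ z => ω * z.2) :=
  ⟨by fun_prop, fun y θ z _ => analyticAt_const.mul analyticAt_snd, fun _ _ _ _ => rfl,
    fun _ _ _ _ => rfl, fun _ _ t h _ => by simp⟩

lemma ph_congr (h : ∀ y θ, ∀ z ∈ dom ρ r, K y θ z = K' y θ z) (y θ : ℝ) {z : ℂ × ℂ}
    (hz : z ∈ dom ρ r) : JumpingKAM.ph K y θ z = JumpingKAM.ph K' y θ z := by
  refine Filter.EventuallyEq.deriv_eq ?_
  have : Continuous fun t : ℂ => (z.1, t) := by fun_prop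
  filter_upwards [this.continuousAt.preimage_mem_nhds ((isOpen_dom ρ r).mem_nhds hz)] with t ht
    using h y θ (z.1, t) ht

lemma pt_sub (hK : Ham ρ r K) (hK' : Ham ρ r K') (y θ : ℝ) {z : ℂ × ℂ} (hz : z ∈ dom ρ r) :
    JumpingKAM.pt (fun y θ z => K y θ z - K' y θ z) y θ z =
      JumpingKAM.pt K y θ z - JumpingKAM.pt K' y θ z := by
  rw [hK.pt_eq hz, hK'.pt_eq hz]
  exact ((hK.hasDerivAt_t hz).sub (hK'.hasDerivAt_t hz)).deriv

lemma ph_sub (hK : Ham ρ r K) (hK' : Ham ρ r K') (y θ : ℝ) {z : ℂ × ℂ} (hz : z ∈ dom ρ r) :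
    JumpingKAM.ph (fun y θ z => K y θ z - K' y θ z) y θ z =
      JumpingKAM.ph K y θ z - JumpingKAM.ph K' y θ z := by
  rw [hK.ph_eq hz, hK'.ph_eq hz]
  exact ((hK.hasDerivAt_h hz).sub (hK'.hasDerivAt_h hz)).deriv

lemma ph_ph_sub (hρ : 0 < ρ) (hK : Ham ρ r K) (hK' : Ham ρ r K') (y θ : ℝ) {z : ℂ × ℂ}
    (hz : z ∈ dom ρ r) :
    JumpingKAM.ph (JumpingKAM.ph (fun y θ z => K y θ z - K' y θ z)) y θ z =
      JumpingKAM.ph (JumpingKAM.ph K) y θ z - JumpingKAM.ph (JumpingKAM.ph K') y θ z := by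
  rw [ph_congr (fun y θ z hz => hK.ph_sub hK' y θ hz) y θ hz, (hK.ph hρ).ph_sub (hK'.ph hρ) y θ hz]

lemma pt_lin (ω y θ : ℝ) (z : ℂ × ℂ) : JumpingKAM.pt (fun _ _ z => (ω : ℂ) * z.2) y θ z = 0 := by
  simp [JumpingKAM.pt]

lemma ph_lin (ω : ℝ) : JumpingKAM.ph (fun _ _ z => (ω : ℂ) * z.2) = fun _ _ _ => (ω : ℂ) := by
  funext y θ z
  have := ((hasDerivAt_id z.2).const_mul (ω : ℂ)).deriv
  simpa [JumpingKAM.ph] using this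

lemma ph_ph_lin (ω y θ : ℝ) (z : ℂ × ℂ) :
    JumpingKAM.ph (JumpingKAM.ph (fun _ _ z => (ω : ℂ) * z.2)) y θ z = 0 := by
  rw [ph_lin]
  simp [JumpingKAM.ph]

/-- Cauchy estimates for the derivatives entering the iteration. -/
lemma deriv_bounds (hK : Ham ρ 2 K) (hM : ∀ y θ, ∀ z ∈ dom ρ 2, ‖K y θ z‖ ≤ M) (hδ : 0 < δ)
    (hδ1 : δ ≤ 1) (hδρ : δ < ρ) (y θ : ℝ) {z : ℂ × ℂ} (hz : z ∈ dom (ρ - δ) 1) :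
    ‖JumpingKAM.pt K y θ z‖ ≤ M / δ ∧ ‖JumpingKAM.ph K y θ z‖ ≤ M / δ ∧
      ‖JumpingKAM.ph (JumpingKAM.ph K) y θ z‖ ≤ 4 * M / δ ^ 2 := by
  have hz' : z ∈ dom (ρ - δ) (2 - δ) := dom_mono le_rfl (by linarith) hz
  refine ⟨hK.norm_pt_le hM hδ y θ hz', hK.norm_ph_le hM hδ y θ hz', ?_⟩
  have h1 := ((hK.ph (by linarith)).mono (ρ' := ρ - δ / 2) (r' := 2 - δ / 2) (by linarith)
    (by linarith)).norm_ph_le (δ := δ / 2) (M := M / (δ / 2))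
    (fun y θ z hz => hK.norm_ph_le hM (by linarith) y θ hz) (by linarith) y θ (z := z)
    (dom_mono (by linarith) (by linarith) hz')
  refine h1.trans_eq ?_
  field_simp
  norm_num

end Ham

lemma dom_half {j : ℕ} {z : ℂ × ℂ} (hz : z ∈ dom ((1 / 2) ^ (j + 1)) 1) :
    z ∈ dom ((1 / 2) ^ j - (1 / 2) ^ (j + 1)) 1 := by
  have : (1 / 2 : ℝ) ^ j - (1 / 2) ^ (j + 1) = (1 / 2) ^ (j + 1) := by rw [pow_succ]; ring
  rwa [this]

/-- Uniform bounds along a rapidly convergent sequence of Hamiltonians. -/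
lemma ham_seq_bounds (hε : 0 ≤ ε) (hD : ∀ j, Ham ((1 / 2) ^ j) 2 (D j))
    (h0 : ∀ y θ, ∀ z ∈ dom 1 2, ‖D 0 y θ z‖ ≤ ε)
    (hstep : ∀ j y θ, ∀ z ∈ dom ((1 / 2) ^ (j + 1)) 2,
      ‖D (j + 1) y θ z - D j y θ z‖ ≤ ε * (1 / 2) ^ (19 * j)) (j : ℕ) :
    (∀ y θ, ∀ z ∈ dom ((1 / 2) ^ (j + 1)) 1, ‖pt (D j) y θ z‖ ≤ 256 * ε ∧
      ‖ph (D j) y θ z‖ ≤ 256 * ε ∧ ‖ph (ph (D j)) y θ z‖ ≤ 256 * ε) ∧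
    (∀ y θ, ∀ z ∈ dom ((1 / 2) ^ (j + 2)) 1,
      ‖pt (D (j + 1)) y θ z - pt (D j) y θ z‖ ≤ 4 * ε * (1 / 2) ^ (18 * j) ∧
      ‖ph (D (j + 1)) y θ z - ph (D j) y θ z‖ ≤ 4 * ε * (1 / 2) ^ (18 * j)) := by
  have key : ∀ j y θ, ∀ z ∈ dom ((1 / 2) ^ (j + 2)) 1,
      ‖pt (D (j + 1)) y θ z - pt (D j) y θ z‖ ≤ 4 * ε * (1 / 2) ^ (18 * j) ∧
      ‖ph (D (j + 1)) y θ z - ph (D j) y θ z‖ ≤ 4 * ε * (1 / 2) ^ (18 * j) ∧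
      ‖ph (ph (D (j + 1))) y θ z - ph (ph (D j)) y θ z‖ ≤ 64 * ε * (1 / 2) ^ j := by
    intro j y θ z hz
    have e1 : (1 / 2 : ℝ) ^ (j + 1) ≤ (1 / 2) ^ j := pow_le_pow_of_le_one (by norm_num) (by norm_num) (by omega)
    have e2 : (1 / 2 : ℝ) ^ (j + 2) < (1 / 2) ^ (j + 1) :=
      pow_lt_pow_right_of_lt_one₀ (by norm_num) (by norm_num) (by omega)
    have hz' : z ∈ dom ((1 / 2) ^ (j + 1)) 2 := dom_mono e2.le (by norm_num) hz
    have h1 := (hD (j + 1)).mono (r' := 2) le_rfl le_rfl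
    have h2 := (hD j).mono (r' := 2) e1 le_rfl
    have hp : (0 : ℝ) < (1 / 2) ^ (j + 2) := by positivity
    obtain ⟨b1, b2, b3⟩ := (h1.sub h2).deriv_bounds (hstep j) (δ := (1 / 2) ^ (j + 2)) hp
      (pow_le_one₀ (by norm_num) (by norm_num)) e2 y θ (dom_half hz)
    rw [h1.pt_sub h2 y θ hz'] at b1
    rw [h1.ph_sub h2 y θ hz'] at b2
    rw [Ham.ph_ph_sub (by positivity) h1 h2 y θ hz'] at b3
    have c1 : ε * (1 / 2) ^ (19 * j) / (1 / 2) ^ (j + 2) = 4 * ε * (1 / 2) ^ (18 * j) := by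
      rw [div_eq_iff hp.ne', show 19 * j = 18 * j + j by ring, pow_add, pow_add]
      ring
    have c2 : 4 * (ε * (1 / 2) ^ (19 * j)) / ((1 / 2) ^ (j + 2)) ^ 2 =
        64 * ε * (1 / 2) ^ (17 * j) := by
      rw [div_eq_iff (by positivity), show 19 * j = 17 * j + j * 2 by ring, pow_add, pow_add, mul_pow,
        pow_mul _ j 2]
      ring
    rw [c1] at b1 b2
    rw [c2] at b3
    refine ⟨b1, b2, b3.trans ?_⟩
    refine mul_le_mul_of_nonneg_left ?_ (by positivity)
    exact pow_le_pow_of_le_one (by norm_num) (by norm_num) (by omega)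
  refine ⟨?_, fun y θ z hz => ⟨(key j y θ z hz).1, (key j y θ z hz).2.1⟩⟩
  have main : ∀ y θ, ∀ z ∈ dom ((1 / 2) ^ (j + 1)) 1,
      ‖pt (D j) y θ z‖ ≤ 256 * ε * (1 - (1 / 2) ^ (j + 1)) ∧
      ‖ph (D j) y θ z‖ ≤ 256 * ε * (1 - (1 / 2) ^ (j + 1)) ∧
      ‖ph (ph (D j)) y θ z‖ ≤ 256 * ε * (1 - (1 / 2) ^ (j + 1)) := by
    induction j with
    | zero =>
      intro y θ z hz
      obtain ⟨b1, b2, b3⟩ := ((hD 0).mono (ρ' := 1) (r' := 2) (by norm_num) le_rfl).deriv_bounds h0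
        (δ := 1 / 2) (by norm_num) (by norm_num) (by norm_num) y θ (z := z)
        (dom_mono (by norm_num) le_rfl hz)
      norm_num at b1 b2 b3 ⊢
      exact ⟨by linarith, by linarith, by linarith⟩
    | succ j ih =>
      intro y θ z hz
      have e2 : (1 / 2 : ℝ) ^ (j + 2) ≤ (1 / 2) ^ (j + 1) :=
        pow_le_pow_of_le_one (by norm_num) (by norm_num) (by omega)
      obtain ⟨a1, a2, a3⟩ := ih y θ z (dom_mono e2 le_rfl hz)
      obtain ⟨b1, b2, b3⟩ := key j y θ z hz
      have e3 : (1 / 2 : ℝ) ^ (18 * j) ≤ (1 / 2) ^ j :=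
        pow_le_pow_of_le_one (by norm_num) (by norm_num) (by omega)
      have e4 : 4 * ε * (1 / 2 : ℝ) ^ (18 * j) ≤ 64 * ε * (1 / 2) ^ j := by
        have := mul_le_mul_of_nonneg_left e3 hε
        have h2 : 0 ≤ ε * (1 / 2 : ℝ) ^ j := by positivity
        linarith
      have tri : ∀ a b : ℂ, ‖a‖ ≤ ‖a - b‖ + ‖b‖ := fun a b => by
        simpa using norm_add_le (a - b) b
      have e5 : 256 * ε * (1 - (1 / 2 : ℝ) ^ (j + 1)) + 64 * ε * (1 / 2) ^ j =
        256 * ε * (1 - (1 / 2 : ℝ) ^ (j + 1 + 1)) := by rw [pow_succ _ (j + 1), pow_succ]; ring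
      rw [← e5]
      have comb : ∀ {a b c d : ℝ}, a ≤ d → b ≤ c → a + b ≤ c + d := fun h1 h2 => by linarith
      exact ⟨(tri _ _).trans (comb (b1.trans e4) a1), (tri _ _).trans (comb (b2.trans e4) a2),
        (tri _ _).trans (comb b3 a3)⟩
  intro y θ z hz
  have hle : 256 * ε * (1 - (1 / 2 : ℝ) ^ (j + 1)) ≤ 256 * ε := by
    have : (0 : ℝ) ≤ (1 / 2) ^ (j + 1) := by positivity
    nlinarith
  obtain ⟨a1, a2, a3⟩ := main y θ z hz
  exact ⟨a1.trans hle, a2.trans hle, a3.trans hle⟩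

lemma exists_seq_of_step {α : Type*} {P : ℕ → α → Prop} {R : ℕ → α → α → Prop} (h0 : ∃ a, P 0 a)
    (h : ∀ j a, P j a → ∃ b, P (j + 1) b ∧ R j a b) :
    ∃ f : ℕ → α, (∀ j, P j (f j)) ∧ ∀ j, R j (f j) (f (j + 1)) := by
  choose! g hg hR using h
  obtain ⟨a, ha⟩ := h0
  have hP : ∀ j, P j (Nat.rec a (fun j b => g j b) j : α) := fun j => by
    induction j with
    | zero => exact ha
    | succ j ih => exact hg j _ ih
  exact ⟨fun j => Nat.rec a (fun j b => g j b) j, hP, fun j => hR j _ (hP j)⟩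

variable {β σ τ γ ω : ℝ} {K : ℝ → ℝ → ℂ × ℂ → ℂ}

/-- Data carried along the iteration. -/
structure Stage where
  l : ℝ → ℝ
  u : ℝ → ℝ → ℂ → ℂ
  v : ℝ → ℝ → ℂ → ℂ
  Q : ℝ → ℝ → ℂ → ℂ
  E₁ : ℝ → ℝ → ℂ → ℂ
  E₂ : ℝ → ℝ → ℂ → ℂ

/-- A stage is an approximate torus with error at most `e` and size at most `b`. -/
structure Stage.Good (S : Stage) (β σ : ℝ) (K : ℝ → ℝ → ℂ × ℂ → ℂ) (e b : ℝ) : Prop where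
  approx : Approx β σ K S.l S.u S.v S.Q S.E₁ S.E₂
  be₁ : Bd σ e S.E₁
  be₂ : Bd σ e S.E₂
  bu : Bd σ b S.u
  bdu : Bd σ b (ds S.u)
  bv : Bd σ b S.v
  bdv : Bd σ b (ds S.v)
  bQ : Bd σ b S.Q

/-- Two stages are `d`-close on the strip of width `σ`. -/
structure Stage.Close (S T : Stage) (σ d : ℝ) : Prop where
  l : ∀ y, |T.l y - S.l y| ≤ d
  u : Bd σ d (fun y θ s => T.u y θ s - S.u y θ s)
  du : Bd σ d (fun y θ s => ds T.u y θ s - ds S.u y θ s)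
  v : Bd σ d (fun y θ s => T.v y θ s - S.v y θ s)
  dv : Bd σ d (fun y θ s => ds T.v y θ s - ds S.v y θ s)
  Q : Bd σ d (fun y θ s => T.Q y θ s - S.Q y θ s)

lemma Bd.of_sub {b d : ℝ} {F G : ℝ → ℝ → ℂ → ℂ} (hσ : τ ≤ σ) (h : Bd σ b F)
    (hd : Bd τ d (fun y θ s => G y θ s - F y θ s)) : Bd τ (b + d) G := fun y θ s hs => by
  have := norm_add_le (F y θ s) (G y θ s - F y θ s)
  rw [add_sub_cancel] at this
  linarith [h y θ s (strip_mono hσ hs), hd y θ s hs]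

lemma Stage.Good.step {S : Stage} {L e b d f e' : ℝ} {c : ℂ} {K K' : ℝ → ℝ → ℂ × ℂ → ℂ}
    (h : S.Good β σ K e b) (hγ : 0 < γ)
    (hβ : Dioph γ β) (hσ : 0 < σ) (hσ4 : σ ≤ 1 / 4) (he : 0 < e) (hL1 : 1 ≤ L)
    (hL : (12 / γ + 1) / (σ / 10) ^ 4 ≤ L) (hsmall : 96 * L ^ 2 * e ≤ σ)
    (hK : Ham (4 * σ) 1 K)
    (hKh : ∀ y θ, ∀ z ∈ dom (4 * σ) 1, ‖ph K y θ z - c‖ ≤ 1)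
    (hKt : ∀ y θ, ∀ z ∈ dom (4 * σ) 1, ‖pt K y θ z‖ ≤ 1)
    (hK2 : ∀ y θ, ∀ z ∈ dom (4 * σ) 1, ‖ph (ph K) y θ z‖ ≤ 1 / 16)
    (hd : 320 * L ^ 3 * e / σ ≤ d) (hb : b + d ≤ 1 / 4)
    (hK' : Ham (2 * σ) 1 K')
    (hdt : ∀ y θ, ∀ z ∈ dom (2 * σ) 1, ‖pt K' y θ z - pt K y θ z‖ ≤ f)
    (hdh : ∀ y θ, ∀ z ∈ dom (2 * σ) 1, ‖ph K' y θ z - ph K y θ z‖ ≤ f)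
    (he' : 10 ^ 4 * L ^ 4 * e ^ 2 / σ ^ 2 + f ≤ e') :
    ∃ T : Stage, T.Good β (σ / 2) K' e' (b + d) ∧ S.Close T (σ / 2) d := by
  have hd0 : 0 ≤ d := le_trans (by positivity) hd
  have hb4 : b ≤ 1 / 4 := by linarith
  obtain ⟨l', u', v', Q', E₁', E₂', ha, b1, b2, c1, c2, c3, c4, c5, c6⟩ := newton_step h.approx hγ hβ
    hσ hσ4 he hL1 hL hsmall hK hKh hKt hK2 (h.bdu.mono le_rfl hb4) (h.bdv.mono le_rfl (by linarith))
    (h.bv.mono le_rfl (by linarith)) (h.bQ.mono le_rfl (by linarith)) h.be₁ h.be₂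
  have le : σ / 2 ≤ σ := by linarith
  have d2 := c2.mono le_rfl hd
  have d3 := c3.mono le_rfl hd
  have d4 := c4.mono le_rfl hd
  have d5 := c5.mono le_rfl hd
  have d6 := c6.mono le_rfl hd
  have bu' := Bd.of_sub le h.bu d2
  have bdu' := Bd.of_sub le h.bdu d3
  have bv' := Bd.of_sub le h.bv d4
  have bdv' := Bd.of_sub le h.bdv d5
  have bQ' := Bd.of_sub le h.bQ d6
  have hin : InDom β (σ / 2) (2 * σ) 1 u' v' := by
    have := inDom_of_bd (σ := σ / 2) (by linarith) ha.pfu ha.pfv (bdu'.mono le_rfl (by linarith))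
      (bdv'.mono le_rfl (by linarith)) (bv'.mono le_rfl (by linarith))
    rwa [show 4 * (σ / 2) = 2 * σ by ring] at this
  have hKm : Ham (2 * σ) 1 K := hK.mono (by linarith) le_rfl
  have hρ : 0 < 2 * σ := by linarith
  have pc : ∀ {F : ℝ → ℝ → ℂ × ℂ → ℂ}, Ham (2 * σ) 1 F → PF β (σ / 2) (comp β F u' v') :=
    fun hF => PF.comp hF ha.pfu ha.pfv hin (by linarith)
  refine ⟨⟨l', u', v', Q', fun y θ s => E₁' y θ s - (comp β (ph K') u' v' y θ s -
    comp β (ph K) u' v' y θ s), fun y θ s => E₂' y θ s + (comp β (pt K') u' v' y θ s -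
    comp β (pt K) u' v' y θ s)⟩, ⟨⟨ha.pfl, ha.pfu, ha.pfv, ha.pfQ,
    ha.pfE₁.sub ((pc (hK'.ph hρ)).sub (pc (hKm.ph hρ))),
    ha.pfE₂.add ((pc (hK'.pt hρ)).sub (pc (hKm.pt hρ))), ?_, ?_, ha.dtQ⟩, ?_, ?_, bu', bdu', bv',
    bdv', bQ'⟩, ⟨fun y => (c1 y).trans hd, d2, d3, d4, d5, d6⟩⟩
  · intro y θ s hs
    exact (ha.dtu y θ s hs).congr_deriv (by ring)
  · intro y θ s hs
    exact (ha.dtv y θ s hs).congr_deriv (by ring)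
  · intro y θ s hs
    exact (norm_sub_le _ _).trans ((add_le_add (b1 y θ s hs) (hdh y θ _ (hin y θ s hs))).trans he')
  · intro y θ s hs
    exact (norm_add_le _ _).trans ((add_le_add (b2 y θ s hs) (hdt y θ _ (hin y θ s hs))).trans he')

/-- The trivial torus as a starting point. -/
lemma exists_good_zero {e : ℝ} (hσ : 0 < σ) (hK : Ham (4 * σ) 1 K)
    (he : 0 ≤ e) (hKh : ∀ y θ, ∀ z ∈ dom (4 * σ) 1, ‖ph K y θ z - ω‖ ≤ e)
    (hKt : ∀ y θ, ∀ z ∈ dom (4 * σ) 1, ‖pt K y θ z‖ ≤ e) :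
    ∃ S : Stage, S.Good β σ K e 0 ∧ S.l = fun _ => β - ω := by
  have p0 : PF β σ (fun _ _ _ => 0) := by
    simpa using PF.param (β := β) (σ := σ) (g := fun _ => 0) continuous_const
  have hin : InDom β σ (4 * σ) 1 (fun _ _ _ => 0) (fun _ _ _ => 0) := by
    intro y θ s hs
    have hs' : |s.im| < σ := hs
    refine ⟨?_, ?_, ?_⟩ <;> simp <;> linarith [abs_nonneg s.im]
  have pω : PF β σ (fun _ _ _ => (ω : ℂ)) := PF.param (g := fun _ => ω) continuous_const
  have hρ : 0 < 4 * σ := by linarith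
  have d0 : ∀ M : ℝ, 0 ≤ M → Bd σ M (fun _ _ _ => 0) := fun M hM y θ s _ => by simpa using hM
  have e0 : ds (fun _ _ _ => 0) = fun _ _ _ => 0 := by
    funext y θ s
    simp [ds]
  refine ⟨⟨fun _ => β - ω, fun _ _ _ => 0, fun _ _ _ => 0, fun _ _ _ => 0,
    fun y θ s => ω - comp β (ph K) (fun _ _ _ => 0) (fun _ _ _ => 0) y θ s,
    fun y θ s => comp β (pt K) (fun _ _ _ => 0) (fun _ _ _ => 0) y θ s⟩,
    ⟨⟨continuous_const, p0, p0, p0, pω.sub (PF.comp (hK.ph hρ) p0 p0 hin hσ),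
      PF.comp (hK.pt hρ) p0 p0 hin hσ, ?_, ?_, ?_⟩, ?_, ?_, d0 0 le_rfl, ?_, d0 0 le_rfl, ?_,
      d0 0 le_rfl⟩, rfl⟩
  · intro y θ s _
    refine (hasDerivAt_const θ (0 : ℂ)).congr_deriv ?_
    push_cast
    ring
  · intro y θ s _
    refine (hasDerivAt_const θ (0 : ℂ)).congr_deriv ?_
    ring
  · intro y θ s _
    dsimp only
    rw [e0]
    exact hasDerivAt_const θ (0 : ℂ)
  · intro y θ s hs
    dsimp only
    rw [norm_sub_rev]
    exact hKh y θ _ (hin y θ s hs)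
  · intro y θ s hs
    exact hKt y θ _ (hin y θ s hs)
  · dsimp only
    rw [e0]
    exact d0 0 le_rfl
  · dsimp only
    rw [e0]
    exact d0 0 le_rfl

/-- A rapidly convergent sequence of real-analytic Hamiltonians close to `ω h`. -/
structure HamSeq (ω ε : ℝ) (K : ℕ → ℝ → ℝ → ℂ × ℂ → ℂ) : Prop where
  ham : ∀ j, Ham ((1 / 2) ^ j) 2 (K j)
  zero : ∀ y θ, ∀ z ∈ dom 1 2, ‖K 0 y θ z - ω * z.2‖ ≤ ε
  step : ∀ j y θ, ∀ z ∈ dom ((1 / 2) ^ (j + 1)) 2,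
    ‖K (j + 1) y θ z - K j y θ z‖ ≤ ε * (1 / 2) ^ (19 * j)

lemma half_pow_le {m n : ℕ} (h : m ≤ n) : (1 / 2 : ℝ) ^ n ≤ (1 / 2) ^ m :=
  pow_le_pow_of_le_one (by norm_num) (by norm_num) h

lemma HamSeq.bounds {ω ε : ℝ} {K : ℕ → ℝ → ℝ → ℂ × ℂ → ℂ} (h : HamSeq ω ε K) (hε : 0 ≤ ε) (j : ℕ) :
    (∀ y θ, ∀ z ∈ dom ((1 / 2) ^ (j + 1)) 1, ‖pt (K j) y θ z‖ ≤ 256 * ε ∧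
      ‖ph (K j) y θ z - ω‖ ≤ 256 * ε ∧ ‖ph (ph (K j)) y θ z‖ ≤ 256 * ε) ∧
    (∀ y θ, ∀ z ∈ dom ((1 / 2) ^ (j + 2)) 1,
      ‖pt (K (j + 1)) y θ z - pt (K j) y θ z‖ ≤ 4 * ε * (1 / 2) ^ (18 * j) ∧
      ‖ph (K (j + 1)) y θ z - ph (K j) y θ z‖ ≤ 4 * ε * (1 / 2) ^ (18 * j)) := by
  set D : ℕ → ℝ → ℝ → ℂ × ℂ → ℂ := fun j y θ z => K j y θ z - ω * z.2 with hD
  have hH : ∀ j, Ham ((1 / 2) ^ j) 2 (D j) := fun j => (h.ham j).sub (Ham.lin ω)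
  have hs : ∀ j y θ z, D (j + 1) y θ z - D j y θ z = K (j + 1) y θ z - K j y θ z := fun j y θ z => by
    simp only [hD]; ring
  obtain ⟨a, b⟩ := ham_seq_bounds hε hH h.zero (fun j y θ z hz => by rw [hs]; exact h.step j y θ z hz) j
  have e1 : ∀ j y θ, ∀ z ∈ dom ((1 / 2) ^ j) 2, pt (D j) y θ z = pt (K j) y θ z := by
    intro j y θ z hz
    rw [(h.ham j).pt_sub (Ham.lin ω) y θ hz, Ham.pt_lin, sub_zero]
  have e2 : ∀ j y θ, ∀ z ∈ dom ((1 / 2) ^ j) 2, ph (D j) y θ z = ph (K j) y θ z - ω := by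
    intro j y θ z hz
    rw [(h.ham j).ph_sub (Ham.lin ω) y θ hz, Ham.ph_lin]
  have e3 : ∀ j y θ, ∀ z ∈ dom ((1 / 2) ^ j) 2, ph (ph (D j)) y θ z = ph (ph (K j)) y θ z := by
    intro j y θ z hz
    rw [Ham.ph_ph_sub (by positivity) (h.ham j) (Ham.lin ω) y θ hz, Ham.ph_ph_lin, sub_zero]
  refine ⟨fun y θ z hz => ?_, fun y θ z hz => ?_⟩
  · have hz' : z ∈ dom ((1 / 2) ^ j) 2 := dom_mono (half_pow_le (by omega)) (by norm_num) hz
    have := a y θ z hz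
    rwa [e1 j y θ z hz', e2 j y θ z hz', e3 j y θ z hz'] at this
  · have hz' : z ∈ dom ((1 / 2) ^ j) 2 := dom_mono (half_pow_le (by omega)) (by norm_num) hz
    have hz'' : z ∈ dom ((1 / 2) ^ (j + 1)) 2 := dom_mono (half_pow_le (by omega)) (by norm_num) hz
    have := b y θ z hz
    rwa [e1 j y θ z hz', e2 j y θ z hz', e1 (j + 1) y θ z hz'', e2 (j + 1) y θ z hz'',
      sub_sub_sub_cancel_right] at this

/-- The sequence of approximate tori produced by the iteration. -/
lemma exists_stages {γ η : ℝ} (hγ : 0 < γ) (hη : 0 < η) (hη4 : η ≤ 1 / 4) :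
    ∃ ε > 0, 256 * ε ≤ η ∧ ∃ κ : ℝ, 0 < κ ∧ κ ≤ 1 ∧ ∀ (β ω : ℝ) (K : ℕ → ℝ → ℝ → ℂ × ℂ → ℂ), Dioph γ β → HamSeq ω ε K →
      ∃ S : ℕ → Stage, (S 0).l = (fun _ => β - ω) ∧ ∀ j,
        (S j).Good β ((1 / 2) ^ j / 16) (K j) (κ * ((1 / 2) ^ j / 16) ^ 18)
          (η / 2 * (1 - (1 / 2) ^ j)) ∧
        (S j).Close (S (j + 1)) ((1 / 2) ^ j / 16 / 2) (η * (1 / 2) ^ j / 4) := by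
  set c := 12 / γ + 1 with hc
  have hc1 : 1 ≤ c := by
    have : 0 ≤ 12 / γ := by positivity
    linarith
  have hc2 : c ^ 2 ≤ c ^ 4 := pow_le_pow_right₀ hc1 (by norm_num)
  have hc3 : c ^ 3 ≤ c ^ 4 := pow_le_pow_right₀ hc1 (by norm_num)
  have hc4 : 1 ≤ c ^ 4 := one_le_pow₀ hc1
  have hc0 : 0 < c := by linarith
  set κ := η / (10 ^ 26 * c ^ 4) with hκ
  have hκ0 : 0 < κ := by positivity
  have hk : κ * c ^ 4 = η / 10 ^ 26 := by rw [hκ]; field_simp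
  have hkc2 : κ * c ^ 2 ≤ η / 10 ^ 26 := hk ▸ mul_le_mul_of_nonneg_left hc2 hκ0.le
  have hkc3 : κ * c ^ 3 ≤ η / 10 ^ 26 := hk ▸ mul_le_mul_of_nonneg_left hc3 hκ0.le
  have hkc0 : κ ≤ η / 10 ^ 26 := by nlinarith
  refine ⟨κ / 2 ^ 100, by positivity, by linarith, κ, hκ0, by linarith, fun β ω K hβ hK => ?_⟩
  have hε : 0 ≤ κ / 2 ^ 100 := by positivity
  have hb := hK.bounds hε
  have hq : ∀ j, 0 < (1 / 2 : ℝ) ^ j := fun j => by positivity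
  have hq1 : ∀ j, (1 / 2 : ℝ) ^ j ≤ 1 := fun j => pow_le_one₀ (by norm_num) (by norm_num)
  have hseq := exists_seq_of_step
    (P := fun j (S : Stage) => (j = 0 → S.l = fun _ => β - ω) ∧
      S.Good β ((1 / 2) ^ j / 16) (K j) (κ * ((1 / 2) ^ j / 16) ^ 18) (η / 2 * (1 - (1 / 2) ^ j)))
    (R := fun j S T => S.Close T ((1 / 2) ^ j / 16 / 2) (η * (1 / 2) ^ j / 4))
  refine (hseq ?_ ?_).elim fun S ⟨hS, hR⟩ => ?_
  rotate_left 2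
  · exact ⟨S, (hS 0).1 rfl, fun j => ⟨(hS j).2, hR j⟩⟩
  · have hsub : dom (4 * ((1 / 2) ^ 0 / 16)) 1 ⊆ dom ((1 / 2) ^ (0 + 1)) 1 :=
      dom_mono (by norm_num) le_rfl
    have hle : 256 * (κ / 2 ^ 100) ≤ κ * ((1 / 2) ^ 0 / 16) ^ 18 := by
      rw [show κ * ((1 / 2) ^ 0 / 16) ^ 18 = κ / 2 ^ 72 by norm_num; ring]
      linarith
    obtain ⟨S, hS, hl⟩ := exists_good_zero (β := β) (ω := ω) (K := K 0) (σ := (1 / 2) ^ 0 / 16)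
      (e := κ * ((1 / 2) ^ 0 / 16) ^ 18) (by norm_num)
      ((hK.ham 0).mono (by norm_num) (by norm_num)) (by positivity)
      (fun y θ z hz => ((hb 0).1 y θ z (hsub hz)).2.1.trans hle)
      (fun y θ z hz => ((hb 0).1 y θ z (hsub hz)).1.trans hle)
    refine ⟨S, fun _ => hl, ?_⟩
    simpa using hS
  · rintro j S ⟨-, hS⟩
    set q := (1 / 2 : ℝ) ^ j with hqdef
    have q0 : 0 < q := hq j
    have q1 : q ≤ 1 := hq1 j
    have hq1' : (1 / 2 : ℝ) ^ (j + 1) = q / 2 := by rw [pow_succ]; ring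
    have hq2' : (1 / 2 : ℝ) ^ (j + 2) = q / 4 := by rw [pow_succ, hq1']; ring
    set σ := q / 16 with hσ
    have σ0 : 0 < σ := by positivity
    have σ1 : σ ≤ 1 / 16 := by linarith
    have hsub : dom (4 * σ) 1 ⊆ dom ((1 / 2) ^ (j + 1)) 1 :=
      dom_mono (by rw [hq1']; linarith) le_rfl
    have hsub2 : dom (2 * σ) 1 ⊆ dom ((1 / 2) ^ (j + 2)) 1 :=
      dom_mono (by rw [hq2']; linarith) le_rfl
    have hbig : 256 * (κ / 2 ^ 100) ≤ 1 / 16 := by linarith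
    have hσp : ∀ n : ℕ, 1 ≤ n → σ ^ n ≤ σ := fun n hn => by
      simpa using pow_le_pow_of_le_one σ0.le (by linarith) hn
    have hstep := hS.step (L := c * 10 ^ 4 / σ ^ 4) (d := η * q / 4)
      (f := 4 * (κ / 2 ^ 100) * (1 / 2) ^ (18 * j)) (e' := κ * (σ / 2) ^ 18) (c := ω) (K' := K (j + 1)) hγ hβ σ0
    refine (hstep (by linarith) (by positivity) ?_ ?_ ?_ ((hK.ham j).mono (by rw [← hqdef]; linarith) (by norm_num))
      (fun y θ z hz => ((hb j).1 y θ z (hsub hz)).2.1.trans (by linarith))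
      (fun y θ z hz => ((hb j).1 y θ z (hsub hz)).1.trans (by linarith))
      (fun y θ z hz => ((hb j).1 y θ z (hsub hz)).2.2.trans hbig)
      ?_ ?_ ((hK.ham (j + 1)).mono (by rw [hq1']; linarith) (by norm_num))
      (fun y θ z hz => ((hb j).2 y θ z (hsub2 hz)).1)
      (fun y θ z hz => ((hb j).2 y θ z (hsub2 hz)).2) ?_).elim fun T ⟨hT, hR⟩ => ?_
    rotate_left 6
    · refine ⟨T, ⟨fun h => absurd h (by omega), ?_⟩, hR⟩
      rw [hq1']
      have e1 : q / 2 / 16 = σ / 2 := by rw [hσ]; ring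
      have e2 : η / 2 * (1 - q / 2) = η / 2 * (1 - q) + η * q / 4 := by ring
      rw [e1, e2]
      exact hT
    · rw [le_div_iff₀ (by positivity)]
      have := hσp 4 (by norm_num)
      nlinarith
    · rw [← hc]
      exact le_of_eq (by field_simp)
    · have h1 := hσp 10 (by norm_num)
      calc 96 * (c * 10 ^ 4 / σ ^ 4) ^ 2 * (κ * σ ^ 18) = 96 * 10 ^ 8 * (κ * c ^ 2) * σ ^ 10 := by
            field_simp
        _ ≤ 1 * σ := mul_le_mul (by linarith) h1 (by positivity) (by norm_num)
        _ = σ := one_mul σ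
    · have h1 := hσp 5 (by norm_num)
      calc 320 * (c * 10 ^ 4 / σ ^ 4) ^ 3 * (κ * σ ^ 18) / σ
          = 320 * 10 ^ 12 * (κ * c ^ 3) * σ ^ 5 := by field_simp
        _ ≤ η * σ := mul_le_mul (by linarith) h1 (by positivity) hη.le
        _ ≤ η * q / 4 := by rw [hσ]; nlinarith
    · nlinarith
    · have e1 : 10 ^ 4 * (c * 10 ^ 4 / σ ^ 4) ^ 4 * (κ * σ ^ 18) ^ 2 / σ ^ 2 =
          10 ^ 20 * (κ * c ^ 4) * (κ * σ ^ 18) := by field_simp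
      have e2 : 4 * (κ / 2 ^ 100) * (1 / 2 : ℝ) ^ (18 * j) = 1 / 2 ^ 26 * (κ * σ ^ 18) := by
        rw [show 18 * j = j * 18 by ring, pow_mul, ← hqdef, hσ]
        field_simp
        norm_num
      have e3 : κ * (σ / 2) ^ 18 = 1 / 2 ^ 18 * (κ * σ ^ 18) := by ring
      rw [e1, e2, e3, hk, ← add_mul]
      refine mul_le_mul_of_nonneg_right ?_ (by positivity)
      linarith

section Limits

variable {X : Type*} [TopologicalSpace X] {s : Set X} {F : ℕ → X → ℝ} {f : X → ℝ} {x : X} {C : ℝ}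

lemma exists_geometric_limit (hF : ∀ j, ContinuousOn (F j) s)
    (hc : ∀ j, ∀ x ∈ s, |F (j + 1) x - F j x| ≤ C * (1 / 2) ^ j) :
    ∃ f : X → ℝ, (∀ x ∈ s, Tendsto (fun j => F j x) atTop (𝓝 (f x))) ∧
      TendstoUniformlyOn F f atTop s ∧ ContinuousOn f s := by
  have hd : ∀ x ∈ s, ∀ j, dist (F j x) (F (j + 1) x) ≤ C * (1 / 2) ^ j := fun x hx j => by
    rw [dist_comm, Real.dist_eq]
    exact hc j x hx
  have hl : ∀ x, ∃ a, x ∈ s → Tendsto (fun j => F j x) atTop (𝓝 a) := fun x => by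
    by_cases hx : x ∈ s
    · obtain ⟨a, ha⟩ := cauchySeq_tendsto_of_complete
        (cauchySeq_of_le_geometric (1 / 2) C (by norm_num) (hd x hx))
      exact ⟨a, fun _ => ha⟩
    · exact ⟨0, fun h => absurd h hx⟩
  choose f hf using hl
  have hu : TendstoUniformlyOn F f atTop s := by
    rw [Metric.tendstoUniformlyOn_iff]
    intro δ hδ
    have ht : Tendsto (fun j : ℕ => C * (1 / 2 : ℝ) ^ j / (1 - 1 / 2)) atTop (𝓝 0) := by
      have := ((tendsto_pow_atTop_nhds_zero_of_lt_one (r := (1 / 2 : ℝ)) (by norm_num)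
        (by norm_num)).const_mul C).div_const (1 - 1 / 2)
      simpa using this
    filter_upwards [ht.eventually_lt_const hδ] with j hj x hx
    rw [dist_comm]
    exact (dist_le_of_le_geometric_of_tendsto (1 / 2) C (by norm_num) (hd x hx) (hf x hx) j).trans_lt hj
  exact ⟨f, hf, hu, hu.continuousOn (Frequently.of_forall hF)⟩

lemma joint_tendsto (hu : TendstoUniformlyOn F f atTop s) (hf : ContinuousOn f s) (hs : s ∈ 𝓝 x) :
    Tendsto (fun q : ℕ × X => F q.1 q.2) (atTop ×ˢ 𝓝 x) (𝓝 (f x)) := by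
  refine tendsto_comp_of_locally_uniform_limit (F := fun q : ℕ × X => F q.1) (g := fun q => q.2)
    (hf.continuousAt hs) tendsto_snd fun W hW => ⟨s, hs, ?_⟩
  exact (tendsto_fst (f := (atTop : Filter ℕ)) (g := 𝓝 x)).eventually (hu W hW)

lemma hasDerivAt_of_joint {f f' : ℕ → ℝ → ℝ} {g g' : ℝ → ℝ} {x : ℝ}
    (h' : Tendsto (fun q : ℕ × ℝ => f' q.1 q.2) (atTop ×ˢ 𝓝 x) (𝓝 (g' x)))
    (hc : ContinuousAt g' x) (hf : ∀ n, ∀ᶠ y in 𝓝 x, HasDerivAt (f n) (f' n y) y)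
    (hf2 : ∀ᶠ q : ℕ × ℝ in atTop ×ˢ 𝓝 x, HasDerivAt (f q.1) (f' q.1 q.2) q.2)
    (hfg : ∀ᶠ y in 𝓝 x, Tendsto (fun n => f n y) atTop (𝓝 (g y))) : HasDerivAt g (g' x) x := by
  refine hasDerivAt_of_tendstoUniformlyOnFilter (l := atTop) (f := f) (f' := f') ?_ hf2 hfg
  rw [tendstoUniformlyOnFilter_iff_tendsto]
  refine Tendsto.mono_right ?_ (nhds_le_uniformity (g' x))
  rw [nhds_prod_eq]
  exact (hc.tendsto.comp tendsto_snd).prodMk h'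

end Limits

/-- The limit Hamiltonian `k` together with an invariant torus `(x + βθ + u, v)` of rotation number
`β` for the Hamiltonian `k + l h`. -/
structure KamTorus (β ω η : ℝ) (k kt kh : ℝ → ℝ → ℝ → ℝ → ℝ) (l : ℝ → ℝ) (u v : ℝ → ℝ → ℝ → ℝ) :
    Prop where
  dt : ∀ y θ t h, |h| < 1 → HasDerivAt (fun t => k y θ t h) (kt y θ t h) t
  dh : ∀ y θ t h, |h| < 1 → HasDerivAt (fun h => k y θ t h) (kh y θ t h) h
  ckt : ContinuousOn (fun q : (ℝ × ℝ) × (ℝ × ℝ) => kt q.1.1 q.1.2 q.2.1 q.2.2) {q | |q.2.2| < 1}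
  ckh : ContinuousOn (fun q : (ℝ × ℝ) × (ℝ × ℝ) => kh q.1.1 q.1.2 q.2.1 q.2.2) {q | |q.2.2| < 1}
  bkt : ∀ y θ t h, |h| < 1 → |kt y θ t h| ≤ η
  bkh : ∀ y θ t h, |h| < 1 → |kh y θ t h - ω| ≤ η
  cl : Continuous l
  cu : Continuous (fun q : (ℝ × ℝ) × ℝ => u q.1.1 q.1.2 q.2)
  cv : Continuous (fun q : (ℝ × ℝ) × ℝ => v q.1.1 q.1.2 q.2)
  bu : ∀ y θ x, |u y θ x| ≤ η
  bv : ∀ y θ x, |v y θ x| ≤ η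
  lip : ∀ y θ x x', |u y θ x - u y θ x'| ≤ η * |x - x'|
  peru : ∀ y θ x, u y θ (x + 1) = u y θ x
  perv : ∀ y θ x, v y θ (x + 1) = v y θ x
  twu : ∀ y θ x, u y (θ + 1) x = u y θ (x + β)
  twv : ∀ y θ x, v y (θ + 1) x = v y θ (x + β)
  du : ∀ y θ x, HasDerivAt (fun θ => u y θ x) (kh y θ (x + β * θ + u y θ x) (v y θ x) + l y - β) θ
  dv : ∀ y θ x, HasDerivAt (fun θ => v y θ x) (-kt y θ (x + β * θ + u y θ x) (v y θ x)) θ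

/-- Real points of the domain of a Hamiltonian. -/
def rdom : Set ((ℝ × ℝ) × (ℝ × ℝ)) := {q | |q.2.2| < 1}

lemma isOpen_rdom : IsOpen rdom :=
  isOpen_lt (by fun_prop) continuous_const

lemma real_mem_dom {ρ r t h : ℝ} (hρ : 0 < ρ) (hh : |h| < r) : ((t : ℂ), (h : ℂ)) ∈ dom ρ r :=
  ⟨by simpa using hρ, by simpa using hρ, by simpa using hh⟩

/-- Restriction of a Hamiltonian to real arguments. -/
noncomputable def rre (K : ℝ → ℝ → ℂ × ℂ → ℂ) (q : (ℝ × ℝ) × (ℝ × ℝ)) : ℝ :=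
  (K q.1.1 q.1.2 (q.2.1, q.2.2)).re

lemma Ham.continuousOn_rre {ρ : ℝ} {K : ℝ → ℝ → ℂ × ℂ → ℂ} (h : Ham ρ 1 K) (hρ : 0 < ρ) :
    ContinuousOn (rre K) rdom :=
  continuous_re.comp_continuousOn (h.cont.comp
    (f := fun q : (ℝ × ℝ) × (ℝ × ℝ) => (q.1, ((q.2.1 : ℂ), (q.2.2 : ℂ))))
    (by fun_prop) fun _ hq => ⟨mem_univ _, real_mem_dom hρ hq⟩)

lemma abs_re_sub_le {z w : ℂ} {b : ℝ} (h : ‖z - w‖ ≤ b) : |z.re - w.re| ≤ b := by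
  rw [← sub_re]
  exact (abs_re_le_norm _).trans h

lemma PF.continuous_re {β σ : ℝ} {F : ℝ → ℝ → ℂ → ℂ} (h : PF β σ F) (hσ : 0 < σ) :
    Continuous fun q : (ℝ × ℝ) × ℝ => (F q.1.1 q.1.2 q.2).re :=
  Complex.continuous_re.comp (h.cont.comp_continuous
    (f := fun q : (ℝ × ℝ) × ℝ => (q.1, (q.2 : ℂ))) (by fun_prop)
    fun _ => ⟨mem_univ _, ofReal_mem_strip hσ _⟩)

lemma PF.lip_re {β σ b : ℝ} {F : ℝ → ℝ → ℂ → ℂ} (h : PF β σ F) (hσ : 0 < σ) (hb : Bd σ b (JumpingKAM.ds F))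
    (y θ x x' : ℝ) : |(F y θ x).re - (F y θ x').re| ≤ b * |x - x'| := by
  have h1 := Convex.norm_image_sub_le_of_norm_hasDerivWithin_le (s := univ) (C := b)
    (f := fun x : ℝ => (F y θ x).re) (f' := fun x : ℝ => (JumpingKAM.ds F y θ x).re) (x := x') (y := x)
    (fun z _ => ((h.hasDerivAt (ofReal_mem_strip hσ z)).real_of_complex).hasDerivWithinAt)
    (fun z _ => (abs_re_le_norm _).trans (hb y θ z (ofReal_mem_strip hσ z))) convex_univ
    (mem_univ _) (mem_univ _)
  simpa only [Real.norm_eq_abs] using h1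

/-- Existence of invariant tori, with a counterterm, for limits of rapidly convergent sequences of
analytic Hamiltonians. -/
theorem exists_kamTorus {γ η : ℝ} (hγ : 0 < γ) (hη : 0 < η) (hη4 : η ≤ 1 / 4) :
    ∃ ε > 0, ∀ (β ω : ℝ) (K : ℕ → ℝ → ℝ → ℂ × ℂ → ℂ), Dioph γ β → HamSeq ω ε K →
      ∃ k kt kh l u v, KamTorus β ω η k kt kh l u v ∧
        ∀ y θ t h : ℝ, |h| < 1 →
          Tendsto (fun j => (K j y θ (t, h)).re) atTop (𝓝 (k y θ t h)) := by
  obtain ⟨ε, hε, hεη, κ, hκ, hκ1, H⟩ := exists_stages hγ hη hη4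
  refine ⟨ε, hε, fun β ω K hβ hK => ?_⟩
  obtain ⟨S, -, hS⟩ := H β ω K hβ hK
  have hb := hK.bounds hε.le
  have q0 : ∀ j, 0 < (1 / 2 : ℝ) ^ j := fun j => by positivity
  have q1 : ∀ j, (1 / 2 : ℝ) ^ j ≤ 1 := fun j => pow_le_one₀ (by norm_num) (by norm_num)
  have hσ : ∀ j, 0 < (1 / 2 : ℝ) ^ j / 16 := fun j => by positivity
  have hH : ∀ j, Ham ((1 / 2) ^ j) 1 (K j) := fun j => (hK.ham j).mono le_rfl (by norm_num)
  have hpow : ∀ j, ε * (1 / 2 : ℝ) ^ (19 * j) ≤ ε * (1 / 2) ^ j := fun j =>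
    mul_le_mul_of_nonneg_left (half_pow_le (by omega)) hε.le
  have hpow' : ∀ j, 4 * ε * (1 / 2 : ℝ) ^ (18 * j) ≤ 4 * ε * (1 / 2) ^ j := fun j =>
    mul_le_mul_of_nonneg_left (half_pow_le (by omega)) (by positivity)
  obtain ⟨k, lk, -, -⟩ := exists_geometric_limit (s := rdom) (F := fun j => rre (K j)) (C := ε)
    (fun j => (hH j).continuousOn_rre (q0 j)) (fun j q hq => abs_re_sub_le
      ((hK.step j _ _ _ (real_mem_dom (q0 _) (lt_trans hq (by norm_num)))).trans (hpow j)))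
  obtain ⟨kt, lkt, ukt, ckt⟩ := exists_geometric_limit (s := rdom) (F := fun j => rre (pt (K j)))
    (C := 4 * ε) (fun j => ((hH j).pt (q0 j)).continuousOn_rre (q0 j)) (fun j q hq => abs_re_sub_le
      (((hb j).2 _ _ _ (real_mem_dom (q0 _) hq)).1.trans (hpow' j)))
  obtain ⟨kh, lkh, ukh, ckh⟩ := exists_geometric_limit (s := rdom) (F := fun j => rre (ph (K j)))
    (C := 4 * ε) (fun j => ((hH j).ph (q0 j)).continuousOn_rre (q0 j)) (fun j q hq => abs_re_sub_le
      (((hb j).2 _ _ _ (real_mem_dom (q0 _) hq)).2.trans (hpow' j)))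
  have hd : ∀ j, η * (1 / 2 : ℝ) ^ j / 4 = η / 4 * (1 / 2) ^ j := fun j => by ring
  have hστ : ∀ j, 0 < (1 / 2 : ℝ) ^ j / 16 / 2 := fun j => by positivity
  obtain ⟨l, ll, ul, cl⟩ := exists_geometric_limit (s := univ) (F := fun j => (S j).l) (C := η / 4)
    (fun j => ((hS j).1.approx.pfl).continuousOn) (fun j y _ => ((hS j).2.l y).trans_eq (hd j))
  obtain ⟨u, lu, uu, cu⟩ := exists_geometric_limit (s := univ)
    (F := fun j (q : (ℝ × ℝ) × ℝ) => ((S j).u q.1.1 q.1.2 q.2).re) (C := η / 4)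
    (fun j => ((hS j).1.approx.pfu.continuous_re (hσ j)).continuousOn)
    (fun j q _ => abs_re_sub_le
      (((hS j).2.u q.1.1 q.1.2 q.2 (ofReal_mem_strip (hστ j) _)).trans_eq (hd j)))
  obtain ⟨v, lv, uv, cv⟩ := exists_geometric_limit (s := univ)
    (F := fun j (q : (ℝ × ℝ) × ℝ) => ((S j).v q.1.1 q.1.2 q.2).re) (C := η / 4)
    (fun j => ((hS j).1.approx.pfv.continuous_re (hσ j)).continuousOn)
    (fun j q _ => abs_re_sub_le
      (((hS j).2.v q.1.1 q.1.2 q.2 (ofReal_mem_strip (hστ j) _)).trans_eq (hd j)))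
  rw [continuousOn_univ] at cl cu cv
  have hbb : ∀ j, η / 2 * (1 - (1 / 2 : ℝ) ^ j) ≤ η := fun j => by
    nlinarith [q0 j, q1 j]
  have bv : ∀ y θ x, |v ((y, θ), x)| ≤ η := fun y θ x =>
    le_of_tendsto (lv _ (mem_univ _)).abs (Eventually.of_forall fun j =>
      (abs_re_le_norm _).trans (((hS j).1.bv _ _ _ (ofReal_mem_strip (hσ j) _)).trans (hbb j)))
  have jl : ∀ y, Tendsto (fun j => (S j).l y) atTop (𝓝 (l y)) := fun y => ll y (mem_univ _)
  have ju : ∀ q, Tendsto (fun p : ℕ × ((ℝ × ℝ) × ℝ) => ((S p.1).u p.2.1.1 p.2.1.2 p.2.2).re)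
      (atTop ×ˢ 𝓝 q) (𝓝 (u q)) := fun q => joint_tendsto uu cu.continuousOn univ_mem
  have jv : ∀ q, Tendsto (fun p : ℕ × ((ℝ × ℝ) × ℝ) => ((S p.1).v p.2.1.1 p.2.1.2 p.2.2).re)
      (atTop ×ˢ 𝓝 q) (𝓝 (v q)) := fun q => joint_tendsto uv cv.continuousOn univ_mem
  have jkt : ∀ q ∈ rdom, Tendsto (fun p : ℕ × ((ℝ × ℝ) × (ℝ × ℝ)) => rre (pt (K p.1)) p.2)
      (atTop ×ˢ 𝓝 q) (𝓝 (kt q)) := fun q hq => joint_tendsto ukt ckt (isOpen_rdom.mem_nhds hq)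
  have jkh : ∀ q ∈ rdom, Tendsto (fun p : ℕ × ((ℝ × ℝ) × (ℝ × ℝ)) => rre (ph (K p.1)) p.2)
      (atTop ×ˢ 𝓝 q) (𝓝 (kh q)) := fun q hq => joint_tendsto ukh ckh (isOpen_rdom.mem_nhds hq)
  -- the curve in the space of arguments, at stage `j` and in the limit
  let Wj : ℕ → ℝ → ℝ → ℝ → (ℝ × ℝ) × (ℝ × ℝ) := fun j y θ x =>
    ((y, θ), (x + β * θ + ((S j).u y θ x).re, ((S j).v y θ x).re))
  let W : ℝ → ℝ → ℝ → (ℝ × ℝ) × (ℝ × ℝ) := fun y θ x =>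
    ((y, θ), (x + β * θ + u ((y, θ), x), v ((y, θ), x)))
  have hW : ∀ y θ x, W y θ x ∈ rdom := fun y θ x => lt_of_le_of_lt (bv y θ x) (by linarith)
  have cW : ∀ y x, Continuous fun θ => W y θ x := fun y x => by fun_prop
  have jW : ∀ y θ x, Tendsto (fun p : ℕ × ℝ => (p.1, Wj p.1 y p.2 x)) (atTop ×ˢ 𝓝 θ)
      (atTop ×ˢ 𝓝 (W y θ x)) := by
    intro y θ x
    have h1 : Tendsto (fun p : ℕ × ℝ => (p.1, ((y, p.2), x))) (atTop ×ˢ 𝓝 θ)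
        (atTop ×ˢ 𝓝 ((y, θ), x)) :=
      tendsto_fst.prodMk ((Continuous.tendsto (f := fun θ : ℝ => ((y, θ), x)) (by fun_prop) θ).comp
        tendsto_snd)
    have h2 := (ju _).comp h1
    have h3 := (jv _).comp h1
    have h4 : Tendsto (fun p : ℕ × ℝ => x + β * p.2) (atTop ×ˢ 𝓝 θ) (𝓝 (x + β * θ)) :=
      (Continuous.tendsto (f := fun θ : ℝ => x + β * θ) (by fun_prop) θ).comp tendsto_snd
    have h5 : Tendsto (fun p : ℕ × ℝ => (y, p.2)) (atTop ×ˢ 𝓝 θ) (𝓝 (y, θ)) :=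
      (Continuous.tendsto (f := fun θ : ℝ => (y, θ)) (by fun_prop) θ).comp tendsto_snd
    exact tendsto_fst.prodMk (h5.prodMk_nhds ((h4.add h2).prodMk_nhds h3))
  have hcomp : ∀ j y θ (x : ℝ) (L : ℝ → ℝ → ℂ × ℂ → ℂ),
      (comp β L (S j).u (S j).v y θ x).re = rre L (Wj j y θ x) := by
    intro j y θ x L
    simp only [comp, rre, Wj]
    rw [ofReal_add, ofReal_add, (hS j).1.approx.pfu.ofReal_re, (hS j).1.approx.pfv.ofReal_re]
  have hE : ∀ (E : Stage → ℝ → ℝ → ℂ → ℂ), (∀ j, Bd ((1 / 2) ^ j / 16)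
      (κ * ((1 / 2) ^ j / 16) ^ 18) (E (S j))) → ∀ y θ (x : ℝ),
      Tendsto (fun p : ℕ × ℝ => (E (S p.1) y p.2 x).re) (atTop ×ˢ 𝓝 θ) (𝓝 0) := by
    intro E hE y θ x
    have h0 : Tendsto (fun p : ℕ × ℝ => (1 / 2 : ℝ) ^ p.1) (atTop ×ˢ 𝓝 θ) (𝓝 0) :=
      (tendsto_pow_atTop_nhds_zero_of_lt_one (by norm_num) (by norm_num)).comp tendsto_fst
    refine squeeze_zero_norm (fun p => ?_) h0
    refine (abs_re_le_norm _).trans ((hE p.1 _ _ _ (ofReal_mem_strip (hσ _) _)).trans ?_)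
    have h1 := q0 p.1
    have h2 := q1 p.1
    have h3 : ((1 / 2 : ℝ) ^ p.1 / 16) ^ 18 ≤ (1 / 2 : ℝ) ^ p.1 / 16 := by
      simpa using pow_le_pow_of_le_one (hσ p.1).le (by linarith) (show 1 ≤ 18 by norm_num)
    nlinarith [mul_le_mul hκ1 h3 (by positivity) (by norm_num)]
  refine ⟨fun y θ t h => k ((y, θ), (t, h)), fun y θ t h => kt ((y, θ), (t, h)),
    fun y θ t h => kh ((y, θ), (t, h)), l, fun y θ x => u ((y, θ), x), fun y θ x => v ((y, θ), x),
    ⟨?_, ?_, ckt, ckh, ?_, ?_, cl, cu, cv, ?_, bv, ?_, ?_, ?_, ?_, ?_, ?_, ?_⟩,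
    fun y θ t h hh => lk ((y, θ), (t, h)) hh⟩
  · intro y θ t h hh
    have hc : Tendsto (fun t : ℝ => ((y, θ), (t, h))) (𝓝 t) (𝓝 ((y, θ), (t, h))) :=
      Continuous.tendsto (by fun_prop) t
    have hd : ∀ j (t : ℝ), HasDerivAt (fun t : ℝ => (K j y θ (t, h)).re) (rre (pt (K j)) ((y, θ), (t, h))) t := by
      intro j t
      have hm := real_mem_dom (t := t) (q0 j) hh
      have := (hH j).hasDerivAt_t (y := y) (θ := θ) hm
      rw [← (hH j).pt_eq hm] at this
      exact this.real_of_complex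
    refine hasDerivAt_of_joint (g' := fun t => kt ((y, θ), (t, h)))
      ((jkt _ hh).comp (tendsto_fst.prodMk (hc.comp tendsto_snd)))
      (((ckt _ hh).continuousAt (isOpen_rdom.mem_nhds hh)).tendsto.comp hc)
      (fun j => Eventually.of_forall fun t => hd j t) (Eventually.of_forall fun q => hd q.1 q.2)
      (Eventually.of_forall fun t => lk _ hh)
  · intro y θ t h hh
    have hc : Tendsto (fun h : ℝ => ((y, θ), (t, h))) (𝓝 h) (𝓝 ((y, θ), (t, h))) :=
      Continuous.tendsto (by fun_prop) h
    have hd : ∀ j (h : ℝ), |h| < 1 →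
        HasDerivAt (fun h : ℝ => (K j y θ (t, h)).re) (rre (ph (K j)) ((y, θ), (t, h))) h := by
      intro j h hh
      have hm := real_mem_dom (t := t) (q0 j) hh
      have := (hH j).hasDerivAt_h (y := y) (θ := θ) hm
      rw [← (hH j).ph_eq hm] at this
      exact this.real_of_complex
    have ho : ∀ᶠ h' : ℝ in 𝓝 h, |h'| < 1 :=
      (isOpen_lt continuous_abs continuous_const).mem_nhds hh
    refine hasDerivAt_of_joint (g' := fun h => kh ((y, θ), (t, h)))
      ((jkh _ hh).comp (tendsto_fst.prodMk (hc.comp tendsto_snd)))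
      (((ckh _ hh).continuousAt (isOpen_rdom.mem_nhds hh)).tendsto.comp hc)
      (fun j => ho.mono fun h hh => hd j h hh)
      ((tendsto_snd.eventually ho).mono fun q hq => hd q.1 q.2 hq)
      (ho.mono fun h hh => lk ((y, θ), (t, h)) hh)
  · intro y θ t h hh
    exact le_of_tendsto (lkt ((y, θ), (t, h)) hh).abs (Eventually.of_forall fun j =>
      (abs_re_le_norm _).trans (((hb j).1 _ _ _ (real_mem_dom (q0 _) hh)).1.trans hεη))
  · intro y θ t h hh
    refine le_of_tendsto ((lkh ((y, θ), (t, h)) hh).sub_const ω).abs (Eventually.of_forall fun j => ?_)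
    have := abs_re_sub_le (w := (ω : ℂ)) ((hb j).1 y θ _ (real_mem_dom (t := t) (q0 _) hh)).2.1
    exact this.trans hεη
  · exact fun y θ x => le_of_tendsto (lu ((y, θ), x) (mem_univ _)).abs (Eventually.of_forall fun j =>
      (abs_re_le_norm _).trans (((hS j).1.bu _ _ _ (ofReal_mem_strip (hσ j) _)).trans (hbb j)))
  · intro y θ x x'
    refine le_of_tendsto ((lu ((y, θ), x) (mem_univ _)).sub (lu ((y, θ), x') (mem_univ _))).abs
      (Eventually.of_forall fun j => ((hS j).1.approx.pfu.lip_re (hσ j) (hS j).1.bdu y θ x x').trans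
        (mul_le_mul_of_nonneg_right (hbb j) (abs_nonneg _)))
  · intro y θ x
    refine tendsto_nhds_unique (lu ((y, θ), x + 1) (mem_univ _))
      ((lu ((y, θ), x) (mem_univ _)).congr fun j => ?_)
    have := (hS j).1.approx.pfu.per y θ x (ofReal_mem_strip (hσ j) _)
    simp [← this]
  · intro y θ x
    refine tendsto_nhds_unique (lv ((y, θ), x + 1) (mem_univ _))
      ((lv ((y, θ), x) (mem_univ _)).congr fun j => ?_)
    have := (hS j).1.approx.pfv.per y θ x (ofReal_mem_strip (hσ j) _)
    simp [← this]
  · intro y θ x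
    refine tendsto_nhds_unique (lu ((y, θ + 1), x) (mem_univ _))
      ((lu ((y, θ), x + β) (mem_univ _)).congr fun j => ?_)
    have := (hS j).1.approx.pfu.tw y θ x (ofReal_mem_strip (hσ j) _)
    simp [this]
  · intro y θ x
    refine tendsto_nhds_unique (lv ((y, θ + 1), x) (mem_univ _))
      ((lv ((y, θ), x + β) (mem_univ _)).congr fun j => ?_)
    have := (hS j).1.approx.pfv.tw y θ x (ofReal_mem_strip (hσ j) _)
    simp [this]
  · intro y θ x
    have hd : ∀ j θ, HasDerivAt (fun θ => ((S j).u y θ x).re) (rre (ph (K j)) (Wj j y θ x) +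
        ((S j).l y - β) + ((S j).E₁ y θ x).re) θ := by
      intro j θ
      have h1 := (hS j).1.approx.dtu y θ x (ofReal_mem_strip (hσ j) _)
      have h2 := reCLM.hasFDerivAt.comp_hasDerivAt θ h1
      refine h2.congr_deriv ?_
      rw [reCLM_apply, add_re, add_re, hcomp, ofReal_re]
    have hlim : Tendsto (fun p : ℕ × ℝ => rre (ph (K p.1)) (Wj p.1 y p.2 x) +
        ((S p.1).l y - β) + ((S p.1).E₁ y p.2 x).re) (atTop ×ˢ 𝓝 θ)
        (𝓝 (kh (W y θ x) + (l y - β) + 0)) :=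
      ((((jkh _ (hW y θ x)).comp (jW y θ x))).add (((jl y).comp tendsto_fst).sub_const β)).add
        (hE Stage.E₁ (fun j => (hS j).1.be₁) y θ x)
    rw [add_zero, ← add_sub_assoc] at hlim
    refine hasDerivAt_of_joint (g' := fun θ => kh (W y θ x) + l y - β) hlim ?_
      (fun j => Eventually.of_forall fun θ => hd j θ) (Eventually.of_forall fun q => hd q.1 q.2)
      (Eventually.of_forall fun θ => lu _ (mem_univ _))
    exact (((ckh.comp_continuous (cW y x) (fun θ => hW y θ x)).add continuous_const).sub
      continuous_const).continuousAt
  · intro y θ x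
    have hd : ∀ j θ, HasDerivAt (fun θ => ((S j).v y θ x).re) (-rre (pt (K j)) (Wj j y θ x) +
        ((S j).E₂ y θ x).re) θ := by
      intro j θ
      have h1 := (hS j).1.approx.dtv y θ x (ofReal_mem_strip (hσ j) _)
      have h2 := reCLM.hasFDerivAt.comp_hasDerivAt θ h1
      refine h2.congr_deriv ?_
      rw [reCLM_apply, add_re, neg_re, hcomp]
    have hlim : Tendsto (fun p : ℕ × ℝ => -rre (pt (K p.1)) (Wj p.1 y p.2 x) +
        ((S p.1).E₂ y p.2 x).re) (atTop ×ˢ 𝓝 θ) (𝓝 (-kt (W y θ x) + 0)) :=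
      ((jkt _ (hW y θ x)).comp (jW y θ x)).neg.add (hE Stage.E₂ (fun j => (hS j).1.be₂) y θ x)
    rw [add_zero] at hlim
    refine hasDerivAt_of_joint (g' := fun θ => -kt (W y θ x)) hlim ?_
      (fun j => Eventually.of_forall fun θ => hd j θ) (Eventually.of_forall fun q => hd q.1 q.2)
      (Eventually.of_forall fun θ => lv _ (mem_univ _))
    exact (ckt.comp_continuous (cW y x) (fun θ => hW y θ x)).neg.continuousAt

lemma hasDerivAt_ee_neg (m : ℤ) (x : ℝ) :
    HasDerivAt (fun x : ℝ => ee (-(m * (x : ℂ)))) (-(2 * Real.pi * I * m) * ee (-(m * (x : ℂ)))) x := by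
  have h : HasDerivAt (fun x : ℝ => 2 * Real.pi * I * (-(m * (x : ℂ)))) (-(2 * Real.pi * I * m)) x := by
    have := ((hasDerivAt_id x).ofReal_comp).const_mul (-(2 * Real.pi * I * m))
    simp only [id, ofReal_one, mul_one] at this
    rwa [show (fun x : ℝ => 2 * Real.pi * I * (-(m * (x : ℂ)))) =
      fun y : ℝ => -(2 * Real.pi * I * m) * (y : ℂ) by funext y; ring]
  have := h.cexp
  unfold ee
  convert this using 1
  ring

lemma norm_ee_neg_int_mul (m : ℤ) (x : ℝ) : ‖ee (-(m * (x : ℂ)))‖ = 1 := by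
  rw [norm_ee]; simp

/-- Decay of the Fourier coefficients of a smooth periodic function. -/
lemma norm_fourier_le (n : ℕ) : ∀ {g : ℝ → ℝ} {B : ℝ}, ContDiff ℝ n g → (∀ x, g (x + 1) = g x) →
    (∀ x, |iteratedDeriv n g x| ≤ B) → ∀ {m : ℤ}, m ≠ 0 →
    ‖∫ x in (0 : ℝ)..1, (g x : ℂ) * ee (-(m * (x : ℂ)))‖ ≤ B / |(m : ℝ)| ^ n := by
  induction n with
  | zero =>
    intro g B _ _ hb m _
    have := intervalIntegral.norm_integral_le_of_norm_le_const (a := (0 : ℝ)) (b := 1) (C := B)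
      (f := fun x : ℝ => (g x : ℂ) * ee (-(m * (x : ℂ)))) fun x _ => by
        rw [norm_mul, norm_ee_neg_int_mul, mul_one, norm_real]
        simpa using hb x
    simpa using this
  | succ n ih =>
    intro g B hg hper hb m hm
    have hd : ∀ x, HasDerivAt g (deriv g x) x := fun x =>
      (hg.differentiable (by simp) x).hasDerivAt
    have hg' : ContDiff ℝ n (deriv g) := by
      have := contDiff_succ_iff_deriv.1 (by exact_mod_cast hg : ContDiff ℝ ((n : WithTop ℕ∞) + 1) g)
      exact this.2.2
    have hper' : ∀ x, deriv g (x + 1) = deriv g x := fun x => by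
      rw [← deriv_comp_add_const]; congr 1; ext x; exact hper x
    have hc : (2 * Real.pi * I * m : ℂ) ≠ 0 := by
      have : (m : ℂ) ≠ 0 := by exact_mod_cast hm
      simp [Real.pi_ne_zero, this]
    have hparts := intervalIntegral.integral_mul_deriv_eq_deriv_mul (a := (0 : ℝ)) (b := 1)
      (u := fun x => (g x : ℂ)) (v := fun x : ℝ => ee (-(m * (x : ℂ))))
      (u' := fun x => ((deriv g x : ℝ) : ℂ)) (v' := fun x : ℝ => -(2 * Real.pi * I * m) * ee (-(m * (x : ℂ))))
      (fun x _ => (hd x).ofReal_comp) (fun x _ => hasDerivAt_ee_neg m x)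
      (Continuous.intervalIntegrable (continuous_ofReal.comp hg'.continuous) _ _)
      (Continuous.intervalIntegrable (continuous_const.mul (continuous_ee.comp (by fun_prop))) _ _)
    have h1 : ee (-(m * ((1 : ℝ) : ℂ))) = ee (-(m * ((0 : ℝ) : ℂ))) := by
      have := ee_int (-m)
      push_cast at this ⊢
      simp only [mul_one, mul_zero, neg_zero]
      rw [this]; simp [ee]
    have h2 : g 1 = g 0 := by simpa using hper 0
    simp only [h1, h2, sub_self, zero_sub] at hparts
    have hI : ∫ x in (0 : ℝ)..1, (g x : ℂ) * ee (-(m * (x : ℂ))) =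
        (2 * Real.pi * I * m)⁻¹ * ∫ x in (0 : ℝ)..1, ((deriv g x : ℝ) : ℂ) * ee (-(m * (x : ℂ))) := by
      rw [eq_inv_mul_iff_mul_eq₀ hc, ← neg_inj, ← hparts, ← intervalIntegral.integral_const_mul,
        ← intervalIntegral.integral_neg]
      refine intervalIntegral.integral_congr fun x _ => ?_
      ring
    have := ih (B := B) hg' hper' (fun x => by rw [← iteratedDeriv_succ']; exact hb x) hm
    have hm' : 1 ≤ |(m : ℝ)| := by exact_mod_cast Int.one_le_abs hm
    rw [hI, norm_mul, norm_inv, pow_succ', div_mul_eq_div_div, div_right_comm, inv_mul_eq_div]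
    have hn : |(m : ℝ)| ≤ ‖(2 * Real.pi * I * m : ℂ)‖ := by
      simp only [norm_mul, norm_I, mul_one, Complex.norm_intCast, Complex.norm_ofNat, norm_real,
        Real.norm_eq_abs, abs_of_pos Real.pi_pos]
      nlinarith [Real.pi_gt_three]
    have h0 := (norm_nonneg _).trans this
    gcongr

/-- Smooth families of functions on the two-torus with small derivatives of order `21`. -/
structure TorusFamily (ε : ℝ) (Γ : ℝ → ℝ → ℝ → ℝ → ℝ) : Prop where
  cont : Continuous (fun q : (ℝ × ℝ) × (ℝ × ℝ) => Γ q.1.1 q.1.2 q.2.1 q.2.2)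
  perθ : ∀ y θ t w, Γ y (θ + 1) t w = Γ y θ t w
  pert : ∀ y θ t w, Γ y θ (t + 1) w = Γ y θ t w
  perw : ∀ y θ t w, Γ y θ t (w + 1) = Γ y θ t w
  smt : ∀ y θ w, ContDiff ℝ 21 (fun t => Γ y θ t w)
  smw : ∀ y θ t, ContDiff ℝ 21 (fun w => Γ y θ t w)
  bd : ∀ y θ t w, |Γ y θ t w| ≤ ε
  bdt : ∀ y θ w t, |iteratedDeriv 21 (fun t => Γ y θ t w) t| ≤ ε
  bdw : ∀ y θ t w, |iteratedDeriv 21 (fun w => Γ y θ t w) w| ≤ ε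

/-- Double Fourier coefficients. -/
noncomputable def coef (Γ : ℝ → ℝ → ℝ → ℝ → ℝ) (n l : ℤ) (y θ : ℝ) : ℂ :=
  ∫ w in (0 : ℝ)..1, (∫ t in (0 : ℝ)..1, (Γ y θ t w : ℂ) * ee (-(n * (t : ℂ)))) * ee (-(l * (w : ℂ)))

variable {ε : ℝ} {Γ : ℝ → ℝ → ℝ → ℝ → ℝ}

/-- The weight `max (|n|, 1)`. -/
noncomputable def wt (n : ℤ) : ℝ := max |(n : ℝ)| 1

lemma one_le_wt (n : ℤ) : 1 ≤ wt n := le_max_right _ _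

lemma wt_pos (n : ℤ) : 0 < wt n := one_pos.trans_le (one_le_wt n)

lemma abs_le_wt (n : ℤ) : |(n : ℝ)| ≤ wt n := le_max_left _ _

lemma wt_eq {n : ℤ} (hn : n ≠ 0) : wt n = |(n : ℝ)| :=
  max_eq_left (by exact_mod_cast Int.one_le_abs hn)

lemma summable_wt : Summable fun n : ℤ => 1 / wt n ^ 2 := by
  have h : Summable fun n : ℤ => 1 / |(n : ℝ)| ^ 2 := by
    simpa using (Real.summable_one_div_int_pow (p := 2)).2 one_lt_two
  refine (h.add (summable_of_finite_support (f := fun n : ℤ => if n = 0 then (1 : ℝ) else 0)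
    ((finite_singleton 0).subset fun n hn => by
      by_contra h0; exact hn (if_neg h0)))).of_nonneg_of_le
    (fun n => by have := wt_pos n; positivity) fun n => ?_
  by_cases hn : n = 0
  · subst hn; simp [wt]
  · simp [hn, wt_eq hn]

namespace TorusFamily

lemma nonneg (h : TorusFamily ε Γ) : 0 ≤ ε := (abs_nonneg _).trans (h.bd 0 0 0 0)

lemma continuous_inner (h : TorusFamily ε Γ) (n : ℤ) :
    Continuous fun q : (ℝ × ℝ) × ℝ => ∫ t in (0 : ℝ)..1, (Γ q.1.1 q.1.2 t q.2 : ℂ) * ee (-(n * (t : ℂ))) := by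
  refine intervalIntegral.continuous_parametric_intervalIntegral_of_continuous'
    (f := fun (q : (ℝ × ℝ) × ℝ) (t : ℝ) => (Γ q.1.1 q.1.2 t q.2 : ℂ) * ee (-(n * (t : ℂ)))) ?_ 0 1
  refine Continuous.mul (continuous_ofReal.comp (h.cont.comp
    (f := fun s : ((ℝ × ℝ) × ℝ) × ℝ => (s.1.1, (s.2, s.1.2))) (by fun_prop)))
    (continuous_ee.comp (by fun_prop))

lemma continuous_coef (h : TorusFamily ε Γ) (n l : ℤ) :
    Continuous fun q : ℝ × ℝ => coef Γ n l q.1 q.2 := by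
  refine intervalIntegral.continuous_parametric_intervalIntegral_of_continuous'
    (f := fun (q : ℝ × ℝ) (w : ℝ) => (∫ t in (0 : ℝ)..1, (Γ q.1 q.2 t w : ℂ) * ee (-(n * (t : ℂ)))) *
      ee (-(l * (w : ℂ)))) ?_ 0 1
  exact (h.continuous_inner n).mul (continuous_ee.comp (by fun_prop))

lemma inner_le (h : TorusFamily ε Γ) (n : ℤ) (y θ w : ℝ) :
    ‖∫ t in (0 : ℝ)..1, (Γ y θ t w : ℂ) * ee (-(n * (t : ℂ)))‖ ≤ ε / wt n ^ 21 := by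
  by_cases hn : n = 0
  · subst hn
    have := intervalIntegral.norm_integral_le_of_norm_le_const (a := (0 : ℝ)) (b := 1) (C := ε)
      (f := fun t : ℝ => (Γ y θ t w : ℂ) * ee (-((0 : ℤ) * (t : ℂ)))) fun x _ => by
        rw [norm_mul, norm_ee_neg_int_mul, mul_one, norm_real]; exact h.bd _ _ _ _
    simpa [wt] using this
  · rw [wt_eq hn]
    exact norm_fourier_le 21 (g := fun t => Γ y θ t w) (h.smt y θ w) (fun t => h.pert y θ t w)
      (h.bdt y θ w) hn

lemma inner_le' (h : TorusFamily ε Γ) (l : ℤ) (y θ t : ℝ) :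
    ‖∫ w in (0 : ℝ)..1, (Γ y θ t w : ℂ) * ee (-(l * (w : ℂ)))‖ ≤ ε / wt l ^ 21 := by
  by_cases hn : l = 0
  · subst hn
    have := intervalIntegral.norm_integral_le_of_norm_le_const (a := (0 : ℝ)) (b := 1) (C := ε)
      (f := fun w : ℝ => (Γ y θ t w : ℂ) * ee (-((0 : ℤ) * (w : ℂ)))) fun x _ => by
        rw [norm_mul, norm_ee_neg_int_mul, mul_one, norm_real]; exact h.bd _ _ _ _
    simpa [wt] using this
  · rw [wt_eq hn]
    exact norm_fourier_le 21 (g := fun w => Γ y θ t w) (h.smw y θ t) (fun w => h.perw y θ t w)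
      (h.bdw y θ t) hn

lemma coef_le (h : TorusFamily ε Γ) (n l : ℤ) (y θ : ℝ) : ‖coef Γ n l y θ‖ ≤ ε / wt n ^ 21 := by
  have := intervalIntegral.norm_integral_le_of_norm_le_const (a := (0 : ℝ)) (b := 1) (C := ε / wt n ^ 21)
      (f := fun w : ℝ => (∫ t in (0 : ℝ)..1, (Γ y θ t w : ℂ) * ee (-(n * (t : ℂ)))) *
        ee (-(l * (w : ℂ)))) fun x _ => by
        rw [norm_mul, norm_ee_neg_int_mul, mul_one]; exact h.inner_le _ _ _ _
  simpa [coef] using this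

lemma coef_le' (h : TorusFamily ε Γ) (n l : ℤ) (y θ : ℝ) : ‖coef Γ n l y θ‖ ≤ ε / wt l ^ 21 := by
  have hsw : coef Γ n l y θ = ∫ t in (0 : ℝ)..1, ∫ w in (0 : ℝ)..1,
      (Γ y θ t w : ℂ) * ee (-(n * (t : ℂ))) * ee (-(l * (w : ℂ))) := by
    unfold coef
    simp only [← intervalIntegral.integral_mul_const]
    refine intervalIntegral_intervalIntegral_swap
      (F := fun w t : ℝ => (Γ y θ t w : ℂ) * ee (-(n * (t : ℂ))) * ee (-(l * (w : ℂ)))) ?_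
    refine (Continuous.integrableOn_Icc (a := ((0, 0) : ℝ × ℝ)) (b := (1, 1)) ?_).mono_set ?_
    · exact ((continuous_ofReal.comp (h.cont.comp
        (f := fun s : ℝ × ℝ => ((y, θ), (s.2, s.1))) (by fun_prop))).mul
        (continuous_ee.comp (by fun_prop))).mul (continuous_ee.comp (by fun_prop))
    · rw [uIoc_of_le zero_le_one, ← Icc_prod_Icc]
      exact prod_mono Ioc_subset_Icc_self Ioc_subset_Icc_self
  have := intervalIntegral.norm_integral_le_of_norm_le_const (a := (0 : ℝ)) (b := 1) (C := ε / wt l ^ 21)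
      (f := fun t : ℝ => ∫ w in (0 : ℝ)..1,
      (Γ y θ t w : ℂ) * ee (-(n * (t : ℂ))) * ee (-(l * (w : ℂ)))) fun t _ => by
        have : ∫ w in (0 : ℝ)..1, (Γ y θ t w : ℂ) * ee (-(n * (t : ℂ))) * ee (-(l * (w : ℂ))) =
            ee (-(n * (t : ℂ))) * ∫ w in (0 : ℝ)..1, (Γ y θ t w : ℂ) * ee (-(l * (w : ℂ))) := by
          rw [← intervalIntegral.integral_const_mul]
          congr 1; ext w; ring
        rw [this, norm_mul, norm_ee_neg_int_mul, one_mul]; exact h.inner_le' _ _ _ _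
  rw [hsw]
  simpa using this

/-- Joint decay of the double Fourier coefficients. -/
lemma coef_decay (h : TorusFamily ε Γ) (n l : ℤ) (y θ : ℝ) :
    ‖coef Γ n l y θ‖ * (wt n + wt l) ≤ 2 * ε * ((1 / wt n ^ 2) * (1 / wt l ^ 2)) := by
  have hn := one_le_wt n
  have hl := one_le_wt l
  have hε := h.nonneg
  have key : ∀ a b c : ℝ, 1 ≤ a → a ≤ b → c ≤ ε / b ^ 21 → 0 ≤ c →
      c * (a + b) ≤ 2 * ε * ((1 / a ^ 2) * (1 / b ^ 2)) := by
    intro a b c ha hab hc hc0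
    have hb : 1 ≤ b := ha.trans hab
    rw [le_div_iff₀ (by positivity)] at hc
    rw [one_div_mul_one_div, mul_one_div, le_div_iff₀ (by positivity)]
    have h1 : a ^ 2 ≤ b ^ 2 := by gcongr
    have h2 : b ^ 5 ≤ b ^ 21 := pow_le_pow_right₀ hb (by norm_num)
    calc c * (a + b) * (a ^ 2 * b ^ 2) ≤ c * (b + b) * (b ^ 2 * b ^ 2) := by gcongr
      _ = 2 * (c * b ^ 5) := by ring
      _ ≤ 2 * (c * b ^ 21) := by gcongr
      _ ≤ 2 * ε := by linarith
  rcases le_total (wt n) (wt l) with hnl | hnl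
  · exact key _ _ _ hn hnl (h.coef_le' n l y θ) (norm_nonneg _)
  · have := key _ _ _ hl hnl (h.coef_le n l y θ) (norm_nonneg _)
    rw [add_comm (wt n), mul_comm (1 / wt n ^ 2)]
    exact this

lemma summable_wt_prod : Summable fun m : ℤ × ℤ => (1 / wt m.1 ^ 2) * (1 / wt m.2 ^ 2) :=
  summable_wt.mul_of_nonneg summable_wt (fun n => by have := wt_pos n; positivity)
    (fun n => by have := wt_pos n; positivity)

lemma coef_le_prod (h : TorusFamily ε Γ) (n l : ℤ) (y θ : ℝ) :
    ‖coef Γ n l y θ‖ ≤ 2 * ε * ((1 / wt n ^ 2) * (1 / wt l ^ 2)) := by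
  refine le_trans ?_ (h.coef_decay n l y θ)
  have := one_le_wt n
  have := one_le_wt l
  exact le_mul_of_one_le_right (norm_nonneg _) (by linarith)

lemma norm_ee_real (x : ℝ) : ‖ee (x : ℂ)‖ = 1 := by rw [norm_ee]; simp

/-- Double Fourier inversion. -/
lemma hasSum_coef (h : TorusFamily ε Γ) (y θ t w : ℝ) :
    HasSum (fun m : ℤ × ℤ => coef Γ m.1 m.2 y θ * ee (m.1 * (t : ℂ)) * ee (m.2 * (w : ℂ)))
      (Γ y θ t w) := by
  have hε := h.nonneg
  have hs : Summable fun m : ℤ × ℤ => coef Γ m.1 m.2 y θ * ee (m.1 * (t : ℂ)) * ee (m.2 * (w : ℂ)) := by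
    refine (summable_wt_prod.mul_left (2 * ε)).of_norm_bounded fun m => ?_
    rw [norm_mul, norm_mul]
    have h1 := norm_ee_real (m.1 * t)
    have h2 := norm_ee_real (m.2 * w)
    push_cast at h1 h2
    rw [h1, h2, mul_one, mul_one]
    exact h.coef_le_prod _ _ _ _
  have hin : ∀ n : ℤ, HasSum (fun l : ℤ => coef Γ n l y θ * ee (n * (t : ℂ)) * ee (l * (w : ℂ)))
      ((∫ t in (0 : ℝ)..1, (Γ y θ t w : ℂ) * ee (-(n * (t : ℂ)))) * ee (n * (t : ℂ))) := by
    intro n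
    have hsl : Summable fun l : ℤ => coef Γ n l y θ := by
      refine ((summable_wt.mul_left ((2 * ε) * (1 / wt n ^ 2)))).of_norm_bounded fun l => ?_
      rw [mul_assoc]
      exact h.coef_le_prod _ _ _ _
    have := hasSum_fourier (g := fun w => ∫ t in (0 : ℝ)..1, (Γ y θ t w : ℂ) * ee (-(n * (t : ℂ))))
      ((h.continuous_inner n).comp (f := fun w : ℝ => ((y, θ), w)) (by fun_prop))
      (fun w => by simp only [h.perw]) hsl w
    have := this.mul_right (ee (n * (t : ℂ)))
    rwa [show (fun l : ℤ => coef Γ n l y θ * ee (n * (t : ℂ)) * ee (l * (w : ℂ))) = _ from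
      funext fun l => mul_right_comm _ _ _]
  have hout : HasSum (fun n : ℤ => (∫ t in (0 : ℝ)..1, (Γ y θ t w : ℂ) * ee (-(n * (t : ℂ)))) *
      ee (n * (t : ℂ))) (Γ y θ t w : ℂ) := by
    refine hasSum_fourier (g := fun t => (Γ y θ t w : ℂ)) ?_ (fun t => by simp only [h.pert]) ?_ t
    · exact continuous_ofReal.comp (h.cont.comp (f := fun t : ℝ => ((y, θ), (t, w))) (by fun_prop))
    · refine (summable_wt.mul_left ε).of_norm_bounded fun n => (h.inner_le n y θ w).trans ?_
      have := one_le_wt n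
      rw [mul_one_div]
      have : wt n ^ 2 ≤ wt n ^ 21 := pow_le_pow_right₀ this (by norm_num)
      have := wt_pos n
      gcongr
  have h2 := hs.hasSum.prod_fiberwise hin
  rw [hout.unique h2]
  exact hs.hasSum

end TorusFamily

lemma ee_conj (z : ℂ) : (starRingEnd ℂ) (ee z) = ee (-(starRingEnd ℂ) z) := by
  unfold ee
  rw [← exp_conj]
  congr 1
  simp only [map_mul, conj_I, conj_ofReal, map_ofNat]
  ring

/-- A real trigonometric monomial. -/
noncomputable def mono (c φ : ℂ) : ℂ := (c * ee φ + (starRingEnd ℂ) c * ee (-φ)) / 2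

/-- The bound `e^{6π}` for exponentials on the relevant strips. -/
noncomputable def expBd : ℝ := Real.exp (6 * Real.pi)

lemma expBd_pos : 0 < expBd := Real.exp_pos _

lemma norm_ee_le_expBd {φ : ℂ} (h : |φ.im| ≤ 3) : ‖ee φ‖ ≤ expBd := by
  rw [norm_ee]
  apply Real.exp_le_exp.2
  have := (abs_le.1 h).1
  nlinarith [Real.pi_pos]

lemma norm_mono_le {c φ : ℂ} (h : |φ.im| ≤ 3) : ‖mono c φ‖ ≤ ‖c‖ * expBd := by
  unfold mono
  rw [norm_div, Complex.norm_ofNat, div_le_iff₀ two_pos]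
  refine (norm_add_le _ _).trans ?_
  rw [norm_mul, norm_mul, RCLike.norm_conj]
  have h1 := norm_ee_le_expBd h
  have h2 := norm_ee_le_expBd (φ := -φ) (by simpa using h)
  have := norm_nonneg c
  nlinarith

lemma hasDerivAt_ee (z : ℂ) : HasDerivAt ee (2 * Real.pi * I * ee z) z := by
  unfold ee
  have := ((hasDerivAt_id z).const_mul (2 * Real.pi * I)).cexp
  simp only [id, mul_one] at this
  rwa [mul_comm (cexp _)] at this

lemma norm_ee_sub_le {φ ψ : ℂ} (h : |φ.im| ≤ 3) (h' : |ψ.im| ≤ 3) :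
    ‖ee φ - ee ψ‖ ≤ 2 * Real.pi * expBd * ‖φ - ψ‖ := by
  have hconv : Convex ℝ {z : ℂ | |z.im| ≤ 3} := by
    have : {z : ℂ | |z.im| ≤ 3} = Complex.imLm ⁻¹' (Icc (-3) 3) := by
      ext z; simp [abs_le]
    rw [this]
    exact (convex_Icc _ _).linear_preimage _
  refine hconv.norm_image_sub_le_of_norm_hasDerivWithin_le
    (f' := fun z => 2 * Real.pi * I * ee z) (fun z _ => (hasDerivAt_ee z).hasDerivWithinAt)
    (fun z hz => ?_) h' h
  simp only [norm_mul, norm_I, mul_one, Complex.norm_ofNat, norm_real, Real.norm_eq_abs,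
    abs_of_pos Real.pi_pos]
  have := norm_ee_le_expBd hz
  have := Real.pi_pos
  gcongr

lemma norm_mono_sub_le {c φ ψ : ℂ} (h : |φ.im| ≤ 3) (h' : |ψ.im| ≤ 3) :
    ‖mono c φ - mono c ψ‖ ≤ ‖c‖ * (2 * Real.pi * expBd * ‖φ - ψ‖) := by
  have e : mono c φ - mono c ψ =
      (c * (ee φ - ee ψ) + (starRingEnd ℂ) c * (ee (-φ) - ee (-ψ))) / 2 := by
    unfold mono; ring
  rw [e, norm_div, Complex.norm_ofNat, div_le_iff₀ two_pos]
  refine (norm_add_le _ _).trans ?_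
  rw [norm_mul, norm_mul, RCLike.norm_conj]
  have h1 := norm_ee_sub_le h h'
  have h2 := norm_ee_sub_le (φ := -φ) (ψ := -ψ) (by simpa using h) (by simpa using h')
  rw [neg_sub_neg, norm_sub_rev ψ] at h2
  have := norm_nonneg c
  nlinarith

lemma mono_im {c φ : ℂ} (h : φ.im = 0) : (mono c φ).im = 0 := by
  have hφ : (starRingEnd ℂ) φ = φ := conj_eq_iff_im.2 h
  apply conj_eq_iff_im.1
  unfold mono
  simp only [map_div₀, map_add, map_mul, ee_conj, conj_conj, hφ, map_neg, neg_neg, map_ofNat]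
  ring

lemma analyticAt_ee (z : ℂ) : AnalyticAt ℂ ee z :=
  differentiable_ee.analyticAt z

/-- Frequencies up to `M`. -/
noncomputable def box (M : ℕ) : Finset (ℤ × ℤ) := Finset.Icc (-(M : ℤ)) M ×ˢ Finset.Icc (-(M : ℤ)) M

lemma mem_box {M : ℕ} {m : ℤ × ℤ} : m ∈ box M ↔ |m.1| ≤ M ∧ |m.2| ≤ M := by
  simp [box, abs_le]

lemma box_mono : Monotone box := fun M N h m => by
  have : (M : ℤ) ≤ N := by exact_mod_cast h
  rw [mem_box, mem_box]
  exact fun hm => ⟨hm.1.trans this, hm.2.trans this⟩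

lemma card_box (M : ℕ) : ((box M).card : ℝ) = (2 * M + 1) ^ 2 := by
  have : (Finset.Icc (-(M : ℤ)) M).card = 2 * M + 1 := by simp; omega
  rw [box, Finset.card_product, this]; push_cast; ring

/-- The phase of a monomial. -/
noncomputable def phase (m : ℤ × ℤ) (t w : ℂ) : ℂ := m.1 * t + m.2 * w

lemma abs_phase_im_le {M : ℕ} {m : ℤ × ℤ} (hm : m ∈ box M) {σ : ℝ} (hσ : M * σ ≤ 1)
    {t w : ℂ} (ht : |t.im| ≤ σ) (hw : |w.im| ≤ 2 * σ) : |(phase m t w).im| ≤ 3 := by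
  have h := mem_box.1 hm
  have h1 : |(m.1 : ℝ)| ≤ M := by exact_mod_cast h.1
  have h2 : |(m.2 : ℝ)| ≤ M := by exact_mod_cast h.2
  have e : (phase m t w).im = m.1 * t.im + m.2 * w.im := by simp [phase]
  rw [e]
  refine (abs_add_le _ _).trans ?_
  rw [abs_mul, abs_mul]
  have hσ0 := (abs_nonneg _).trans ht
  have : |(m.1 : ℝ)| * |t.im| ≤ M * σ := by gcongr
  have : |(m.2 : ℝ)| * |w.im| ≤ M * (2 * σ) := by gcongr
  linarith

/-- Trigonometric truncation of a family of functions on the torus. -/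
noncomputable def trunc (Γ : ℝ → ℝ → ℝ → ℝ → ℝ) (M : ℕ) (y θ : ℝ) (t w : ℂ) : ℂ :=
  ∑ m ∈ box M, mono (coef Γ m.1 m.2 y θ) (phase m t w)

/-- The sum of the weights. -/
noncomputable def wtSum : ℝ := ∑' m : ℤ × ℤ, (1 / wt m.1 ^ 2) * (1 / wt m.2 ^ 2)

lemma wtSum_nonneg : 0 ≤ wtSum := tsum_nonneg fun m => by
  have := wt_pos m.1; have := wt_pos m.2; positivity

namespace TorusFamily

variable {ε : ℝ} {Γ : ℝ → ℝ → ℝ → ℝ → ℝ}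

lemma sum_decay (h : TorusFamily ε Γ) (s : Finset (ℤ × ℤ)) (y θ : ℝ) :
    ∑ m ∈ s, ‖coef Γ m.1 m.2 y θ‖ * (wt m.1 + wt m.2) ≤ 2 * ε * wtSum := by
  refine (Finset.sum_le_sum fun m _ => h.coef_decay m.1 m.2 y θ).trans ?_
  rw [← Finset.mul_sum]
  have := summable_wt_prod.sum_le_tsum s fun m _ => by
    have := wt_pos m.1; have := wt_pos m.2; positivity
  have := h.nonneg
  unfold wtSum
  gcongr

lemma norm_trunc_le (h : TorusFamily ε Γ) {M : ℕ} {σ : ℝ} (hσ : M * σ ≤ 1) (y θ : ℝ)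
    {t w : ℂ} (ht : |t.im| ≤ σ) (hw : |w.im| ≤ 2 * σ) :
    ‖trunc Γ M y θ t w‖ ≤ 2 * expBd * wtSum * ε := by
  refine (norm_sum_le _ _).trans ?_
  have : ∀ m ∈ box M, ‖mono (coef Γ m.1 m.2 y θ) (phase m t w)‖ ≤
      expBd * (‖coef Γ m.1 m.2 y θ‖ * (wt m.1 + wt m.2)) := fun m hm => by
    refine (norm_mono_le (abs_phase_im_le hm hσ ht hw)).trans ?_
    rw [mul_comm]
    have := one_le_wt m.1
    have := wt_pos m.2
    have := expBd_pos
    gcongr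
    exact le_mul_of_one_le_right (norm_nonneg _) (by linarith)
  refine (Finset.sum_le_sum this).trans ?_
  rw [← Finset.mul_sum]
  have := h.sum_decay (box M) y θ
  have := expBd_pos
  nlinarith

lemma norm_trunc_sub_le (h : TorusFamily ε Γ) {M : ℕ} {σ : ℝ} (hσ : M * σ ≤ 1) (y θ : ℝ)
    {t w t' w' : ℂ} (ht : |t.im| ≤ σ) (hw : |w.im| ≤ 2 * σ) (ht' : |t'.im| ≤ σ)
    (hw' : |w'.im| ≤ 2 * σ) {d : ℝ} (h1 : ‖t - t'‖ ≤ d) (h2 : ‖w - w'‖ ≤ d) :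
    ‖trunc Γ M y θ t w - trunc Γ M y θ t' w'‖ ≤ 4 * Real.pi * expBd * wtSum * ε * d := by
  unfold trunc
  rw [← Finset.sum_sub_distrib]
  refine (norm_sum_le _ _).trans ?_
  have hd := (norm_nonneg _).trans h1
  have : ∀ m ∈ box M, ‖mono (coef Γ m.1 m.2 y θ) (phase m t w) -
      mono (coef Γ m.1 m.2 y θ) (phase m t' w')‖ ≤
      2 * Real.pi * expBd * d * (‖coef Γ m.1 m.2 y θ‖ * (wt m.1 + wt m.2)) := fun m hm => by
    refine (norm_mono_sub_le (abs_phase_im_le hm hσ ht hw) (abs_phase_im_le hm hσ ht' hw')).trans ?_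
    have e : ‖phase m t w - phase m t' w'‖ ≤ (wt m.1 + wt m.2) * d := by
      have : phase m t w - phase m t' w' = m.1 * (t - t') + m.2 * (w - w') := by
        unfold phase; ring
      rw [this, add_mul]
      refine (norm_add_le _ _).trans ?_
      rw [norm_mul, norm_mul, Complex.norm_intCast, Complex.norm_intCast]
      have := abs_le_wt m.1
      have := abs_le_wt m.2
      have := (wt_pos m.1).le
      have := (wt_pos m.2).le
      gcongr
    have := expBd_pos
    have := Real.pi_pos
    calc _ ≤ ‖coef Γ m.1 m.2 y θ‖ * (2 * Real.pi * expBd * ((wt m.1 + wt m.2) * d)) := by gcongr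
      _ = _ := by ring
  refine (Finset.sum_le_sum this).trans ?_
  rw [← Finset.mul_sum]
  have h3 := h.sum_decay (box M) y θ
  have := expBd_pos
  have := Real.pi_pos
  have h4 : 0 ≤ 2 * Real.pi * expBd * d := by positivity
  nlinarith [mul_le_mul_of_nonneg_left h3 h4]

lemma trunc_im (M : ℕ) (y θ : ℝ) {t w : ℂ} (ht : t.im = 0) (hw : w.im = 0) :
    (trunc Γ M y θ t w).im = 0 := by
  unfold trunc
  rw [im_sum]
  exact Finset.sum_eq_zero fun m _ => mono_im (by simp [phase, ht, hw])

lemma abs_trunc_im_le (h : TorusFamily ε Γ) {M : ℕ} {σ : ℝ} (hσ : M * σ ≤ 1) (y θ : ℝ)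
    {t w : ℂ} (ht : |t.im| ≤ σ) (hw : |w.im| ≤ 2 * σ) :
    |(trunc Γ M y θ t w).im| ≤ 8 * Real.pi * expBd * wtSum * ε * σ := by
  have hσ0 := (abs_nonneg _).trans ht
  have him : ∀ z : ℂ, ‖z - (z.re : ℂ)‖ = |z.im| := fun z => by
    have : z - (z.re : ℂ) = z.im * I := by apply Complex.ext <;> simp
    rw [this]; simp
  have key := h.norm_trunc_sub_le hσ y θ ht hw (t' := (t.re : ℂ)) (w' := (w.re : ℂ))
    (by simpa using hσ0) (by simpa using hσ0) (d := 2 * σ) (by rw [him]; linarith)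
    (by rw [him]; exact hw)
  have := (abs_im_le_norm _).trans key
  rw [sub_im, trunc_im (Γ := Γ) M y θ (ofReal_im _) (ofReal_im _), sub_zero] at this
  linarith

lemma norm_trunc_succ_sub_le (h : TorusFamily ε Γ) {j : ℕ} {σ : ℝ} (hσ : 2 ^ (j + 1) * σ ≤ 1)
    (y θ : ℝ) {t w : ℂ} (ht : |t.im| ≤ σ) (hw : |w.im| ≤ 2 * σ) :
    ‖trunc Γ (2 ^ (j + 1)) y θ t w - trunc Γ (2 ^ j) y θ t w‖ ≤
      25 * expBd * ε * (1 / 2) ^ (19 * j) := by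
  have hε := h.nonneg
  have hE := expBd_pos
  have hsub : box (2 ^ j) ⊆ box (2 ^ (j + 1)) := box_mono (Nat.pow_le_pow_right two_pos (by omega))
  unfold trunc
  rw [← Finset.sum_sdiff hsub, add_sub_cancel_right]
  have hterm : ∀ m ∈ box (2 ^ (j + 1)) \ box (2 ^ j),
      ‖mono (coef Γ m.1 m.2 y θ) (phase m t w)‖ ≤ ε / (2 ^ j) ^ 21 * expBd := fun m hm => by
    rw [Finset.mem_sdiff] at hm
    refine (norm_mono_le (abs_phase_im_le hm.1 (by exact_mod_cast hσ) ht hw)).trans ?_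
    gcongr
    have h2 := hm.2
    rw [mem_box, not_and_or, not_le, not_le] at h2
    have hp : (0 : ℝ) < 2 ^ j := by positivity
    rcases h2 with h2 | h2
    · have : (2 : ℝ) ^ j ≤ |(m.1 : ℝ)| := by exact_mod_cast h2.le
      have := this.trans (abs_le_wt m.1)
      refine (h.coef_le _ _ _ _).trans ?_
      gcongr
    · have : (2 : ℝ) ^ j ≤ |(m.2 : ℝ)| := by exact_mod_cast h2.le
      have := this.trans (abs_le_wt m.2)
      refine (h.coef_le' _ _ _ _).trans ?_
      gcongr
  refine (norm_sum_le_of_le _ hterm).trans ?_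
  rw [Finset.sum_const, nsmul_eq_mul]
  have hcard : ((box (2 ^ (j + 1)) \ box (2 ^ j)).card : ℝ) ≤ 25 * (2 ^ j) ^ 2 := by
    have h1 : ((box (2 ^ (j + 1)) \ box (2 ^ j)).card : ℝ) ≤ (box (2 ^ (j + 1))).card := by
      exact_mod_cast Finset.card_le_card Finset.sdiff_subset
    refine h1.trans ?_
    rw [card_box]
    have : (1 : ℝ) ≤ 2 ^ j := one_le_pow₀ one_le_two
    push_cast
    rw [pow_succ (2 : ℝ) j]
    nlinarith
  have hp : (0 : ℝ) < 2 ^ j := by positivity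
  calc _ ≤ 25 * (2 ^ j) ^ 2 * (ε / (2 ^ j) ^ 21 * expBd) := by gcongr
    _ = _ := by
      rw [one_div, inv_pow, mul_comm 19 j, pow_mul]
      field_simp

lemma tendsto_box : Tendsto (fun j : ℕ => box (2 ^ j)) atTop atTop := by
  refine tendsto_atTop_finset_of_monotone
    (fun i j h => box_mono (Nat.pow_le_pow_right two_pos h)) fun m => ?_
  obtain ⟨j, hj⟩ := pow_unbounded_of_one_lt (max |m.1| |m.2|) (one_lt_two (α := ℤ))
  refine ⟨j, mem_box.2 ⟨?_, ?_⟩⟩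
  · push_cast; exact (le_max_left _ _).trans hj.le
  · push_cast; exact (le_max_right _ _).trans hj.le

lemma tendsto_trunc (h : TorusFamily ε Γ) (y θ t w : ℝ) :
    Tendsto (fun j : ℕ => trunc Γ (2 ^ j) y θ t w) atTop (𝓝 (Γ y θ t w)) := by
  have h1 := h.hasSum_coef y θ t w
  have h2 : HasSum _ _ := (h1.map (starRingEnd ℂ) Complex.continuous_conj)
  have h3 := (h1.add h2).mul_right (1 / 2)
  have h4 : ((Γ y θ t w : ℂ) + (starRingEnd ℂ) (Γ y θ t w : ℂ)) * (1 / 2) = Γ y θ t w := by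
    rw [conj_ofReal]; ring
  rw [h4] at h3
  refine (h3.comp tendsto_box).congr fun j => ?_
  unfold trunc
  refine Finset.sum_congr rfl fun m _ => ?_
  have h5 : (starRingEnd ℂ) (phase m t w) = phase m t w := by simp [phase]
  have h6 : ee (m.1 * (t : ℂ)) * ee (m.2 * (w : ℂ)) = ee (phase m t w) := by
    rw [phase, ee_add]
  simp only [Function.comp_apply, mul_assoc, h6, mono, map_mul, ee_conj, h5]
  ring

end TorusFamily

/-- A complex square containing all action values. -/
def square : Set ℂ := {z | |z.re| < 3 ∧ |z.im| < 3}

/-- Real analytic, `1`-Lipschitz changes of the action variable. -/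
structure ActionMap (W : ℝ → ℂ → ℂ) : Prop where
  cont : ContinuousOn (fun q : ℝ × ℂ => W q.1 q.2) (univ ×ˢ square)
  ana : ∀ y, AnalyticOnNhd ℂ (W y) square
  real : ∀ y, ∀ x : ℝ, |x| < 3 → (W y x).im = 0
  lip : ∀ y, ∀ z ∈ square, ∀ z' ∈ square, ‖W y z - W y z'‖ ≤ ‖z - z'‖

lemma ActionMap.abs_im_le {W : ℝ → ℂ → ℂ} (hW : ActionMap W) (y : ℝ) {z : ℂ} (hz : z ∈ square) :
    |(W y z).im| ≤ |z.im| := by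
  have h1 : ((z.re : ℝ) : ℂ) ∈ square := ⟨by simpa using hz.1, by simp⟩
  have h := hW.lip y z hz _ h1
  have e : z - (z.re : ℂ) = z.im * I := by apply Complex.ext <;> simp
  have h2 := (abs_im_le_norm _).trans h
  rw [sub_im, hW.real y _ hz.1, sub_zero, e] at h2
  simpa using h2

/-- Picard approximations of the implicit equation `I = h + Γ(t, W I)` with truncated `Γ`. -/
noncomputable def picard (Γ : ℝ → ℝ → ℝ → ℝ → ℝ) (W : ℝ → ℂ → ℂ) :
    ℕ → ℝ → ℝ → ℂ × ℂ → ℂ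
  | 0 => fun _ _ z => z.2
  | j + 1 => fun y θ z => z.2 + trunc Γ (2 ^ (j + 1)) y θ z.1 (W y (picard Γ W j y θ z))

variable {ε : ℝ} {Γ : ℝ → ℝ → ℝ → ℝ → ℝ} {W : ℝ → ℂ → ℂ}

/-- The smallness condition under which the Picard approximations stay under control. -/
def Small (ε : ℝ) : Prop := 8 * Real.pi * expBd * wtSum * ε ≤ (1 / 2) ^ 20 ∧ 0 ≤ ε

lemma Small.size (h : Small ε) : 2 * expBd * wtSum * ε ≤ 1 / 2 := by
  have h0 : 0 ≤ expBd * wtSum * ε :=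
    mul_nonneg (mul_nonneg expBd_pos.le wtSum_nonneg) h.2
  have := h.1
  nlinarith [Real.pi_gt_three]

lemma picard_bounds (h : TorusFamily ε Γ) (hW : ActionMap W) (hε : Small ε) (y θ : ℝ) :
    ∀ j : ℕ, ∀ {σ : ℝ}, 0 < σ → 2 ^ j * σ ≤ 1 → ∀ {z : ℂ × ℂ}, z ∈ dom σ 2 →
    ‖picard Γ W j y θ z - z.2‖ ≤ 2 * expBd * wtSum * ε ∧ |(picard Γ W j y θ z).im| ≤ 2 * σ ∧
      picard Γ W j y θ z ∈ square := by
  intro j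
  have hs := hε.size
  have h0 : 0 ≤ 2 * expBd * wtSum * ε := by
    have := mul_nonneg (mul_nonneg expBd_pos.le wtSum_nonneg) hε.2
    nlinarith
  induction j with
  | zero =>
    intro σ hσ hσ1 z hz
    simp only [pow_zero, one_mul] at hσ1
    refine ⟨by simpa [picard] using h0, ?_, ?_⟩
    · simp only [picard]; linarith [hz.2.1]
    · exact ⟨by simp only [picard]; linarith [hz.2.2], by simp only [picard]; linarith [hz.2.1]⟩
  | succ j ih =>
    intro σ hσ hσ1 z hz
    have hσ2 : 2 ^ j * σ ≤ 1 := by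
      refine le_trans ?_ hσ1
      gcongr
      · norm_num
      · omega
    have hσ3 : ((2 ^ (j + 1) : ℕ) : ℝ) * σ ≤ 1 := by exact_mod_cast hσ1
    have hσ4 : σ ≤ 1 := by
      refine le_trans ?_ hσ1
      exact le_mul_of_one_le_left hσ.le (one_le_pow₀ one_le_two)
    obtain ⟨-, h2, h3⟩ := ih hσ hσ2 hz
    have hw := (hW.abs_im_le y h3).trans h2
    have h4 := h.norm_trunc_le hσ3 y θ hz.1.le hw
    have h5 := h.abs_trunc_im_le hσ3 y θ hz.1.le hw
    have e : picard Γ W (j + 1) y θ z - z.2 =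
        trunc Γ (2 ^ (j + 1)) y θ z.1 (W y (picard Γ W j y θ z)) := by
      simp only [picard]; ring
    have h6 : |(picard Γ W (j + 1) y θ z).im| ≤ 2 * σ := by
      simp only [picard, add_im]
      refine (abs_add_le _ _).trans ?_
      have h7 : 8 * Real.pi * expBd * wtSum * ε ≤ 1 := hε.1.trans (by norm_num)
      have := hz.2.1
      nlinarith
    refine ⟨by rw [e]; exact h4, h6, ?_, by linarith⟩
    have h8 := (abs_re_le_norm _).trans (h4.trans hs)
    rw [← e, sub_re] at h8
    have := hz.2.2
    have := abs_sub_abs_le_abs_sub (picard Γ W (j + 1) y θ z).re z.2.re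
    linarith

lemma half_pow_mul (j : ℕ) : (2 : ℝ) ^ j * (1 / 2) ^ j ≤ 1 := by
  rw [← mul_pow]; norm_num

lemma phase_add_one (m : ℤ × ℤ) (t w : ℂ) : phase m (t + 1) w = phase m t w + m.1 := by
  unfold phase; ring

lemma mono_add_int (c φ : ℂ) (n : ℤ) : mono c (φ + n) = mono c φ := by
  have h1 : ee (φ + n) = ee φ := by rw [ee_add, ee_int, mul_one]
  have h2 : ee (-(φ + n)) = ee (-φ) := by
    have := ee_int (-n)
    push_cast at this
    rw [neg_add, ee_add, this, mul_one]
  rw [mono, h1, h2, mono]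

lemma trunc_add_one (M : ℕ) (y θ : ℝ) (t w : ℂ) : trunc Γ M y θ (t + 1) w = trunc Γ M y θ t w := by
  unfold trunc
  exact Finset.sum_congr rfl fun m _ => by rw [phase_add_one, mono_add_int]

lemma TorusFamily.trunc_period (h : TorusFamily ε Γ) (M : ℕ) (y θ : ℝ) (t w : ℂ) :
    trunc Γ M y (θ + 1) t w = trunc Γ M y θ t w := by
  unfold trunc coef
  simp only [h.perθ]

lemma TorusFamily.continuous_trunc (h : TorusFamily ε Γ) (M : ℕ) :
    Continuous fun q : (ℝ × ℝ) × (ℂ × ℂ) => trunc Γ M q.1.1 q.1.2 q.2.1 q.2.2 := by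
  unfold trunc mono phase
  refine continuous_finsetSum _ fun m _ => ?_
  have := (h.continuous_coef m.1 m.2).comp (f := fun q : (ℝ × ℝ) × (ℂ × ℂ) => q.1) (by fun_prop)
  simp only [Function.comp_def] at this
  have e := continuous_ee
  exact ((this.mul (e.comp (by fun_prop))).add
    ((Complex.continuous_conj.comp this).mul (e.comp (by fun_prop)))).div_const _

lemma dom_subset {σ σ' r : ℝ} (h : σ ≤ σ') : dom σ r ⊆ dom σ' r := fun _ hz =>
  ⟨hz.1.trans_le h, hz.2.1.trans_le h, hz.2.2⟩

lemma half_pow_succ_le (j : ℕ) : ((1 : ℝ) / 2) ^ (j + 1) ≤ (1 / 2) ^ j :=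
  pow_le_pow_of_le_one (by norm_num) (by norm_num) (by omega)

lemma isOpen_square : IsOpen square := by
  have h1 : IsOpen {z : ℂ | |z.re| < 3} := isOpen_lt (by fun_prop) continuous_const
  have h2 : IsOpen {z : ℂ | |z.im| < 3} := isOpen_lt (by fun_prop) continuous_const
  exact h1.inter h2

/-- The Picard approximations are admissible Hamiltonians. -/
lemma ham_picard (h : TorusFamily ε Γ) (hW : ActionMap W) (hε : Small ε) (j : ℕ) :
    Ham ((1 / 2) ^ j) 2 (picard Γ W j) := by
  induction j with
  | zero =>
    exact ⟨by simp only [picard]; fun_prop, fun y θ z _ => by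
      simp only [picard]; exact analyticAt_snd, fun _ _ _ _ => rfl, fun _ _ _ _ => rfl, fun y θ t x _ => by
      simp [picard]⟩
  | succ j ih =>
    have hsub : dom ((1 / 2) ^ (j + 1)) 2 ⊆ dom ((1 / 2) ^ j) 2 := dom_subset (half_pow_succ_le j)
    have hmem : ∀ y θ, ∀ z ∈ dom ((1 / 2) ^ j) 2, picard Γ W j y θ z ∈ square := fun y θ z hz =>
      (picard_bounds h hW hε y θ j (by positivity) (half_pow_mul j) hz).2.2
    refine ⟨?_, ?_, ?_, ?_, ?_⟩
    · simp only [picard]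
      have h1 : ContinuousOn (fun q : (ℝ × ℝ) × (ℂ × ℂ) => W q.1.1 (picard Γ W j q.1.1 q.1.2 q.2))
          (univ ×ˢ dom ((1 / 2) ^ (j + 1)) 2) :=
        hW.cont.comp (f := fun q : (ℝ × ℝ) × (ℂ × ℂ) => (q.1.1, picard Γ W j q.1.1 q.1.2 q.2))
          ((by fun_prop : Continuous fun q : (ℝ × ℝ) × (ℂ × ℂ) => q.1.1).continuousOn.prodMk
            (ih.cont.mono (prod_mono_right hsub)))
          fun q hq => ⟨mem_univ _, hmem _ _ _ (hsub hq.2)⟩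
      refine ContinuousOn.add (by fun_prop) ?_
      exact (h.continuous_trunc (2 ^ (j + 1))).comp_continuousOn
        (f := fun q : (ℝ × ℝ) × (ℂ × ℂ) => (q.1, (q.2.1, W q.1.1 (picard Γ W j q.1.1 q.1.2 q.2))))
        (ContinuousOn.prodMk (by fun_prop) (ContinuousOn.prodMk (by fun_prop) h1))
    · intro y θ
      have h1 : DifferentiableOn ℂ (W y) square := (hW.ana y).differentiableOn
      have h2 : DifferentiableOn ℂ (fun z => W y (picard Γ W j y θ z)) (dom ((1 / 2) ^ (j + 1)) 2) :=
        h1.comp ((ih.ana y θ).differentiableOn.mono hsub) fun z hz => hmem _ _ _ (hsub hz)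
      intro z hz
      have hz1 := hsub hz
      have a1 : AnalyticAt ℂ (fun z => W y (picard Γ W j y θ z)) z :=
        (hW.ana y _ (hmem y θ z hz1)).comp (ih.ana y θ z hz1)
      simp only [picard]
      refine AnalyticAt.add analyticAt_snd ?_
      unfold trunc mono phase
      refine Finset.analyticAt_fun_sum _ fun m _ => ?_
      have a2 : AnalyticAt ℂ (fun z : ℂ × ℂ => (m.1 : ℂ) * z.1 + m.2 * W y (picard Γ W j y θ z)) z :=
        (analyticAt_const.mul analyticAt_fst).add (analyticAt_const.mul a1)
      have a3 := AnalyticAt.fun_comp (g := ee) (analyticAt_ee _) a2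
      have a4 := AnalyticAt.fun_comp (g := ee) (analyticAt_ee _) a2.neg
      exact ((analyticAt_const.mul a3).add (analyticAt_const.mul a4)).div analyticAt_const two_ne_zero
    · intro y θ z hz
      simp only [picard, trunc_add_one, ih.per y θ z (hsub hz)]
    · intro y θ z hz
      simp only [picard, h.trunc_period, ih.pert y θ z (hsub hz)]
    · intro y θ t x hx
      have h1 : (picard Γ W j y θ (t, x)) = ((picard Γ W j y θ (t, x)).re : ℂ) := by
        apply Complex.ext
        · simp
        · simpa using ih.real y θ t x hx
      have h2 := (hmem y θ (t, x) (real_mem_dom (by positivity) hx)).1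
      simp only [picard, add_im, ofReal_im, zero_add]
      refine TorusFamily.trunc_im _ _ _ (ofReal_im _) ?_
      rw [h1]
      exact hW.real y _ h2

lemma picard_step (h : TorusFamily ε Γ) (hW : ActionMap W) (hε : Small ε) (y θ : ℝ) (j : ℕ)
    {z : ℂ × ℂ} (hz : z ∈ dom ((1 / 2) ^ (j + 1)) 2) :
    ‖picard Γ W (j + 1) y θ z - picard Γ W j y θ z‖ ≤
      (2 * wtSum + 50) * expBd * ε * (1 / 2) ^ (19 * j) := by
  have hE := expBd_pos
  have hS := wtSum_nonneg
  have hε0 := hε.2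
  induction j generalizing z with
  | zero =>
    have := (picard_bounds h hW hε y θ 1 (by positivity) (by norm_num) hz).1
    simp only [picard] at this ⊢
    refine this.trans ?_
    simp only [mul_zero, pow_zero, mul_one]
    have : 0 ≤ expBd * ε := by positivity
    nlinarith
  | succ j ih =>
    have hz' := dom_subset (half_pow_succ_le (j + 1)) hz
    have hsum := half_pow_mul (j + 1 + 1)
    have hp : (0 : ℝ) < (1 / 2) ^ (j + 1 + 1) := by positivity
    have hM1 : (2 : ℝ) ^ (j + 1) * (1 / 2) ^ (j + 1 + 1) ≤ 1 := by
      refine le_trans ?_ hsum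
      gcongr
      · norm_num
      · omega
    have hM0 : (2 : ℝ) ^ j * (1 / 2) ^ (j + 1 + 1) ≤ 1 := by
      refine le_trans ?_ hM1
      gcongr
      · norm_num
      · omega
    obtain ⟨-, b1, c1⟩ := picard_bounds h hW hε y θ (j + 1) hp hM1 hz
    obtain ⟨-, b0, c0⟩ := picard_bounds h hW hε y θ j hp hM0 hz
    have w1 := (hW.abs_im_le y c1).trans b1
    have w0 := (hW.abs_im_le y c0).trans b0
    have hd := ih hz'
    have hl := (hW.lip y _ c1 _ c0).trans hd
    have hdn := (norm_nonneg _).trans hd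
    have t1 := h.norm_trunc_succ_sub_le (j := j + 1) hsum y θ hz.1.le w1
    have t2 := h.norm_trunc_sub_le (M := 2 ^ (j + 1)) (by exact_mod_cast hM1) y θ hz.1.le w1 hz.1.le w0
      (by simpa using hdn) hl
    have e : picard Γ W (j + 1 + 1) y θ z - picard Γ W (j + 1) y θ z =
        (trunc Γ (2 ^ (j + 1 + 1)) y θ z.1 (W y (picard Γ W (j + 1) y θ z)) -
          trunc Γ (2 ^ (j + 1)) y θ z.1 (W y (picard Γ W (j + 1) y θ z))) +
        (trunc Γ (2 ^ (j + 1)) y θ z.1 (W y (picard Γ W (j + 1) y θ z)) -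
          trunc Γ (2 ^ (j + 1)) y θ z.1 (W y (picard Γ W j y θ z))) := by
      rw [picard, picard]; ring
    rw [e]
    refine (norm_add_le _ _).trans ((add_le_add t1 t2).trans ?_)
    have hsm := hε.1
    have e1 : ((1 : ℝ) / 2) ^ (19 * (j + 1)) = (1 / 2) ^ (19 * j) * (1 / 2) ^ 19 := by
      rw [← pow_add]; congr 1
    rw [e1]
    set b : ℝ := (1 / 2) ^ (19 * j) with hb
    have hb0 : 0 < b := by positivity
    set X := (2 * wtSum + 50) * expBd * ε with hX
    have hX1 : 50 * expBd * ε ≤ X := by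
      have : 0 ≤ 2 * wtSum * expBd * ε := by positivity
      rw [hX]; nlinarith
    have : 4 * Real.pi * expBd * wtSum * ε * (X * b) ≤ (1 / 2) ^ 21 * (X * b) := by
      refine mul_le_mul_of_nonneg_right ?_ hdn
      norm_num at hsm ⊢
      linarith
    have h25 : 25 * expBd * ε * (b * (1 / 2) ^ 19) ≤ X / 2 * (b * (1 / 2) ^ 19) := by
      gcongr; linarith
    norm_num at this h25 ⊢
    nlinarith

lemma exists_small {ε₁ ω : ℝ} (hε₁ : 0 < ε₁) (hω : 0 < ω) : ∃ ε > 0, ∀ ε' : ℝ, 0 ≤ ε' → ε' ≤ ε → Small ε' ∧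
    ω * ((2 * wtSum + 50) * expBd * ε') ≤ ε₁ := by
  have hE := expBd_pos
  have hS := wtSum_nonneg
  have hpi := Real.pi_pos
  refine ⟨min ((1 / 2) ^ 20 / (8 * Real.pi * expBd * (wtSum + 1)))
    (ε₁ / (ω * ((2 * wtSum + 50) * expBd))), by positivity, fun ε' h0 h => ⟨⟨?_, h0⟩, ?_⟩⟩
  · have := h.trans (min_le_left _ _)
    rw [le_div_iff₀ (by positivity)] at this
    refine le_trans ?_ this
    have : 0 ≤ Real.pi * expBd * ε' := by positivity
    nlinarith
  · have := h.trans (min_le_right _ _)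
    rw [le_div_iff₀ (by positivity)] at this
    linarith

lemma hamSeq_picard (h : TorusFamily ε Γ) (hW : ActionMap W) (hε : Small ε) {ω ε₁ : ℝ} (hω : 0 < ω)
    (hε₁ : ω * ((2 * wtSum + 50) * expBd * ε) ≤ ε₁) :
    HamSeq ω ε₁ (fun j y θ z => ω * picard Γ W j y θ z) := by
  have h0 : 0 ≤ ε₁ := by
    refine le_trans ?_ hε₁
    have := wtSum_nonneg
    have := expBd_pos
    have := hε.2
    positivity
  refine ⟨fun j => ?_, fun y θ z _ => by simpa [picard] using h0, fun j y θ z hz => ?_⟩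
  · have := ham_picard h hW hε j
    exact ⟨continuousOn_const.mul this.cont, fun y θ => analyticOnNhd_const.mul (this.ana y θ),
      fun y θ z hz => by simp only [this.per y θ z hz], fun y θ z hz => by simp only [this.pert y θ z hz],
      fun y θ t x hx => by rw [im_ofReal_mul, this.real y θ t x hx, mul_zero]⟩
  · rw [← mul_sub, norm_mul, norm_real, Real.norm_eq_abs, abs_of_pos hω]
    refine (mul_le_mul_of_nonneg_left (picard_step h hW hε y θ j hz) hω.le).trans ?_
    rw [← mul_assoc]
    gcongr

/-- The limit of the Picard approximations solves the implicit equation. -/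
lemma picard_limit (h : TorusFamily ε Γ) (hW : ActionMap W) (hε : Small ε) {y θ t x A : ℝ}
    (hx : |x| < 1) (hA : Tendsto (fun j => (picard Γ W j y θ (t, x)).re) atTop (𝓝 A)) :
    |A - x| ≤ 1 / 2 ∧ A = x + Γ y θ t (W y A).re := by
  have hmem : ∀ σ > 0, ((t : ℂ), (x : ℂ)) ∈ dom σ 2 := fun σ hσ => real_mem_dom hσ (by linarith)
  have hre : ∀ j, picard Γ W j y θ (t, x) = ((picard Γ W j y θ (t, x)).re : ℂ) := fun j => by
    apply Complex.ext
    · simp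
    · simpa using (ham_picard h hW hε j).real y θ t x (by linarith)
  have hsz : ∀ j, |(picard Γ W j y θ (t, x)).re - x| ≤ 1 / 2 := fun j => by
    have := (picard_bounds h hW hε y θ j (by positivity) (half_pow_mul j) (hmem _ (by positivity))).1
    have := (abs_re_le_norm _).trans (this.trans hε.size)
    simpa using this
  have hA1 : |A - x| ≤ 1 / 2 :=
    le_of_tendsto (hA.sub_const x).abs (Eventually.of_forall hsz)
  have hA3 : |A| < 3 := by
    have := abs_sub_abs_le_abs_sub A x
    linarith
  refine ⟨hA1, ?_⟩
  have hAs : (A : ℂ) ∈ square := ⟨by simpa using hA3, by simp⟩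
  set w : ℝ := (W y A).re with hw
  have hwA : W y A = (w : ℂ) := by
    apply Complex.ext
    · simp [hw]
    · simpa using hW.real y A hA3
  have h1 := (h.tendsto_trunc y θ t w).comp (tendsto_add_atTop_nat 1)
  have h2 : Tendsto (fun j => picard Γ W (j + 1) y θ (t, x) - x - trunc Γ (2 ^ (j + 1)) y θ t w)
      atTop (𝓝 0) := by
    have hd : Tendsto (fun j => 4 * Real.pi * expBd * wtSum * ε *
        |(picard Γ W j y θ (t, x)).re - A|) atTop (𝓝 0) := by
      have := ((hA.sub_const A).abs).const_mul (4 * Real.pi * expBd * wtSum * ε)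
      simpa using this
    refine squeeze_zero_norm (fun j => ?_) hd
    have e : picard Γ W (j + 1) y θ (t, x) - x - trunc Γ (2 ^ (j + 1)) y θ t w =
        trunc Γ (2 ^ (j + 1)) y θ t (W y (picard Γ W j y θ (t, x))) -
          trunc Γ (2 ^ (j + 1)) y θ t (W y A) := by
      rw [hwA, picard]; ring
    rw [e]
    have hs := (picard_bounds h hW hε y θ j (by positivity) (half_pow_mul j) (hmem _ (by positivity))).2.2
    have hl := hW.lip y _ hs _ hAs
    have en : ‖picard Γ W j y θ (t, x) - A‖ = |(picard Γ W j y θ (t, x)).re - A| := by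
      rw [hre j, ← ofReal_sub, norm_real, ofReal_re, Real.norm_eq_abs]
    rw [en] at hl
    refine h.norm_trunc_sub_le (M := 2 ^ (j + 1)) (σ := (1 / 2) ^ (j + 1))
      (by exact_mod_cast half_pow_mul (j + 1)) y θ ?_ ?_ ?_ ?_ ?_ hl
    · simp
    · rw [hre j, hW.real y _ (by simpa using hs.1), abs_zero]; positivity
    · simp
    · rw [hwA]; simp
    · simp
  have h3 := (h2.add h1)
  have h4 : Tendsto (fun j => picard Γ W (j + 1) y θ (t, x) - x) atTop (𝓝 (Γ y θ t w : ℂ)) := by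
    rw [zero_add] at h3
    refine h3.congr fun j => ?_
    simp only [Function.comp_apply]; ring
  have h5 := (Complex.continuous_re.tendsto _).comp h4
  have h6 := (hA.comp (tendsto_add_atTop_nat 1)).sub_const x
  have := tendsto_nhds_unique h6 (h5.congr fun j => by simp)
  rw [ofReal_re] at this
  linarith

/-- Invariant tori for Hamiltonians given implicitly by a small smooth perturbation. -/
theorem exists_implicit_torus {γ ω η : ℝ} (hγ : 0 < γ) (hω : 0 < ω) (hη : 0 < η) (hη4 : η ≤ 1 / 4) :
    ∃ ε > 0, ∀ β Γ W, Dioph γ β → TorusFamily ε Γ → ActionMap W →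
      ∃ k kt kh l u v, KamTorus β ω η k kt kh l u v ∧ ∀ y θ t h, |h| < 1 →
        |k y θ t h / ω - h| ≤ 1 / 2 ∧
        k y θ t h / ω = h + Γ y θ t (W y ((k y θ t h / ω : ℝ) : ℂ)).re := by
  obtain ⟨ε₁, hε₁, hK⟩ := exists_kamTorus hγ hη hη4
  obtain ⟨ε, hε, hs⟩ := exists_small hε₁ hω
  refine ⟨ε, hε, fun β Γ W hβ hΓ hW => ?_⟩
  obtain ⟨h1, h2⟩ := hs ε hε.le le_rfl
  obtain ⟨k, kt, kh, l, u, v, hT, hlim⟩ := hK β ω _ hβ (hamSeq_picard hΓ hW h1 hω h2)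
  refine ⟨k, kt, kh, l, u, v, hT, fun y θ t h hh => picard_limit hΓ hW h1 hh ?_⟩
  refine ((hlim y θ t h hh).div_const ω).congr fun j => ?_
  rw [re_ofReal_mul, mul_div_cancel_left₀ _ hω.ne']

/-- Near a Diophantine number of exponent `τ < 2` there are numbers which are Diophantine of
exponent `3`, with a uniform constant. -/
theorem exists_dioph_near {ω γ τ : ℝ} (hγ : 0 < γ) (hτ1 : 1 < τ) (hτ2 : τ < 2)
    (h : ∀ m n : ℤ, m ≠ 0 → γ / |(m : ℝ)| ^ τ ≤ |m * ω + n|) :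
    ∃ γ' > 0, ∀ δ > 0, ∀ c, ω - δ ≤ c → c ≤ ω → ∃ β ∈ Ioo c (c + δ), Dioph γ' β := by
  set d : ℕ → ℝ := fun m => 4 * (1 / ((m : ℝ) + 1) ^ 3) + 12 / γ * (1 / ((m : ℝ) + 1) ^ (3 - τ)) with hd
  have hd0 : ∀ m, 0 ≤ d m := fun m => by positivity
  have hds : Summable d := by
    refine Summable.add (Summable.mul_left _ ?_) (Summable.mul_left _ ?_)
    · have := (summable_nat_add_iff 1).2 (Real.summable_one_div_nat_pow.2 (by norm_num : 1 < 3))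
      exact_mod_cast this
    · have := (summable_nat_add_iff 1).2 (Real.summable_one_div_nat_rpow.2 (by linarith : 1 < 3 - τ))
      exact_mod_cast this
  set S := ∑' m, d m with hS
  have hS0 : 0 ≤ S := tsum_nonneg hd0
  set g := min (min (γ / 2) (1 / 2)) (1 / (2 * (S + 1))) with hg
  have hg0 : 0 < g := by positivity
  have hg1 : g ≤ γ / 2 := (min_le_left _ _).trans (min_le_left _ _)
  have hg2 : g ≤ 1 / 2 := (min_le_left _ _).trans (min_le_right _ _)
  have hg3 : g * S < 1 := by
    have h1 : g ≤ 1 / (2 * (S + 1)) := min_le_right _ _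
    rw [le_div_iff₀ (by positivity)] at h1
    nlinarith
  refine ⟨g, hg0, fun δ hδ c hc1 hc2 => ?_⟩
  by_contra! hcon
  set bad : ℕ → Set ℝ := fun m =>
    {β | β ∈ Ioo c (c + δ) ∧ ∃ n : ℤ, |((m : ℝ) + 1) * β + n| < g / ((m : ℝ) + 1) ^ 3} with hbad
  have hcover : Ioo c (c + δ) ⊆ ⋃ m, bad m := by
    intro β hβ
    have := hcon β hβ
    unfold Dioph at this
    push Not at this
    obtain ⟨m, n, hm, hlt⟩ := this
    have hm1 : 1 ≤ m.natAbs := Int.natAbs_pos.2 hm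
    have hcast : |(m : ℝ)| = ((m.natAbs - 1 : ℕ) : ℝ) + 1 := by
      rw [Nat.cast_sub hm1, Nat.cast_natAbs]; simp
    refine mem_iUnion.2 ⟨m.natAbs - 1, hβ, ?_⟩
    rw [← hcast]
    rcases abs_choice (m : ℝ) with h1 | h1
    · exact ⟨n, by rw [h1] at hlt ⊢; exact hlt⟩
    · refine ⟨-n, lt_of_eq_of_lt ?_ hlt⟩
      rw [h1, ← abs_neg]; congr 1; push_cast; ring
  have hvol : ∀ m, volume (bad m) ≤ ENNReal.ofReal (g * δ * d m) := by
    intro m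
    rcases (bad m).eq_empty_or_nonempty with h0 | ⟨β, hβ, n, hn⟩
    · rw [h0]; simp
    set M : ℝ := (m : ℝ) + 1 with hM
    have hM1 : 1 ≤ M := by rw [hM]; linarith [(Nat.cast_nonneg m : (0 : ℝ) ≤ m)]
    have hM0 : 0 < M := by linarith
    have hclose : ∀ β ∈ Ioo c (c + δ), |β - ω| ≤ δ := fun β hβ => by
      rw [abs_le]; constructor <;> linarith [hβ.1, hβ.2]
    have hτle : g / M ^ 3 ≤ γ / 2 / M ^ τ := by
      have h1 : M ^ τ ≤ M ^ 3 := by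
        rw [← Real.rpow_natCast]
        exact Real.rpow_le_rpow_of_exponent_le hM1 (by norm_num; linarith)
      have : 0 < M ^ τ := by positivity
      gcongr
    have hkey : γ / 2 / M ^ τ ≤ M * δ := by
      have h1 := h (m + 1) n (by omega)
      push_cast at h1
      rw [← hM, abs_of_pos hM0] at h1
      have h2 : |M * ω + n| ≤ |M * β + n| + M * δ := by
        have e : M * ω + n = (M * β + n) - M * (β - ω) := by ring
        rw [e]
        refine (abs_sub _ _).trans ?_
        rw [abs_mul, abs_of_pos hM0]
        gcongr
        exact hclose β hβ
      have e2 : γ / M ^ τ = γ / 2 / M ^ τ + γ / 2 / M ^ τ := by ring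
      linarith
    have hsmall : 1 / M ^ 4 ≤ δ * (2 / γ * (1 / M ^ (3 - τ))) := by
      rw [div_le_iff₀ (by positivity)] at hkey
      have e1 : M ^ 4 = M * M ^ τ * M ^ (3 - τ) := by
        rw [mul_assoc, ← Real.rpow_add hM0]
        norm_num
        ring
      have : 0 < M ^ (3 - τ) := by positivity
      rw [e1, div_le_iff₀ (by positivity)]
      calc (1 : ℝ) = 2 / γ * (γ / 2) := by field_simp
        _ ≤ 2 / γ * (M * δ * M ^ τ) := by gcongr
        _ = _ := by field_simp
    set F := Finset.Icc ⌈-(M * ω) - (M * δ + 1)⌉ ⌊-(M * ω) + (M * δ + 1)⌋ with hF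
    have hFcard : (F.card : ℝ) ≤ 2 * M * δ + 3 := by
      rw [hF, Int.card_Icc]
      have h1 := Int.floor_le (-(M * ω) + (M * δ + 1))
      have h2 := Int.le_ceil (-(M * ω) - (M * δ + 1))
      have h3 : (((⌊-(M * ω) + (M * δ + 1)⌋ + 1 - ⌈-(M * ω) - (M * δ + 1)⌉).toNat : ℤ) : ℝ) ≤
          max (((⌊-(M * ω) + (M * δ + 1)⌋ + 1 - ⌈-(M * ω) - (M * δ + 1)⌉ : ℤ)) : ℝ) 0 := by
        rw [Int.toNat_eq_max]; push_cast; exact le_rfl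
      have h4 : max (((⌊-(M * ω) + (M * δ + 1)⌋ + 1 - ⌈-(M * ω) - (M * δ + 1)⌉ : ℤ)) : ℝ) 0 ≤
          2 * M * δ + 3 := by
        refine max_le ?_ (by positivity)
        push_cast; linarith
      exact_mod_cast h3.trans h4
    have hsub : bad m ⊆ ⋃ n ∈ F, Ioo (-(n : ℝ) / M - g / M ^ 4) (-(n : ℝ) / M + g / M ^ 4) := by
      rintro β ⟨hβ, n, hn⟩
      rw [← hM] at hn
      have hgM : g / M ^ 3 ≤ 1 := by
        rw [div_le_one (by positivity)]
        have := one_le_pow₀ hM1 (n := 3)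
        linarith
      have h1 := hclose β hβ
      have h2 : |M * ω + n| ≤ M * δ + 1 := by
        have e : M * ω + n = (M * β + n) - M * (β - ω) := by ring
        rw [e]
        refine (abs_sub _ _).trans ?_
        rw [abs_mul, abs_of_pos hM0]
        have : M * |β - ω| ≤ M * δ := by gcongr
        linarith
      rw [abs_le] at h2
      refine mem_iUnion₂.2 ⟨n, ?_, ?_⟩
      · rw [hF, Finset.mem_Icc]
        exact ⟨Int.ceil_le.2 (by linarith), Int.le_floor.2 (by linarith)⟩
      · have h3 : |β - -(n : ℝ) / M| < g / M ^ 4 := by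
          have e : β - -(n : ℝ) / M = (M * β + n) / M := by field_simp; ring
          rw [e, abs_div, abs_of_pos hM0, div_lt_iff₀ hM0]
          refine hn.trans_eq ?_
          field_simp
        rw [abs_lt] at h3
        constructor <;> linarith
    calc volume (bad m) ≤ ∑ n ∈ F, volume (Ioo (-(n : ℝ) / M - g / M ^ 4) (-(n : ℝ) / M + g / M ^ 4)) :=
          (measure_mono hsub).trans (measure_biUnion_finset_le _ _)
      _ = ENNReal.ofReal (F.card * (2 * g / M ^ 4)) := by
        rw [ENNReal.ofReal_mul (by positivity), ENNReal.ofReal_natCast, ← nsmul_eq_mul,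
          ← Finset.sum_const]
        refine Finset.sum_congr rfl fun n _ => ?_
        rw [Real.volume_Ioo]
        congr 1; ring
      _ ≤ ENNReal.ofReal (g * δ * d m) := by
        apply ENNReal.ofReal_le_ofReal
        calc (F.card : ℝ) * (2 * g / M ^ 4) ≤ (2 * M * δ + 3) * (2 * g / M ^ 4) := by gcongr
          _ = g * (4 * δ * (1 / M ^ 3)) + 6 * g * (1 / M ^ 4) := by field_simp; ring
          _ ≤ g * (4 * δ * (1 / M ^ 3)) + 6 * g * (δ * (2 / γ * (1 / M ^ (3 - τ)))) := by gcongr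
          _ = g * δ * d m := by rw [hd]; simp only; ring
  have h1 : volume (Ioo c (c + δ)) ≤ ENNReal.ofReal (g * δ * S) := by
    refine (measure_mono hcover).trans ((measure_iUnion_le _).trans ((ENNReal.tsum_le_tsum hvol).trans ?_))
    rw [← ENNReal.ofReal_tsum_of_nonneg (fun m => mul_nonneg (by positivity) (hd0 m))
      (hds.mul_left _), tsum_mul_left]
  rw [Real.volume_Ioo, ENNReal.ofReal_le_ofReal_iff (by positivity)] at h1
  nlinarith

/-- The exponent conjugate to `p`. -/
noncomputable def cexpo (p : ℝ) : ℝ := p / (p - 1)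

section
variable {p a b : ℝ}

lemma one_lt_cexpo (hp : 2 ≤ p) : 1 < cexpo p := by
  rw [cexpo, lt_div_iff₀ (by linarith)]; linarith

lemma cexpo_le_two (hp : 2 ≤ p) : cexpo p ≤ 2 := by
  rw [cexpo, div_le_iff₀ (by linarith)]; linarith

lemma inv_cexpo (hp : 2 ≤ p) : 1 / cexpo p = 1 - 1 / p := by
  have : p - 1 ≠ 0 := by linarith
  have : p ≠ 0 := by linarith
  rw [cexpo]; field_simp

lemma cexpo_sub_one (hp : 2 ≤ p) : cexpo p - 1 = 1 / (p - 1) := by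
  have : p - 1 ≠ 0 := by linarith
  rw [cexpo]; field_simp; ring

lemma abs_phi {r : ℝ} (hr : r ≠ 1) (s : ℝ) : |phi r s| = |s| ^ (r - 1) := by
  rw [phi, abs_mul, abs_of_nonneg (Real.rpow_nonneg (abs_nonneg s) _)]
  rcases eq_or_ne s 0 with rfl | hs
  · simp [Real.zero_rpow (sub_ne_zero.2 hr)]
  · rw [← Real.rpow_add_one (abs_pos.2 hs).ne']; congr 1; ring

lemma phi_of_nonneg {r : ℝ} (hr : r ≠ 1) {s : ℝ} (hs : 0 ≤ s) : phi r s = s ^ (r - 1) := by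
  have h0 : 0 ≤ phi r s := mul_nonneg (Real.rpow_nonneg (abs_nonneg s) _) hs
  have := abs_phi hr s
  rwa [abs_of_nonneg h0, abs_of_nonneg hs] at this

lemma phi_neg (r s : ℝ) : phi r (-s) = -phi r s := by simp [phi]

lemma phi_mul_self {r : ℝ} (hr : 1 < r) (s : ℝ) : phi r s * s = |s| ^ r := by
  rcases eq_or_ne s 0 with rfl | hs
  · simp [phi, Real.zero_rpow (by linarith : r ≠ 0)]
  · rw [phi, mul_assoc, ← abs_mul_abs_self s, ← mul_assoc, ← Real.rpow_add_one (abs_pos.2 hs).ne',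
      ← Real.rpow_add_one (abs_pos.2 hs).ne']
    congr 1; ring

lemma phi_mul {r : ℝ} (hr : r ≠ 1) {μ : ℝ} (hμ : 0 < μ) (s : ℝ) :
    phi r (μ * s) = μ ^ (r - 1) * phi r s := by
  rw [phi, phi, abs_mul, abs_of_pos hμ, Real.mul_rpow hμ.le (abs_nonneg _),
    show r - 1 = (r - 2) + 1 by ring, Real.rpow_add_one hμ.ne']
  ring

lemma continuous_phi {r : ℝ} (hr : 1 < r) : Continuous (phi r) := by
  have h : phi r = fun s => max s 0 ^ (r - 1) - max (-s) 0 ^ (r - 1) := by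
    funext s
    rcases le_total 0 s with hs | hs
    · rw [phi_of_nonneg hr.ne' hs, max_eq_left hs, max_eq_right (by linarith),
        Real.zero_rpow (by linarith), sub_zero]
    · rw [← neg_neg s, phi_neg, phi_of_nonneg hr.ne' (by linarith), neg_neg, max_eq_right hs,
        max_eq_left (by linarith), Real.zero_rpow (by linarith), zero_sub]
  rw [h]
  have e : 0 ≤ r - 1 := by linarith
  exact ((continuous_id.max continuous_const).rpow_const fun _ => Or.inr e).sub
    ((continuous_id.neg.max continuous_const).rpow_const fun _ => Or.inr e)

lemma phi_zero (r : ℝ) : phi r 0 = 0 := by simp [phi]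

lemma phi_phi_cexpo (hp : 2 ≤ p) (s : ℝ) : phi (cexpo p) (phi p s) = s := by
  have h1 := one_lt_cexpo hp
  have key : ∀ s, 0 ≤ s → phi (cexpo p) (phi p s) = s := fun s hs => by
    rw [phi_of_nonneg (by linarith : p ≠ 1) hs, phi_of_nonneg h1.ne' (by positivity),
      ← Real.rpow_mul hs, cexpo_sub_one hp, mul_one_div_cancel (by linarith), Real.rpow_one]
  rcases le_total 0 s with hs | hs
  · exact key s hs
  · have := key (-s) (by linarith)
    rw [phi_neg, phi_neg] at this; linarith

lemma hasDerivAt_posPart_rpow {r : ℝ} (hr : 1 < r) (x : ℝ) :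
    HasDerivAt (fun x => max x 0 ^ r) (r * phi r (max x 0)) x := by
  rcases lt_trichotomy x 0 with hx | rfl | hx
  · rw [max_eq_right hx.le, phi_zero, mul_zero]
    refine (hasDerivAt_const x (0 : ℝ)).congr_of_eventuallyEq ?_
    filter_upwards [Iio_mem_nhds hx] with y hy
    rw [max_eq_right (le_of_lt hy), Real.zero_rpow (by linarith)]
  · rw [max_self, phi_zero, mul_zero]
    have h := hasDerivAt_abs_rpow 0 hr
    simp only [mul_zero] at h
    rw [hasDerivAt_iff_isLittleO_nhds_zero] at h ⊢
    refine Asymptotics.IsBigO.trans_isLittleO (Asymptotics.IsBigO.of_bound 1 ?_) h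
    refine Eventually.of_forall fun x => ?_
    have e : (0 : ℝ) ^ r = 0 := Real.zero_rpow (by linarith)
    simp only [zero_add, max_self, e, smul_zero, sub_zero, abs_zero, one_mul, Real.norm_eq_abs]
    have h1 : 0 ≤ max x 0 := le_max_right _ _
    rw [abs_of_nonneg (Real.rpow_nonneg h1 _), abs_of_nonneg (Real.rpow_nonneg (abs_nonneg x) _)]
    exact Real.rpow_le_rpow h1 (max_le (le_abs_self _) (abs_nonneg _)) (by linarith)
  · rw [max_eq_left hx.le, phi_of_nonneg hr.ne' hx.le]
    refine (Real.hasDerivAt_rpow_const (Or.inl hx.ne')).congr_of_eventuallyEq ?_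
    filter_upwards [Ioi_mem_nhds hx] with y hy
    rw [max_eq_left (le_of_lt hy)]

/-- The restoring force of the jumping nonlinearity. -/
noncomputable def force (p a b x : ℝ) : ℝ := a * phi p (max x 0) - b * phi p (max (-x) 0)

/-- The (normalised) potential of the jumping nonlinearity. -/
noncomputable def pot (p a b x : ℝ) : ℝ := cexpo p / p * (a * max x 0 ^ p + b * max (-x) 0 ^ p)

lemma hasDerivAt_pot (hp : 2 ≤ p) (x : ℝ) :
    HasDerivAt (pot p a b) (cexpo p * force p a b x) x := by
  have hp0 : p ≠ 0 := by linarith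
  have h1 := hasDerivAt_posPart_rpow (by linarith : 1 < p) x
  have h2 := (hasDerivAt_posPart_rpow (by linarith : 1 < p) (-x)).comp x (hasDerivAt_neg x)
  have := ((h1.const_mul a).add (h2.const_mul b)).const_mul (cexpo p / p)
  refine this.congr_deriv ?_
  unfold force
  field_simp
  ring

lemma continuous_force (hp : 2 ≤ p) : Continuous (force p a b) := by
  have := continuous_phi (by linarith : 1 < p)
  unfold force
  exact (continuous_const.mul (this.comp (continuous_id.max continuous_const))).sub
    (continuous_const.mul (this.comp (continuous_id.neg.max continuous_const)))

lemma pot_eq (hp : 2 ≤ p) (x : ℝ) : pot p a b x = cexpo p / p * (force p a b x * x) := by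
  unfold pot force
  congr 1
  have h1 := phi_mul_self (by linarith : 1 < p) (max x 0)
  have h2 := phi_mul_self (by linarith : 1 < p) (max (-x) 0)
  rw [abs_of_nonneg (le_max_right _ _)] at h1 h2
  rw [← h1, ← h2]
  rcases le_total 0 x with hx | hx
  · rw [max_eq_left hx, max_eq_right (by linarith : -x ≤ 0), phi_zero]; ring
  · rw [max_eq_right hx, max_eq_left (by linarith : 0 ≤ -x), phi_zero]; ring

lemma pot_mul {μ : ℝ} (hμ : 0 < μ) (x : ℝ) : pot p a b (μ * x) = μ ^ p * pot p a b x := by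
  have h1 : max (μ * x) 0 = μ * max x 0 := by
    rw [mul_max_of_nonneg _ _ hμ.le, mul_zero]
  have h2 : max (-(μ * x)) 0 = μ * max (-x) 0 := by
    rw [mul_max_of_nonneg _ _ hμ.le, mul_zero, mul_neg]
  unfold pot
  rw [h1, h2, Real.mul_rpow hμ.le (le_max_right _ _), Real.mul_rpow hμ.le (le_max_right _ _)]
  ring

lemma force_mul (hp : 2 ≤ p) {μ : ℝ} (hμ : 0 < μ) (x : ℝ) :
    force p a b (μ * x) = μ ^ (p - 1) * force p a b x := by
  have h1 : max (μ * x) 0 = μ * max x 0 := by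
    rw [mul_max_of_nonneg _ _ hμ.le, mul_zero]
  have h2 : max (-(μ * x)) 0 = μ * max (-x) 0 := by
    rw [mul_max_of_nonneg _ _ hμ.le, mul_zero, mul_neg]
  unfold force
  rw [h1, h2, phi_mul (by linarith) hμ, phi_mul (by linarith) hμ]
  ring

lemma pot_nonneg (hp : 2 ≤ p) (ha : 0 < a) (hb : 0 < b) (x : ℝ) : 0 ≤ pot p a b x := by
  have := one_lt_cexpo hp
  have := le_max_right x 0
  have := le_max_right (-x) 0
  unfold pot
  positivity

lemma pot_pos (hp : 2 ≤ p) (ha : 0 < a) (hb : 0 < b) {x : ℝ} (hx : x ≠ 0) : 0 < pot p a b x := by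
  have := one_lt_cexpo hp
  unfold pot
  have h1 := le_max_right x 0
  have h2 := le_max_right (-x) 0
  refine mul_pos (by positivity) ?_
  rcases lt_or_gt_of_ne hx with h | h
  · have : 0 < max (-x) 0 := lt_max_of_lt_left (by linarith)
    have := Real.rpow_nonneg h1 p
    positivity
  · have : 0 < max x 0 := lt_max_of_lt_left h
    have := Real.rpow_nonneg h2 p
    positivity

lemma hasDerivAt_abs_cexpo (hp : 2 ≤ p) (y : ℝ) :
    HasDerivAt (fun y => |y| ^ cexpo p) (cexpo p * phi (cexpo p) y) y := by
  have := hasDerivAt_abs_rpow y (one_lt_cexpo hp)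
  unfold phi
  rwa [mul_assoc] at this

/-- The energy on the unit circle. -/
noncomputable def ray (p a b α : ℝ) : ℝ := |Real.cos α| ^ cexpo p + pot p a b (Real.sin α)

lemma ray_pos (hp : 2 ≤ p) (ha : 0 < a) (hb : 0 < b) (α : ℝ) : 0 < ray p a b α := by
  have h0 := pot_nonneg hp ha hb (Real.sin α)
  have h1 : 0 ≤ |Real.cos α| ^ cexpo p := Real.rpow_nonneg (abs_nonneg _) _
  unfold ray
  by_cases hs : Real.sin α = 0
  · have : Real.cos α ≠ 0 := fun hc => by
      have := Real.sin_sq_add_cos_sq α; rw [hs, hc] at this; norm_num at this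
    have := Real.rpow_pos_of_pos (abs_pos.2 this) (cexpo p)
    linarith
  · have := pot_pos hp ha hb hs
    linarith

lemma hasDerivAt_ray (hp : 2 ≤ p) (α : ℝ) : HasDerivAt (ray p a b)
    (cexpo p * (force p a b (Real.sin α) * Real.cos α - phi (cexpo p) (Real.cos α) * Real.sin α)) α := by
  have h1 := (hasDerivAt_abs_cexpo hp (Real.cos α)).comp α (Real.hasDerivAt_cos α)
  have h2 := (hasDerivAt_pot (a := a) (b := b) hp (Real.sin α)).comp α (Real.hasDerivAt_sin α)
  refine (h1.add h2).congr_deriv ?_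
  ring

lemma continuous_ray (hp : 2 ≤ p) : Continuous (ray p a b) :=
  continuous_iff_continuousAt.2 fun α => (hasDerivAt_ray hp α).continuousAt

/-- Rate of the time along the unit level set. -/
noncomputable def rate (p a b α : ℝ) : ℝ :=
  (Real.cos α ^ 2 + cexpo p / p * Real.sin α ^ 2) / ray p a b α

lemma cexpo_div (hp : 2 ≤ p) : cexpo p / p = 1 / (p - 1) := by
  have : p ≠ 0 := by linarith
  rw [cexpo]; field_simp

lemma weight_pos (hp : 2 ≤ p) (α : ℝ) : 1 / (p - 1) ≤ Real.cos α ^ 2 + cexpo p / p * Real.sin α ^ 2 := by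
  rw [cexpo_div hp, Real.cos_sq']
  have h : 1 / (p - 1) ≤ 1 := by rw [div_le_one (by linarith)]; linarith
  nlinarith [Real.sin_sq_le_one α]

lemma rate_pos (hp : 2 ≤ p) (ha : 0 < a) (hb : 0 < b) (α : ℝ) : 0 < rate p a b α := by
  have h1 := weight_pos hp α
  have : 0 < 1 / (p - 1) := by have : 0 < p - 1 := by linarith
                               positivity
  exact div_pos (by linarith) (ray_pos hp ha hb α)

lemma continuous_rate (hp : 2 ≤ p) (ha : 0 < a) (hb : 0 < b) : Continuous (rate p a b) :=
  Continuous.div (by fun_prop) (continuous_ray hp) fun α => (ray_pos hp ha hb α).ne'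

/-- First coordinate on the unit level set. -/
noncomputable def cpos (p a b α : ℝ) : ℝ := ray p a b α ^ (-(1 / p)) * Real.sin α

/-- Second coordinate on the unit level set. -/
noncomputable def cmom (p a b α : ℝ) : ℝ := ray p a b α ^ (-(1 / cexpo p)) * Real.cos α

lemma hasDerivAt_cpos (hp : 2 ≤ p) (ha : 0 < a) (hb : 0 < b) (α : ℝ) :
    HasDerivAt (cpos p a b) (rate p a b α * phi (cexpo p) (cmom p a b α)) α := by
  have hN := ray_pos hp ha hb α
  have hp0 : p ≠ 0 := by linarith
  have hq := one_lt_cexpo hp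
  have hq0 : cexpo p ≠ 0 := by linarith
  have h := ((hasDerivAt_ray (a := a) (b := b) hp α).rpow_const (p := -(1 / p)) (Or.inl hN.ne')).mul
    (Real.hasDerivAt_sin α)
  refine h.congr_deriv ?_
  have e1 : phi (cexpo p) (cmom p a b α) = ray p a b α ^ (-(1 / p)) * phi (cexpo p) (Real.cos α) := by
    rw [cmom, phi_mul hq.ne' (by positivity), ← Real.rpow_mul hN.le]
    congr 2
    rw [inv_cexpo hp, cexpo_sub_one hp]
    have : p - 1 ≠ 0 := by linarith
    field_simp
  have e2 : ray p a b α = phi (cexpo p) (Real.cos α) * Real.cos α +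
      cexpo p / p * (force p a b (Real.sin α) * Real.sin α) := by
    rw [phi_mul_self hq, ← pot_eq hp, ray]
  rw [e1, rate, Real.rpow_sub_one hN.ne']
  set M := ray p a b α ^ (-(1 / p)) with hM
  set N := ray p a b α with hNd
  field_simp
  rw [e2]
  field_simp
  ring

lemma hasDerivAt_cmom (hp : 2 ≤ p) (ha : 0 < a) (hb : 0 < b) (α : ℝ) :
    HasDerivAt (cmom p a b) (-(rate p a b α * force p a b (cpos p a b α))) α := by
  have hN := ray_pos hp ha hb α
  have hp0 : p ≠ 0 := by linarith
  have hq := one_lt_cexpo hp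
  have hq0 : cexpo p ≠ 0 := by linarith
  have h := ((hasDerivAt_ray (a := a) (b := b) hp α).rpow_const (p := -(1 / cexpo p))
    (Or.inl hN.ne')).mul (Real.hasDerivAt_cos α)
  refine h.congr_deriv ?_
  have e1 : force p a b (cpos p a b α) = ray p a b α ^ (-(1 / cexpo p)) * force p a b (Real.sin α) := by
    rw [cpos, force_mul hp (by positivity), ← Real.rpow_mul hN.le]
    congr 2
    rw [inv_cexpo hp]
    field_simp
  have e2 : ray p a b α = phi (cexpo p) (Real.cos α) * Real.cos α +
      cexpo p / p * (force p a b (Real.sin α) * Real.sin α) := by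
    rw [phi_mul_self hq, ← pot_eq hp, ray]
  rw [e1, rate, Real.rpow_sub_one hN.ne']
  set M := ray p a b α ^ (-(1 / cexpo p)) with hM
  set N := ray p a b α with hNd
  field_simp
  rw [e2]
  field_simp
  ring

lemma energy_curve (hp : 2 ≤ p) (ha : 0 < a) (hb : 0 < b) (α : ℝ) :
    |cmom p a b α| ^ cexpo p + pot p a b (cpos p a b α) = 1 := by
  have hN := ray_pos hp ha hb α
  have hp0 : p ≠ 0 := by linarith
  have hq := one_lt_cexpo hp
  rw [cmom, cpos, pot_mul (by positivity), abs_mul, abs_of_pos (by positivity),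
    Real.mul_rpow (by positivity) (abs_nonneg _), ← Real.rpow_mul hN.le, ← Real.rpow_mul hN.le]
  have e1 : -(1 / cexpo p) * cexpo p = -1 := by field_simp
  have e2 : -(1 / p) * p = -1 := by field_simp
  rw [e1, e2, ← mul_add, ← ray, Real.rpow_neg_one, inv_mul_cancel₀ hN.ne']

end

section
variable {p a b : ℝ}

lemma continuous_cpos (hp : 2 ≤ p) (ha : 0 < a) (hb : 0 < b) : Continuous (cpos p a b) :=
  continuous_iff_continuousAt.2 fun α => (hasDerivAt_cpos hp ha hb α).continuousAt

lemma quarter_integral (hp : 2 ≤ p) (ha : 0 < a) (hb : 0 < b) (k : ℕ) :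
    ∫ α in (0 : ℝ)..Real.pi / 2, cpos p a b α ^ k * rate p a b α =
      1 / p * (cexpo p / p * a) ^ (-((1 + k) / p)) *
        ∫ x in Ioo (0 : ℝ) 1, x ^ ((1 + k) / p - 1) * (1 - x) ^ (-(1 / p)) := by
  have hp0 : 0 < p := by linarith
  have hp1 : p - 1 ≠ 0 := by linarith
  have hq := one_lt_cexpo hp
  have hq0 : 0 < cexpo p := by linarith
  have hpi := Real.pi_pos
  set X : ℝ → ℝ := fun α => pot p a b (cpos p a b α) with hX
  have hcp : ∀ α ∈ Ioo (0 : ℝ) (Real.pi / 2), 0 < cpos p a b α := fun α hα =>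
    mul_pos (Real.rpow_pos_of_pos (ray_pos hp ha hb α) _)
      (Real.sin_pos_of_pos_of_lt_pi hα.1 (by linarith [hα.2]))
  have hsp : ∀ α ∈ Ioo (0 : ℝ) (Real.pi / 2), 0 < cmom p a b α := fun α hα =>
    mul_pos (Real.rpow_pos_of_pos (ray_pos hp ha hb α) _)
      (Real.cos_pos_of_mem_Ioo ⟨by linarith [hα.1], hα.2⟩)
  have hforce : ∀ x, 0 < x → force p a b x = a * x ^ (p - 1) := fun x hx => by
    rw [force, max_eq_left hx.le, max_eq_right (by linarith), phi_zero,
      phi_of_nonneg (by linarith) hx.le]; ring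
  have hpot : ∀ x, 0 < x → pot p a b x = cexpo p / p * a * x ^ p := fun x hx => by
    rw [pot, max_eq_left hx.le, max_eq_right (by linarith), Real.zero_rpow hp0.ne']; ring
  set X' : ℝ → ℝ := fun α => cexpo p * force p a b (cpos p a b α) *
    (rate p a b α * phi (cexpo p) (cmom p a b α)) with hX'
  have hd : ∀ α, HasDerivAt X (X' α) α := fun α =>
    (hasDerivAt_pot hp _).comp α (hasDerivAt_cpos hp ha hb α)
  have hX'pos : ∀ α ∈ Ioo (0 : ℝ) (Real.pi / 2), 0 < X' α := fun α hα => by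
    have h1 := hcp α hα
    have h2 := hsp α hα
    have h3 := rate_pos hp ha hb α
    simp only [hX', hforce _ h1, phi_of_nonneg hq.ne' h2.le]
    positivity
  have hcX : Continuous X := continuous_iff_continuousAt.2 fun α => (hd α).continuousAt
  have hmono : StrictMonoOn X (Icc 0 (Real.pi / 2)) := by
    refine strictMonoOn_of_deriv_pos (convex_Icc _ _) hcX.continuousOn fun α hα => ?_
    rw [interior_Icc] at hα
    rw [(hd α).deriv]; exact hX'pos α hα
  have hX0 : X 0 = 0 := by simp [hX, cpos, pot, Real.zero_rpow hp0.ne']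
  have hX1 : X (Real.pi / 2) = 1 := by
    have := energy_curve hp ha hb (Real.pi / 2)
    simpa [cmom, Real.zero_rpow hq0.ne'] using this
  have himg : X '' Ioo 0 (Real.pi / 2) = Ioo 0 1 := by
    apply Subset.antisymm
    · rintro _ ⟨α, hα, rfl⟩
      constructor
      · rw [← hX0]; exact hmono ⟨le_rfl, by linarith⟩ ⟨hα.1.le, hα.2.le⟩ hα.1
      · rw [← hX1]; exact hmono ⟨hα.1.le, hα.2.le⟩ ⟨by linarith, le_rfl⟩ hα.2
    · have := intermediate_value_Ioo (by linarith : (0 : ℝ) ≤ Real.pi / 2) hcX.continuousOn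
      rwa [hX0, hX1] at this
  rw [intervalIntegral.integral_of_le (by linarith), integral_Ioc_eq_integral_Ioo, ← himg,
    integral_image_eq_integral_abs_deriv_smul measurableSet_Ioo
      (fun α _ => (hd α).hasDerivWithinAt) (hmono.injOn.mono Ioo_subset_Icc_self),
    ← integral_const_mul]
  refine setIntegral_congr_fun measurableSet_Ioo fun α hα => ?_
  have h1 := hcp α hα
  have h2 := hsp α hα
  have hκ : 0 < cexpo p / p * a := by positivity
  have hs : 1 - X α = cmom p a b α ^ cexpo p := by
    have := energy_curve hp ha hb α
    rw [abs_of_pos h2] at this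
    simp only [hX]; linarith
  have hr := rate_pos hp ha hb α
  simp only [smul_eq_mul]
  rw [abs_of_pos (hX'pos α hα), hs, ← Real.rpow_mul h2.le]
  simp only [hX', hX, hforce _ h1, hpot _ h1, phi_of_nonneg hq.ne' h2.le]
  have e1 : cexpo p * -(1 / p) = -(cexpo p - 1) := by
    rw [cexpo_sub_one hp, cexpo]; field_simp
  rw [e1, Real.mul_rpow hκ.le (by positivity), ← Real.rpow_mul h1.le, Real.rpow_neg h2.le,
    Real.rpow_neg hκ.le, Real.rpow_sub_one hκ.ne']
  have e2 : p * ((1 + k) / p - 1) = k - (p - 1) := by field_simp; ring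
  rw [e2, Real.rpow_sub h1 (k : ℝ) (p - 1), Real.rpow_natCast]
  have i1 : 0 < cmom p a b α ^ (cexpo p - 1) := by positivity
  have i2 : 0 < cpos p a b α ^ (p - 1) := by positivity
  have i3 : 0 < (cexpo p / p * a) ^ ((1 + k) / p : ℝ) := by positivity
  field_simp

lemma rate_add_pi (α : ℝ) : rate p a b (α + Real.pi) = rate p b a α := by
  have : ray p a b (α + Real.pi) = ray p b a α := by
    simp [ray, pot, Real.cos_add_pi, Real.sin_add_pi, add_comm]
  simp [rate, this, Real.cos_add_pi, Real.sin_add_pi]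

lemma cpos_add_pi (α : ℝ) : cpos p a b (α + Real.pi) = -cpos p b a α := by
  have : ray p a b (α + Real.pi) = ray p b a α := by
    simp [ray, pot, Real.cos_add_pi, Real.sin_add_pi, add_comm]
  simp [cpos, this, Real.sin_add_pi]

lemma half_integral (hp : 2 ≤ p) (ha : 0 < a) (hb : 0 < b) (k : ℕ) :
    ∫ α in (0 : ℝ)..Real.pi, cpos p a b α ^ k * rate p a b α =
      2 * ∫ α in (0 : ℝ)..Real.pi / 2, cpos p a b α ^ k * rate p a b α := by
  have hc : Continuous fun α => cpos p a b α ^ k * rate p a b α :=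
    ((continuous_cpos hp ha hb).pow k).mul (continuous_rate hp ha hb)
  rw [← intervalIntegral.integral_add_adjacent_intervals (hc.intervalIntegrable 0 (Real.pi / 2))
    (hc.intervalIntegrable (Real.pi / 2) Real.pi), two_mul]
  congr 1
  have h := intervalIntegral.integral_comp_sub_left (a := 0) (b := Real.pi / 2)
    (fun α => cpos p a b α ^ k * rate p a b α) Real.pi
  rw [sub_zero, show Real.pi - Real.pi / 2 = Real.pi / 2 by ring] at h
  rw [← h]
  refine intervalIntegral.integral_congr fun α _ => ?_
  simp [cpos, rate, ray]

lemma full_integral (hp : 2 ≤ p) (ha : 0 < a) (hb : 0 < b) (k : ℕ) :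
    ∫ α in (0 : ℝ)..2 * Real.pi, cpos p a b α ^ k * rate p a b α =
      2 / p * ((cexpo p / p * a) ^ (-((1 + k) / p) : ℝ) +
        (-1) ^ k * (cexpo p / p * b) ^ (-((1 + k) / p) : ℝ)) *
        ∫ x in Ioo (0 : ℝ) 1, x ^ ((1 + k) / p - 1) * (1 - x) ^ (-(1 / p)) := by
  have hc : Continuous fun α => cpos p a b α ^ k * rate p a b α :=
    ((continuous_cpos hp ha hb).pow k).mul (continuous_rate hp ha hb)
  have h := intervalIntegral.integral_comp_add_right (a := 0) (b := Real.pi)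
    (fun α => cpos p a b α ^ k * rate p a b α) Real.pi
  rw [zero_add, ← two_mul] at h
  have h2 : ∫ α in (0 : ℝ)..Real.pi, cpos p a b (α + Real.pi) ^ k * rate p a b (α + Real.pi) =
      (-1) ^ k * ∫ α in (0 : ℝ)..Real.pi, cpos p b a α ^ k * rate p b a α := by
    rw [← intervalIntegral.integral_const_mul]
    refine intervalIntegral.integral_congr fun α _ => ?_
    simp only [rate_add_pi, cpos_add_pi]
    rw [neg_pow]; ring
  rw [← intervalIntegral.integral_add_adjacent_intervals (hc.intervalIntegrable 0 Real.pi)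
    (hc.intervalIntegrable Real.pi (2 * Real.pi)), ← h, h2, half_integral hp ha hb,
    half_integral hp hb ha, quarter_integral hp ha hb, quarter_integral hp hb ha]
  ring

lemma beta_integral {s t : ℝ} (hs : 0 < s) (ht : 0 < t) :
    ∫ x in Ioo (0 : ℝ) 1, x ^ (s - 1) * (1 - x) ^ (t - 1) = ProbabilityTheory.beta s t := by
  have h : ((∫ x in Ioo (0 : ℝ) 1, x ^ (s - 1) * (1 - x) ^ (t - 1) : ℝ) : ℂ) = betaIntegral s t := by
    rw [betaIntegral, intervalIntegral.integral_of_le zero_le_one, integral_Ioc_eq_integral_Ioo,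
      ← integral_complex_ofReal]
    refine setIntegral_congr_fun measurableSet_Ioo fun x hx => ?_
    have h1 : 0 ≤ 1 - x := by linarith [hx.2]
    simp only [ofReal_mul, ofReal_cpow hx.1.le, ofReal_cpow h1]
    push_cast; rfl
  rw [ProbabilityTheory.beta_eq_betaIntegralReal s t hs ht, ← h, ofReal_re]

lemma full_rate (hp : 2 ≤ p) (ha : 0 < a) (hb : 0 < b) :
    ∫ α in (0 : ℝ)..2 * Real.pi, rate p a b α =
      2 * pip p * ((a ^ (-(1 : ℝ) / p) + b ^ (-(1 : ℝ) / p)) / 2) := by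
  have hp0 : 0 < p := by linarith
  have hp1 : 0 < p - 1 := by linarith
  have hip : 1 / p < 1 := by rw [div_lt_one hp0]; linarith
  have h := full_integral hp ha hb 0
  simp only [pow_zero, one_mul, Nat.cast_zero, add_zero] at h
  rw [h, show -(1 / p) = (1 - 1 / p) - 1 by ring,
    beta_integral (s := 1 / p) (t := 1 - 1 / p) (by positivity) (by linarith), ProbabilityTheory.beta,
    Real.Gamma_mul_Gamma_one_sub, show 1 / p + (1 - 1 / p) = 1 by ring, Real.Gamma_one, div_one,
    show 1 - 1 / p - 1 = -(1 / p) by ring, cexpo_div hp,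
    Real.mul_rpow (by positivity) ha.le, Real.mul_rpow (by positivity) hb.le,
    one_div (p - 1), Real.inv_rpow hp1.le, Real.rpow_neg hp1.le, inv_inv, pip,
    show -(1 : ℝ) / p = -(1 / p) by ring, show Real.pi * (1 / p) = Real.pi / p by ring]
  field_simp

lemma full_cpos_ne (hp : 2 ≤ p) (ha : 0 < a) (hb : 0 < b) (hab : a ≠ b) :
    ∫ α in (0 : ℝ)..2 * Real.pi, cpos p a b α * rate p a b α ≠ 0 := by
  have hp0 : 0 < p := by linarith
  have hq := one_lt_cexpo hp
  have h := full_integral hp ha hb 1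
  simp only [pow_one, Nat.cast_one] at h
  rw [h]
  have hB := quarter_integral hp ha hb 1
  simp only [pow_one, Nat.cast_one] at hB
  have hpos : 0 < ∫ α in (0 : ℝ)..Real.pi / 2, cpos p a b α * rate p a b α := by
    refine intervalIntegral.intervalIntegral_pos_of_pos_on
      (((continuous_cpos hp ha hb).mul (continuous_rate hp ha hb)).intervalIntegrable _ _)
      (fun α hα => mul_pos ?_ (rate_pos hp ha hb α)) (by linarith [Real.pi_pos])
    exact mul_pos (Real.rpow_pos_of_pos (ray_pos hp ha hb α) _)
      (Real.sin_pos_of_pos_of_lt_pi hα.1 (by linarith [hα.2, Real.pi_pos]))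
  rw [hB] at hpos
  have hne := right_ne_zero_of_mul hpos.ne'
  refine mul_ne_zero (mul_ne_zero (by positivity) ?_) hne
  intro h0
  have h1 : (cexpo p / p * a) ^ (-((1 + 1) / p)) = (cexpo p / p * b) ^ (-((1 + 1) / p)) := by linarith
  have := Real.rpow_left_injOn (x := -((1 + 1) / p)) (by
    rw [neg_ne_zero]; positivity) (by simp; positivity) (by simp; positivity) h1
  have hqp : cexpo p / p ≠ 0 := by positivity
  exact hab (mul_left_cancel₀ hqp this)

end

/-- Generalised polar coordinates `x = r C θ`, `y = r^{p-1} S θ` adapted to the jumping oscillator. -/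
structure Curve (p a b T : ℝ) (C S : ℝ → ℝ) : Prop where
  T_pos : 0 < T
  dC : ∀ θ, HasDerivAt C (phi (cexpo p) (S θ)) θ
  dS : ∀ θ, HasDerivAt S (-(force p a b (C θ))) θ
  energy : ∀ θ, |S θ| ^ cexpo p + pot p a b (C θ) = 1
  perC : ∀ θ, C (θ + T) = C θ
  perS : ∀ θ, S (θ + T) = S θ
  mean : ∫ θ in (0 : ℝ)..T, C θ ≠ 0
  polar : ∀ x y : ℝ, (x ≠ 0 ∨ y ≠ 0) → ∃ r > 0, ∃ θ ∈ Icc 0 T, x = r * C θ ∧ y = r ^ (p - 1) * S θ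
  inj : ∀ r r' θ θ', 0 < r → 0 < r' → r * C θ = r' * C θ' →
    r ^ (p - 1) * S θ = r' ^ (p - 1) * S θ' → r = r' ∧ ∃ n : ℤ, θ' = θ + n * T

section
variable {p a b : ℝ}

lemma exists_angle {x y : ℝ} (h : x ^ 2 + y ^ 2 = 1) : ∃ α, x = Real.sin α ∧ y = Real.cos α := by
  have hn : ‖(⟨y, x⟩ : ℂ)‖ = 1 := by
    rw [Complex.norm_def, Complex.normSq_mk, Real.sqrt_eq_one]; linarith
  have hz : (⟨y, x⟩ : ℂ) ≠ 0 := by rw [← norm_ne_zero_iff, hn]; exact one_ne_zero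
  refine ⟨Complex.arg ⟨y, x⟩, ?_, ?_⟩
  · rw [Complex.sin_arg, hn, div_one]
  · rw [Complex.cos_arg hz, hn, div_one]

lemma exists_angle_of_ne (hp : 2 ≤ p) {x y : ℝ} (h : x ≠ 0 ∨ y ≠ 0) :
    ∃ μ > 0, ∃ α, μ * x = Real.sin α ∧ μ ^ (p - 1) * y = Real.cos α := by
  have hs : 0 < x ^ 2 + y ^ 2 := by
    rcases h with h | h <;> positivity
  set g : ℝ → ℝ := fun μ => (μ * x) ^ 2 + (μ ^ (p - 1) * y) ^ 2
  have hg : Continuous g := by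
    have : Continuous fun μ : ℝ => μ ^ (p - 1) := Real.continuous_rpow_const (by linarith)
    fun_prop
  set M : ℝ := 1 + 1 / (x ^ 2 + y ^ 2)
  have hM : 1 ≤ M := by simp only [M, le_add_iff_nonneg_right]; positivity
  have h0 : g 0 = 0 := by simp [g, Real.zero_rpow (by linarith : p - 1 ≠ 0)]
  have h1 : 1 ≤ g M := by
    have e1 : M ≤ M ^ (p - 1) := by
      simpa using Real.rpow_le_rpow_of_exponent_le hM (by linarith : 1 ≤ p - 1)
    have e2 : M ^ 2 ≤ (M ^ (p - 1)) ^ 2 := by gcongr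
    have e3 : M * (x ^ 2 + y ^ 2) = x ^ 2 + y ^ 2 + 1 := by simp only [M]; field_simp
    have e4 : M ≤ M ^ 2 := by nlinarith
    simp only [g, mul_pow]
    nlinarith [mul_le_mul_of_nonneg_right e2 (sq_nonneg y), mul_le_mul_of_nonneg_right e4 hs.le]
  obtain ⟨μ, hμ, he⟩ := intermediate_value_Icc (by linarith : (0 : ℝ) ≤ M) hg.continuousOn
    (show (1 : ℝ) ∈ Icc (g 0) (g M) from ⟨by rw [h0]; exact zero_le_one, h1⟩)
  have hμ0 : μ ≠ 0 := by rintro rfl; rw [h0] at he; exact zero_ne_one he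
  obtain ⟨α, h2, h3⟩ := exists_angle he
  exact ⟨μ, lt_of_le_of_ne hμ.1 hμ0.symm, α, h2, h3⟩

lemma one_of_scaled_circle (hp : 2 ≤ p) {ν s c : ℝ} (hν : 0 < ν) (h : s ^ 2 + c ^ 2 = 1)
    (h' : (ν * s) ^ 2 + (ν ^ (p - 1) * c) ^ 2 = 1) : ν = 1 := by
  have e : ν ^ (p - 1) = ν * ν ^ (p - 2) := by
    rw [show p - 1 = p - 2 + 1 by ring, Real.rpow_add_one hν.ne']; ring
  have hm : 0 < ν ^ (p - 2) := by positivity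
  rw [e] at h'
  set m := ν ^ (p - 2)
  have h2 : ν ^ 2 * (s ^ 2 + m ^ 2 * c ^ 2) = 1 := by rw [← h']; ring
  rcases lt_trichotomy ν 1 with hl | rfl | hl
  · exfalso
    have hm1 : m ≤ 1 := Real.rpow_le_one hν.le hl.le (by linarith)
    have hm2 : m ^ 2 ≤ 1 := by nlinarith
    have : s ^ 2 + m ^ 2 * c ^ 2 ≤ 1 := by nlinarith [mul_le_mul_of_nonneg_right hm2 (sq_nonneg c)]
    have : ν ^ 2 < 1 := by nlinarith
    nlinarith [sq_nonneg s, sq_nonneg (m * c)]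
  · rfl
  · exfalso
    have hm1 : 1 ≤ m := Real.one_le_rpow hl.le (by linarith)
    have hm2 : 1 ≤ m ^ 2 := by nlinarith
    have : 1 ≤ s ^ 2 + m ^ 2 * c ^ 2 := by nlinarith [mul_le_mul_of_nonneg_right hm2 (sq_nonneg c)]
    have : 1 < ν ^ 2 := by nlinarith
    nlinarith

lemma cpos_cmom_inj (hp : 2 ≤ p) (ha : 0 < a) (hb : 0 < b) {α α' : ℝ}
    (h1 : cpos p a b α = cpos p a b α') (h2 : cmom p a b α = cmom p a b α') :
    ∃ n : ℤ, α' = α + n * (2 * Real.pi) := by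
  have hN := ray_pos hp ha hb α
  have hN' := ray_pos hp ha hb α'
  have hp0 : p ≠ 0 := by linarith
  rw [cpos, cpos, Real.rpow_neg hN.le, Real.rpow_neg hN'.le] at h1
  rw [cmom, cmom, inv_cexpo hp, Real.rpow_neg hN.le, Real.rpow_neg hN'.le] at h2
  have key : ∀ x : ℝ, 0 < x → x ^ (1 - 1 / p) = (x ^ (1 / p)) ^ (p - 1) := fun x hx => by
    rw [← Real.rpow_mul hx.le]; congr 1; field_simp
  rw [key _ hN, key _ hN'] at h2
  have hu : 0 < ray p a b α ^ (1 / p) := by positivity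
  have hv : 0 < ray p a b α' ^ (1 / p) := by positivity
  generalize ray p a b α ^ (1 / p) = u at *
  generalize ray p a b α' ^ (1 / p) = v at *
  have hs : Real.sin α = u / v * Real.sin α' := by field_simp at h1 ⊢; linarith
  have hc : Real.cos α = (u / v) ^ (p - 1) * Real.cos α' := by
    rw [Real.div_rpow hu.le hv.le]
    have : 0 < u ^ (p - 1) := by positivity
    have : 0 < v ^ (p - 1) := by positivity
    field_simp at h2 ⊢; linarith
  have h := Real.sin_sq_add_cos_sq α
  rw [hs, hc] at h
  have hone := one_of_scaled_circle hp (by positivity) (Real.sin_sq_add_cos_sq α') h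
  rw [hone, one_mul] at hs
  rw [hone, Real.one_rpow, one_mul] at hc
  obtain ⟨n, hn⟩ := Real.Angle.angle_eq_iff_two_pi_dvd_sub.1 (Real.Angle.cos_sin_inj hc hs)
  exact ⟨-n, by push_cast; linarith⟩

theorem exists_curve (hp : 2 ≤ p) (ha : 0 < a) (hb : 0 < b) (hab : a ≠ b) :
    ∃ C S, Curve p a b (2 * pip p * ((a ^ (-(1 : ℝ) / p) + b ^ (-(1 : ℝ) / p)) / 2)) C S := by
  have hp0 : 0 < p := by linarith
  have hp1 : 0 < p - 1 := by linarith
  rw [← full_rate hp ha hb]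
  set T := ∫ α in (0 : ℝ)..2 * Real.pi, rate p a b α with hT
  have hrc := continuous_rate hp ha hb
  have hT0 : 0 < T := intervalIntegral.intervalIntegral_pos_of_pos_on (hrc.intervalIntegrable _ _)
    (fun α _ => rate_pos hp ha hb α) (by positivity)
  set Θ : ℝ → ℝ := fun α => ∫ s in (0 : ℝ)..α, rate p a b s with hΘ
  have hd : ∀ α, HasDerivAt Θ (rate p a b α) α := fun α => (hrc.integral_hasStrictDerivAt 0 α).hasDerivAt
  have hmono : StrictMono Θ := strictMono_of_hasDerivAt_pos hd (rate_pos hp ha hb)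
  have hΘ0 : Θ 0 = 0 := by simp [hΘ]
  have hadd : ∀ α, Θ (α + 2 * Real.pi) = Θ α + T := fun α => by
    have hper : Function.Periodic (rate p a b) (2 * Real.pi) := fun s => by
      simp [rate, ray]
    have h1 := hper.intervalIntegral_add_eq α 0
    rw [zero_add] at h1
    simp only [hΘ, hT]
    rw [← h1, intervalIntegral.integral_add_adjacent_intervals (hrc.intervalIntegrable _ _)
      (hrc.intervalIntegrable _ _)]
  have haddn : ∀ (n : ℤ) α, Θ (α + n * (2 * Real.pi)) = Θ α + n * T := fun n α => by
    have hper : Function.Periodic (fun α => Θ α - α / (2 * Real.pi) * T) (2 * Real.pi) := fun s => by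
      simp only [hadd]; field_simp; ring
    have h1 : Θ (α + n * (2 * Real.pi)) - (α + n * (2 * Real.pi)) / (2 * Real.pi) * T =
      Θ α - α / (2 * Real.pi) * T := hper.int_mul n α
    have h2 : (α + n * (2 * Real.pi)) / (2 * Real.pi) = α / (2 * Real.pi) + n := by field_simp
    rw [h2] at h1
    linarith
  have hsurj : Function.Surjective Θ := by
    refine (continuous_iff_continuousAt.2 fun α => (hd α).continuousAt).surjective ?_ ?_
    · refine tendsto_atTop.2 fun B => ?_
      obtain ⟨n, hn⟩ := exists_int_gt (B / T)
      filter_upwards [eventually_ge_atTop (n * (2 * Real.pi))] with α hα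
      have h1 := haddn n 0
      rw [zero_add, hΘ0, zero_add] at h1
      have := hmono.monotone hα
      rw [h1] at this
      rw [div_lt_iff₀ hT0] at hn
      linarith
    · refine tendsto_atBot.2 fun B => ?_
      obtain ⟨n, hn⟩ := exists_int_lt (B / T)
      filter_upwards [eventually_le_atBot (n * (2 * Real.pi))] with α hα
      have h1 := haddn n 0
      rw [zero_add, hΘ0, zero_add] at h1
      have := hmono.monotone hα
      rw [h1] at this
      rw [lt_div_iff₀ hT0] at hn
      linarith
  set e := hmono.orderIsoOfSurjective Θ hsurj with he
  have heΘ : ∀ θ, Θ (e.symm θ) = θ := fun θ => e.apply_symm_apply θ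
  have hΘe : ∀ α, e.symm (Θ α) = α := fun α => e.symm_apply_apply α
  have hde : ∀ θ, HasDerivAt e.symm (rate p a b (e.symm θ))⁻¹ θ := fun θ =>
    HasDerivAt.of_local_left_inverse e.symm.continuous.continuousAt (hd _)
      (rate_pos hp ha hb _).ne' (Eventually.of_forall heΘ)
  have hsadd : ∀ θ, e.symm (θ + T) = e.symm θ + 2 * Real.pi := fun θ => by
    rw [← hΘe (e.symm θ + 2 * Real.pi), hadd, heΘ]
  have hdC : ∀ θ, HasDerivAt (fun θ => cpos p a b (e.symm θ)) (phi (cexpo p) (cmom p a b (e.symm θ))) θ :=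
    fun θ => ((hasDerivAt_cpos hp ha hb _).comp θ (hde θ)).congr_deriv (by
      have := (rate_pos hp ha hb (e.symm θ)).ne'
      field_simp)
  have hperC : Function.Periodic (fun θ => cpos p a b (e.symm θ)) T := fun θ => by
    simp [hsadd, cpos, ray]
  have hperS : Function.Periodic (fun θ => cmom p a b (e.symm θ)) T := fun θ => by
    simp [hsadd, cmom, ray]
  refine ⟨fun θ => cpos p a b (e.symm θ), fun θ => cmom p a b (e.symm θ), hT0, hdC,
    fun θ => ((hasDerivAt_cmom hp ha hb _).comp θ (hde θ)).congr_deriv ?_,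
    fun θ => energy_curve hp ha hb _, hperC, hperS, ?_, ?_, ?_⟩
  · have := (rate_pos hp ha hb (e.symm θ)).ne'
    field_simp
  · have h := intervalIntegral.integral_comp_mul_deriv (a := 0) (b := 2 * Real.pi)
      (fun α _ => hd α) hrc.continuousOn ((continuous_cpos hp ha hb).comp e.symm.continuous)
    rw [hΘ0] at h
    change _ ≠ _
    have h2 := full_cpos_ne hp ha hb hab
    simp only [Function.comp_def, hΘe] at h
    rw [h] at h2
    exact h2
  · intro x y hxy
    obtain ⟨μ, hμ, α, h1, h2⟩ := exists_angle_of_ne hp hxy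
    have hN := ray_pos hp ha hb α
    have hmem := toIcoMod_mem_Ico hT0 0 (Θ α)
    rw [zero_add] at hmem
    have hmod : toIcoMod hT0 0 (Θ α) = Θ α - toIcoDiv hT0 0 (Θ α) • T := rfl
    refine ⟨μ⁻¹ * ray p a b α ^ (1 / p), by positivity, toIcoMod hT0 0 (Θ α), ⟨hmem.1, hmem.2.le⟩, ?_, ?_⟩
    · have h3 := hperC.sub_zsmul_eq (x := Θ α) (toIcoDiv hT0 0 (Θ α))
      simp only [← hmod, hΘe] at h3
      rw [h3, cpos, Real.rpow_neg hN.le, ← h1]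
      have : 0 < ray p a b α ^ (1 / p) := by positivity
      field_simp
    · have h3 := hperS.sub_zsmul_eq (x := Θ α) (toIcoDiv hT0 0 (Θ α))
      simp only [← hmod, hΘe] at h3
      rw [h3, cmom, Real.rpow_neg hN.le, ← h2, Real.mul_rpow (by positivity) (by positivity),
        Real.inv_rpow hμ.le, ← Real.rpow_mul hN.le, inv_cexpo hp,
        show 1 / p * (p - 1) = 1 - 1 / p by field_simp]
      have : 0 < ray p a b α ^ (1 - 1 / p) := by positivity
      have : 0 < μ ^ (p - 1) := by positivity
      field_simp
  · intro r r' θ θ' hr hr' h1 h2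
    have hE : ∀ r θ, 0 < r → |r ^ (p - 1) * cmom p a b (e.symm θ)| ^ cexpo p +
        pot p a b (r * cpos p a b (e.symm θ)) = r ^ p := fun r θ hr => by
      rw [pot_mul hr, abs_mul, abs_of_pos (by positivity : 0 < r ^ (p - 1)),
        Real.mul_rpow (by positivity) (abs_nonneg _), ← Real.rpow_mul hr.le,
        show (p - 1) * cexpo p = p by rw [cexpo]; field_simp, ← mul_add, energy_curve hp ha hb, mul_one]
    have hrr : r = r' := by
      have h3 := hE r θ hr
      rw [h1, h2, hE r' θ' hr'] at h3
      exact (Real.rpow_left_injOn hp0.ne' hr.le hr'.le h3.symm)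
    subst hrr
    refine ⟨rfl, ?_⟩
    obtain ⟨n, hn⟩ := cpos_cmom_inj hp ha hb (mul_left_cancel₀ hr.ne' h1)
      (mul_left_cancel₀ (by positivity) h2)
    refine ⟨n, ?_⟩
    rw [← heΘ θ', hn, haddn, heΘ]

end

/-- Regularity and boundedness of the forcing `G_x(x,t) + f(t)` with period `P`. -/
structure Forcing (P B : ℝ) (G : ℝ → ℝ → ℝ) (f : ℝ → ℝ) : Prop where
  P_pos : 0 < P
  B_one : 1 ≤ B
  smG : ContDiff ℝ 21 (fun z : ℝ × ℝ => G z.1 z.2)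
  smf : ContDiff ℝ 21 f
  perG : ∀ x t, G x (t + P) = G x t
  perf : ∀ t, f (t + P) = f t
  bdx : ∀ i, i ≤ 21 → ∀ x t, |iteratedDeriv i (fun y => G y t) x| ≤ B
  bdt : ∀ j, j ≤ 21 → ∀ x t, |iteratedDeriv j (G x) t| ≤ B
  bdf : ∀ j, j ≤ 21 → ∀ t, |iteratedDeriv j f t| ≤ B

/-- A smooth `1`-periodic function equal to the identity near `0`. -/
noncomputable def wrap (w : ℝ) : ℝ :=
  (⟨3 / 4, 9 / 10, by norm_num, by norm_num⟩ : ContDiffBump (0 : ℝ)) (Real.sin (2 * Real.pi * w)) *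
    Real.arcsin (Real.sin (2 * Real.pi * w)) / (2 * Real.pi)

lemma wrap_eq {w : ℝ} (hw : |w| ≤ 1 / 8) : wrap w = w := by
  have hpi := Real.pi_pos
  have h1 := abs_le.1 hw
  have h2 : Real.arcsin (Real.sin (2 * Real.pi * w)) = 2 * Real.pi * w :=
    Real.arcsin_sin (by nlinarith) (by nlinarith)
  have h3 : |Real.sin (2 * Real.pi * w)| ≤ 3 / 4 := by
    rw [← abs_of_pos (by norm_num : (0 : ℝ) < 3 / 4), ← sq_le_sq, Real.sin_sq]
    have : √2 / 2 ≤ Real.cos (2 * Real.pi * w) := by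
      rw [← Real.cos_pi_div_four, ← Real.cos_abs (2 * Real.pi * w)]
      refine Real.cos_le_cos_of_nonneg_of_le_pi (abs_nonneg _) (by linarith) ?_
      rw [abs_mul, abs_of_pos (by positivity)]; nlinarith
    have h4 : (√2 / 2) ^ 2 ≤ Real.cos (2 * Real.pi * w) ^ 2 := by gcongr
    rw [div_pow, Real.sq_sqrt (by norm_num)] at h4
    norm_num at h4 ⊢; linarith
  rw [wrap, ContDiffBump.one_of_mem_closedBall _ (by simpa using h3), h2]
  field_simp

lemma wrap_add_one (w : ℝ) : wrap (w + 1) = wrap w := by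
  simp only [wrap, mul_add, mul_one, Real.sin_add_two_pi]

lemma contDiff_wrap : ContDiff ℝ 21 wrap := by
  set φ : ContDiffBump (0 : ℝ) := ⟨3 / 4, 9 / 10, by norm_num, by norm_num⟩ with hφ
  have hg : ContDiff ℝ 21 fun s : ℝ => φ s * Real.arcsin s := by
    rw [contDiff_iff_contDiffAt]
    intro s
    rcases lt_or_ge |s| 1 with hs | hs
    · exact φ.contDiff.contDiffAt.mul (Real.contDiffAt_arcsin (by linarith [neg_abs_le s] : -1 < s).ne'
        (by linarith [le_abs_self s] : s < 1).ne)
    · have : (fun s : ℝ => φ s * Real.arcsin s) =ᶠ[𝓝 s] fun _ => 0 := by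
        have h9 : ∀ᶠ t in 𝓝 s, 9 / 10 < |t| :=
          continuous_abs.continuousAt.eventually (lt_mem_nhds (by linarith))
        filter_upwards [h9] with t ht
        rw [φ.zero_of_le_dist (by simpa [hφ] using ht.le), zero_mul]
      exact contDiffAt_const.congr_of_eventuallyEq this
  have : ContDiff ℝ 21 fun w : ℝ => Real.sin (2 * Real.pi * w) := Real.contDiff_sin.comp (by fun_prop)
  exact (hg.comp this).div_const _

lemma periodic_bounded {c : ℝ} {F : ℝ → ℝ} (hc : c ≠ 0) (hF : Continuous F) (hper : ∀ x, F (x + c) = F x) :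
    ∃ M ≥ 1, ∀ x, |F x| ≤ M := by
  obtain ⟨M, hM⟩ := (Function.Periodic.compact_of_continuous (f := F) hper hc hF).isBounded.exists_norm_le
  exact ⟨max M 1, le_max_right _ _, fun x => (hM _ (mem_range_self x)).trans (le_max_left _ _)⟩

lemma iteratedDeriv_periodic {c : ℝ} {F : ℝ → ℝ} (hper : ∀ x, F (x + c) = F x) (i : ℕ) (x : ℝ) :
    iteratedDeriv i F (x + c) = iteratedDeriv i F x := by
  have h := congrFun (iteratedDeriv_comp_add_const i F c) x
  simp only [hper] at h
  exact h.symm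

lemma exists_iteratedDeriv_le {c : ℝ} {F : ℝ → ℝ} (hc : c ≠ 0) (hF : ContDiff ℝ 21 F)
    (hper : ∀ x, F (x + c) = F x) : ∃ D ≥ 1, ∀ i ≤ 21, ∀ w, |iteratedDeriv i F w| ≤ D := by
  have h : ∀ i : ℕ, ∃ M ≥ 1, i ≤ 21 → ∀ w, |iteratedDeriv i F w| ≤ M := fun i => by
    by_cases hi : i ≤ 21
    · obtain ⟨M, hM, hb⟩ := periodic_bounded hc (hF.continuous_iteratedDeriv i
        (by exact_mod_cast hi)) (iteratedDeriv_periodic hper i)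
      exact ⟨M, hM, fun _ => hb⟩
    · exact ⟨1, le_rfl, fun h => absurd h hi⟩
  choose M hM1 hM using h
  have hle : ∀ i ∈ Finset.range 22, M i ≤ ∑ j ∈ Finset.range 22, M j := fun i hi =>
    Finset.single_le_sum (f := M) (fun j _ => by linarith [hM1 j]) hi
  exact ⟨_, (hM1 0).trans (hle 0 (by simp)), fun i hi w => (hM i hi w).trans (hle i (by simp; omega))⟩

lemma wrap_bounds : ∃ D ≥ 1, (∀ w, |wrap w| ≤ D) ∧
    ∀ i, 1 ≤ i → i ≤ 21 → ∀ w, |iteratedDeriv i wrap w| ≤ D ^ i := by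
  obtain ⟨D, h1, hD⟩ := exists_iteratedDeriv_le one_ne_zero (contDiff_wrap.of_le (by norm_num)) wrap_add_one
  exact ⟨D, h1, fun w => by simpa using hD 0 (by norm_num) w, fun i h1i hi w =>
    (hD i hi w).trans (le_self_pow₀ h1 (by omega))⟩

section
variable {p a b T P B : ℝ} {C S : ℝ → ℝ} {G : ℝ → ℝ → ℝ} {f : ℝ → ℝ}

lemma Curve.contC (hc : Curve p a b T C S) : Continuous C :=
  continuous_iff_continuousAt.2 fun θ => (hc.dC θ).continuousAt

lemma Curve.contS (hc : Curve p a b T C S) : Continuous S :=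
  continuous_iff_continuousAt.2 fun θ => (hc.dS θ).continuousAt

lemma Forcing.contG (hF : Forcing P B G f) : Continuous fun z : ℝ × ℝ => G z.1 z.2 := hF.smG.continuous

lemma Forcing.smGx (hF : Forcing P B G f) (t : ℝ) : ContDiff ℝ 21 fun x => G x t :=
  hF.smG.comp (contDiff_id.prodMk contDiff_const)

lemma Forcing.smGt (hF : Forcing P B G f) (x : ℝ) : ContDiff ℝ 21 (G x) :=
  hF.smG.comp (contDiff_const.prodMk contDiff_id)

/-- The rescaled perturbation on the torus. -/
noncomputable def pert (p A R T P : ℝ) (C : ℝ → ℝ) (G : ℝ → ℝ → ℝ) (f : ℝ → ℝ) (y θ t w : ℝ) : ℝ :=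
  (G ((max y R + A * 32 * wrap w) * C (T * θ)) (P * t) +
    f (P * t) * ((max y R + A * 32 * wrap w) * C (T * θ))) / (A * max y R ^ (p - 1))

lemma scale_le (hp : 2 ≤ p) {A R y : ℝ} (hA : 1 ≤ A) (hR : 1 ≤ R) :
    R ≤ max y R ∧ A * max y R ≤ A * max y R ^ (p - 1) := by
  have h1 : R ≤ max y R := le_max_right _ _
  refine ⟨h1, mul_le_mul_of_nonneg_left ?_ (by linarith)⟩
  simpa using Real.rpow_le_rpow_of_exponent_le (by linarith : 1 ≤ max y R) (by linarith : 1 ≤ p - 1)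

lemma iteratedDeriv_pert_t (hF : Forcing P B G f) {A R : ℝ} (y θ w t : ℝ) (j : ℕ) (hj : j ≤ 21) :
    iteratedDeriv j (fun t => pert p A R T P C G f y θ t w) t =
      P ^ j * (iteratedDeriv j (G ((max y R + A * 32 * wrap w) * C (T * θ))) (P * t) +
        ((max y R + A * 32 * wrap w) * C (T * θ)) * iteratedDeriv j f (P * t)) /
        (A * max y R ^ (p - 1)) := by
  set X := (max y R + A * 32 * wrap w) * C (T * θ)
  have hj' : (j : WithTop ℕ∞) ≤ 21 := by exact_mod_cast hj
  have s1 : ContDiff ℝ j fun s => G X s := (hF.smGt X).of_le hj'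
  have s2 : ContDiff ℝ j fun s => X * f s := (contDiff_const.mul (hF.smf.of_le hj'))
  have h := congrFun (iteratedDeriv_comp_const_mul (f := fun s => G X s + X * f s) (s1.add s2) P) t
  rw [iteratedDeriv_fun_add s1.contDiffAt s2.contDiffAt, iteratedDeriv_const_mul_field] at h
  simp only [pert]
  rw [iteratedDeriv_div_const, ← h]
  simp only [mul_comm, X]

lemma abs_pert_t_le (hp : 2 ≤ p) (hF : Forcing P B G f) {A R M D : ℝ} (hA : 1 ≤ A) (hR : 1 ≤ R)
    (hM : 1 ≤ M) (hCM : ∀ θ, |C θ| ≤ M) (hD : 1 ≤ D) (hwD : ∀ w, |wrap w| ≤ D)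
    (y θ w t : ℝ) (j : ℕ) (hj : j ≤ 21) :
    |iteratedDeriv j (fun t => pert p A R T P C G f y θ t w) t| ≤
      P ^ j * (B * M / A) + P ^ j * (B * (1 + A * 32 * D * M)) / R := by
  obtain ⟨h1, h2⟩ := scale_le (y := y) hp hA hR
  have hP := hF.P_pos
  have hB := hF.B_one
  rw [iteratedDeriv_pert_t hF _ _ _ _ _ hj, abs_div, abs_mul, abs_of_pos (pow_pos hP j)]
  have hX : |(max y R + A * 32 * wrap w) * C (T * θ)| ≤ (max y R + A * 32 * D) * M := by
    rw [abs_mul]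
    gcongr
    · refine (abs_add_le _ _).trans (add_le_add (abs_of_pos (by linarith)).le ?_)
      rw [abs_mul, abs_of_pos (by positivity)]
      gcongr; exact hwD w
    · exact hCM _
  have hnum : |iteratedDeriv j (G ((max y R + A * 32 * wrap w) * C (T * θ))) (P * t) +
        ((max y R + A * 32 * wrap w) * C (T * θ)) * iteratedDeriv j f (P * t)| ≤
      B + (max y R + A * 32 * D) * M * B := by
    refine (abs_add_le _ _).trans (add_le_add (hF.bdt j hj _ _) ?_)
    rw [abs_mul]
    exact mul_le_mul hX (hF.bdf j hj _) (abs_nonneg _) (by positivity)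
  have hy0 : 0 < max y R := by linarith
  have hden : 0 < A * max y R := by positivity
  rw [abs_of_pos (by linarith : 0 < A * max y R ^ (p - 1))]
  calc P ^ j * |_| / (A * max y R ^ (p - 1))
      ≤ P ^ j * (B + (max y R + A * 32 * D) * M * B) / (A * max y R) := by gcongr
    _ = P ^ j * (B * M / A) + P ^ j * (B * (1 + A * 32 * D * M)) / (A * max y R) := by
        field_simp; ring
    _ ≤ _ := by
        gcongr
        nlinarith

lemma abs_pert_w_le (hp : 2 ≤ p) (hF : Forcing P B G f) {A R M D : ℝ} (hA : 1 ≤ A) (hR : 1 ≤ R)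
    (hM : 1 ≤ M) (hCM : ∀ θ, |C θ| ≤ M) (hD : 1 ≤ D)
    (hwi : ∀ i, 1 ≤ i → i ≤ 21 → ∀ w, |iteratedDeriv i wrap w| ≤ D ^ i) (y θ t w : ℝ) :
    |iteratedDeriv 21 (fun w => pert p A R T P C G f y θ t w) w| ≤
      ((21).factorial * ((1 + A * 32 * M) ^ 21 * B) * D ^ 21 + B * (A * 32 * M) * D ^ 21) / R := by
  obtain ⟨h1, h2⟩ := scale_le (y := y) hp hA hR
  have hB := hF.B_one
  set c0 := max y R * C (T * θ) with hc0
  set c1 := A * 32 * C (T * θ) with hc1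
  have hc1M : |c1| ≤ A * 32 * M := by
    rw [hc1, abs_mul, abs_of_pos (by positivity)]; gcongr; exact hCM _
  set g : ℝ → ℝ := fun σ => G (c0 + c1 * σ) (P * t) with hg
  have sg : ContDiff ℝ 21 g := (hF.smGx (P * t)).comp (by fun_prop)
  have hgi : ∀ i ≤ 21, ∀ σ, |iteratedDeriv i g σ| ≤ (1 + A * 32 * M) ^ 21 * B := fun i hi σ => by
    have hi' : (i : WithTop ℕ∞) ≤ 21 := by exact_mod_cast hi
    have e1 := congrFun (iteratedDeriv_comp_const_add i (fun x => G x (P * t)) c0)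
    have e2 := congrFun (iteratedDeriv_comp_const_mul
      (f := fun s => G (c0 + s) (P * t)) (((hF.smGx (P * t)).of_le hi').comp (by fun_prop)) c1) σ
    simp only [hg]
    rw [e2, e1, abs_mul, abs_pow]
    have h3 : |c1| ^ i ≤ (1 + A * 32 * M) ^ 21 :=
      calc |c1| ^ i ≤ (1 + A * 32 * M) ^ i := by gcongr; linarith
        _ ≤ _ := pow_le_pow_right₀ (by nlinarith) hi
    exact mul_le_mul h3 (hF.bdx i hi _ _) (abs_nonneg _) (by positivity)
  have hcomp : |iteratedDeriv 21 (g ∘ wrap) w| ≤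
      (21).factorial * ((1 + A * 32 * M) ^ 21 * B) * D ^ 21 := by
    have h := norm_iteratedFDeriv_comp_le sg contDiff_wrap (n := 21) le_rfl w
      (C := (1 + A * 32 * M) ^ 21 * B) (D := D)
      (fun i hi => by rw [norm_iteratedFDeriv_eq_norm_iteratedDeriv]; exact hgi i hi _)
      (fun i h1i hi => by rw [norm_iteratedFDeriv_eq_norm_iteratedDeriv]; exact hwi i h1i hi w)
    rwa [norm_iteratedFDeriv_eq_norm_iteratedDeriv] at h
  have heq : (fun w => pert p A R T P C G f y θ t w) =
      fun w => ((g ∘ wrap) w + (f (P * t) * c0 + f (P * t) * c1 * wrap w)) / (A * max y R ^ (p - 1)) := by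
    funext w
    simp only [pert, Function.comp, hg, hc0, hc1]
    congr 2
    · congr 1; ring
    · ring
  have s1 : ContDiff ℝ 21 (g ∘ wrap) := sg.comp contDiff_wrap
  have s2 : ContDiff ℝ 21 fun w => f (P * t) * c0 + f (P * t) * c1 * wrap w :=
    contDiff_const.add (contDiff_const.mul contDiff_wrap)
  rw [heq, iteratedDeriv_div_const, iteratedDeriv_fun_add s1.contDiffAt s2.contDiffAt,
    iteratedDeriv_const_add (by norm_num), iteratedDeriv_const_mul_field, abs_div]
  have hRle : R ≤ A * max y R ^ (p - 1) := by nlinarith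
  rw [abs_of_pos (by linarith : 0 < A * max y R ^ (p - 1))]
  have h4 : |f (P * t) * c1 * iteratedDeriv 21 wrap w| ≤ B * (A * 32 * M) * D ^ 21 := by
    have hf0 := hF.bdf 0 (by norm_num) (P * t)
    rw [iteratedDeriv_zero] at hf0
    rw [abs_mul, abs_mul]
    have := hwi 21 (by norm_num) le_rfl w
    gcongr
  gcongr
  exact (abs_add_le _ _).trans (add_le_add hcomp h4)

lemma torusFamily_pert (hp : 2 ≤ p) (hc : Curve p a b T C S) (hF : Forcing P B G f) {ε : ℝ} (hε : 0 < ε) :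
    ∃ A ≥ 1, ∃ R₀ ≥ 1, ∀ R ≥ R₀, TorusFamily ε (pert p A R T P C G f) := by
  obtain ⟨D, hD, hwD, hwi⟩ := wrap_bounds
  obtain ⟨M, hM, hCM⟩ := periodic_bounded hc.T_pos.ne' hc.contC hc.perC
  have hP := hF.P_pos
  have hB := hF.B_one
  obtain ⟨Q, hQ0, hQ1⟩ : ∃ Q : ℝ, P ^ 0 ≤ Q ∧ P ^ 21 ≤ Q := ⟨_, le_max_left _ _, le_max_right _ _⟩
  have hQp : 0 < Q := lt_of_lt_of_le (by simp) hQ0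
  obtain ⟨A, hA, hA2⟩ : ∃ A ≥ 1, Q * (B * M / A) ≤ ε / 2 := by
    refine ⟨1 + 2 * (Q * (B * M)) / ε, by rw [ge_iff_le, le_add_iff_nonneg_right]; positivity, ?_⟩
    rw [← mul_div_assoc, div_le_iff₀ (by positivity)]
    field_simp
    linarith
  obtain ⟨E1, hE1p, hE1⟩ : ∃ E1 > 0, Q * (B * (1 + A * 32 * D * M)) ≤ E1 :=
    ⟨_, by positivity, le_rfl⟩
  obtain ⟨E2, hE2p, hE2⟩ : ∃ E2 > 0,
      (21).factorial * ((1 + A * 32 * M) ^ 21 * B) * D ^ 21 + B * (A * 32 * M) * D ^ 21 ≤ E2 :=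
    ⟨_, by positivity, le_rfl⟩
  refine ⟨A, hA, 1 + 2 * (E1 + E2) / ε, by rw [ge_iff_le, le_add_iff_nonneg_right]; positivity,
    fun R hR => ?_⟩
  have hR1 : 1 ≤ R := le_trans (by rw [le_add_iff_nonneg_right]; positivity) hR
  have hRE : 2 * (E1 + E2) ≤ R * ε := by
    have h3 : 2 * (E1 + E2) / ε ≤ R := by linarith
    rwa [div_le_iff₀ hε] at h3
  have hR2 : E1 / R ≤ ε / 2 := by rw [div_le_iff₀ (by linarith)]; linarith
  have hR3 : E2 / R ≤ ε := by rw [div_le_iff₀ (by linarith)]; linarith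
  have hbt : ∀ j ≤ 21, (P ^ j : ℝ) ≤ Q → ∀ y θ w t,
      |iteratedDeriv j (fun t => pert p A R T P C G f y θ t w) t| ≤ ε := fun j hj hPj y θ w t => by
    refine (abs_pert_t_le hp hF hA hR1 hM hCM hD hwD y θ w t j hj).trans ?_
    have h3 : P ^ j * (B * M / A) ≤ Q * (B * M / A) := by gcongr
    have h4 : P ^ j * (B * (1 + A * 32 * D * M)) / R ≤ E1 / R := by
      gcongr
      refine le_trans ?_ hE1
      gcongr
    linarith
  have hCc := hc.contC
  have hwc := contDiff_wrap.continuous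
  have hmpos : ∀ y, 0 < max y R := fun y => lt_of_lt_of_le (by linarith) (le_max_right y R)
  refine ⟨?_, fun y θ t w => ?_, fun y θ t w => ?_, fun y θ t w => ?_, fun y θ w => ?_, fun y θ t => ?_,
    fun y θ t w => ?_, fun y θ w t => hbt 21 le_rfl hQ1 y θ w t,
    fun y θ t w => (abs_pert_w_le hp hF hA hR1 hM hCM hD hwi y θ t w).trans
      ((div_le_div_of_nonneg_right hE2 (by linarith)).trans hR3)⟩
  · have hX : Continuous fun q : (ℝ × ℝ) × (ℝ × ℝ) =>
        (max q.1.1 R + A * 32 * wrap q.2.2) * C (T * q.1.2) := by fun_prop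
    have h5 : Continuous fun q : (ℝ × ℝ) × (ℝ × ℝ) => A * max q.1.1 R ^ (p - 1) :=
      continuous_const.mul ((by fun_prop : Continuous fun q : (ℝ × ℝ) × (ℝ × ℝ) =>
        max q.1.1 R).rpow_const fun q => Or.inl (hmpos _).ne')
    have hfc := hF.smf.continuous
    refine Continuous.div ?_ h5 fun q => ?_
    · exact (hF.contG.comp (hX.prodMk (by fun_prop : Continuous fun q : (ℝ × ℝ) × (ℝ × ℝ) =>
        P * q.2.1))).add ((by fun_prop : Continuous fun q : (ℝ × ℝ) × (ℝ × ℝ) => f (P * q.2.1)).mul hX)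
    · have := hmpos q.1.1
      positivity
  · simp only [pert, mul_add, mul_one, hc.perC]
  · simp only [pert, mul_add, mul_one, hF.perG, hF.perf]
  · simp only [pert, wrap_add_one]
  · have h6 := hF.smGt ((max y R + A * 32 * wrap w) * C (T * θ))
    have h7 := hF.smf
    exact ((h6.comp (by fun_prop : ContDiff ℝ 21 fun t : ℝ => P * t)).add ((h7.comp
      (by fun_prop : ContDiff ℝ 21 fun t : ℝ => P * t)).mul contDiff_const)).div_const _
  · have h6 := hF.smGx (P * t)
    have h7 : ContDiff ℝ 21 fun w : ℝ => (max y R + A * 32 * wrap w) * C (T * θ) :=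
      (contDiff_const.add (contDiff_const.mul contDiff_wrap)).mul contDiff_const
    exact ((h6.comp h7).add (contDiff_const.mul h7)).div_const _
  · simpa using hbt 0 (by norm_num) hQ0 y θ w t

end

/-- The radius of the curve with rescaled action `I`, centred at radius `r0`. -/
noncomputable def rad (p A r0 I : ℝ) : ℝ := r0 * (1 + cexpo p * A / r0 * I) ^ (1 / p)

/-- The rescaled radius as a holomorphic function of the rescaled action. -/
noncomputable def actionRad (p A R : ℝ) (y : ℝ) (z : ℂ) : ℂ :=
  ((max y R / A : ℝ) : ℂ) * ((1 + ((cexpo p * A / max y R : ℝ) : ℂ) * z) ^ ((1 / p : ℝ) : ℂ) - 1) / 32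

section
variable {p A R : ℝ}

lemma scale_bounds (hp : 2 ≤ p) (hA : 1 ≤ A) (hR : 24 * A ≤ R) (y : ℝ) :
    0 < max y R ∧ 0 < cexpo p * A / max y R ∧ cexpo p * A / max y R ≤ 1 / 12 := by
  have h1 := one_lt_cexpo hp
  have h2 := cexpo_le_two hp
  have h3 : 24 * A ≤ max y R := hR.trans (le_max_right _ _)
  have h4 : 0 < max y R := by linarith
  refine ⟨h4, by positivity, ?_⟩
  rw [div_le_iff₀ h4]; nlinarith

lemma half_le_re (hp : 2 ≤ p) (hA : 1 ≤ A) (hR : 24 * A ≤ R) (y : ℝ) {z : ℂ} (hz : z ∈ square) :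
    1 / 2 ≤ (1 + ((cexpo p * A / max y R : ℝ) : ℂ) * z).re := by
  obtain ⟨-, h1, h2⟩ := scale_bounds hp hA hR y
  have h3 := (abs_lt.1 hz.1).1
  rw [add_re, re_ofReal_mul, one_re]
  nlinarith

lemma hasDerivAt_actionRad (hp : 2 ≤ p) (hA : 1 ≤ A) (hR : 24 * A ≤ R) (y : ℝ) {z : ℂ} (hz : z ∈ square) :
    ∃ d, HasDerivAt (actionRad p A R y) d z ∧ ‖d‖ ≤ 1 / 16 := by
  obtain ⟨h0, h1, h2⟩ := scale_bounds hp hA hR y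
  have h3 := half_le_re hp hA hR y hz
  have h1p : 0 < 1 / p ∧ 1 / p ≤ 1 / 2 := ⟨by positivity, by gcongr⟩
  have hq2 := cexpo_le_two hp
  have hq1 := one_lt_cexpo hp
  set κ : ℝ := cexpo p * A / max y R with hκ
  have hd : HasDerivAt (fun z : ℂ => 1 + (κ : ℂ) * z) (κ : ℂ) z := by
    simpa using ((hasDerivAt_id z).const_mul (κ : ℂ)).const_add 1
  have hd2 := (((hd.cpow_const (c := ((1 / p : ℝ) : ℂ)) (Or.inl (by linarith))).sub_const 1).const_mul
    ((max y R / A : ℝ) : ℂ)).div_const 32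
  refine ⟨_, hd2, ?_⟩
  have hcast : ((1 / p : ℝ) : ℂ) - 1 = ((1 / p - 1 : ℝ) : ℂ) := by push_cast; ring
  have hn : 1 / 2 ≤ ‖1 + (κ : ℂ) * z‖ := h3.trans ((le_abs_self _).trans (abs_re_le_norm _))
  have hpow : ‖1 + (κ : ℂ) * z‖ ^ (1 / p - 1) ≤ 2 := by
    calc ‖1 + (κ : ℂ) * z‖ ^ (1 / p - 1) ≤ (1 / 2 : ℝ) ^ (1 / p - 1) :=
          Real.rpow_le_rpow_of_nonpos (by norm_num) hn (by linarith)
      _ ≤ (1 / 2 : ℝ) ^ (-1 : ℝ) :=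
          Real.rpow_le_rpow_of_exponent_ge (by norm_num) (by norm_num) (by linarith)
      _ = 2 := by rw [Real.rpow_neg_one]; norm_num
  rw [norm_div, norm_mul, norm_mul, norm_mul, hcast,
    Complex.norm_cpow_real, norm_real, norm_real, norm_real, Real.norm_eq_abs, Real.norm_eq_abs,
    Real.norm_eq_abs, abs_of_pos (by positivity : 0 < max y R / A), abs_of_pos h1, abs_of_pos h1p.1]
  have h5 : max y R / A * κ = cexpo p := by rw [hκ]; field_simp
  rw [show max y R / A * (1 / p * ‖1 + (κ : ℂ) * z‖ ^ (1 / p - 1) * κ) =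
    cexpo p * (1 / p) * ‖1 + (κ : ℂ) * z‖ ^ (1 / p - 1) by rw [← h5]; ring]
  have h6 : cexpo p * (1 / p) ≤ 1 := by nlinarith
  have h7 : 0 ≤ ‖1 + (κ : ℂ) * z‖ ^ (1 / p - 1) := by positivity
  norm_num
  rw [div_le_iff₀ (by norm_num)]
  rw [one_div] at h6
  norm_num at h7 hpow ⊢
  nlinarith [mul_le_mul h6 hpow h7 zero_le_one]

lemma actionRad_lip (hp : 2 ≤ p) (hA : 1 ≤ A) (hR : 24 * A ≤ R) (y : ℝ) {z z' : ℂ}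
    (hz : z ∈ square) (hz' : z' ∈ square) :
    ‖actionRad p A R y z - actionRad p A R y z'‖ ≤ 1 / 16 * ‖z - z'‖ := by
  have hconv : Convex ℝ square := by
    have : square = re ⁻¹' {x | |x| < 3} ∩ im ⁻¹' {x | |x| < 3} := rfl
    have h3 : ({x | |x| < 3} : Set ℝ) = Ioo (-3) 3 := by ext; simp [abs_lt]
    rw [this, h3]
    exact ((convex_Ioo _ _).linear_preimage reLm).inter ((convex_Ioo _ _).linear_preimage imLm)
  refine hconv.norm_image_sub_le_of_norm_deriv_le (𝕜 := ℂ) (fun w hw => ?_) (fun w hw => ?_) hz' hz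
  · obtain ⟨d, hd, -⟩ := hasDerivAt_actionRad hp hA hR y hw
    exact hd.differentiableAt
  · obtain ⟨d, hd, hb⟩ := hasDerivAt_actionRad hp hA hR y hw
    rwa [hd.deriv]

lemma actionRad_ofReal (hp : 2 ≤ p) (hA : 1 ≤ A) (hR : 24 * A ≤ R) (y : ℝ) {x : ℝ} (hx : |x| < 3) :
    actionRad p A R y (x : ℂ) = ((rad p A (max y R) x - max y R) / A / 32 : ℝ) := by
  have hz : (x : ℂ) ∈ square := ⟨by simpa using hx, by simp⟩
  have h := half_le_re hp hA hR y hz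
  simp only [add_re, re_ofReal_mul, one_re, ofReal_re] at h
  rw [actionRad, ← ofReal_mul, ← ofReal_one, ← ofReal_add, ← ofReal_cpow (by linarith), rad]
  push_cast; ring

lemma actionMap_actionRad (hp : 2 ≤ p) (hA : 1 ≤ A) (hR : 24 * A ≤ R) : ActionMap (actionRad p A R) := by
  refine ⟨?_, fun y => ?_, fun y x hx => ?_, fun y z hz z' hz' => ?_⟩
  · have hm : Continuous fun q : ℝ × ℂ => max q.1 R := by fun_prop
    have h1 : Continuous fun q : ℝ × ℂ => 1 + ((cexpo p * A / max q.1 R : ℝ) : ℂ) * q.2 :=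
      continuous_const.add ((continuous_ofReal.comp (continuous_const.div hm
        fun q => (scale_bounds hp hA hR q.1).1.ne')).mul continuous_snd)
    have h2 : Continuous fun q : ℝ × ℂ => ((max q.1 R / A : ℝ) : ℂ) :=
      continuous_ofReal.comp (hm.div_const _)
    exact (h2.continuousOn.mul ((h1.continuousOn.cpow continuousOn_const fun q hq =>
      Or.inl (by linarith [half_le_re hp hA hR q.1 hq.2])).sub continuousOn_const)).div_const _
  · refine DifferentiableOn.analyticOnNhd (fun z hz => ?_) isOpen_square
    obtain ⟨d, hd, -⟩ := hasDerivAt_actionRad hp hA hR y hz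
    exact hd.differentiableAt.differentiableWithinAt
  · rw [actionRad_ofReal hp hA hR y hx, ofReal_im]
  · linarith [actionRad_lip hp hA hR y hz hz', norm_nonneg (z - z')]

end

theorem exists_torus {p a b T P B γ ω η : ℝ} {C S : ℝ → ℝ} {G : ℝ → ℝ → ℝ} {f : ℝ → ℝ} (hp : 2 ≤ p)
    (hc : Curve p a b T C S) (hF : Forcing P B G f) (hγ : 0 < γ) (hω : 0 < ω) (hη : 0 < η)
    (hη4 : η ≤ 1 / 4) :
    ∃ A ≥ 1, ∃ R₀ ≥ 24 * A, ∀ R ≥ R₀, ∀ β, Dioph γ β → ∃ k kt kh l u v,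
      KamTorus β ω η k kt kh l u v ∧ ∀ y θ t h, |h| < 1 → |k y θ t h / ω - h| ≤ 1 / 2 ∧
        rad p A (max y R) (k y θ t h / ω) ^ p / cexpo p -
          (G (rad p A (max y R) (k y θ t h / ω) * C (T * θ)) (P * t) +
            f (P * t) * (rad p A (max y R) (k y θ t h / ω) * C (T * θ))) =
        max y R ^ p / cexpo p + A * max y R ^ (p - 1) * h := by
  obtain ⟨ε, hε, H⟩ := exists_implicit_torus hγ hω hη hη4
  obtain ⟨A, hA, R₁, hR₁, hfam⟩ := torusFamily_pert hp hc hF hε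
  refine ⟨A, hA, max R₁ (24 * A), le_max_right _ _, fun R hR β hβ => ?_⟩
  have hR24 : 24 * A ≤ R := (le_max_right _ _).trans hR
  obtain ⟨k, kt, kh, l, u, v, hK, hk⟩ := H β _ _ hβ (hfam R ((le_max_left _ _).trans hR))
    (actionMap_actionRad hp hA hR24)
  refine ⟨k, kt, kh, l, u, v, hK, fun y θ t h hh => ?_⟩
  obtain ⟨h1, h2⟩ := hk y θ t h hh
  refine ⟨h1, ?_⟩
  obtain ⟨hm, hκ, hκ2⟩ := scale_bounds hp hA hR24 y
  set I := k y θ t h / ω with hI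
  have hI2 : |I| < 3 / 2 := by
    have := abs_add_le (I - h) h
    rw [sub_add_cancel] at this
    linarith
  have hI3 : |I| < 3 := by linarith
  rw [actionRad_ofReal hp hA hR24 y hI3, ofReal_re] at h2
  set r0 := max y R with hr0
  have hz : (I : ℂ) ∈ square := ⟨by simpa using hI3, by simp⟩
  have h0z : (0 : ℂ) ∈ square := by constructor <;> simp
  have hW0 : actionRad p A R y 0 = 0 := by simp [actionRad]
  have hW := actionRad_lip hp hA hR24 y hz h0z
  rw [hW0, sub_zero, sub_zero, actionRad_ofReal hp hA hR24 y hI3, norm_real, norm_real, ← hr0,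
    Real.norm_eq_abs, Real.norm_eq_abs] at hW
  have hwrap := wrap_eq (w := (rad p A r0 I - r0) / A / 32) (by linarith)
  have hpos : 0 < 1 + cexpo p * A / r0 * I := by
    have := (abs_lt.1 hI2).1
    nlinarith
  have hrp : rad p A r0 I ^ p = r0 ^ p * (1 + cexpo p * A / r0 * I) := by
    rw [rad, Real.mul_rpow hm.le (by positivity), ← Real.rpow_mul hpos.le, one_div_mul_cancel (by linarith),
      Real.rpow_one]
  have hq := one_lt_cexpo hp
  have hA0 : A ≠ 0 := by linarith
  rw [pert, ← hr0, hwrap, show r0 + A * 32 * ((rad p A r0 I - r0) / A / 32) = rad p A r0 I by field_simp; ring]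
    at h2
  have hpp : r0 ^ p = r0 * r0 ^ (p - 1) := by
    rw [← Real.rpow_one_add' hm.le (by linarith)]; congr 1; ring
  have hpm : 0 < r0 ^ (p - 1) := Real.rpow_pos_of_pos hm _
  rw [hrp]
  set Φ := G (rad p A r0 I * C (T * θ)) (P * t) + f (P * t) * (rad p A r0 I * C (T * θ)) with hΦ
  have h9 : A * r0 ^ (p - 1) * I = A * r0 ^ (p - 1) * h + Φ := by
    have h10 : (A * r0 ^ (p - 1)) * (Φ / (A * r0 ^ (p - 1))) = Φ := by field_simp
    rw [← h10, ← mul_add, ← h2]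
  rw [show r0 ^ p * (1 + cexpo p * A / r0 * I) / cexpo p = r0 ^ p / cexpo p + A * r0 ^ (p - 1) * I by
    rw [hpp]; field_simp]
  linarith

lemma hasDerivAt_of_implicit {F D : ℝ → ℝ → ℝ} {ρ : ℝ → ℝ} {θ₀ F' δ lo hi : ℝ} (hδ : 0 < δ)
    (hD : ∀ r ∈ Icc lo hi, ∀ θ, HasDerivAt (fun r => F r θ) (D r θ) r)
    (hDδ : ∀ r ∈ Icc lo hi, ∀ θ, δ ≤ D r θ)
    (hDc : ContinuousAt (fun q : ℝ × ℝ => D q.1 q.2) (ρ θ₀, θ₀))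
    (hρ : ∀ θ, ρ θ ∈ Icc lo hi) (hF : ∀ θ, F (ρ θ) θ = 0) (hF' : HasDerivAt (F (ρ θ₀)) F' θ₀) :
    HasDerivAt ρ (-F' / D (ρ θ₀) θ₀) θ₀ := by
  have hmv : ∀ θ, ∃ ξ ∈ uIcc (ρ θ₀) (ρ θ), ξ ∈ Icc lo hi ∧ F (ρ θ₀) θ = D ξ θ * (ρ θ₀ - ρ θ) := fun θ => by
    have key : ∀ s ∈ Icc lo hi, ∀ s' ∈ Icc lo hi, s < s' →
        ∃ ξ ∈ Icc s s', ξ ∈ Icc lo hi ∧ F s' θ - F s θ = D ξ θ * (s' - s) := fun s hs s' hs' hss => by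
      obtain ⟨ξ, hξ, he⟩ := exists_hasDerivAt_eq_slope (fun r => F r θ) (fun r => D r θ) hss
        (fun r hr => (hD r ⟨hs.1.trans hr.1, hr.2.trans hs'.2⟩ θ).continuousAt.continuousWithinAt)
        (fun r hr => hD r ⟨hs.1.trans hr.1.le, hr.2.le.trans hs'.2⟩ θ)
      refine ⟨ξ, Ioo_subset_Icc_self hξ, ⟨hs.1.trans hξ.1.le, hξ.2.le.trans hs'.2⟩, ?_⟩
      rw [he, div_mul_cancel₀ _ (by linarith)]
    rcases lt_trichotomy (ρ θ₀) (ρ θ) with h | h | h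
    · obtain ⟨ξ, h1, h2, h3⟩ := key _ (hρ _) _ (hρ _) h
      refine ⟨ξ, by rwa [uIcc_of_le h.le], h2, ?_⟩
      rw [hF] at h3; linarith
    · exact ⟨ρ θ₀, left_mem_uIcc, hρ _, by rw [h, hF]; ring⟩
    · obtain ⟨ξ, h1, h2, h3⟩ := key _ (hρ _) _ (hρ _) h
      refine ⟨ξ, by rwa [uIcc_of_ge h.le], h2, ?_⟩
      rw [hF] at h3; linarith
  choose ξ hξ hξI hξe using hmv
  have hFt : Tendsto (fun θ => F (ρ θ₀) θ) (𝓝 θ₀) (𝓝 0) := by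
    have := hF'.continuousAt.tendsto; rwa [hF] at this
  have hb : ∀ θ, |ξ θ - ρ θ₀| ≤ |F (ρ θ₀) θ| / δ := fun θ => by
    have h1 : |ξ θ - ρ θ₀| ≤ |ρ θ - ρ θ₀| := abs_sub_left_of_mem_uIcc (hξ θ)
    rw [le_div_iff₀ hδ, hξe θ, abs_mul, abs_sub_comm (ρ θ₀), mul_comm]
    have h2 := hDδ _ (hξI θ) θ
    rw [abs_of_pos (by linarith : 0 < D (ξ θ) θ)]
    exact mul_le_mul h2 h1 (abs_nonneg _) (by linarith)
  have hξt : Tendsto ξ (𝓝 θ₀) (𝓝 (ρ θ₀)) := by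
    rw [tendsto_iff_dist_tendsto_zero]
    refine squeeze_zero (fun _ => dist_nonneg) (fun θ => (Real.dist_eq _ _).trans_le (hb θ)) ?_
    simpa using hFt.abs.div_const δ
  have hDt : Tendsto (fun θ => D (ξ θ) θ) (𝓝 θ₀) (𝓝 (D (ρ θ₀) θ₀)) :=
    hDc.tendsto.comp (hξt.prodMk_nhds tendsto_id)
  rw [hasDerivAt_iff_tendsto_slope] at hF' ⊢
  have hpos := hDδ _ (hρ θ₀) θ₀
  refine (hF'.neg.div (hDt.mono_left nhdsWithin_le_nhds) (by linarith)).congr fun θ => ?_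
  have h2 := hDδ _ (hξI θ) θ
  have h3 : D (ξ θ) θ ≠ 0 := by linarith
  simp only [Pi.div_apply, slope_def_field, hF θ₀, hξe θ]
  field_simp
  ring

/-- The derivative of `G` in space. -/
noncomputable def gx (G : ℝ → ℝ → ℝ) (x t : ℝ) : ℝ := deriv (fun y => G y t) x

/-- The derivative of `G` in time. -/
noncomputable def gt (G : ℝ → ℝ → ℝ) (x t : ℝ) : ℝ := deriv (G x) t

section
variable {p a b T P B : ℝ} {C S : ℝ → ℝ} {G : ℝ → ℝ → ℝ} {f : ℝ → ℝ}

lemma Forcing.fderiv_apply (hF : Forcing P B G f) (x t v w : ℝ) :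
    fderiv ℝ (fun z : ℝ × ℝ => G z.1 z.2) (x, t) (v, w) = gx G x t * v + gt G x t * w := by
  have hfd := (hF.smG.differentiable (by norm_num) (x, t)).hasFDerivAt
  have h1 := (hfd.comp_hasDerivAt x ((hasDerivAt_id x).prodMk (hasDerivAt_const x t))).deriv
  have h2 := (hfd.comp_hasDerivAt t ((hasDerivAt_const t x).prodMk (hasDerivAt_id t))).deriv
  have h3 : ((v, w) : ℝ × ℝ) = v • ((1, 0) : ℝ × ℝ) + w • ((0, 1) : ℝ × ℝ) := by simp
  rw [h3, map_add, map_smul, map_smul, ← h1, ← h2, smul_eq_mul, smul_eq_mul, mul_comm v, mul_comm w]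
  rfl

lemma Forcing.hasDerivAt_comp (hF : Forcing P B G f) {X τ : ℝ → ℝ} {X' τ' s : ℝ}
    (hX : HasDerivAt X X' s) (hτ : HasDerivAt τ τ' s) :
    HasDerivAt (fun s => G (X s) (τ s)) (gx G (X s) (τ s) * X' + gt G (X s) (τ s) * τ') s := by
  have hfd := (hF.smG.differentiable (by norm_num) (X s, τ s)).hasFDerivAt
  have h := hfd.comp_hasDerivAt s (hX.prodMk hτ)
  rwa [hF.fderiv_apply] at h

lemma Forcing.continuous_gx (hF : Forcing P B G f) : Continuous fun z : ℝ × ℝ => gx G z.1 z.2 := by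
  have h := (hF.smG.continuous_fderiv (by norm_num)).clm_apply (continuous_const (y := ((1, 0) : ℝ × ℝ)))
  refine h.congr fun z => ?_
  rw [hF.fderiv_apply]; ring

lemma Forcing.hasDerivAt_f (hF : Forcing P B G f) (t : ℝ) : HasDerivAt f (deriv f t) t :=
  (hF.smf.differentiable (by norm_num) t).hasDerivAt

lemma Forcing.gx_le (hF : Forcing P B G f) (x t : ℝ) : |gx G x t| ≤ B := by
  simpa [gx, iteratedDeriv_one] using hF.bdx 1 (by norm_num) x t

lemma Forcing.gt_le (hF : Forcing P B G f) (x t : ℝ) : |gt G x t| ≤ B := by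
  simpa [gt, iteratedDeriv_one] using hF.bdt 1 (by norm_num) x t

lemma Forcing.G_le (hF : Forcing P B G f) (x t : ℝ) : |G x t| ≤ B := by
  simpa using hF.bdt 0 (by norm_num) x t

lemma Forcing.f_le (hF : Forcing P B G f) (t : ℝ) : |f t| ≤ B := by
  simpa using hF.bdf 0 (by norm_num) t

lemma Forcing.deriv_f_le (hF : Forcing P B G f) (t : ℝ) : |deriv f t| ≤ B := by
  simpa [iteratedDeriv_one] using hF.bdf 1 (by norm_num) t

/-- The rescaled energy on the curve of radius `r`. -/
noncomputable def level (p T P : ℝ) (C : ℝ → ℝ) (G : ℝ → ℝ → ℝ) (f : ℝ → ℝ) (θ t r : ℝ) : ℝ :=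
  r ^ p / cexpo p - (G (r * C (T * θ)) (P * t) + f (P * t) * (r * C (T * θ)))

/-- The total external force. -/
noncomputable def drive (T P : ℝ) (C : ℝ → ℝ) (G : ℝ → ℝ → ℝ) (f : ℝ → ℝ) (θ t r : ℝ) : ℝ :=
  gx G (r * C (T * θ)) (P * t) + f (P * t)

/-- The time derivative of the external potential. -/
noncomputable def power (T P : ℝ) (C : ℝ → ℝ) (G : ℝ → ℝ → ℝ) (f : ℝ → ℝ) (θ t r : ℝ) : ℝ :=
  gt G (r * C (T * θ)) (P * t) + deriv f (P * t) * (r * C (T * θ))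

/-- The radial derivative of the rescaled energy. -/
noncomputable def den (p T P : ℝ) (C : ℝ → ℝ) (G : ℝ → ℝ → ℝ) (f : ℝ → ℝ) (θ t r : ℝ) : ℝ :=
  (p - 1) * r ^ (p - 1) - C (T * θ) * drive T P C G f θ t r

lemma Forcing.drive_le (hF : Forcing P B G f) (θ t r : ℝ) : |drive T P C G f θ t r| ≤ 2 * B :=
  (abs_add_le _ _).trans (by linarith [hF.gx_le (r * C (T * θ)) (P * t), hF.f_le (P * t)])

lemma hasDerivAt_level (hp : 2 ≤ p) (hF : Forcing P B G f) {r : ℝ} (hr : 0 < r) (θ t : ℝ) :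
    HasDerivAt (level p T P C G f θ t) (den p T P C G f θ t r) r := by
  have hq := one_lt_cexpo hp
  have h1 := (Real.hasDerivAt_rpow_const (p := p) (Or.inl hr.ne')).div_const (cexpo p)
  have hX : HasDerivAt (fun r => r * C (T * θ)) (C (T * θ)) r := by
    simpa using (hasDerivAt_id r).mul_const (C (T * θ))
  have h2 := hF.hasDerivAt_comp hX (hasDerivAt_const r (P * t))
  have h3 := h1.sub (h2.add (hX.const_mul (f (P * t))))
  refine h3.congr_deriv ?_
  have h4 : p / cexpo p = p - 1 := by
    have : p - 1 ≠ 0 := by linarith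
    have : p ≠ 0 := by linarith
    rw [cexpo]; field_simp
  simp only [den, drive]
  rw [mul_div_right_comm, h4]; ring

lemma continuous_den (hp : 2 ≤ p) (hc : Curve p a b T C S) (hF : Forcing P B G f) {U : ℝ → ℝ}
    (hU : Continuous U) : Continuous fun q : ℝ × ℝ => den p T P C G f q.2 (U q.2) q.1 := by
  have h1 := hc.contC
  have h2 := hF.smf.continuous
  have h3 : Continuous fun q : ℝ × ℝ => gx G (q.1 * C (T * q.2)) (P * U q.2) :=
    hF.continuous_gx.comp (by fun_prop : Continuous fun q : ℝ × ℝ => (q.1 * C (T * q.2), P * U q.2))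
  have h4 : Continuous fun q : ℝ × ℝ => q.1 ^ (p - 1) :=
    continuous_fst.rpow_const fun _ => Or.inr (by linarith)
  simp only [den, drive]
  fun_prop

lemma continuous_level (hp : 2 ≤ p) (hc : Curve p a b T C S) (hF : Forcing P B G f) :
    Continuous fun q : ℝ × ℝ × ℝ => level p T P C G f q.1 q.2.1 q.2.2 := by
  have h1 := hc.contC
  have h2 := hF.smf.continuous
  have h3 : Continuous fun q : ℝ × ℝ × ℝ => G (q.2.2 * C (T * q.1)) (P * q.2.1) :=
    hF.contG.comp (by fun_prop : Continuous fun q : ℝ × ℝ × ℝ => (q.2.2 * C (T * q.1), P * q.2.1))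
  have h4 : Continuous fun q : ℝ × ℝ × ℝ => q.2.2 ^ p :=
    (by fun_prop : Continuous fun q : ℝ × ℝ × ℝ => q.2.2).rpow_const fun _ => Or.inr (by linarith)
  exact (h4.div_const _).sub (h3.add (by fun_prop))

variable {M : ℝ}

lemma le_rpow_sub_one (hp : 2 ≤ p) {r : ℝ} (hr : 1 ≤ r) : r ≤ r ^ (p - 1) := by
  simpa using Real.rpow_le_rpow_of_exponent_le hr (by linarith : 1 ≤ p - 1)

lemma le_den (hp : 2 ≤ p) (hF : Forcing P B G f) (hM : 1 ≤ M) (hCM : ∀ θ, |C θ| ≤ M) {r : ℝ}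
    (hr : 4 * M * B ≤ r) (θ t : ℝ) : (p - 1) * r ^ (p - 1) / 2 ≤ den p T P C G f θ t r ∧
      |C (T * θ) * drive T P C G f θ t r| ≤ 2 * M * B := by
  have hB := hF.B_one
  have h1 : 1 ≤ r := by nlinarith
  have h2 := le_rpow_sub_one hp h1
  have h3 : |C (T * θ) * drive T P C G f θ t r| ≤ M * (2 * B) := by
    rw [abs_mul]; exact mul_le_mul (hCM _) (hF.drive_le _ _ _) (abs_nonneg _) (by linarith)
  have h4 := (abs_le.1 h3).2
  refine ⟨?_, by linarith⟩
  rw [den]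
  nlinarith

lemma half_le_den (hp : 2 ≤ p) (hF : Forcing P B G f) (hM : 1 ≤ M) (hCM : ∀ θ, |C θ| ≤ M) {r : ℝ}
    (hr : 4 * M * B ≤ r) (θ t : ℝ) : 1 / 2 ≤ den p T P C G f θ t r := by
  have hB := hF.B_one
  have h1 : 1 ≤ r := by nlinarith
  have h2 := le_rpow_sub_one hp h1
  have := (le_den (T := T) hp hF hM hCM hr θ t).1
  nlinarith

lemma abs_sub_le_level (hp : 2 ≤ p) (hF : Forcing P B G f) (hM : 1 ≤ M) (hCM : ∀ θ, |C θ| ≤ M) {r s : ℝ}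
    (hr : 4 * M * B ≤ r) (hs : 4 * M * B ≤ s) (θ t : ℝ) :
    |r - s| ≤ 2 * |level p T P C G f θ t r - level p T P C G f θ t s| := by
  wlog h : s < r generalizing r s
  · rcases eq_or_lt_of_le (not_lt.1 h) with h' | h'
    · simp [h']
    · rw [abs_sub_comm, abs_sub_comm (level p T P C G f θ t r)]; exact this hs hr h'
  have hB := hF.B_one
  have hpos : 0 < s := by nlinarith
  obtain ⟨ξ, hξ, he⟩ := exists_hasDerivAt_eq_slope _ _ h (fun x hx =>
    (hasDerivAt_level (T := T) (C := C) hp hF (hpos.trans_le hx.1) θ t).continuousAt.continuousWithinAt)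
    (fun x hx => hasDerivAt_level hp hF (hpos.trans hx.1) θ t)
  have h1 := half_le_den (T := T) hp hF hM hCM (hs.trans hξ.1.le) θ t
  rw [he, le_div_iff₀ (by linarith)] at h1
  rw [abs_of_pos (by linarith), ← abs_of_pos (by norm_num : (0 : ℝ) < 2), ← abs_mul]
  exact le_trans (by linarith) (le_abs_self _)

end

section
variable {p A r0 I : ℝ}

lemma rad_bounds (hp : 2 ≤ p) (hA : 1 ≤ A) (hr : 24 * A ≤ r0) (hI : |I| ≤ 3 / 2) :
    7 / 8 ≤ 1 + cexpo p * A / r0 * I ∧ r0 / 2 ≤ rad p A r0 I ∧ rad p A r0 I ≤ 2 * r0 ∧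
      |r0 ^ (p - 1) - rad p A r0 I ^ (p - 1)| ≤ 6 * A / r0 * rad p A r0 I ^ (p - 1) := by
  have h0 : 0 < r0 := by linarith
  have hq := one_lt_cexpo hp
  have hq2 := cexpo_le_two hp
  have hκ : |cexpo p * A / r0 * I| ≤ 3 * A / r0 := by
    rw [abs_mul, abs_of_pos (by positivity)]
    calc cexpo p * A / r0 * |I| ≤ 2 * A / r0 * (3 / 2) := by gcongr
      _ = 3 * A / r0 := by ring
  have hκ2 : 3 * A / r0 ≤ 1 / 8 := by rw [div_le_iff₀ h0]; linarith
  obtain ⟨hl, hh⟩ := abs_le.1 (hκ.trans hκ2)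
  set s := 1 + cexpo p * A / r0 * I with hs
  have hs0 : 0 < s := by linarith
  have hsp : rad p A r0 I = r0 * s ^ (1 / p) := rfl
  have hpow : ∀ e : ℝ, 0 < e → e ≤ 1 → 7 / 8 ≤ s ^ e ∧ s ^ e ≤ 9 / 8 ∧ |1 - s ^ e| ≤ |1 - s| := fun e he he1 => by
    rcases le_total 1 s with h | h
    · have h1 : s ^ e ≤ s := by simpa using Real.rpow_le_rpow_of_exponent_le h he1
      have h2 : 1 ≤ s ^ e := Real.one_le_rpow h he.le
      refine ⟨by linarith, by linarith, ?_⟩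
      rw [abs_of_nonpos (by linarith), abs_of_nonpos (by linarith)]; linarith
    · have h1 : s ≤ s ^ e := by simpa using Real.rpow_le_rpow_of_exponent_ge hs0 h he1
      have h2 : s ^ e ≤ 1 := Real.rpow_le_one hs0.le h he.le
      refine ⟨by linarith, by linarith, ?_⟩
      rw [abs_of_nonneg (by linarith), abs_of_nonneg (by linarith)]; linarith
  obtain ⟨e1, e2, -⟩ := hpow (1 / p) (by positivity) (by rw [div_le_iff₀ (by linarith)]; linarith)
  obtain ⟨d1, d2, d3⟩ := hpow (1 / p * (p - 1)) (mul_pos (by positivity) (by linarith))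
    (by rw [one_div_mul_eq_div, div_le_iff₀ (by linarith)]; linarith)
  refine ⟨by linarith, by rw [hsp]; nlinarith, by rw [hsp]; nlinarith, ?_⟩
  have h3 : rad p A r0 I ^ (p - 1) = r0 ^ (p - 1) * s ^ (1 / p * (p - 1)) := by
    rw [hsp, Real.mul_rpow h0.le (by positivity), ← Real.rpow_mul hs0.le]
  have h4 : |1 - s| ≤ 3 * A / r0 := by
    rw [abs_sub_comm, hs, add_sub_cancel_left]; exact hκ
  have h5 : 0 < r0 ^ (p - 1) := Real.rpow_pos_of_pos h0 _
  rw [h3, ← mul_one_sub, abs_mul, abs_of_pos h5]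
  have h6 : 0 < A / r0 := by positivity
  have h7 : 3 * A / r0 = 3 * (A / r0) := by ring
  have h8 : 6 * A / r0 = 6 * (A / r0) := by ring
  rw [h7] at h4
  rw [h8, mul_left_comm]
  refine mul_le_mul_of_nonneg_left ((d3.trans h4).trans ?_) h5.le
  nlinarith

lemma hasDerivAt_rad (hp : 2 ≤ p) (hA : 1 ≤ A) (hr : 24 * A ≤ r0) (hI : |I| ≤ 3 / 2) :
    HasDerivAt (rad p A r0) (A * r0 ^ (p - 1) / ((p - 1) * rad p A r0 I ^ (p - 1))) I := by
  have h0 : 0 < r0 := by linarith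
  have hs := (rad_bounds hp hA hr hI).1
  have hs0 : 0 < 1 + cexpo p * A / r0 * I := by linarith
  have h1 : HasDerivAt (fun I => 1 + cexpo p * A / r0 * I) (cexpo p * A / r0) I := by
    simpa using ((hasDerivAt_id I).const_mul (cexpo p * A / r0)).const_add 1
  refine ((h1.rpow_const (p := 1 / p) (Or.inl hs0.ne')).const_mul r0).congr_deriv ?_
  rw [rad, Real.mul_rpow h0.le (by positivity), ← Real.rpow_mul hs0.le]
  set s := 1 + cexpo p * A / r0 * I
  have h2 : s ^ (1 / p - 1) = (s ^ (1 / p * (p - 1)))⁻¹ := by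
    rw [← Real.rpow_neg hs0.le]; congr 1; field_simp; ring
  have h3 : 0 < s ^ (1 / p * (p - 1)) := Real.rpow_pos_of_pos hs0 _
  have h4 : 0 < r0 ^ (p - 1) := Real.rpow_pos_of_pos h0 _
  have h5 : p - 1 ≠ 0 := by linarith
  have h6 : p ≠ 0 := by linarith
  rw [h2, cexpo]
  field_simp

end

/-- The flow lines of the reduced system: time `U` and radius `ρ` as functions of the angle. -/
structure Orbit (p T P ω A r0 l : ℝ) (C S : ℝ → ℝ) (G : ℝ → ℝ → ℝ) (f U ρ : ℝ → ℝ) : Prop where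
  dU : ∀ θ, HasDerivAt U
    (ω * ((p - 1) * ρ θ ^ (p - 1) / den p T P C G f θ (U θ) (ρ θ)) + l) θ
  dρ : ∀ θ, HasDerivAt ρ
    ((T * phi (cexpo p) (S (T * θ)) * ρ θ * drive T P C G f θ (U θ) (ρ θ) +
      P * power T P C G f θ (U θ) (ρ θ) * l) / den p T P C G f θ (U θ) (ρ θ)) θ
  lo : ∀ θ, r0 / 2 ≤ ρ θ
  hi : ∀ θ, ρ θ ≤ 2 * r0
  near : ∀ θ, |r0 ^ (p - 1) - ρ θ ^ (p - 1)| ≤ 6 * A / r0 * ρ θ ^ (p - 1)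

/-- The time on the torus. -/
noncomputable def angle (β : ℝ) (u : ℝ → ℝ → ℝ → ℝ) (y x θ : ℝ) : ℝ := x + β * θ + u y θ x

/-- The radius on the torus. -/
noncomputable def radius (p A R ω β : ℝ) (k : ℝ → ℝ → ℝ → ℝ → ℝ) (u v : ℝ → ℝ → ℝ → ℝ) (y x θ : ℝ) : ℝ :=
  rad p A (max y R) (k y θ (angle β u y x θ) (v y θ x) / ω)

/-- The function `k` is the scaled action as a function of angle, time and energy. -/
structure LevelAction (p T P A R ω : ℝ) (C : ℝ → ℝ) (G : ℝ → ℝ → ℝ) (f : ℝ → ℝ)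
    (k : ℝ → ℝ → ℝ → ℝ → ℝ) : Prop where
  near : ∀ y θ t h, |h| < 1 → |k y θ t h / ω - h| ≤ 1 / 2
  eq : ∀ y θ t h, |h| < 1 → level p T P C G f θ t (rad p A (max y R) (k y θ t h / ω)) =
    max y R ^ p / cexpo p + A * max y R ^ (p - 1) * h

section
variable {p a b T P B M A R ω β η : ℝ} {C S : ℝ → ℝ} {G : ℝ → ℝ → ℝ} {f : ℝ → ℝ}
  {k kt kh : ℝ → ℝ → ℝ → ℝ → ℝ} {l : ℝ → ℝ} {u v : ℝ → ℝ → ℝ → ℝ}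

lemma LevelAction.abs_le (hk : LevelAction p T P A R ω C G f k) (y θ t : ℝ) {h : ℝ} (hh : |h| < 1) :
    |k y θ t h / ω| ≤ 3 / 2 := by
  have := abs_add_le (k y θ t h / ω - h) h
  rw [sub_add_cancel] at this
  linarith [hk.near y θ t h hh]

lemma hasDerivAt_level_comp (hp : 2 ≤ p) (hc : Curve p a b T C S) (hF : Forcing P B G f)
    {ϑ τ r : ℝ → ℝ} {ϑ' τ' r' s : ℝ} (hϑ : HasDerivAt ϑ ϑ' s) (hτ : HasDerivAt τ τ' s)
    (hr : HasDerivAt r r' s) (hr0 : 0 < r s) :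
    HasDerivAt (fun s => level p T P C G f (ϑ s) (τ s) (r s))
      (den p T P C G f (ϑ s) (τ s) (r s) * r' -
        T * phi (cexpo p) (S (T * ϑ s)) * r s * drive T P C G f (ϑ s) (τ s) (r s) * ϑ' -
        P * power T P C G f (ϑ s) (τ s) (r s) * τ') s := by
  have hC : HasDerivAt (fun s => C (T * ϑ s)) (phi (cexpo p) (S (T * ϑ s)) * (T * ϑ')) s :=
    (hc.dC (T * ϑ s)).comp s (hϑ.const_mul T)
  have hX := hr.mul hC
  have hPτ := hτ.const_mul P
  have h1 := (hr.rpow_const (p := p) (Or.inl hr0.ne')).div_const (cexpo p)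
  have h2 := hF.hasDerivAt_comp hX hPτ
  have h3 : HasDerivAt (fun s => f (P * τ s)) (deriv f (P * τ s) * (P * τ')) s :=
    (hF.hasDerivAt_f _).comp s hPτ
  refine (h1.sub (h2.add (h3.mul hX))).congr_deriv ?_
  have h4 : r' * p * r s ^ (p - 1) / cexpo p = (p - 1) * r s ^ (p - 1) * r' := by
    have : p - 1 ≠ 0 := by linarith
    have : p ≠ 0 := by linarith
    rw [cexpo]; field_simp
  rw [h4]
  simp only [den, drive, power, Pi.mul_apply]
  ring

lemma LevelAction.derivs (hp : 2 ≤ p) (hc : Curve p a b T C S) (hF : Forcing P B G f) (hM : 1 ≤ M)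
    (hCM : ∀ θ, |C θ| ≤ M) (hA : 1 ≤ A) (hRA : 24 * A ≤ R) (hRM : 8 * M * B ≤ R) (hω : 0 < ω)
    (hk : LevelAction p T P A R ω C G f k) {y θ t h : ℝ} (hh : |h| < 1) {kt' kh' : ℝ}
    (dt : HasDerivAt (fun t => k y θ t h) kt' t) (dh : HasDerivAt (fun h => k y θ t h) kh' h) :
    kh' = ω * ((p - 1) * rad p A (max y R) (k y θ t h / ω) ^ (p - 1) /
        den p T P C G f θ t (rad p A (max y R) (k y θ t h / ω))) ∧
      A * max y R ^ (p - 1) * kt' = P * power T P C G f θ t (rad p A (max y R) (k y θ t h / ω)) * kh' := by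
  have hB := hF.B_one
  have hRm : R ≤ max y R := le_max_right _ _
  have hI := hk.abs_le y θ t hh
  obtain ⟨-, hlo, -, -⟩ := rad_bounds hp hA (hRA.trans hRm) hI
  have hrad := hasDerivAt_rad hp hA (hRA.trans hRm) hI
  set r := rad p A (max y R) (k y θ t h / ω) with hr
  have h1 : 0 < r := by linarith
  have hden := half_le_den (T := T) hp hF hM hCM (r := r) (by linarith) θ t
  have hm : 0 < A * max y R ^ (p - 1) := mul_pos (by linarith) (Real.rpow_pos_of_pos (by linarith) _)
  have hrp : 0 < r ^ (p - 1) := Real.rpow_pos_of_pos h1 _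
  have hp1 : 0 < p - 1 := by linarith
  have eh : HasDerivAt (fun h => max y R ^ p / cexpo p + A * max y R ^ (p - 1) * h)
      (A * max y R ^ (p - 1)) h := by
    simpa using ((hasDerivAt_id h).const_mul (A * max y R ^ (p - 1))).const_add
      (max y R ^ p / cexpo p)
  have eh2 : (fun h => level p T P C G f θ t (rad p A (max y R) (k y θ t h / ω))) =ᶠ[𝓝 h]
      fun h => max y R ^ p / cexpo p + A * max y R ^ (p - 1) * h := by
    filter_upwards [continuous_abs.continuousAt.eventually (gt_mem_nhds hh)] with h' hh'
    exact hk.eq y θ t h' hh'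
  have dh2 := hasDerivAt_level_comp hp hc hF (hasDerivAt_const h θ) (hasDerivAt_const h t)
    (r := fun h => rad p A (max y R) (k y θ t h / ω)) (HasDerivAt.comp (h₂ := rad p A (max y R)) h hrad (dh.div_const ω)) h1
  have e1 := (dh2.congr_of_eventuallyEq eh2.symm).unique eh
  have dt2 := hasDerivAt_level_comp hp hc hF (hasDerivAt_const t θ) (hasDerivAt_id t)
    (r := fun t => rad p A (max y R) (k y θ t h / ω)) (HasDerivAt.comp (h₂ := rad p A (max y R)) t hrad (dt.div_const ω)) h1
  have et2 : (fun t => level p T P C G f θ t (rad p A (max y R) (k y θ t h / ω))) =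
      fun t => max y R ^ p / cexpo p + A * max y R ^ (p - 1) * h := funext fun t => hk.eq y θ t h hh
  have e2 := (dt2.congr_of_eventuallyEq (Eq.eventuallyEq et2.symm)).unique (hasDerivAt_const t _)
  simp only [id, ← hr, mul_zero, sub_zero, mul_one] at e1 e2
  have hd : 0 < den p T P C G f θ t r := by linarith
  set d := den p T P C G f θ t r
  have hkh : kh' = ω * ((p - 1) * r ^ (p - 1) / d) := by
    have hm0 : 0 < max y R ^ (p - 1) := Real.rpow_pos_of_pos (by linarith) _
    field_simp at e1 ⊢
    linarith
  refine ⟨hkh, ?_⟩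
  rw [hkh]
  have e3 : d * (A * max y R ^ (p - 1) / ((p - 1) * r ^ (p - 1)) * (kt' / ω)) = P * power T P C G f θ t r := by
    linarith
  rw [← e3]
  field_simp

theorem orbit_of_torus (hp : 2 ≤ p) (hc : Curve p a b T C S) (hF : Forcing P B G f) (hM : 1 ≤ M)
    (hCM : ∀ θ, |C θ| ≤ M) (hA : 1 ≤ A) (hRA : 24 * A ≤ R) (hRM : 8 * M * B ≤ R) (hω : 0 < ω) (hη : η < 1)
    (hK : KamTorus β ω η k kt kh l u v) (hk : LevelAction p T P A R ω C G f k) (y x : ℝ) :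
    Orbit p T P ω A (max y R) (l y) C S G f (angle β u y x) (radius p A R ω β k u v y x) := by
  have hB := hF.B_one
  have hRm : R ≤ max y R := le_max_right _ _
  have hv : ∀ θ, |v y θ x| < 1 := fun θ => (hK.bv y θ x).trans_lt hη
  have hbd := fun θ => rad_bounds hp hA (hRA.trans hRm) (hk.abs_le y θ (angle β u y x θ) (hv θ))
  have hder := fun θ => hk.derivs hp hc hF hM hCM hA hRA hRM hω (hv θ)
    (hK.dt y θ (angle β u y x θ) (v y θ x) (hv θ)) (hK.dh y θ (angle β u y x θ) (v y θ x) (hv θ))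
  have hdU : ∀ θ, HasDerivAt (angle β u y x) (kh y θ (angle β u y x θ) (v y θ x) + l y) θ := fun θ => by
    have h1 : HasDerivAt (fun θ => x + β * θ) β θ := by
      simpa using ((hasDerivAt_id θ).const_mul β).const_add x
    exact (h1.add (hK.du y θ x)).congr_deriv (by simp only [angle]; ring)
  have hUc : Continuous (angle β u y x) := continuous_iff_continuousAt.2 fun θ => (hdU θ).continuousAt
  refine ⟨fun θ => (hdU θ).congr_deriv (by rw [(hder θ).1]; rfl), fun θ => ?_, fun θ => (hbd θ).2.1,
    fun θ => (hbd θ).2.2.1, fun θ => (hbd θ).2.2.2⟩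
  have hpos : ∀ r ∈ Icc (max y R / 2) (2 * max y R), 0 < r := fun r hr => by nlinarith [hr.1]
  have hF' := ((hasDerivAt_level_comp hp hc hF (hasDerivAt_id θ) (hdU θ)
    (hasDerivAt_const θ (radius p A R ω β k u v y x θ)) (hpos _ ⟨(hbd θ).2.1, (hbd θ).2.2.1⟩)).sub_const
    (max y R ^ p / cexpo p)).sub ((hK.dv y θ x).const_mul (A * max y R ^ (p - 1)))
  have himp := hasDerivAt_of_implicit (ρ := radius p A R ω β k u v y x) (lo := max y R / 2)
    (hi := 2 * max y R) (δ := 1 / 2) (θ₀ := θ)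
    (F := fun r θ => level p T P C G f θ (angle β u y x θ) r - max y R ^ p / cexpo p -
      A * max y R ^ (p - 1) * v y θ x)
    (D := fun r θ => den p T P C G f θ (angle β u y x θ) r) (by norm_num)
    (fun r hr θ => ((hasDerivAt_level hp hF (hpos r hr) θ _).sub_const _).sub_const _)
    (fun r hr θ => half_le_den hp hF hM hCM (by linarith [hr.1]) θ _)
    (continuous_den hp hc hF hUc).continuousAt (fun θ => ⟨(hbd θ).2.1, (hbd θ).2.2.1⟩)
    (fun θ => by
      have := hk.eq y θ (angle β u y x θ) (v y θ x) (hv θ)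
      simp only [radius]; rw [this]; ring) hF'
  refine himp.congr_deriv ?_
  have e := (hder θ).2
  simp only [id, radius, angle] at e ⊢
  congr 1
  linear_combination -e

lemma radius_eq (hη : η < 1) (hK : KamTorus β ω η k kt kh l u v) (hk : LevelAction p T P A R ω C G f k)
    (y x θ : ℝ) : level p T P C G f θ (angle β u y x θ) (radius p A R ω β k u v y x θ) =
      max y R ^ p / cexpo p + A * max y R ^ (p - 1) * v y θ x :=
  hk.eq y θ _ _ ((hK.bv y θ x).trans_lt hη)

lemma continuous_angle (hK : KamTorus β ω η k kt kh l u v) (y : ℝ) :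
    Continuous fun q : ℝ × ℝ => angle β u y q.1 q.2 := by
  have h : Continuous fun q : ℝ × ℝ => u y q.2 q.1 :=
    hK.cu.comp (by fun_prop : Continuous fun q : ℝ × ℝ => (((y, q.2), q.1) : (ℝ × ℝ) × ℝ))
  exact (by fun_prop : Continuous fun q : ℝ × ℝ => q.1 + β * q.2).add h

lemma angle_add_one (hK : KamTorus β ω η k kt kh l u v) (y x θ : ℝ) :
    angle β u y x (θ + 1) = angle β u y (x + β) θ := by
  simp only [angle, hK.twu]; ring

end

lemma abs_sub_le_integral {F F' E : ℝ → ℝ} (hF : ∀ θ, HasDerivAt F (F' θ) θ) (hE : Continuous E)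
    (h : ∀ θ, |F' θ| ≤ E θ) : |F 1 - F 0| ≤ ∫ θ in (0 : ℝ)..1, E θ :=
  image_norm_le_of_norm_deriv_right_le_deriv_boundary (f := fun θ => F θ - F 0) (a := 0) (b := 1)
    (fun θ _ => ((hF θ).sub_const _).continuousAt.continuousWithinAt)
    (fun θ _ => ((hF θ).sub_const _).hasDerivWithinAt) (by simp)
    (fun θ => intervalIntegral.integral_hasDerivAt_right (hE.intervalIntegrable 0 θ)
      (hE.stronglyMeasurableAtFilter _ _) hE.continuousAt) (fun θ _ => h θ) (right_mem_Icc.2 zero_le_one)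

section
variable {p a b T P B M A R ω β η δ r0 l : ℝ} {C S : ℝ → ℝ} {G : ℝ → ℝ → ℝ} {f : ℝ → ℝ}

lemma Curve.abs_S_le (hc : Curve p a b T C S) (hp : 2 ≤ p) (ha : 0 < a) (hb : 0 < b) (θ : ℝ) : |S θ| ≤ 1 := by
  have hq := one_lt_cexpo hp
  have h : |S θ| ^ cexpo p ≤ 1 := by linarith [hc.energy θ, pot_nonneg hp ha hb (C θ)]
  by_contra! h1
  exact absurd h (not_le.2 (Real.one_lt_rpow h1 (by linarith)))

lemma Curve.abs_phi_S_le (hc : Curve p a b T C S) (hp : 2 ≤ p) (ha : 0 < a) (hb : 0 < b) (θ : ℝ) :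
    |phi (cexpo p) (S θ)| ≤ 1 := by
  have hq := one_lt_cexpo hp
  rw [abs_phi hq.ne']
  exact Real.rpow_le_one (abs_nonneg _) (hc.abs_S_le hp ha hb θ) (by linarith)

/-- A multiplier turning multiplication by `C` into differentiation along the curve, away from the
turning points. -/
lemma Curve.exists_weight (hc : Curve p a b T C S) (hp : 2 ≤ p) (ha : 0 < a) (hb : 0 < b) (hM : 1 ≤ M)
    (hCM : ∀ θ, |C θ| ≤ M) (hδ : 0 < δ) : ∃ w w' : ℝ → ℝ, ∃ W, (∀ θ, HasDerivAt w (w' θ) θ) ∧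
      (∀ θ, |w θ| ≤ W) ∧ (∀ θ, |w' θ| ≤ W) ∧
      ∀ θ, |C θ - w θ * phi (cexpo p) (S θ)| ≤ M * (δ / (|S θ| ^ cexpo p + δ)) := by
  have hq := one_lt_cexpo hp
  have hD : ∀ θ, 0 < |S θ| ^ cexpo p + δ := fun θ => by positivity
  have hd : ∀ θ, HasDerivAt (fun θ => C θ * S θ / (|S θ| ^ cexpo p + δ))
      (((phi (cexpo p) (S θ) * S θ + C θ * -(force p a b (C θ))) * (|S θ| ^ cexpo p + δ) - C θ * S θ *
        (cexpo p * phi (cexpo p) (S θ) * -(force p a b (C θ)))) / (|S θ| ^ cexpo p + δ) ^ 2) θ := fun θ =>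
    ((hc.dC θ).mul (hc.dS θ)).div (((hasDerivAt_abs_cexpo hp (S θ)).comp θ (hc.dS θ)).add_const δ) (hD θ).ne'
  have hcont : Continuous fun θ => (((phi (cexpo p) (S θ) * S θ + C θ * -(force p a b (C θ))) *
      (|S θ| ^ cexpo p + δ) - C θ * S θ * (cexpo p * phi (cexpo p) (S θ) * -(force p a b (C θ)))) /
      (|S θ| ^ cexpo p + δ) ^ 2) := by
    have h1 := hc.contC
    have h2 := hc.contS
    have h3 := (continuous_phi hq).comp h2
    have h4 := (continuous_force (a := a) (b := b) hp).comp h1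
    have h5 : Continuous fun θ => |S θ| ^ cexpo p := h2.abs.rpow_const fun _ => Or.inr (by linarith)
    simp only [Function.comp_def] at h3 h4
    exact Continuous.div (by fun_prop) (by fun_prop) fun θ => (pow_pos (hD θ) 2).ne'
  obtain ⟨W1, -, hW1⟩ := periodic_bounded hc.T_pos.ne'
    (continuous_iff_continuousAt.2 fun θ => (hd θ).continuousAt) fun θ => by simp only [hc.perC, hc.perS]
  obtain ⟨W2, -, hW2⟩ := periodic_bounded hc.T_pos.ne' hcont fun θ => by simp only [hc.perC, hc.perS]
  refine ⟨_, _, max W1 W2, hd, fun θ => (hW1 θ).trans (le_max_left _ _),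
    fun θ => (hW2 θ).trans (le_max_right _ _), fun θ => ?_⟩
  have h1 := phi_mul_self hq (S θ)
  have h2 : C θ - C θ * S θ / (|S θ| ^ cexpo p + δ) * phi (cexpo p) (S θ) =
      C θ * (δ / (|S θ| ^ cexpo p + δ)) := by
    have := (hD θ).ne'
    field_simp
    linear_combination -h1 * C θ
  rw [h2, abs_mul, abs_of_pos (div_pos hδ (hD θ))]
  exact mul_le_mul_of_nonneg_right (hCM θ) (div_pos hδ (hD θ)).le

lemma Orbit.bounds {U ρ : ℝ → ℝ} (hp : 2 ≤ p) (ha : 0 < a) (hb : 0 < b) (hc : Curve p a b T C S)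
    (hF : Forcing P B G f) (hM : 1 ≤ M) (hCM : ∀ θ, |C θ| ≤ M) (hA : 1 ≤ A) (hω : 0 < ω) (hr : 8 * M * B ≤ r0)
    (hl : |l| ≤ 2) (hO : Orbit p T P ω A r0 l C S G f U ρ) (θ : ℝ) :
    r0 / 4 ≤ den p T P C G f θ (U θ) (ρ θ) ∧ |deriv ρ θ| ≤ 4 * T * B + 8 * P * M * B ∧
    |deriv U θ| ≤ 2 * ω + 2 ∧ |(p - 1) * r0 ^ (p - 1) / ω * (deriv U θ - (l + ω)) -
      C (T * θ) * drive T P C G f θ (U θ) (ρ θ)| ≤ 2 * M * B * (12 * A + 8 * M * B) / r0 := by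
  have hB := hF.B_one
  have hT := hc.T_pos
  have hP := hF.P_pos
  have hMB : 1 ≤ M * B := by nlinarith
  have hlo := hO.lo θ
  have hr0 : 0 < r0 := by nlinarith
  have hρ : 1 ≤ ρ θ := by nlinarith
  obtain ⟨hden, hdr⟩ := le_den (T := T) hp hF hM hCM (r := ρ θ) (by linarith) θ (U θ)
  have hpw := le_rpow_sub_one hp hρ
  have hnear := hO.near θ
  have hdrive := hF.drive_le (T := T) (C := C) θ (U θ) (ρ θ)
  have hφ := hc.abs_phi_S_le hp ha hb (T * θ)
  have hpow : |power T P C G f θ (U θ) (ρ θ)| ≤ 2 * M * B * ρ θ := by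
    have h1 := hF.gt_le (ρ θ * C (T * θ)) (P * U θ)
    have h2 : |deriv f (P * U θ) * (ρ θ * C (T * θ))| ≤ B * (ρ θ * M) := by
      rw [abs_mul, abs_mul, abs_of_pos (by linarith : 0 < ρ θ)]
      gcongr
      exacts [hF.deriv_f_le _, hCM _]
    refine (abs_add_le _ _).trans ?_
    nlinarith
  rw [(hO.dU θ).deriv, (hO.dρ θ).deriv]
  have hde : den p T P C G f θ (U θ) (ρ θ) = (p - 1) * ρ θ ^ (p - 1) -
    C (T * θ) * drive T P C G f θ (U θ) (ρ θ) := rfl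
  set d := den p T P C G f θ (U θ) (ρ θ)
  set g := drive T P C G f θ (U θ) (ρ θ)
  set X := ρ θ ^ (p - 1)
  have hX : 0 < X := by linarith
  have hd1 : ρ θ / 2 ≤ d := by nlinarith
  have hd : 0 < d := by linarith
  have hdr0 : r0 / 4 ≤ d := by linarith
  refine ⟨hdr0, ?_, ?_, ?_⟩
  · rw [abs_div, abs_of_pos hd, div_le_iff₀ hd]
    have h1 : |T * phi (cexpo p) (S (T * θ)) * ρ θ * g| ≤ T * 1 * ρ θ * (2 * B) := by
      rw [abs_mul, abs_mul, abs_mul, abs_of_pos hT, abs_of_pos (by linarith : 0 < ρ θ)]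
      gcongr
    have h2 : |P * power T P C G f θ (U θ) (ρ θ) * l| ≤ P * (2 * M * B * ρ θ) * 2 := by
      rw [abs_mul, abs_mul, abs_of_pos hP]
      gcongr
    refine (abs_add_le _ _).trans ((add_le_add h1 h2).trans ?_)
    have h3 : (4 * T * B + 8 * P * M * B) * (ρ θ / 2) ≤ (4 * T * B + 8 * P * M * B) * d := by gcongr
    linarith
  · have h1 : 0 < (p - 1) * X / d := div_pos (mul_pos (by linarith) hX) hd
    have h2 : (p - 1) * X / d ≤ 2 := by rw [div_le_iff₀ hd]; linarith
    refine (abs_add_le _ _).trans ?_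
    rw [abs_mul, abs_of_pos hω, abs_of_pos h1]
    nlinarith
  · have e : (p - 1) * r0 ^ (p - 1) / ω * (ω * ((p - 1) * X / d) + l - (l + ω)) - C (T * θ) * g =
        C (T * θ) * g * (((p - 1) * (r0 ^ (p - 1) - X) + C (T * θ) * g) / d) := by
      field_simp
      rw [hde]; ring
    rw [e, abs_mul, mul_div_assoc]
    gcongr
    rw [abs_div, abs_of_pos hd, div_le_iff₀ hd]
    have h1 : |(p - 1) * (r0 ^ (p - 1) - X)| ≤ (p - 1) * (6 * A / r0 * X) := by
      rw [abs_mul, abs_of_pos (by linarith : 0 < p - 1)]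
      gcongr
      linarith
    have h2 : 6 * A / r0 * ((p - 1) * X) ≤ 6 * A / r0 * (2 * d) :=
      mul_le_mul_of_nonneg_left (by linarith) (by positivity)
    have h3 : 2 * M * B ≤ 8 * M * B / r0 * d := by
      calc 2 * M * B = 8 * M * B / r0 * (r0 / 4) := by field_simp; norm_num
        _ ≤ _ := by gcongr
    refine (abs_add_le _ _).trans ?_
    have e2 : (12 * A + 8 * M * B) / r0 * d = 6 * A / r0 * (2 * d) + 8 * M * B / r0 * d := by ring
    rw [e2]
    linarith

end

section
variable {p a b T P B M A R ω β η δ r0 l : ℝ} {C S : ℝ → ℝ} {G : ℝ → ℝ → ℝ} {f : ℝ → ℝ}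

lemma orbit_mean (hp : 2 ≤ p) (ha : 0 < a) (hb : 0 < b) (hc : Curve p a b T C S)
    (hF : Forcing P B G f) (hM : 1 ≤ M) (hCM : ∀ θ, |C θ| ≤ M) (hA : 1 ≤ A) (hω : 0 < ω) (hδ : 0 < δ) :
    ∃ K, ∀ r0 l β η x : ℝ, ∀ U ρ : ℝ → ℝ, 8 * M * B ≤ r0 → |l| ≤ 2 → Orbit p T P ω A r0 l C S G f U ρ →
      (∀ θ, |U θ - (x + β * θ)| ≤ η) →
      |(p - 1) * r0 ^ (p - 1) / ω * (U 1 - U 0 - (l + ω)) - ∫ θ in (0 : ℝ)..1, C (T * θ) * f (P * (x + β * θ))| ≤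
        M * P * B * η + B * M * (∫ θ in (0 : ℝ)..1, δ / (|S (T * θ)| ^ cexpo p + δ)) + K / r0 := by
  obtain ⟨w, w', W, hw, hW, hW', hwC⟩ := hc.exists_weight hp ha hb hM hCM hδ
  have hB := hF.B_one
  have hT := hc.T_pos
  have hP := hF.P_pos
  have hq := one_lt_cexpo hp
  have hW0 : 0 ≤ W := (abs_nonneg _).trans (hW 0)
  set K1 : ℝ := 4 * T * B + 8 * P * M * B with hK1
  have hK10 : 0 ≤ K1 := by positivity
  set K2 : ℝ := 2 * (W * B + W * (B * (K1 * M) + B * P * (2 * ω + 2) + B * K1) / T) with hK2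
  refine ⟨2 * M * B * (12 * A + 8 * M * B) + K2 + 4 * W * B / T, fun r0 l β η x U ρ hr hl hO hη => ?_⟩
  have hMB : 1 ≤ M * B := by nlinarith
  have hr0 : 0 < r0 := by nlinarith
  have hρ : ∀ θ, 1 ≤ ρ θ := fun θ => by nlinarith [hO.lo θ]
  have hinv : ∀ θ, 1 / ρ θ ≤ 2 / r0 := fun θ => by
    rw [div_le_div_iff₀ (by linarith [hρ θ]) hr0]; linarith [hO.lo θ]
  have dU : ∀ θ, HasDerivAt U (deriv U θ) θ := fun θ => (hO.dU θ).differentiableAt.hasDerivAt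
  have dρ : ∀ θ, HasDerivAt ρ (deriv ρ θ) θ := fun θ => (hO.dρ θ).differentiableAt.hasDerivAt
  have hbd := hO.bounds hp ha hb hc hF hM hCM hA hω hr hl
  have hCc := hc.contC
  have hSc := hc.contS
  have hfc := hF.smf.continuous
  set Ψ : ℝ → ℝ := fun θ => w (T * θ) * (G (ρ θ * C (T * θ)) (P * U θ) / ρ θ) with hΨ
  set Ψ' : ℝ → ℝ := fun θ => w' (T * θ) * T * (G (ρ θ * C (T * θ)) (P * U θ) / ρ θ) + w (T * θ) *
    (((gx G (ρ θ * C (T * θ)) (P * U θ) * (deriv ρ θ * C (T * θ) + ρ θ * (phi (cexpo p) (S (T * θ)) * T)) +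
      gt G (ρ θ * C (T * θ)) (P * U θ) * (P * deriv U θ)) * ρ θ -
      G (ρ θ * C (T * θ)) (P * U θ) * deriv ρ θ) / ρ θ ^ 2) with hΨ'
  have dT : ∀ θ, HasDerivAt (fun θ => T * θ) T θ := fun θ => by simpa using (hasDerivAt_id θ).const_mul T
  have dΨ : ∀ θ, HasDerivAt Ψ (Ψ' θ) θ := fun θ =>
    ((hw (T * θ)).comp θ (dT θ)).mul ((hF.hasDerivAt_comp ((dρ θ).mul ((hc.dC (T * θ)).comp θ (dT θ)))
      ((dU θ).const_mul P)).div (dρ θ) (by linarith [hρ θ]))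
  have hgC : Continuous fun θ => C (T * θ) * f (P * (x + β * θ)) := by fun_prop
  have hE1 : Continuous fun θ => δ / (|S (T * θ)| ^ cexpo p + δ) := by
    have h5 : Continuous fun θ => |S (T * θ)| ^ cexpo p :=
      (hSc.comp (continuous_const.mul continuous_id)).abs.rpow_const fun _ => Or.inr (by linarith)
    exact continuous_const.div (by fun_prop) fun θ => by positivity
  set Z := (p - 1) * r0 ^ (p - 1) / ω
  have key := abs_sub_le_integral
    (F := fun θ => Z * (U θ - (l + ω) * θ) - (∫ σ in (0 : ℝ)..θ, C (T * σ) * f (P * (x + β * σ))) - Ψ θ / T)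
    (F' := fun θ => Z * (deriv U θ - (l + ω)) - C (T * θ) * f (P * (x + β * θ)) - Ψ' θ / T)
    (E := fun θ => M * P * B * η + B * M * (δ / (|S (T * θ)| ^ cexpo p + δ)) +
      (2 * M * B * (12 * A + 8 * M * B) + K2) / r0)
    (fun θ => by
      have h1 : HasDerivAt (fun θ => (l + ω) * θ) (l + ω) θ := by
        simpa using (hasDerivAt_id θ).const_mul (l + ω)
      exact ((((dU θ).sub h1).const_mul Z).sub (intervalIntegral.integral_hasDerivAt_right
        (hgC.intervalIntegrable 0 θ) (hgC.stronglyMeasurableAtFilter _ _) hgC.continuousAt)).sub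
        ((dΨ θ).div_const T)) (by fun_prop) fun θ => ?_
  · rw [intervalIntegral.integral_add, intervalIntegral.integral_add, intervalIntegral.integral_const,
      intervalIntegral.integral_const, intervalIntegral.integral_const_mul] at key
    · have hΨb : ∀ θ, |Ψ θ / T| ≤ 2 * W * B / T / r0 := fun θ => by
        have h1 : 0 < ρ θ := by linarith [hρ θ]
        rw [abs_div, abs_of_pos hT, abs_mul, abs_div, abs_of_pos h1]
        calc |w (T * θ)| * (|G (ρ θ * C (T * θ)) (P * U θ)| / ρ θ) / T
            = |w (T * θ)| * (|G (ρ θ * C (T * θ)) (P * U θ)| * (1 / ρ θ)) / T := by ring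
          _ ≤ W * (B * (2 / r0)) / T := div_le_div_of_nonneg_right (mul_le_mul (hW _) (mul_le_mul (hF.G_le _ _) (hinv θ)
              (by positivity) (by linarith)) (by positivity) hW0) hT.le
          _ = _ := by ring
      simp only [intervalIntegral.integral_same, mul_one, mul_zero, sub_zero, smul_eq_mul, one_mul] at key
      have h0 := hΨb 0
      have h1 := hΨb 1
      have e : Z * (U 1 - U 0 - (l + ω)) - (∫ θ in (0 : ℝ)..1, C (T * θ) * f (P * (x + β * θ))) =
          (Z * (U 1 - (l + ω)) - (∫ σ in (0 : ℝ)..1, C (T * σ) * f (P * (x + β * σ))) - Ψ 1 / T -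
            (Z * U 0 - Ψ 0 / T)) + Ψ 1 / T - Ψ 0 / T := by ring
      rw [e]
      refine (abs_sub _ _).trans ((add_le_add (abs_add_le _ _) le_rfl).trans ?_)
      have e2 : (2 * M * B * (12 * A + 8 * M * B) + K2 + 4 * W * B / T) / r0 =
        (2 * M * B * (12 * A + 8 * M * B) + K2) / r0 + 2 * W * B / T / r0 + 2 * W * B / T / r0 := by ring
      linarith
    all_goals exact Continuous.intervalIntegrable (by fun_prop) _ _
  · obtain ⟨-, h2, h3, h4⟩ := hbd θ
    have hg1 := hF.gx_le (ρ θ * C (T * θ)) (P * U θ)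
    have hg2 := hF.gt_le (ρ θ * C (T * θ)) (P * U θ)
    have hg3 := hF.G_le (ρ θ * C (T * θ)) (P * U θ)
    have h1 : 0 < ρ θ := by linarith [hρ θ]
    have hfd : |f (P * U θ) - f (P * (x + β * θ))| ≤ B * (P * η) := by
      have := Convex.norm_image_sub_le_of_norm_deriv_le (f := f) (C := B) (s := univ)
        (fun t _ => (hF.hasDerivAt_f t).differentiableAt) (fun t _ => hF.deriv_f_le t) convex_univ
        (mem_univ (P * (x + β * θ))) (mem_univ (P * U θ))
      rw [Real.norm_eq_abs, Real.norm_eq_abs, ← mul_sub, abs_mul, abs_of_pos hP] at this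
      exact this.trans (by gcongr; exact hη θ)
    have hdr : drive T P C G f θ (U θ) (ρ θ) = gx G (ρ θ * C (T * θ)) (P * U θ) + f (P * U θ) := rfl
    rw [hdr] at h4
    have e : Z * (deriv U θ - (l + ω)) - C (T * θ) * f (P * (x + β * θ)) - Ψ' θ / T =
        (Z * (deriv U θ - (l + ω)) - C (T * θ) * (gx G (ρ θ * C (T * θ)) (P * U θ) + f (P * U θ))) +
        C (T * θ) * (f (P * U θ) - f (P * (x + β * θ))) +
        gx G (ρ θ * C (T * θ)) (P * U θ) * (C (T * θ) - w (T * θ) * phi (cexpo p) (S (T * θ))) -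
        (w' (T * θ) * G (ρ θ * C (T * θ)) (P * U θ) +
          w (T * θ) * (gx G (ρ θ * C (T * θ)) (P * U θ) * (deriv ρ θ * C (T * θ)) +
          gt G (ρ θ * C (T * θ)) (P * U θ) * (P * deriv U θ) -
          G (ρ θ * C (T * θ)) (P * U θ) * (deriv ρ θ * (1 / ρ θ))) / T) * (1 / ρ θ) := by
      simp only [hΨ']
      field_simp
      ring
    have hr1 : 1 / ρ θ ≤ 1 := by rw [div_le_one h1]; exact hρ θ
    have hr2 : 0 ≤ 1 / ρ θ := by positivity
    have b2 : |C (T * θ) * (f (P * U θ) - f (P * (x + β * θ)))| ≤ M * (B * (P * η)) := by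
      rw [abs_mul]
      exact mul_le_mul (hCM _) hfd (abs_nonneg _) (by linarith)
    have b3 : |gx G (ρ θ * C (T * θ)) (P * U θ) * (C (T * θ) - w (T * θ) * phi (cexpo p) (S (T * θ)))| ≤
        B * (M * (δ / (|S (T * θ)| ^ cexpo p + δ))) := by
      rw [abs_mul]
      exact mul_le_mul hg1 (hwC _) (abs_nonneg _) (by linarith)
    have b4 : |(w' (T * θ) * G (ρ θ * C (T * θ)) (P * U θ) +
          w (T * θ) * (gx G (ρ θ * C (T * θ)) (P * U θ) * (deriv ρ θ * C (T * θ)) +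
          gt G (ρ θ * C (T * θ)) (P * U θ) * (P * deriv U θ) -
          G (ρ θ * C (T * θ)) (P * U θ) * (deriv ρ θ * (1 / ρ θ))) / T) * (1 / ρ θ)| ≤
        (W * B + W * (B * (K1 * M) + B * (P * (2 * ω + 2)) + B * (K1 * 1)) / T) * (2 / r0) := by
      rw [abs_mul, abs_of_nonneg hr2]
      refine mul_le_mul ?_ (hinv θ) hr2 (by positivity)
      refine (abs_add_le _ _).trans (add_le_add ?_ ?_)
      · rw [abs_mul]; exact mul_le_mul (hW' _) hg3 (abs_nonneg _) hW0
      rw [abs_div, abs_of_pos hT, abs_mul]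
      refine div_le_div_of_nonneg_right (mul_le_mul (hW _) ?_ (abs_nonneg _) hW0) hT.le
      refine (abs_sub _ _).trans (add_le_add ((abs_add_le _ _).trans (add_le_add ?_ ?_)) ?_)
      · rw [abs_mul, abs_mul]
        gcongr
        exact hCM _
      · rw [abs_mul, abs_mul, abs_of_pos hP]
        gcongr
      · rw [abs_mul, abs_mul, abs_of_nonneg hr2]
        gcongr
    rw [e]
    refine (abs_sub _ _).trans ((add_le_add ((abs_add_le _ _).trans (add_le_add ((abs_add_le _ _).trans
      (add_le_add h4 b2)) b3)) b4).trans (le_of_eq ?_))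
    rw [hK2]; ring

end

section
variable {p a b T P B M A R ω β η δ γ τ : ℝ} {C S : ℝ → ℝ} {G : ℝ → ℝ → ℝ} {f : ℝ → ℝ}
  {k kt kh : ℝ → ℝ → ℝ → ℝ → ℝ} {l : ℝ → ℝ} {u v : ℝ → ℝ → ℝ → ℝ}

lemma Curve.countable_zeros (hc : Curve p a b T C S) (hp : 2 ≤ p) : {θ | S θ = 0}.Countable := by
  have hq := one_lt_cexpo hp
  have h : ∀ s : ℝ, {θ | S θ = 0 ∧ 0 < s * C θ}.Countable := fun s => by
    rcases eq_empty_or_nonempty {θ | S θ = 0 ∧ 0 < s * C θ} with h0 | ⟨θ₀, hS0, hC0⟩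
    · rw [h0]; exact countable_empty
    refine (countable_range fun n : ℤ => θ₀ + n * T).mono fun θ ⟨hS, hC⟩ => ?_
    have h1 : C θ ≠ 0 := fun h => by simp [h] at hC
    have h2 : 0 < C θ₀ / C θ := by
      have := div_pos hC0 hC
      rwa [mul_div_mul_left _ _ (fun h => by simp [h] at hC)] at this
    obtain ⟨-, n, hn⟩ := hc.inj 1 (C θ₀ / C θ) θ₀ θ one_pos h2 (by field_simp) (by rw [hS0, hS]; simp)
    exact ⟨n, hn.symm⟩
  refine ((h 1).union (h (-1))).mono fun θ (hθ : S θ = 0) => ?_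
  rcases lt_trichotomy (C θ) 0 with h0 | h0 | h0
  · exact Or.inr ⟨hθ, by linarith⟩
  · have := hc.energy θ
    rw [hθ, h0, pot_eq hp] at this
    simp [Real.zero_rpow (by linarith : cexpo p ≠ 0)] at this
  · exact Or.inl ⟨hθ, by linarith⟩

lemma Curve.exists_small (hc : Curve p a b T C S) (hp : 2 ≤ p) {e : ℝ} (he : 0 < e) :
    ∃ δ > 0, ∫ θ in (0 : ℝ)..1, δ / (|S (T * θ)| ^ cexpo p + δ) ≤ e := by
  have hq := one_lt_cexpo hp
  have hT := hc.T_pos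
  have hSc := hc.contS
  have hpos : ∀ᶠ δ : ℝ in 𝓝[>] 0, 0 < δ := self_mem_nhdsWithin
  have hlim : Tendsto (fun δ : ℝ => ∫ θ in (0 : ℝ)..1, δ / (|S (T * θ)| ^ cexpo p + δ)) (𝓝[>] 0)
      (𝓝 (∫ _ in (0 : ℝ)..1, (0 : ℝ))) := by
    refine intervalIntegral.tendsto_integral_filter_of_dominated_convergence (fun _ => 1) ?_ ?_
      intervalIntegrable_const ?_
    · filter_upwards [hpos] with δ hδ
      have h5 : Continuous fun θ => |S (T * θ)| ^ cexpo p :=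
        (hSc.comp (continuous_const.mul continuous_id)).abs.rpow_const fun _ => Or.inr (by linarith)
      exact (continuous_const.div (by fun_prop) fun θ => by positivity).aestronglyMeasurable
    · filter_upwards [hpos] with δ hδ
      refine Eventually.of_forall fun θ _ => ?_
      have h5 : 0 ≤ |S (T * θ)| ^ cexpo p := by positivity
      rw [Real.norm_eq_abs, abs_of_nonneg (by positivity), div_le_one (by positivity)]
      linarith
    · have hz : (fun θ => T * θ) ⁻¹' {θ | S θ = 0} |>.Countable :=
        (hc.countable_zeros hp).preimage (mul_right_injective₀ hT.ne')
      filter_upwards [hz.ae_notMem volume] with θ hθ _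
      have h5 : 0 < |S (T * θ)| ^ cexpo p := Real.rpow_pos_of_pos (abs_pos.2 hθ) _
      have : ContinuousAt (fun δ : ℝ => δ / (|S (T * θ)| ^ cexpo p + δ)) 0 :=
        continuousAt_id.div (by fun_prop) (by simpa using h5.ne')
      have h6 := this.tendsto
      rw [zero_div] at h6
      exact h6.mono_left nhdsWithin_le_nhds
  rw [intervalIntegral.integral_zero] at hlim
  obtain ⟨δ, h1, h2⟩ := ((hlim.eventually (gt_mem_nhds he)).and hpos).exists
  exact ⟨δ, h2, h1.le⟩

lemma KamTorus.abs_mean_sub_le (hK : KamTorus β ω η k kt kh l u v) {φ : ℝ → ℝ} (hφ : Continuous φ)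
    {y z c E : ℝ} (h : ∀ x, |z * (u y 1 x - u y 0 x) + c - φ x| ≤ E) :
    |c - ∫ x in (0 : ℝ)..1, φ x| ≤ E := by
  have hc : ∀ θ, Continuous fun x => u y θ x := fun θ =>
    hK.cu.comp (continuous_const.prodMk continuous_id : Continuous fun x => ((y, θ), x))
  have h1 : ∫ x in (0 : ℝ)..1, u y 1 x = ∫ x in (0 : ℝ)..1, u y 0 x := by
    have h2 : ∀ x, u y 1 x = u y 0 (x + β) := fun x => by simpa using hK.twu y 0 x
    have h3 := Function.Periodic.intervalIntegral_add_eq (f := u y 0) (T := 1) (hK.peru y 0) β 0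
    simp only [h2, intervalIntegral.integral_comp_add_right]
    rw [zero_add] at h3
    rw [zero_add, add_comm 1 β]
    exact h3
  have e : c - ∫ x in (0 : ℝ)..1, φ x = ∫ x in (0 : ℝ)..1, (z * (u y 1 x - u y 0 x) + c - φ x) := by
    have := hc 0
    have := hc 1
    rw [intervalIntegral.integral_sub, intervalIntegral.integral_add, intervalIntegral.integral_const_mul,
      intervalIntegral.integral_sub, h1]
    · simp
    all_goals exact Continuous.intervalIntegrable (by fun_prop) _ _
  rw [e]
  simpa using intervalIntegral.norm_integral_le_of_norm_le_const (a := 0) (b := 1)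
    (f := fun x => z * (u y 1 x - u y 0 x) + c - φ x) (fun x _ => h x)

lemma KamTorus.abs_l_le (hK : KamTorus β ω η k kt kh l u v) (hη : η < 1) (y : ℝ) : |β - ω - l y| ≤ η := by
  have h := hK.abs_mean_sub_le (φ := fun _ => 0) continuous_const (y := y) (z := 1) (c := β - ω - l y)
    (E := η) fun x => ?_
  · simpa using h
  have h1 := abs_sub_le_integral (F := fun θ => u y θ x - (ω + l y - β) * θ)
    (fun θ => (hK.du y θ x).sub (by simpa using (hasDerivAt_id θ).const_mul (ω + l y - β)))
    (continuous_const (y := η)) fun θ => ?_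
  · simp only [intervalIntegral.integral_const, sub_zero, one_smul, mul_one, mul_zero] at h1
    convert h1 using 2
    ring
  · convert hK.bkh y θ (x + β * θ + u y θ x) (v y θ x) ((hK.bv y θ x).trans_lt hη) using 2
    ring

/-- The mean of `l`, up to scaling, is the product of the means of `C` and `f`. -/
lemma exists_asymptotics (hp : 2 ≤ p) (ha : 0 < a) (hb : 0 < b) (hc : Curve p a b T C S)
    (hF : Forcing P B G f) (hM : 1 ≤ M) (hCM : ∀ θ, |C θ| ≤ M) (hA : 1 ≤ A) (hω : 0 < ω) (hη : η ≤ 1 / 4)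
    {e : ℝ} (he : 0 < e) :
    ∃ R₁, ∀ R β, R₁ ≤ R → 24 * A ≤ R → |β - ω| ≤ 1 → ∀ k kt kh l u v, KamTorus β ω η k kt kh l u v →
      LevelAction p T P A R ω C G f k → ∀ y, |(p - 1) * max y R ^ (p - 1) / ω * (β - ω - l y) -
        (∫ θ in (0 : ℝ)..1, C (T * θ)) * ∫ t in (0 : ℝ)..1, f (P * t)| ≤ M * P * B * η + e := by
  have hB := hF.B_one
  have hP := hF.P_pos
  obtain ⟨δ, hδ, hint⟩ := hc.exists_small hp (show 0 < e / (2 * (B * M)) by positivity)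
  obtain ⟨K, hK⟩ := orbit_mean hp ha hb hc hF hM hCM hA hω hδ
  refine ⟨max (8 * M * B) (2 * K / e), fun R β hR hRA hβ k kt kh l u v hT hk y => ?_⟩
  have hRm : R ≤ max y R := le_max_right _ _
  have hR1 := (le_max_left _ _).trans hR
  have hR2 := ((le_max_right _ _).trans hR).trans hRm
  have h0 : 0 < max y R := by linarith
  have hl : |l y| ≤ 2 := by
    have h1 := abs_le.1 (hT.abs_l_le (by linarith) y)
    have h2 := abs_le.1 hβ
    rw [abs_le]; constructor <;> linarith
  have hCc := hc.contC
  have hfc := hF.smf.continuous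
  have hφ : Continuous fun x => ∫ θ in (0 : ℝ)..1, C (T * θ) * f (P * (x + β * θ)) :=
    intervalIntegral.continuous_parametric_intervalIntegral_of_continuous' (by fun_prop) _ _
  have hm : ∫ x in (0 : ℝ)..1, ∫ θ in (0 : ℝ)..1, C (T * θ) * f (P * (x + β * θ)) =
      (∫ θ in (0 : ℝ)..1, C (T * θ)) * ∫ t in (0 : ℝ)..1, f (P * t) := by
    rw [intervalIntegral_intervalIntegral_swap]
    · have hfp : Function.Periodic (fun t => f (P * t)) 1 := fun t => by
        simp only [mul_add, mul_one, hF.perf]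
      simp only [intervalIntegral.integral_const_mul]
      rw [← intervalIntegral.integral_mul_const]
      refine intervalIntegral.integral_congr fun θ _ => ?_
      congr 1
      have h3 := hfp.intervalIntegral_add_eq (β * θ) 0
      rw [zero_add] at h3
      rw [← h3, intervalIntegral.integral_comp_add_right (fun t => f (P * t)), zero_add, add_comm 1]
    · refine (Continuous.integrableOn_Icc (a := ((0 : ℝ), (0 : ℝ))) (b := (1, 1)) (f := Function.uncurry fun x θ => C (T * θ) *
        f (P * (x + β * θ))) (by fun_prop)).mono_set ?_
      rw [uIoc_of_le zero_le_one, ← Icc_prod_Icc]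
      exact prod_mono Ioc_subset_Icc_self Ioc_subset_Icc_self
  rw [← hm]
  refine hT.abs_mean_sub_le hφ (y := y) (z := (p - 1) * max y R ^ (p - 1) / ω) fun x => ?_
  have hO := orbit_of_torus hp hc hF hM hCM hA hRA hR1 hω (by linarith) hT hk y x
  have := hK (max y R) (l y) β η x _ _ (hR1.trans hRm) hl hO fun θ => by
    simpa [angle] using hT.bu y θ x
  simp only [angle, mul_zero, mul_one, add_zero] at this
  have e1 : x + β + u y 1 x - (x + u y 0 x) - (l y + ω) = u y 1 x - u y 0 x + (β - ω - l y) := by ring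
  rw [e1, mul_add] at this
  refine this.trans ?_
  have h3 : K / max y R ≤ e / 2 := by
    rw [div_le_iff₀ h0]; rw [div_le_iff₀ he] at hR2; linarith
  have h4 : B * M * ∫ θ in (0 : ℝ)..1, δ / (|S (T * θ)| ^ cexpo p + δ) ≤ e / 2 := by
    calc _ ≤ B * M * (e / (2 * (B * M))) := by gcongr
      _ = e / 2 := by field_simp
  linarith

/-- There are invariant tori of the unmodified system at arbitrarily large energies. -/
theorem exists_balanced_torus (hp : 2 ≤ p) (ha : 0 < a) (hb : 0 < b) (hc : Curve p a b T C S)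
    (hF : Forcing P B G f) (hM : 1 ≤ M) (hCM : ∀ θ, |C θ| ≤ M) (hω : 0 < ω) (hγ : 0 < γ) (hτ1 : 1 < τ)
    (hτ2 : τ < 2) (hdio : ∀ m n : ℤ, m ≠ 0 → γ / |(m : ℝ)| ^ τ ≤ |m * ω + n|)
    (hm : (∫ θ in (0 : ℝ)..1, C (T * θ)) * ∫ t in (0 : ℝ)..1, f (P * t) ≠ 0) :
    ∃ A ≥ 1, ∃ η, 0 < η ∧ η ≤ 1 / 4 ∧ ∃ R₁, ∀ R ≥ R₁, ∃ β k kt kh l u v, ∃ y,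
      24 * A ≤ R ∧ KamTorus β ω η k kt kh l u v ∧ LevelAction p T P A R ω C G f k ∧ l y = 0 ∧
      β ≠ 0 := by
  have hB := hF.B_one
  have hP := hF.P_pos
  set m := (∫ θ in (0 : ℝ)..1, C (T * θ)) * ∫ t in (0 : ℝ)..1, f (P * t)
  have hm0 : 0 < |m| := abs_pos.2 hm
  set η := min (1 / 4) (|m| / (8 * (M * P * B)))
  have hη : 0 < η := lt_min (by norm_num) (by positivity)
  have hη4 : η ≤ 1 / 4 := min_le_left _ _
  have hηm : M * P * B * η ≤ |m| / 8 := by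
    calc M * P * B * η ≤ M * P * B * (|m| / (8 * (M * P * B))) :=
          mul_le_mul_of_nonneg_left (min_le_right _ _) (by positivity)
      _ = _ := by field_simp
  obtain ⟨γ', hγ', hnear⟩ := exists_dioph_near hγ hτ1 hτ2 hdio
  obtain ⟨A, hA, R₀, hR₀, htor⟩ := exists_torus hp hc hF hγ' hω hη hη4
  obtain ⟨R₁, hR₁⟩ := exists_asymptotics hp ha hb hc hF hM hCM hA hω hη4 (show 0 < |m| / 8 by positivity)
  refine ⟨A, hA, η, hη, hη4, max R₀ R₁, fun R hR => ?_⟩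
  have hRA : 24 * A ≤ R := hR₀.le.trans ((le_max_left _ _).trans hR)
  obtain ⟨σ, hσ, hσm⟩ : ∃ σ : ℝ, (σ = 1 ∨ σ = -1) ∧ σ * m = |m| := by
    rcases abs_choice m with h | h
    · exact ⟨1, Or.inl rfl, by rw [h, one_mul]⟩
    · exact ⟨-1, Or.inr rfl, by rw [h, neg_one_mul]⟩
  have hZpos : ∀ y : ℝ, 0 < (p - 1) * max y R ^ (p - 1) / ω := fun y =>
    div_pos (mul_pos (by linarith) (Real.rpow_pos_of_pos (by linarith [le_max_right y R]) _)) hω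
  set Z := fun y : ℝ => (p - 1) * max y R ^ (p - 1) / ω with hZ
  set d := min 1 (|m| / (2 * Z R))
  have hd : 0 < d := lt_min one_pos (div_pos hm0 (by linarith [hZpos R]))
  have hdZ : Z R * d ≤ |m| / 2 := by
    have := hZpos R
    calc Z R * d ≤ Z R * (|m| / (2 * Z R)) := mul_le_mul_of_nonneg_left (min_le_right _ _) this.le
      _ = _ := by
        have : Z R ≠ 0 := this.ne'
        field_simp
  obtain ⟨β, hβ, hβ0, hβd⟩ : ∃ β, Dioph γ' β ∧ 0 < σ * (β - ω) ∧ σ * (β - ω) < d := by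
    rcases hσ with rfl | rfl
    · obtain ⟨β, h, h'⟩ := hnear d hd ω (by linarith) le_rfl
      exact ⟨β, h', by linarith [h.1], by linarith [h.2]⟩
    · obtain ⟨β, h, h'⟩ := hnear d hd (ω - d) le_rfl (by linarith)
      exact ⟨β, h', by linarith [h.2], by linarith [h.1]⟩
  have hβ1 : |β - ω| ≤ 1 := by
    have : d ≤ 1 := min_le_left _ _
    rcases hσ with rfl | rfl <;> rw [abs_le] <;> constructor <;> linarith
  obtain ⟨k, kt, kh, l, u, v, hK, hk⟩ := htor R ((le_max_left _ _).trans hR) β hβ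
  have hk' : LevelAction p T P A R ω C G f k :=
    ⟨fun y θ t h hh => (hk y θ t h hh).1, fun y θ t h hh => (hk y θ t h hh).2⟩
  have has := hR₁ R β ((le_max_right _ _).trans hR) hRA hβ1 k kt kh l u v hK hk'
  have hbd : ∀ y, |Z y * (σ * (β - ω)) - Z y * (σ * l y) - σ * m| ≤ |m| / 4 := fun y => by
    have hs : |σ| = 1 := by rcases hσ with rfl | rfl <;> simp
    have : |Z y * (β - ω - l y) - m| ≤ _ := has y
    rw [← one_mul |_|, ← hs, ← abs_mul] at this
    refine le_trans (le_of_eq ?_) (this.trans (by linarith))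
    congr 1
    ring
  have hZm : ∀ y, max y R ≤ ω * Z y := fun y => by
    have h1 := le_rpow_sub_one hp (r := max y R) (by linarith [le_max_right y R])
    have : ω * Z y = (p - 1) * max y R ^ (p - 1) := by simp only [hZ]; field_simp
    rw [this]
    nlinarith [le_max_right y R]
  obtain ⟨y, hy⟩ : (0 : ℝ) ∈ range fun y => σ * l y := by
    refine mem_range_of_exists_le_of_exists_ge (continuous_const.mul hK.cl) ⟨R, ?_⟩
      ⟨ω * (2 * |m| / (σ * (β - ω))), ?_⟩
    · have h1 := abs_le.1 (hbd R)
      have h2 : Z R * (σ * (β - ω)) ≤ Z R * d := mul_le_mul_of_nonneg_left hβd.le (hZpos R).le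
      by_contra! h3
      have := mul_pos (hZpos R) h3
      simp only [hZ] at *
      linarith
    · set y := ω * (2 * |m| / (σ * (β - ω)))
      have h1 := abs_le.1 (hbd y)
      have h2 : 2 * |m| ≤ Z y * (σ * (β - ω)) := by
        rw [← div_le_iff₀ hβ0]
        exact le_of_mul_le_mul_left ((le_max_left y R).trans (hZm y)) hω
      by_contra! h3
      have := mul_neg_of_pos_of_neg (hZpos y) h3
      simp only [hZ] at *
      linarith
  refine ⟨β, k, kt, kh, l, u, v, y, hRA, hK, hk', ?_, ?_⟩
  swap
  · rintro rfl
    have := hβ 1 0 one_ne_zero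
    norm_num at this
    linarith
  rcases hσ with rfl | rfl <;> simpa using hy

end

lemma abs_phi_sub_le {q : ℝ} (hq : 1 < q) (hq2 : q ≤ 2) {x : ℝ} (hx : x ≠ 0) (y : ℝ) :
    |phi q x - phi q y| ≤ 2 * |x| ^ (q - 2) * |x - y| := by
  have key : ∀ c, |1 - phi q c| ≤ 2 * |1 - c| := fun c => by
    rcases le_total 0 c with hc | hc
    · rw [phi_of_nonneg hq.ne' hc]
      rcases le_total c 1 with h | h
      · have h1 := Real.rpow_le_rpow_of_exponent_ge' hc h (by linarith : 0 ≤ q - 1) (by linarith : q - 1 ≤ 1)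
        have h2 := Real.rpow_le_one hc h (by linarith : 0 ≤ q - 1)
        rw [Real.rpow_one] at h1
        rw [abs_of_nonneg (by linarith), abs_of_nonneg (by linarith)]; linarith
      · have h1 := Real.rpow_le_rpow_of_exponent_le h (by linarith : q - 1 ≤ 1)
        have h2 := Real.one_le_rpow h (by linarith : 0 ≤ q - 1)
        rw [Real.rpow_one] at h1
        rw [abs_of_nonpos (by linarith), abs_of_nonpos (by linarith)]; linarith
    · have h1 : |c| ^ (q - 1) ≤ 1 + |c| := by
        refine (Real.rpow_le_rpow (abs_nonneg c) (by linarith : |c| ≤ 1 + |c|) (by linarith)).trans ?_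
        simpa using Real.rpow_le_rpow_of_exponent_le (by linarith [abs_nonneg c] : 1 ≤ 1 + |c|)
          (by linarith : q - 1 ≤ 1)
      refine (abs_sub _ _).trans ?_
      rw [abs_phi hq.ne', abs_one, abs_of_nonneg (by linarith : 0 ≤ 1 - c)]
      rw [abs_of_nonpos hc] at h1 ⊢
      linarith
  have h := key (y / x)
  have e1 : phi q x - phi q y = phi q x * (1 - phi q (y / x)) := by
    have : |x| ^ (q - 2) ≠ 0 := (Real.rpow_pos_of_pos (abs_pos.2 hx) _).ne'
    simp only [phi, abs_div, Real.div_rpow (abs_nonneg y) (abs_nonneg x)]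
    field_simp
  have e2 : x - y = x * (1 - y / x) := by field_simp
  rw [e1, e2, phi, abs_mul, abs_mul, abs_mul x, abs_of_nonneg (by positivity : 0 ≤ |x| ^ (q - 2))]
  calc _ ≤ |x| ^ (q - 2) * |x| * (2 * |1 - y / x|) := by gcongr
    _ = _ := by ring

/-- Uniqueness for systems driven by `phi q` with `q ≤ 2` along solutions crossing `Y = 0` transversally. -/
lemma eq_of_eq_at {q : ℝ} (hq : 1 < q) (hq2 : q ≤ 2) {X₁ Y₁ X₂ Y₂ κ : ℝ → ℝ} {g : ℝ → ℝ → ℝ} (hκ : Continuous κ)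
    (dX₁ : ∀ s, HasDerivAt X₁ (κ s * phi q (Y₁ s)) s) (dY₁ : ∀ s, HasDerivAt Y₁ (κ s * g s (X₁ s)) s)
    (dX₂ : ∀ s, HasDerivAt X₂ (κ s * phi q (Y₂ s)) s) (dY₂ : ∀ s, HasDerivAt Y₂ (κ s * g s (X₂ s)) s)
    (hne : ∀ s, Y₁ s = 0 → κ s * g s (X₁ s) ≠ 0)
    (hL : ∀ s, X₁ s = X₂ s → ∃ L ≥ 0, ∀ᶠ σ in 𝓝 s, |g σ (X₁ σ) - g σ (X₂ σ)| ≤ L * |X₁ σ - X₂ σ|) {s₀ : ℝ}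
    (hX : X₁ s₀ = X₂ s₀) (hY : Y₁ s₀ = Y₂ s₀) (s : ℝ) : X₁ s = X₂ s ∧ Y₁ s = Y₂ s := by
  have hc : ∀ {F F' : ℝ → ℝ}, (∀ s, HasDerivAt F (F' s) s) → Continuous F := fun h =>
    continuous_iff_continuousAt.2 fun θ => (h θ).continuousAt
  have hX₁ := hc dX₁
  have hX₂ := hc dX₂
  have hY₁ := hc dY₁
  have hY₂ := hc dY₂
  have hcl : IsClosed {s | X₁ s = X₂ s ∧ Y₁ s = Y₂ s} := (isClosed_eq hX₁ hX₂).inter (isClosed_eq hY₁ hY₂)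
  suffices hop : IsOpen {s | X₁ s = X₂ s ∧ Y₁ s = Y₂ s} by
    have := (IsClopen.eq_univ ⟨hcl, hop⟩ ⟨s₀, hX, hY⟩).ge (mem_univ s)
    exact this
  clear hX hY s₀ s
  rw [isOpen_iff_mem_nhds]
  rintro s₀ ⟨hX, hY⟩
  obtain ⟨L, hL0, hL⟩ := hL s₀ hX
  obtain ⟨c, hc0, hc⟩ : ∃ c > 0, ∀ᶠ σ in 𝓝 s₀, c * |σ - s₀| ≤ |Y₁ σ| := by
    by_cases h0 : Y₁ s₀ = 0
    · have hd := abs_pos.2 (hne s₀ h0)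
      refine ⟨_, half_pos hd, ?_⟩
      filter_upwards [(hasDerivAt_iff_isLittleO.1 (dY₁ s₀)).def (half_pos hd)] with σ hσ
      rw [h0, sub_zero, Real.norm_eq_abs, Real.norm_eq_abs, smul_eq_mul] at hσ
      have := abs_sub_abs_le_abs_sub ((σ - s₀) * (κ s₀ * g s₀ (X₁ s₀))) (Y₁ σ)
      rw [abs_sub_comm, abs_mul] at this
      linarith
    · have hd := abs_pos.2 h0
      refine ⟨_, half_pos hd, ?_⟩
      filter_upwards [hY₁.abs.continuousAt.eventually (lt_mem_nhds (half_lt_self hd)),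
        Metric.ball_mem_nhds s₀ one_pos] with σ h1 h2
      rw [Metric.mem_ball, Real.dist_eq] at h2
      nlinarith
  set K := |κ s₀| + 1
  have hK0 : 0 < K := by positivity
  have hK : ∀ᶠ σ in 𝓝 s₀, |κ σ| < K := hκ.abs.continuousAt.eventually (gt_mem_nhds (lt_add_one _))
  obtain ⟨ε₀, hε₀, H⟩ := Metric.eventually_nhds_iff.1 (hL.and (hc.and hK))
  set c₁ := K * (2 * c ^ (q - 2) * (K * L))
  have hc₁ : 0 ≤ c₁ := by positivity
  set ε := min (ε₀ / 2) (min 1 (1 / (2 * (c₁ + 1))))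
  have hε : 0 < ε := by positivity
  have hε1 : ε ≤ 1 := (min_le_right _ _).trans (min_le_left _ _)
  have hεc : c₁ * ε ≤ 1 / 2 := by
    have : ε ≤ 1 / (2 * (c₁ + 1)) := (min_le_right _ _).trans (min_le_right _ _)
    rw [le_div_iff₀ (by positivity)] at this
    linarith
  have hmem : Metric.closedBall s₀ ε ∈ 𝓝 s₀ := Metric.closedBall_mem_nhds _ hε
  have hs₀ : s₀ ∈ Metric.closedBall s₀ ε := mem_of_mem_nhds hmem
  obtain ⟨m, hm, hmax⟩ := (isCompact_closedBall s₀ ε).exists_isMaxOn ⟨s₀, hs₀⟩ (hX₁.sub hX₂).abs.continuousOn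
  have hI : ∀ σ ∈ Metric.closedBall s₀ ε, |σ - s₀| ≤ ε ∧ dist σ s₀ < ε₀ := fun σ hσ =>
    ⟨hσ, hσ.trans_lt ((min_le_left _ _).trans_lt (half_lt_self hε₀))⟩
  set Δ := |X₁ m - X₂ m|
  have hΔ : ∀ σ ∈ Metric.closedBall s₀ ε, |X₁ σ - X₂ σ| ≤ Δ := fun σ hσ => hmax hσ
  have hYd : ∀ σ ∈ Metric.closedBall s₀ ε, |Y₁ σ - Y₂ σ| ≤ K * (L * Δ) * |σ - s₀| := fun σ hσ => by
    have := (convex_closedBall s₀ ε).norm_image_sub_le_of_norm_hasDerivWithin_le (C := K * (L * Δ))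
      (fun τ _ => ((dY₁ τ).sub (dY₂ τ)).hasDerivWithinAt) (fun τ hτ => ?_) hs₀ hσ
    · simpa [hY] using this
    obtain ⟨h1, -, h3⟩ := H (hI τ hτ).2
    rw [← mul_sub, Real.norm_eq_abs, abs_mul]
    exact mul_le_mul h3.le (h1.trans (mul_le_mul_of_nonneg_left (hΔ τ hτ) hL0)) (abs_nonneg _) hK0.le
  have hXd : ∀ σ ∈ Metric.closedBall s₀ ε, |X₁ σ - X₂ σ| ≤ c₁ * Δ * |σ - s₀| := fun σ hσ => by
    have := (convex_closedBall s₀ ε).norm_image_sub_le_of_norm_hasDerivWithin_le (C := c₁ * Δ)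
      (fun τ _ => ((dX₁ τ).sub (dX₂ τ)).hasDerivWithinAt) (fun τ hτ => ?_) hs₀ hσ
    · simpa [hX] using this
    obtain ⟨-, h2, h3⟩ := H (hI τ hτ).2
    rw [← mul_sub, Real.norm_eq_abs, abs_mul]
    rcases eq_or_ne τ s₀ with rfl | hne
    · rw [hY]; simp only [sub_self, abs_zero, mul_zero]; positivity
    have h4 : 0 < |τ - s₀| := abs_pos.2 (sub_ne_zero.2 hne)
    have h5 : 0 < c * |τ - s₀| := by positivity
    have h6 := Real.rpow_le_rpow_of_nonpos h5 h2 (by linarith : q - 2 ≤ 0)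
    rw [Real.mul_rpow hc0.le h4.le] at h6
    have h7 : |τ - s₀| ^ (q - 2) * |τ - s₀| ≤ 1 := by
      rw [← Real.rpow_add_one h4.ne']
      exact Real.rpow_le_one h4.le ((hI τ hτ).1.trans hε1) (by linarith)
    have h8 := abs_phi_sub_le hq hq2 (abs_pos.1 (h5.trans_le h2)) (Y₂ τ)
    calc |κ τ| * |phi q (Y₁ τ) - phi q (Y₂ τ)|
        ≤ K * (2 * (c ^ (q - 2) * |τ - s₀| ^ (q - 2)) * (K * (L * Δ) * |τ - s₀|)) :=
          mul_le_mul h3.le (h8.trans (mul_le_mul (mul_le_mul_of_nonneg_left h6 two_pos.le) (hYd τ hτ)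
            (abs_nonneg _) (by positivity))) (abs_nonneg _) hK0.le
      _ = c₁ * Δ * (|τ - s₀| ^ (q - 2) * |τ - s₀|) := by simp only [c₁]; ring
      _ ≤ c₁ * Δ * 1 := by gcongr
      _ = _ := mul_one _
  have hΔ0 : Δ = 0 := by
    have h1 := hXd m hm
    have h2 : c₁ * Δ * |m - s₀| ≤ c₁ * Δ * ε := mul_le_mul_of_nonneg_left (hI m hm).1 (by positivity)
    have h3 : 0 ≤ Δ := abs_nonneg _
    nlinarith
  filter_upwards [hmem] with σ hσ
  have h1 := hΔ σ hσ
  have h2 := hYd σ hσ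
  rw [hΔ0] at h1 h2
  simp only [mul_zero, zero_mul, abs_nonpos_iff, sub_eq_zero] at h1 h2
  exact ⟨h1, h2⟩

lemma locallyLipschitz_force {p : ℝ} (hp : 2 ≤ p) (a b : ℝ) : LocallyLipschitz (force p a b) := by
  have h1 : ∀ c : ℝ, LocallyLipschitz fun x : ℝ => c * phi p (max x 0) := fun c => by
    have h2 : (fun x : ℝ => c * phi p (max x 0)) = (fun x => c * x ^ (p - 1)) ∘ fun x => max x 0 :=
      funext fun x => by simp only [Function.comp, phi_of_nonneg (by linarith : p ≠ 1) (le_max_right x 0)]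
    rw [h2]
    exact (contDiff_const.mul (Real.contDiff_rpow_const_of_le (n := 1) (by norm_num; linarith))).locallyLipschitz.comp
      (LocallyLipschitz.id.max (LocallyLipschitz.const 0))
  intro x
  obtain ⟨K₁, t₁, ht₁, H₁⟩ := h1 a x
  obtain ⟨K₂, t₂, ht₂, H₂⟩ := ((h1 (-b)).comp (contDiff_neg (𝕜 := ℝ) (F := ℝ) (n := 1)).locallyLipschitz) x
  refine ⟨K₁ + K₂, t₁ ∩ t₂, inter_mem ht₁ ht₂, ?_⟩
  have h : force p a b = fun x => a * phi p (max x 0) + ((fun x => -b * phi p (max x 0)) ∘ fun p => -p) x := by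
    funext x
    simp only [force, Function.comp]; ring
  rw [h]
  exact (H₁.mono inter_subset_left).add (H₂.mono inter_subset_right)

/-- An invariant torus of the equation: time `P * α x s` and radius `ρ x s` along the curves `s ↦ (x, s)`. -/
structure InvTorus (p a b T P β r₁ r₂ : ℝ) (C S : ℝ → ℝ) (G : ℝ → ℝ → ℝ) (f : ℝ → ℝ) (α ρ : ℝ → ℝ → ℝ) :
    Prop where
  cα : Continuous fun q : ℝ × ℝ => α q.1 q.2
  cρ : Continuous fun q : ℝ × ℝ => ρ q.1 q.2
  twα : ∀ x s, α x (s + 1) = α (x + β) s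
  twρ : ∀ x s, ρ x (s + 1) = ρ (x + β) s
  inj : ∀ s x x', α x s = α x' s → x = x'
  near : ∀ x s, |α x s - (x + β * s)| ≤ 1
  lo : ∀ x s, r₁ ≤ ρ x s
  hi : ∀ x s, ρ x s ≤ r₂
  flow : ∀ x, ∃ κ : ℝ → ℝ, Continuous κ ∧ ∀ s, HasDerivAt (fun s => P * α x s) (κ s) s ∧
    HasDerivAt (fun s => ρ x s * C (T * s)) (κ s * phi (cexpo p) (ρ x s ^ (p - 1) * S (T * s))) s ∧
    HasDerivAt (fun s => ρ x s ^ (p - 1) * S (T * s))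
      (κ s * (gx G (ρ x s * C (T * s)) (P * α x s) + f (P * α x s) - force p a b (ρ x s * C (T * s)))) s ∧
    (ρ x s ^ (p - 1) * S (T * s) = 0 →
      κ s * (gx G (ρ x s * C (T * s)) (P * α x s) + f (P * α x s) - force p a b (ρ x s * C (T * s))) ≠ 0)

section
variable {p a b T P B M A R ω β η r0 : ℝ} {C S : ℝ → ℝ} {G : ℝ → ℝ → ℝ} {f : ℝ → ℝ}
  {k kt kh : ℝ → ℝ → ℝ → ℝ → ℝ} {l : ℝ → ℝ} {u v : ℝ → ℝ → ℝ → ℝ}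

lemma Orbit.cartesian {U ρ : ℝ → ℝ} (hp : 2 ≤ p) (ha : 0 < a) (hb : 0 < b) (hc : Curve p a b T C S)
    (hF : Forcing P B G f) (hM : 1 ≤ M) (hCM : ∀ θ, |C θ| ≤ M) (hT : T = P * ω)
    (hr : 8 * M * B ≤ r0) (hO : Orbit p T P ω A r0 0 C S G f U ρ) :
    ∃ κ : ℝ → ℝ, Continuous κ ∧ ∀ s, HasDerivAt (fun s => P * U s) (κ s) s ∧
    HasDerivAt (fun s => ρ s * C (T * s)) (κ s * phi (cexpo p) (ρ s ^ (p - 1) * S (T * s))) s ∧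
    HasDerivAt (fun s => ρ s ^ (p - 1) * S (T * s))
      (κ s * (gx G (ρ s * C (T * s)) (P * U s) + f (P * U s) - force p a b (ρ s * C (T * s)))) s ∧
    (ρ s ^ (p - 1) * S (T * s) = 0 →
      κ s * (gx G (ρ s * C (T * s)) (P * U s) + f (P * U s) - force p a b (ρ s * C (T * s))) ≠ 0) := by
  have hB := hF.B_one
  have hMB : 1 ≤ M * B := by nlinarith
  have hq := one_lt_cexpo hp
  have hp1 : 0 < p - 1 := by linarith
  have hU : Continuous U := continuous_iff_continuousAt.2 fun s => (hO.dU s).continuousAt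
  have hρ : Continuous ρ := continuous_iff_continuousAt.2 fun s => (hO.dρ s).continuousAt
  have hρ4 : ∀ s, 4 * M * B ≤ ρ s := fun s => by linarith [hO.lo s]
  have hρ0 : ∀ s, 0 < ρ s := fun s => by linarith [hρ4 s]
  have hpw : ∀ s, 0 < ρ s ^ (p - 1) := fun s => Real.rpow_pos_of_pos (hρ0 s) _
  have hd : ∀ s, 0 < den p T P C G f s (U s) (ρ s) := fun s =>
    one_half_pos.trans_le (half_le_den hp hF hM hCM (hρ4 s) s (U s))
  refine ⟨fun s => T * ((p - 1) * ρ s ^ (p - 1) / den p T P C G f s (U s) (ρ s)), ?_, fun s => ?_⟩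
  · refine continuous_const.mul (Continuous.div (continuous_const.mul
      (hρ.rpow_const fun s => Or.inl (hρ0 s).ne')) ?_ fun s => (hd s).ne')
    exact (continuous_den hp hc hF hU).comp (by fun_prop : Continuous fun s => (ρ s, s))
  have hTs : HasDerivAt (fun s => T * s) T s := by simpa using (hasDerivAt_id s).const_mul T
  have hC : HasDerivAt (fun s => C (T * s)) (phi (cexpo p) (S (T * s)) * T) s := (hc.dC (T * s)).comp s hTs
  have hS : HasDerivAt (fun s => S (T * s)) (-(force p a b (C (T * s))) * T) s := (hc.dS (T * s)).comp s hTs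
  have hdr : gx G (ρ s * C (T * s)) (P * U s) + f (P * U s) = drive T P C G f s (U s) (ρ s) := rfl
  have hde : (p - 1) * ρ s ^ (p - 1) = den p T P C G f s (U s) (ρ s) +
    C (T * s) * drive T P C G f s (U s) (ρ s) := by simp only [den]; ring
  have hdle := hF.drive_le (T := T) (C := C) s (U s) (ρ s)
  have he : (p - 1) * (phi (cexpo p) (S (T * s)) * S (T * s)) +
      force p a b (C (T * s)) * C (T * s) = p - 1 := by
    have := hc.energy (T * s)
    rw [pot_eq hp, cexpo_div hp, ← phi_mul_self hq] at this
    field_simp at this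
    linarith
  have hd' := hd s
  have hP := (hO.dU s).const_mul P
  have hX := (hO.dρ s).mul hC
  have hY := ((hO.dρ s).rpow_const (p := p - 1) (Or.inl (hρ0 s).ne')).mul hS
  have hρρ : ρ s ^ (p - 1 - 1) * ρ s = ρ s ^ (p - 1) := by
    rw [← Real.rpow_add_one (hρ0 s).ne']; congr 1; ring
  have hpq : (ρ s ^ (p - 1)) ^ (cexpo p - 1) = ρ s := by
    rw [← Real.rpow_mul (hρ0 s).le, cexpo_sub_one hp, mul_one_div_cancel hp1.ne', Real.rpow_one]
  rw [hdr, force_mul hp (hρ0 s), phi_mul hq.ne' (hpw s), hpq]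
  beta_reduce
  have hw := hpw s
  have hρs := hρ4 s
  have h1 := le_rpow_sub_one hp (r := ρ s) (by linarith)
  generalize den p T P C G f s (U s) (ρ s) = d at *
  generalize drive T P C G f s (U s) (ρ s) = g at *
  generalize ρ s ^ (p - 1) = w at *
  generalize ρ s ^ (p - 1 - 1) = w' at *
  refine ⟨hP.congr_deriv ?_, hX.congr_deriv ?_, hY.congr_deriv ?_, fun h0 => ?_⟩
  · rw [hT]; ring
  · field_simp
    linear_combination (-(T * ρ s * phi (cexpo p) (S (T * s)))) * hde
  · field_simp
    linear_combination (T * phi (cexpo p) (S (T * s)) * g * (p - 1) * S (T * s)) * hρρ + (T * w * g) * he +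
      (T * w * force p a b (C (T * s))) * hde
  · have hS0 : S (T * s) = 0 := (mul_eq_zero.1 h0).resolve_left hw.ne'
    rw [hS0, mul_zero, mul_zero, zero_add] at he
    have h2 : 1 ≤ |force p a b (C (T * s))| * M := by
      calc 1 ≤ |force p a b (C (T * s)) * C (T * s)| := by rw [he, abs_of_pos hp1]; linarith
        _ ≤ _ := by rw [abs_mul]; exact mul_le_mul_of_nonneg_left (hCM _) (abs_nonneg _)
    refine mul_ne_zero (mul_pos hc.T_pos (by positivity)).ne' fun h => ?_
    have h3 : |w * force p a b (C (T * s))| ≤ 2 * B := by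
      rw [← sub_eq_zero.1 h]; exact hdle
    rw [abs_mul, abs_of_pos hw] at h3
    have h4 : 4 * M * B * |force p a b (C (T * s))| ≤ 2 * B :=
      (mul_le_mul_of_nonneg_right (hρs.trans h1) (abs_nonneg _)).trans h3
    nlinarith

lemma invTorus_of_torus (hp : 2 ≤ p) (ha : 0 < a) (hb : 0 < b) (hc : Curve p a b T C S)
    (hF : Forcing P B G f) (hM : 1 ≤ M) (hCM : ∀ θ, |C θ| ≤ M) (hA : 1 ≤ A) (hRA : 24 * A ≤ R)
    (hRM : 8 * M * B ≤ R) (hω : 0 < ω) (hT : T = P * ω) (hη : η ≤ 1 / 4) (hK : KamTorus β ω η k kt kh l u v)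
    (hk : LevelAction p T P A R ω C G f k) {y : ℝ} (hl : l y = 0) :
    InvTorus p a b T P β (R / 2) (2 * max y R) C S G f (angle β u y) (radius p A R ω β k u v y) := by
  have hO : ∀ x, Orbit p T P ω A (max y R) 0 C S G f (angle β u y x) (radius p A R ω β k u v y x) := fun x => by
    have := orbit_of_torus hp hc hF hM hCM hA hRA hRM hω (by linarith) hK hk y x
    rwa [hl] at this
  have hRm : R ≤ max y R := le_max_right _ _
  have hlo : ∀ x s, R / 2 ≤ radius p A R ω β k u v y x s := fun x s => by linarith [(hO x).lo s]
  have hcα := continuous_angle hK y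
  have hsub : ∀ x s x' s', |radius p A R ω β k u v y x s - radius p A R ω β k u v y x' s'| ≤
      2 * |max y R ^ p / cexpo p + A * max y R ^ (p - 1) * v y s x -
        level p T P C G f s (angle β u y x s) (radius p A R ω β k u v y x' s')| := fun x s x' s' => by
    rw [← radius_eq (by linarith) hK hk]
    exact abs_sub_le_level hp hF hM hCM (by linarith [hlo x s]) (by linarith [hlo x' s']) _ _
  refine ⟨hcα, continuous_iff_continuousAt.2 fun q => ?_, angle_add_one hK y, fun x s => ?_, fun s x x' h => ?_,
    fun x s => ?_, hlo, fun x s => (hO x).hi s, fun x => (hO x).cartesian hp ha hb hc hF hM hCM hT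
      (hRM.trans hRm)⟩
  · have hv : Continuous fun q : ℝ × ℝ => v y q.2 q.1 :=
      hK.cv.comp (by fun_prop : Continuous fun q : ℝ × ℝ => (((y, q.2), q.1) : (ℝ × ℝ) × ℝ))
    have h1 : Continuous fun q' : ℝ × ℝ => 2 * |max y R ^ p / cexpo p + A * max y R ^ (p - 1) * v y q'.2 q'.1 -
        level p T P C G f q'.2 (angle β u y q'.1 q'.2) (radius p A R ω β k u v y q.1 q.2)| :=
      continuous_const.mul ((continuous_const.add (continuous_const.mul hv)).sub
        ((continuous_level hp hc hF).comp (continuous_snd.prodMk (hcα.prodMk continuous_const)))).abs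
    have h2 := h1.tendsto q
    rw [← radius_eq (by linarith) hK hk, sub_self, abs_zero, mul_zero] at h2
    exact tendsto_iff_dist_tendsto_zero.2 (squeeze_zero (fun _ => dist_nonneg)
      (fun q' => hsub q'.1 q'.2 q.1 q.2) h2)
  · have h1 := hsub x (s + 1) (x + β) s
    have h2 := radius_eq (by linarith) hK hk y (x + β) s
    have h3 : ∀ t r, level p T P C G f (s + 1) t r = level p T P C G f s t r := fun t r => by
      simp only [level, mul_add, mul_one, hc.perC]
    rw [h3, angle_add_one hK, h2, hK.twv, sub_self, abs_zero, mul_zero] at h1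
    exact sub_eq_zero.1 (abs_nonpos_iff.1 h1)
  · have h1 := hK.lip y s x x'
    simp only [angle] at h
    rw [show u y s x - u y s x' = -(x - x') by linarith, abs_neg] at h1
    have h2 : |x - x'| ≤ 0 := by nlinarith [abs_nonneg (x - x')]
    exact sub_eq_zero.1 (abs_nonpos_iff.1 h2)
  · simp only [angle, add_sub_cancel_left]
    linarith [hK.bu y s x]

end

lemma isClosed_setOf_exists_mem {X Y : Type*} [TopologicalSpace X] [TopologicalSpace Y] {K : Set Y}
    (hK : IsCompact K) {F : Set (X × Y)} (hF : IsClosed F) : IsClosed {t | ∃ k ∈ K, (t, k) ∈ F} := by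
  have := isCompact_iff_compactSpace.1 hK
  convert isClosedMap_fst_of_compactSpace (X := X) (Y := K) _
    (hF.preimage (by fun_prop : Continuous fun q : X × K => (q.1, (q.2 : Y)))) using 1
  ext t
  simp

section
variable {p a b T P B β r₁ r₂ : ℝ} {C S x y : ℝ → ℝ} {G : ℝ → ℝ → ℝ} {f : ℝ → ℝ} {α ρ : ℝ → ℝ → ℝ}

lemma Forcing.abs_gx_sub_le (hF : Forcing P B G f) (x x' t : ℝ) : |gx G x t - gx G x' t| ≤ B * |x - x'| := by
  have hd : Differentiable ℝ fun x => gx G x t := by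
    have := (hF.smGx t).differentiable_iteratedDeriv 1 (by norm_num)
    rwa [iteratedDeriv_one] at this
  have := convex_univ.norm_image_sub_le_of_norm_deriv_le (C := B) (fun x _ => hd x) (fun x _ => ?_)
    (mem_univ x') (mem_univ x)
  · simpa using this
  · have h := hF.bdx 2 (by norm_num) x t
    rwa [iteratedDeriv_succ, iteratedDeriv_one] at h

lemma InvTorus.eqOn (hp : 2 ≤ p) (hF : Forcing P B G f)
    (hI : InvTorus p a b T P β r₁ r₂ C S G f α ρ) (hx : ∀ t, HasDerivAt x (phi (cexpo p) (y t)) t)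
    (hy : ∀ t, HasDerivAt y (gx G (x t) t + f t - force p a b (x t)) t) {w s₀ : ℝ}
    (hxs : ρ w s₀ * C (T * s₀) = x (P * α w s₀)) (hys : ρ w s₀ ^ (p - 1) * S (T * s₀) = y (P * α w s₀)) (s : ℝ) :
    ρ w s * C (T * s) = x (P * α w s) ∧ ρ w s ^ (p - 1) * S (T * s) = y (P * α w s) := by
  obtain ⟨κ, hκ, h⟩ := hI.flow w
  have hX₂ := fun s => ((hx _).comp s (h s).1).congr_deriv (mul_comm _ _)
  refine eq_of_eq_at (X₁ := fun s => ρ w s * C (T * s)) (Y₁ := fun s => ρ w s ^ (p - 1) * S (T * s))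
    (X₂ := fun s => x (P * α w s)) (Y₂ := fun s => y (P * α w s))
    (g := fun s X => gx G X (P * α w s) + f (P * α w s) - force p a b X)
    (one_lt_cexpo hp) (cexpo_le_two hp) hκ (fun s => (h s).2.1) (fun s => (h s).2.2.1) hX₂
    (fun s => ((hy _).comp s (h s).1).congr_deriv (mul_comm _ _)) (fun s => (h s).2.2.2) (fun s hs => ?_) hxs hys s
  obtain ⟨K, t, ht, hK⟩ := locallyLipschitz_force hp a b (x (P * α w s))
  have h2 := (hX₂ s).continuousAt.eventually_mem ht
  rw [← hs] at ht
  have h1 := (h s).2.1.continuousAt.eventually_mem ht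
  have hB := hF.B_one
  refine ⟨B + K, by positivity, ?_⟩
  filter_upwards [h1, h2] with σ h1 h2
  have h3 := hK.dist_le_mul _ h1 _ h2
  have h4 := hF.abs_gx_sub_le (ρ w σ * C (T * σ)) (x (P * α w σ)) (P * α w σ)
  rw [Real.dist_eq, Real.dist_eq] at h3
  have h5 := abs_sub (gx G (ρ w σ * C (T * σ)) (P * α w σ) - gx G (x (P * α w σ)) (P * α w σ))
    (force p a b (ρ w σ * C (T * σ)) - force p a b (x (P * α w σ)))
  refine le_trans (le_of_eq ?_) (h5.trans ((add_le_add h4 h3).trans (by rw [add_mul]; rfl)))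
  congr 1
  ring

lemma InvTorus.surjective (hI : InvTorus p a b T P β r₁ r₂ C S G f α ρ) (hβ : β ≠ 0) (x t : ℝ) :
    ∃ s, α x s = t := by
  refine mem_range_of_exists_le_of_exists_ge
    (hI.cα.comp (by fun_prop : Continuous fun s : ℝ => (x, s))) ⟨(t - x - 1) / β, ?_⟩ ⟨(t - x + 1) / β, ?_⟩
  · have := (abs_le.1 (hI.near x ((t - x - 1) / β))).2
    rw [mul_div_cancel₀ _ hβ] at this
    show _ ≤ _; linarith
  · have := (abs_le.1 (hI.near x ((t - x + 1) / β))).1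
    rw [mul_div_cancel₀ _ hβ] at this
    show _ ≤ _; linarith

/-- A solution starting inside an invariant torus stays inside. -/
lemma InvTorus.trap (hp : 2 ≤ p) (ha : 0 < a) (hb : 0 < b) (hc : Curve p a b T C S) (hF : Forcing P B G f)
    (hI : InvTorus p a b T P β r₁ r₂ C S G f α ρ) (hβ : β ≠ 0) (hr₁ : 0 < r₁)
    (hx : ∀ t, HasDerivAt x (phi (cexpo p) (y t)) t)
    (hy : ∀ t, HasDerivAt y (gx G (x t) t + f t - force p a b (x t)) t)
    (h0 : (|y 0| ^ cexpo p + pot p a b (x 0)) ^ (1 / p) ≤ r₁) (t : ℝ) :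
    ∃ r θ, 0 ≤ r ∧ r ≤ r₂ ∧ x t = r * C θ ∧ y t = r ^ (p - 1) * S θ := by
  have hq := one_lt_cexpo hp
  have hp0 : 0 < p := by linarith
  have hT := hc.T_pos
  have hP := hF.P_pos
  have hxc : Continuous x := continuous_iff_continuousAt.2 fun s => (hx s).continuousAt
  have hyc : Continuous y := continuous_iff_continuousAt.2 fun s => (hy s).continuousAt
  have hpot : Continuous (pot p a b) := continuous_iff_continuousAt.2 fun s => (hasDerivAt_pot hp s).continuousAt
  set rr : ℝ → ℝ := fun t => (|y t| ^ cexpo p + pot p a b (x t)) ^ (1 / p)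
  have hrrc : Continuous rr := ((hyc.abs.rpow_const fun _ => Or.inr (by linarith)).add
    (hpot.comp hxc)).rpow_const fun _ => Or.inr (by positivity)
  have hrr0 : ∀ t, 0 ≤ rr t := fun t => Real.rpow_nonneg
    (add_nonneg (Real.rpow_nonneg (abs_nonneg _) _) (pot_nonneg hp ha hb _)) _
  set w : ℝ × ℝ × ℝ → ℝ := fun q => q.1 / P - β * q.2.1 - q.2.2
  have hw : Continuous w := by fun_prop
  have hw2 : Continuous fun q : ℝ × ℝ × ℝ => (w q, q.2.1) := hw.prodMk (by fun_prop)
  set K : Set (ℝ × ℝ) := Icc 0 1 ×ˢ Icc (-1) 1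
  have hK : IsCompact K := isCompact_Icc.prod isCompact_Icc
  set F : Set (ℝ × ℝ × ℝ) := {q | α (w q) q.2.1 = q.1 / P ∧ x q.1 = rr q.1 * C (T * q.2.1) ∧
    y q.1 = rr q.1 ^ (p - 1) * S (T * q.2.1)}
  have hFc : IsClosed F := by
    have hC := hc.contC
    have hS := hc.contS
    have hrp : Continuous fun t => rr t ^ (p - 1) := hrrc.rpow_const fun _ => Or.inr (by linarith)
    exact (isClosed_eq (hI.cα.comp hw2) (by fun_prop)).inter
      ((isClosed_eq (by fun_prop) (by fun_prop)).inter (isClosed_eq (by fun_prop)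
        ((hrp.comp continuous_fst).mul (by fun_prop))))
  have hle := isClosed_setOf_exists_mem hK
    (hFc.inter (isClosed_le (hrrc.comp continuous_fst) (hI.cρ.comp hw2)))
  have hge := isClosed_setOf_exists_mem hK
    (hFc.inter (isClosed_le (hI.cρ.comp hw2) (hrrc.comp continuous_fst)))
  have hcov : ∀ t, ∃ k ∈ K, (t, k) ∈ F := fun t => by
    obtain ⟨s, hs, h1, h2⟩ : ∃ s ∈ Icc (0 : ℝ) 1, x t = rr t * C (T * s) ∧ y t = rr t ^ (p - 1) * S (T * s) := by
      by_cases hz : x t ≠ 0 ∨ y t ≠ 0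
      · obtain ⟨r, hr, θ, hθ, h1, h2⟩ := hc.polar _ _ hz
        have h3 : rr t = r := by
          have hpq : (r ^ (p - 1)) ^ cexpo p = r ^ p := by
            rw [← Real.rpow_mul hr.le, cexpo, mul_div_cancel₀ _ (by linarith)]
          simp only [rr]
          rw [h1, h2, abs_mul, abs_of_pos (Real.rpow_pos_of_pos hr _), Real.mul_rpow (by positivity) (abs_nonneg _),
            hpq, pot_mul hr, ← mul_add, hc.energy, mul_one, one_div, Real.rpow_rpow_inv hr.le hp0.ne']
        refine ⟨θ / T, ⟨by have := hθ.1; positivity, (div_le_one hT).2 hθ.2⟩, ?_⟩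
        rw [mul_div_cancel₀ _ hT.ne', h3]
        exact ⟨h1, h2⟩
      · push Not at hz
        have h3 : rr t = 0 := by
          simp only [rr, hz.1, hz.2]
          simp [pot, Real.zero_rpow (by linarith : cexpo p ≠ 0), Real.zero_rpow hp0.ne', hp0.ne']
        refine ⟨0, ⟨le_rfl, zero_le_one⟩, ?_⟩
        rw [h3, hz.1, hz.2, Real.zero_rpow (by linarith)]
        simp
    obtain ⟨c, hcI, hcα⟩ : (t / P) ∈ (fun c => α (w (t, s, -c)) s) '' Icc (-1) 1 := by
      refine intermediate_value_Icc (by norm_num) ?_ ⟨?_, ?_⟩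
      · exact (hI.cα.comp (hw2.comp (by fun_prop : Continuous fun c : ℝ => (t, s, -c)))).continuousOn
      · have := (abs_le.1 (hI.near (w (t, s, -(-1))) s)).2
        simp only [w] at this ⊢; linarith
      · have := (abs_le.1 (hI.near (w (t, s, -1)) s)).1
        simp only [w] at this ⊢; linarith
    exact ⟨(s, -c), ⟨hs, by constructor <;> linarith [hcI.1, hcI.2]⟩, hcα, h1, h2⟩
  have hcases : ∀ t, (∃ k ∈ K, (t, k) ∈ F ∩ {q | rr q.1 ≤ ρ (w q) q.2.1}) ∨
      ∃ k ∈ K, (t, k) ∈ F ∩ {q | ρ (w q) q.2.1 ≤ rr q.1} := fun t => by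
    obtain ⟨k, hk, h⟩ := hcov t
    exact (le_total (rr t) (ρ (w (t, k)) k.1)).imp (fun h' => ⟨k, hk, h, h'⟩) fun h' => ⟨k, hk, h, h'⟩
  by_cases hcom : ∃ t, (∃ k ∈ K, (t, k) ∈ F ∩ {q | rr q.1 ≤ ρ (w q) q.2.1}) ∧
      ∃ k ∈ K, (t, k) ∈ F ∩ {q | ρ (w q) q.2.1 ≤ rr q.1}
  · obtain ⟨t₀, ⟨⟨s, c⟩, ⟨hs, -⟩, ⟨h1, h2, h3⟩, h4⟩, ⟨s', c'⟩, ⟨hs', -⟩, ⟨h1', h2', h3'⟩, h4'⟩ := hcom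
    simp only [mem_ofPred_eq] at h1 h2 h3 h4 h1' h2' h3' h4' hs hs'
    have hr : 0 < rr t₀ := hr₁.trans_le ((hI.lo _ _).trans h4')
    obtain ⟨-, n, hn⟩ := hc.inj _ _ _ _ hr hr (h2.symm.trans h2') (h3.symm.trans h3')
    replace hn : s' = s + n := mul_left_cancel₀ hT.ne' (by rw [hn]; ring)
    have hn1 : -1 ≤ n ∧ n ≤ 1 := by
      constructor <;> by_contra! h
      · have : (n : ℝ) ≤ -2 := by exact_mod_cast (by omega : n ≤ -2)
        linarith [hs.2, hs'.1]
      · have : (2 : ℝ) ≤ n := by exact_mod_cast (by omega : 2 ≤ n)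
        linarith [hs.1, hs'.2]
    have hρρ : ρ (w (t₀, s, c)) s = ρ (w (t₀, s', c')) s' := by
      have hα := h1.trans h1'.symm
      generalize w (t₀, s, c) = A at hα
      generalize w (t₀, s', c') = A' at hα
      obtain rfl | rfl | rfl : n = -1 ∨ n = 0 ∨ n = 1 := by omega
      · obtain rfl : s = s' + 1 := by rw [hn]; simp
        rw [hI.twα] at hα
        rw [hI.twρ, hI.inj _ _ _ hα]
      · obtain rfl : s' = s := by simpa using hn
        rw [hI.inj _ _ _ hα]
      · obtain rfl : s' = s + 1 := by simpa using hn
        rw [hI.twα] at hα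
        rw [hI.twρ, hI.inj _ _ _ hα]
    have hrρ : rr t₀ = ρ (w (t₀, s, c)) s := le_antisymm h4 (hρρ ▸ h4')
    have hPα : P * α (w (t₀, s, c)) s = t₀ := by rw [h1, mul_div_cancel₀ _ hP.ne']
    obtain ⟨σ, hσ⟩ := hI.surjective hβ (w (t₀, s, c)) (t / P)
    obtain ⟨h5, h6⟩ := hI.eqOn hp hF hx hy (w := w (t₀, s, c)) (s₀ := s) (by rw [hPα, ← hrρ, h2])
      (by rw [hPα, ← hrρ, h3]) σ
    rw [hσ, mul_div_cancel₀ _ hP.ne'] at h5 h6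
    exact ⟨_, _, hr₁.le.trans (hI.lo _ _), hI.hi _ _, h5.symm, h6.symm⟩
  · push Not at hcom
    have hcl : IsClopen {t | ∃ k ∈ K, (t, k) ∈ F ∩ {q | rr q.1 ≤ ρ (w q) q.2.1}} := by
      refine ⟨hle, ?_⟩
      rw [← isClosed_compl_iff]
      convert hge using 1
      ext t
      exact ⟨fun h => (hcases t).resolve_left h, fun ⟨k, hk, h⟩ h' => hcom t h' k hk h⟩
    obtain ⟨k₀, hk₀, h₀⟩ := hcov 0
    obtain ⟨k, -, ⟨-, h2, h3⟩, h4⟩ := (hcl.eq_univ ⟨0, k₀, hk₀, h₀, h0.trans (hI.lo _ _)⟩).ge (mem_univ t)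
    exact ⟨rr t, _, hrr0 t, h4.trans (hI.hi _ _), h2, h3⟩

end

lemma pip_pos {p : ℝ} (hp : 2 ≤ p) : 0 < pip p := by
  have h1 : 0 < Real.sin (Real.pi / p) := Real.sin_pos_of_pos_of_lt_pi (by positivity)
    (div_lt_self Real.pi_pos (by linarith))
  have h2 : 0 < p - 1 := by linarith
  unfold pip
  positivity

lemma mean_ne_zero {F : ℝ → ℝ} {c : ℝ} (hc : 0 < c) (h : ∫ t in (0 : ℝ)..c, F t ≠ 0) :
    ∫ t in (0 : ℝ)..1, F (c * t) ≠ 0 := by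
  rw [intervalIntegral.integral_comp_mul_left F hc.ne', mul_zero, mul_one]
  exact smul_ne_zero (inv_ne_zero hc.ne') h

end JumpingKAM

/-- Under the hypotheses of Theorem 1 (with `a, b > 0`, `a ≠ b`,
`ω = (a^{-1/p}+b^{-1/p})/2` irrational and Diophantine, `f ∈ C^{23}(ℝ/2π_pℤ)` with
nonzero mean, `G ∈ C^{21}(ℝ × ℝ/2π_pℤ)` with all derivatives of order ≤ 21 bounded
and a bounded primitive `Ĝ`), the equation
`(φ_p(x'))' + a φ_p(x⁺) − b φ_p(x⁻) = G_x(x,t) + f(t)` possesses Lagrange stability: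
every solution is defined on all of `ℝ` and `sup_t (|x(t)| + |x'(t)|) < ∞`. -/
theorem lagrange_stability_jumping_pLaplacian
    (p a b ω γ τ C : ℝ) (f : ℝ → ℝ) (G : ℝ → ℝ → ℝ)
    (hp : 2 ≤ p) (ha : 0 < a) (hb : 0 < b) (hab : a ≠ b)
    (hω : ω = (a ^ (-(1 : ℝ) / p) + b ^ (-(1 : ℝ) / p)) / 2)
    (hωirr : Irrational ω)
    (hτ1 : 1 < τ) (hτ2 : τ < 2) (hγ : 0 < γ)
    (hdio : ∀ m n : ℤ, (m, n) ≠ (0, 0) → γ / |(m : ℝ)| ^ τ ≤ |(m : ℝ) * ω + (n : ℝ)|)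
    (hf : ContDiff ℝ 23 f) (hfper : Function.Periodic f (2 * pip p))
    (hG : ContDiff ℝ 21 (fun z : ℝ × ℝ => G z.1 z.2))
    (hGper : ∀ x t, G x (t + 2 * pip p) = G x t)
    (hC : 0 < C)
    (hGbd : ∀ i j : ℕ, i + j ≤ 21 → ∀ x t : ℝ, |iterD G i j x t| ≤ C)
    (hGhat : ∃ Ghat : ℝ → ℝ → ℝ,
      (∀ x t : ℝ, HasDerivAt (fun y => Ghat y t) (G x t) x) ∧
      (∀ j : ℕ, j ≤ 21 → ∀ x t : ℝ, |iteratedDeriv j (Ghat x) t| ≤ C))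
    (hfmean : (1 / (2 * pip p)) * ∫ t in (0 : ℝ)..(2 * pip p), f t ≠ 0)
    -- a (global) solution of the equation, with `x'` its derivative
    (x x' : ℝ → ℝ)
    (hx : ∀ t, HasDerivAt x (x' t) t)
    (heq : ∀ t, HasDerivAt (fun s => phi p (x' s))
      (deriv (fun u => G u t) (x t) + f t
        - a * phi p (max (x t) 0) + b * phi p (max (-x t) 0)) t) :
    ∃ M : ℝ, ∀ t : ℝ, |x t| + |x' t| ≤ M := by
  open JumpingKAM in
  have hP : 0 < 2 * pip p := by have := pip_pos hp; positivity
  have hf' : ContDiff ℝ 21 f := hf.of_le (by norm_num)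
  have hω0 : 0 < ω := hω ▸ (by positivity)
  obtain ⟨D, hD1, hD⟩ := exists_iteratedDeriv_le hP.ne' hf' hfper
  have hF : Forcing (2 * pip p) (D + C) G f := by
    refine ⟨hP, by linarith, hG, hf', hGper, hfper, fun i hi x t => ?_, fun j hj x t => ?_,
      fun j hj t => (hD j hj t).trans (by linarith)⟩
    · have := hGbd i 0 (by omega) x t
      simp only [iterD, iteratedDeriv_zero] at this
      linarith
    · have := hGbd 0 j (by omega) x t
      simp only [iterD, iteratedDeriv_zero] at this
      linarith
  obtain ⟨Cc, S, hc⟩ := exists_curve hp ha hb hab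
  rw [← hω] at hc
  obtain ⟨M, hM, hCM⟩ := periodic_bounded hc.T_pos.ne' hc.contC hc.perC
  have hm := mul_ne_zero (mean_ne_zero hc.T_pos hc.mean) (mean_ne_zero hP (right_ne_zero_of_mul hfmean))
  obtain ⟨A, hA, η, -, hη, R₁, hR₁⟩ := exists_balanced_torus hp ha hb hc hF hM hCM hω0 hγ hτ1 hτ2
    (fun m n hmn => hdio m n (by simp [hmn])) hm
  set r := (|phi p (x' 0)| ^ cexpo p + pot p a b (x 0)) ^ (1 / p)
  have hBM : 0 < 8 * M * (D + C) := by positivity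
  obtain ⟨β, k, kt, kh, l, u, v, y, hRA, hK, hk, hl, hβ⟩ :=
    hR₁ (max R₁ (max (8 * M * (D + C)) (2 * r))) (le_max_left _ _)
  have hR8 : 8 * M * (D + C) ≤ max R₁ (max (8 * M * (D + C)) (2 * r)) :=
    (le_max_left _ _).trans (le_max_right _ _)
  have hRr : 2 * r ≤ max R₁ (max (8 * M * (D + C)) (2 * r)) := (le_max_right _ _).trans (le_max_right _ _)
  have hI := invTorus_of_torus hp ha hb hc hF hM hCM hA hRA hR8 hω0 rfl hη hK hk hl
  set r₂ := 2 * max y (max R₁ (max (8 * M * (D + C)) (2 * r)))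
  have hp1 : 0 < p - 1 := by linarith
  refine ⟨r₂ * M + r₂, fun t => ?_⟩
  obtain ⟨ρ, θ, hρ0, hρ, h1, h2⟩ := hI.trap hp ha hb hc hF hβ (by linarith) (x := x) (y := fun s => phi p (x' s))
    (fun t => by rw [phi_phi_cexpo hp]; exact hx t)
    (fun t => (heq t).congr_deriv (by simp only [gx, force]; ring)) (by linarith) t
  have h3 : |x' t| ≤ ρ := by
    have h4 : |x' t| ^ (p - 1) ≤ ρ ^ (p - 1) := by
      rw [← abs_phi (by linarith : p ≠ 1), h2, abs_mul, abs_of_nonneg (Real.rpow_nonneg hρ0 _)]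
      exact mul_le_of_le_one_right (Real.rpow_nonneg hρ0 _) (hc.abs_S_le hp ha hb θ)
    exact (Real.rpow_le_rpow_iff (abs_nonneg _) hρ0 hp1).1 h4
  have h4 : |x t| ≤ r₂ * M := by
    rw [h1, abs_mul, abs_of_nonneg hρ0]
    exact mul_le_mul hρ (hCM θ) (abs_nonneg _) (hρ0.trans hρ)
  linarith
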